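/- Let K be a number field, D ≥ 1, and let λ_1,…,λ_D ∈ K be nonzero elements, none of which is a root of unity; let α_1,…,α_D ∈ K[X] be nonzero polynomials. Then for every k ≥ 1 there exists w_k ∈ ℕ such that the following holds: for every choice of signs c_1,…,c_k ∈ {1,−1}, indices j_1,…,j_k ∈ {1,…,D}, and every r ∈ K with r ≠ 0, there are at most w_k tuples (n_1,…,n_k) ∈ ℕ^k satisfying Σ_{i=1}^k c_i·α_{j_i}(n_i)·λ_{j_i}^{n_i} = r and Σ_{i∈I} c_i·α_{j_i}(n_i)·λ_{j_i}^{n_i} ≠ 0 for every nonempty proper subset I ⊊ {1,…,k}. -/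

import Mathlib

open Finset

/-- The set of tuples `(n₁,…,n_k) ∈ ℕ^k` with `Σᵢ cᵢ·α_{jᵢ}(nᵢ)·λ_{jᵢ}^{nᵢ} = r` and no
vanishing proper nonempty subsum. -/
def expPolySolSet {K : Type*} [Field K] {D : ℕ} (lam : Fin D → K)
    (α : Fin D → Polynomial K) {k : ℕ} (c : Fin k → K) (j : Fin k → Fin D) (r : K) :
    Set (Fin k → ℕ) :=
  {n | (∑ i, c i * (α (j i)).eval ((n i : ℕ) : K) * lam (j i) ^ (n i)) = r ∧
    ∀ I : Finset (Fin k), I.Nonempty → I ≠ Finset.univ →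
      (∑ i ∈ I, c i * (α (j i)).eval ((n i : ℕ) : K) * lam (j i) ^ (n i)) ≠ 0}

section

/-- Abstract set of places `S` together with the ring of `S`-integers. -/
structure SPl (K : Type*) [Field K] (ι : Type*) [Fintype ι] where
  av : ι → AbsoluteValue K ℝ
  n : ι → ℕ
  npos : ∀ v, 0 < n v
  O : Subring K
  prod_ge : ∀ c ∈ O, c ≠ 0 → 1 ≤ ∏ v, av v c ^ n v
  mink : ∀ (d : ℕ) (A : ι → Matrix (Fin d) (Fin d) ℤ), ∃ C : ℝ, 0 < C ∧
    ∀ s : ι → Fin d → ℝ, (∀ v i, 0 < s v i) → C ≤ ∏ v, ∏ i, s v i ^ n v →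
      ∃ z : Fin d → K, z ≠ 0 ∧ (∀ i, z i ∈ O) ∧
        ∀ v i, av v (∑ j, (A v i j : K) * z j) ≤ s v i

namespace SPl

variable {K : Type*} [Field K]

theorem av_natCast_le (a : AbsoluteValue K ℝ) (m : ℕ) : a (m : K) ≤ m := by
  induction m with
  | zero => simp
  | succ m ih =>
    push_cast
    refine (a.add_le _ _).trans ?_
    simpa using ih

theorem av_intCast_le (a : AbsoluteValue K ℝ) (m : ℤ) : a (m : K) ≤ |(m : ℝ)| := by
  rcases Int.eq_nat_or_neg m with ⟨k, rfl | rfl⟩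
  · simpa using av_natCast_le a k
  · simpa using av_natCast_le a k

end SPl

namespace Rt
open MvPolynomial

variable {K : Type*} [Field K]

/-- sum of absolute values of coefficients -/
noncomputable def l1 (a : AbsoluteValue K ℝ) (f : MvPolynomial ℕ K) : ℝ :=
  ∑ I ∈ f.support, a (coeff I f)

theorem l1_eq (a : AbsoluteValue K ℝ) (f : MvPolynomial ℕ K) (s : Finset (ℕ →₀ ℕ))
    (h : f.support ⊆ s) : l1 a f = ∑ I ∈ s, a (coeff I f) := by
  refine Finset.sum_subset h ?_
  intro I _ hI
  rw [notMem_support_iff.1 hI, map_zero]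

theorem l1_nonneg (a : AbsoluteValue K ℝ) (f : MvPolynomial ℕ K) : 0 ≤ l1 a f :=
  Finset.sum_nonneg fun _ _ => a.nonneg _

theorem coeff_le_l1 (a : AbsoluteValue K ℝ) (f : MvPolynomial ℕ K) (I : ℕ →₀ ℕ) :
    a (coeff I f) ≤ l1 a f := by
  by_cases h : I ∈ f.support
  · exact Finset.single_le_sum (f := fun I => a (coeff I f)) (fun _ _ => a.nonneg _) h
  · rw [notMem_support_iff.1 h, map_zero]; exact l1_nonneg a f

theorem l1_zero (a : AbsoluteValue K ℝ) : l1 a (0 : MvPolynomial ℕ K) = 0 := by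
  simp [l1]

theorem l1_add (a : AbsoluteValue K ℝ) (f g : MvPolynomial ℕ K) :
    l1 a (f + g) ≤ l1 a f + l1 a g := by
  classical
  rw [l1_eq a (f + g) (f.support ∪ g.support) support_add,
    l1_eq a f (f.support ∪ g.support) Finset.subset_union_left,
    l1_eq a g (f.support ∪ g.support) Finset.subset_union_right, ← Finset.sum_add_distrib]
  refine Finset.sum_le_sum fun I _ => ?_
  rw [coeff_add]; exact a.add_le _ _

theorem l1_sum (a : AbsoluteValue K ℝ) {α : Type*} (s : Finset α) (f : α → MvPolynomial ℕ K) :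
    l1 a (∑ i ∈ s, f i) ≤ ∑ i ∈ s, l1 a (f i) := by
  classical
  induction s using Finset.induction_on with
  | empty => simp [l1_zero]
  | insert i s hi ih =>
    rw [Finset.sum_insert hi, Finset.sum_insert hi]
    exact (l1_add a _ _).trans (by gcongr)

theorem l1_monomial (a : AbsoluteValue K ℝ) (I : ℕ →₀ ℕ) (c : K) :
    l1 a (monomial I c) = a c := by
  classical
  rw [l1_eq a _ {I} support_monomial_subset]
  simp

theorem l1_monomial_mul (a : AbsoluteValue K ℝ) (I : ℕ →₀ ℕ) (c : K) (g : MvPolynomial ℕ K) :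
    l1 a (monomial I c * g) ≤ a c * l1 a g := by
  classical
  conv_lhs => rw [← support_sum_monomial_coeff g, Finset.mul_sum]
  refine (l1_sum a _ _).trans ?_
  rw [l1, Finset.mul_sum]
  refine Finset.sum_le_sum fun J _ => ?_
  rw [monomial_mul, l1_monomial, map_mul]

theorem l1_mul (a : AbsoluteValue K ℝ) (f g : MvPolynomial ℕ K) :
    l1 a (f * g) ≤ l1 a f * l1 a g := by
  classical
  conv_lhs => rw [← support_sum_monomial_coeff f, Finset.sum_mul]
  refine (l1_sum a _ _).trans ?_
  conv_rhs => rw [l1, Finset.sum_mul]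
  exact Finset.sum_le_sum fun J _ => l1_monomial_mul a _ _ _

theorem l1_one (a : AbsoluteValue K ℝ) : l1 a (1 : MvPolynomial ℕ K) = 1 := by
  have := l1_monomial a 0 (1 : K)
  simpa using this

theorem l1_prod (a : AbsoluteValue K ℝ) {α : Type*} (s : Finset α) (f : α → MvPolynomial ℕ K) :
    l1 a (∏ i ∈ s, f i) ≤ ∏ i ∈ s, l1 a (f i) := by
  classical
  induction s using Finset.induction_on with
  | empty => simp [l1_one]
  | insert i s hi ih =>
    rw [Finset.prod_insert hi, Finset.prod_insert hi]
    exact (l1_mul a _ _).trans (by gcongr; exact l1_nonneg a _)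

theorem l1_neg (a : AbsoluteValue K ℝ) (f : MvPolynomial ℕ K) : l1 a (-f) = l1 a f := by
  simp [l1]

theorem l1_det (a : AbsoluteValue K ℝ) {n : ℕ} (M : Matrix (Fin n) (Fin n) (MvPolynomial ℕ K))
    (T : ℝ) (hM : ∀ i j, l1 a (M i j) ≤ T) : l1 a M.det ≤ n.factorial * T ^ n := by
  rw [Matrix.det_apply]
  refine (l1_sum a _ _).trans ?_
  have : ∀ σ ∈ (Finset.univ : Finset (Equiv.Perm (Fin n))),
      l1 a (Equiv.Perm.sign σ • ∏ i, M (σ i) i) ≤ T ^ n := by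
    intro σ _
    have h1 : l1 a (∏ i, M (σ i) i) ≤ T ^ n := by
      refine (l1_prod a _ _).trans ?_
      refine (Finset.prod_le_prod (fun i _ => l1_nonneg a _) (fun i _ => hM (σ i) i)).trans ?_
      simp
    rcases Int.units_eq_one_or (Equiv.Perm.sign σ) with h | h <;> rw [h]
    · simpa using h1
    · simpa [l1_neg] using h1
  refine (Finset.sum_le_sum this).trans ?_
  simp [Fintype.card_perm]

/-- coefficients in a subring -/
def CO (O : Subring K) (f : MvPolynomial ℕ K) : Prop := ∀ I, coeff I f ∈ O

theorem CO.add {O : Subring K} {f g : MvPolynomial ℕ K} (hf : CO O f) (hg : CO O g) :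
    CO O (f + g) := fun I => by rw [coeff_add]; exact O.add_mem (hf I) (hg I)

theorem CO.neg {O : Subring K} {f : MvPolynomial ℕ K} (hf : CO O f) :
    CO O (-f) := fun I => by rw [coeff_neg]; exact O.neg_mem (hf I)

theorem CO.mul {O : Subring K} {f g : MvPolynomial ℕ K} (hf : CO O f) (hg : CO O g) :
    CO O (f * g) := fun I => by
  classical
  rw [coeff_mul]; exact O.sum_mem fun x _ => O.mul_mem (hf _) (hg _)

theorem CO.sum {O : Subring K} {α : Type*} {s : Finset α} {f : α → MvPolynomial ℕ K}
    (hf : ∀ i ∈ s, CO O (f i)) : CO O (∑ i ∈ s, f i) := fun I => by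
  rw [coeff_sum]; exact O.sum_mem fun x hx => hf x hx _

theorem CO.monomial {O : Subring K} {c : K} (hc : c ∈ O) (J : ℕ →₀ ℕ) :
    CO O (monomial J c) := fun I => by
  classical
  rw [coeff_monomial]; split_ifs
  · exact hc
  · exact O.zero_mem

theorem CO.one {O : Subring K} : CO O (1 : MvPolynomial ℕ K) := CO.monomial O.one_mem 0

theorem CO.prod {O : Subring K} {α : Type*} {s : Finset α} {f : α → MvPolynomial ℕ K}
    (hf : ∀ i ∈ s, CO O (f i)) : CO O (∏ i ∈ s, f i) := by
  classical
  induction s using Finset.induction_on with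
  | empty => simpa using CO.one
  | insert i s hi ih =>
    rw [Finset.prod_insert hi]
    exact (hf i (by simp)).mul (ih fun j hj => hf j (by simp [hj]))

theorem CO.det {O : Subring K} {n : ℕ} (M : Matrix (Fin n) (Fin n) (MvPolynomial ℕ K))
    (hM : ∀ i j, CO O (M i j)) : CO O M.det := by
  rw [Matrix.det_apply]
  refine CO.sum fun σ _ => ?_
  have h1 : CO O (∏ i, M (σ i) i) := CO.prod fun i _ => hM _ _
  rcases Int.units_eq_one_or (Equiv.Perm.sign σ) with h | h <;> rw [h]
  · simpa using h1
  · simpa using h1.neg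

/-- weight -/
noncomputable def wt (r : ℕ → ℝ) (I : ℕ →₀ ℕ) : ℝ := I.sum fun h m => (m : ℝ) / r h

theorem wt_add (r : ℕ → ℝ) (I J : ℕ →₀ ℕ) : wt r (I + J) = wt r I + wt r J :=
  Finsupp.sum_add_index' (by simp) (by intros; push_cast; ring)

theorem wt_single (r : ℕ → ℝ) (h m : ℕ) : wt r (Finsupp.single h m) = m / r h := by
  simp [wt]

theorem wt_nonneg {r : ℕ → ℝ} (hr : ∀ h, 0 ≤ r h) (I : ℕ →₀ ℕ) : 0 ≤ wt r I :=
  Finset.sum_nonneg fun h _ => div_nonneg (Nat.cast_nonneg _) (hr h)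

/-- the index filtration -/
def F (r : ℕ → ℝ) (θ : ℝ) (g : MvPolynomial ℕ K) : Prop := ∀ I ∈ g.support, θ ≤ wt r I

theorem F.mono {r : ℕ → ℝ} {θ θ' : ℝ} {g : MvPolynomial ℕ K} (h : F r θ g) (h' : θ' ≤ θ) :
    F r θ' g := fun I hI => h'.trans (h I hI)

theorem F_zero (r : ℕ → ℝ) (θ : ℝ) : F r θ (0 : MvPolynomial ℕ K) := by
  intro I hI; simp at hI

theorem F.add {r : ℕ → ℝ} {θ : ℝ} {f g : MvPolynomial ℕ K} (hf : F r θ f) (hg : F r θ g) :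
    F r θ (f + g) := by
  classical
  intro I hI
  rcases Finset.mem_union.1 (support_add hI) with h | h
  · exact hf I h
  · exact hg I h

theorem F.neg {r : ℕ → ℝ} {θ : ℝ} {f : MvPolynomial ℕ K} (hf : F r θ f) : F r θ (-f) := by
  intro I hI; exact hf I (by simpa using hI)

theorem F.sum {r : ℕ → ℝ} {θ : ℝ} {α : Type*} {s : Finset α} {f : α → MvPolynomial ℕ K}
    (hf : ∀ i ∈ s, F r θ (f i)) : F r θ (∑ i ∈ s, f i) := by
  classical
  induction s using Finset.induction_on with
  | empty => simpa using F_zero r θ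
  | insert i s hi ih =>
    rw [Finset.sum_insert hi]
    exact (hf i (by simp)).add (ih fun j hj => hf j (by simp [hj]))

theorem F.mul {r : ℕ → ℝ} {θ η : ℝ} {f g : MvPolynomial ℕ K} (hf : F r θ f) (hg : F r η g) :
    F r (θ + η) (f * g) := by
  classical
  intro I hI
  obtain ⟨a, ha, b, hb, rfl⟩ := Finset.mem_add.1 (support_mul f g hI)
  rw [wt_add]; exact add_le_add (hf a ha) (hg b hb)

theorem F_of_nonneg {r : ℕ → ℝ} (hr : ∀ h, 0 ≤ r h) (f : MvPolynomial ℕ K) : F r 0 f :=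
  fun I _ => wt_nonneg hr I

theorem F.C_mul {r : ℕ → ℝ} {θ : ℝ} {f : MvPolynomial ℕ K} (hf : F r θ f) (c : K) :
    F r θ (C c * f) := by
  intro I hI
  refine hf I ?_
  rw [mem_support_iff, coeff_C_mul] at hI
  exact mem_support_iff.2 (right_ne_zero_of_mul hI)

theorem F.prod {r : ℕ → ℝ} (hr : ∀ h, 0 ≤ r h) {α : Type*} {s : Finset α} {θ : α → ℝ}
    {f : α → MvPolynomial ℕ K} (hf : ∀ i ∈ s, F r (θ i) (f i)) :
    F r (∑ i ∈ s, θ i) (∏ i ∈ s, f i) := by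
  classical
  induction s using Finset.induction_on with
  | empty => simpa using F_of_nonneg hr _
  | insert i s hi ih =>
    rw [Finset.prod_insert hi, Finset.sum_insert hi]
    exact (hf i (by simp)).mul (ih fun j hj => hf j (by simp [hj]))

/-- pderiv lowers weight by `1 / r h` -/
theorem F.pder {r : ℕ → ℝ} {θ : ℝ} {f : MvPolynomial ℕ K} (hf : F r θ f) (h : ℕ) :
    F r (θ - 1 / r h) (pderiv h f) := by
  classical
  rw [← support_sum_monomial_coeff f, map_sum]
  refine F.sum fun I hI => ?_
  rw [pderiv_monomial]
  by_cases h0 : I h = 0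
  · simp [h0, F_zero]
  · intro J hJ
    have := support_monomial_subset hJ
    rw [Finset.mem_singleton] at this
    subst this
    have h1 : I = (I - Finsupp.single h 1) + Finsupp.single h 1 := by
      ext x; by_cases hx : h = x
      · subst hx; simp; omega
      · simp [Finsupp.single_apply, hx]
    have h2 := hf I hI
    rw [h1, wt_add, wt_single] at h2
    push_cast at h2
    linarith

/-- translation -/
noncomputable def tr (ξ : ℕ → K) : MvPolynomial ℕ K →ₐ[K] MvPolynomial ℕ K :=
  aeval fun h => X h + C (ξ h)

theorem tr_X (ξ : ℕ → K) (h : ℕ) : tr ξ (X h) = X h + C (ξ h) := by simp [tr]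

theorem tr_C (ξ : ℕ → K) (c : K) : tr ξ (C c) = C c := by simp [tr]

theorem tr_pderiv (ξ : ℕ → K) (h : ℕ) (f : MvPolynomial ℕ K) :
    tr ξ (pderiv h f) = pderiv h (tr ξ f) := by
  induction f using MvPolynomial.induction_on with
  | C a => simp [tr_C]
  | add p q hp hq => simp [hp, hq]
  | mul_X p x hp =>
    simp only [Derivation.leibniz, map_add, smul_eq_mul, map_mul, hp, tr_X, pderiv_C, add_zero]
    congr 2
    by_cases hx : x = h
    · subst hx; simp
    · simp [pderiv_X_of_ne (Ne.symm hx), pderiv_X_of_ne hx]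

end Rt

end

section

namespace Rt
open MvPolynomial

variable {K : Type*} [Field K]

/-- diagonal operator -/
noncomputable def dg (w : (ℕ →₀ ℕ) → K) (f : MvPolynomial ℕ K) : MvPolynomial ℕ K :=
  ∑ I ∈ f.support, monomial I (w I * coeff I f)

theorem coeff_dg (w : (ℕ →₀ ℕ) → K) (f : MvPolynomial ℕ K) (J : ℕ →₀ ℕ) :
    coeff J (dg w f) = w J * coeff J f := by
  classical
  rw [dg, coeff_sum]
  simp only [coeff_monomial]
  rw [Finset.sum_ite_eq' f.support J (fun I => w I * coeff I f)]
  split_ifs with h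
  · rfl
  · rw [notMem_support_iff.1 h, mul_zero]

/-- binomial weight -/
def bn (μ I : ℕ →₀ ℕ) : ℕ := μ.prod fun h m => (I h).choose m

theorem bn_eq (μ I : ℕ →₀ ℕ) (s : Finset ℕ) (hs : μ.support ⊆ s) :
    bn μ I = ∏ h ∈ s, (I h).choose (μ h) :=
  Finsupp.prod_of_support_subset _ hs _ (by simp)

theorem bn_zero (I : ℕ →₀ ℕ) : bn 0 I = 1 := by simp [bn]

theorem bn_rec (μ I : ℕ →₀ ℕ) (h : ℕ) :
    I h * bn μ I = (μ h + 1) * bn (μ + Finsupp.single h 1) I + μ h * bn μ I := by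
  classical
  have hs1 : μ.support ⊆ insert h μ.support := Finset.subset_insert _ _
  have hs2 : (μ + Finsupp.single h 1).support ⊆ insert h μ.support := by
    intro x hx
    by_cases hxh : x = h
    · simp [hxh]
    · simp [Finsupp.single_apply, Ne.symm hxh] at hx
      simp [hx]
  have hq : ∏ x ∈ insert h μ.support, (I x).choose ((μ + Finsupp.single h 1 : ℕ →₀ ℕ) x) = _ :=
    (Finset.mul_prod_erase _ _ (Finset.mem_insert_self h μ.support)).symm
  rw [bn_eq _ _ _ hs1, bn_eq _ _ _ hs2, hq,
    ← Finset.mul_prod_erase _ (fun x => (I x).choose (μ x)) (Finset.mem_insert_self h μ.support)]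
  have : ∏ x ∈ (insert h μ.support).erase h, (I x).choose ((μ + Finsupp.single h 1 : ℕ →₀ ℕ) x)
      = ∏ x ∈ (insert h μ.support).erase h, (I x).choose (μ x) := by
    refine Finset.prod_congr rfl fun x hx => ?_
    have hne := Finset.ne_of_mem_erase hx
    simp [Finsupp.single_apply, Ne.symm hne]
  rw [this]
  simp only [Finsupp.add_apply, Finsupp.single_eq_same]
  have h1 := Nat.choose_succ_right_eq (I h) (μ h)
  rcases le_or_gt (μ h) (I h) with hle | hlt
  · have h2 : (μ h + 1) * (I h).choose (μ h + 1) + μ h * (I h).choose (μ h)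
        = I h * (I h).choose (μ h) := by
      rw [mul_comm (μ h + 1), h1, mul_comm, ← add_mul, Nat.sub_add_cancel hle] <;> ring
    rw [← mul_assoc, ← mul_assoc, ← mul_assoc, ← add_mul, h2]
  · rw [Nat.choose_eq_zero_of_lt hlt, Nat.choose_eq_zero_of_lt (Nat.lt_succ_of_lt hlt)]
    simp

/-- divided-derivative type operator `X^μ D_μ` -/
noncomputable def Dt (μ : ℕ →₀ ℕ) (f : MvPolynomial ℕ K) : MvPolynomial ℕ K :=
  dg (fun I => (bn μ I : K)) f

theorem coeff_Dt (μ : ℕ →₀ ℕ) (f : MvPolynomial ℕ K) (J : ℕ →₀ ℕ) :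
    coeff J (Dt μ f) = bn μ J * coeff J f := coeff_dg _ _ _

theorem Dt_add (μ : ℕ →₀ ℕ) (f g : MvPolynomial ℕ K) : Dt μ (f + g) = Dt μ f + Dt μ g := by
  ext J; simp only [coeff_Dt, coeff_add]; ring

theorem Dt_zero (μ : ℕ →₀ ℕ) : Dt μ (0 : MvPolynomial ℕ K) = 0 := by
  ext J; simp [coeff_Dt]

theorem Dt_sum (μ : ℕ →₀ ℕ) {α : Type*} (s : Finset α) (f : α → MvPolynomial ℕ K) :
    Dt μ (∑ i ∈ s, f i) = ∑ i ∈ s, Dt μ (f i) := by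
  ext J; simp only [coeff_Dt, coeff_sum, Finset.mul_sum]

theorem Dt_C_mul (μ : ℕ →₀ ℕ) (c : K) (f : MvPolynomial ℕ K) :
    Dt μ (C c * f) = C c * Dt μ f := by
  ext J; simp only [coeff_Dt, coeff_C_mul]; ring

theorem Dt_monomial (μ I : ℕ →₀ ℕ) (c : K) :
    Dt μ (monomial I c) = monomial I (bn μ I * c) := by
  classical
  ext J; simp only [coeff_Dt, coeff_monomial]
  split_ifs with h
  · rw [h]
  · simp

theorem support_Dt (μ : ℕ →₀ ℕ) (f : MvPolynomial ℕ K) : (Dt μ f).support ⊆ f.support := by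
  intro I hI
  rw [mem_support_iff, coeff_Dt] at hI
  exact mem_support_iff.2 (right_ne_zero_of_mul hI)

theorem eu_eq (h : ℕ) (f : MvPolynomial ℕ K) : X h * pderiv h f = dg (fun I => (I h : K)) f := by
  classical
  ext J
  rw [coeff_dg]
  induction f using MvPolynomial.induction_on' with
  | monomial I c =>
    rw [X_mul_pderiv_monomial, coeff_smul, coeff_monomial]
    split_ifs with hI
    · subst hI; simp
    · simp
  | add p q hp hq => simp only [map_add, mul_add, coeff_add, hp, hq]

theorem F.eu {r : ℕ → ℝ} {θ : ℝ} {ξ : ℕ → K} {f : MvPolynomial ℕ K} (hr : ∀ h, 0 ≤ r h)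
    (hf : F r θ (tr ξ f)) (h : ℕ) : F r (θ - 1 / r h) (tr ξ (X h * pderiv h f)) := by
  rw [map_mul, tr_pderiv]
  have := (F_of_nonneg hr (tr ξ (X h))).mul (hf.pder h)
  simpa using this

theorem F.Dt [CharZero K] {r : ℕ → ℝ} {θ : ℝ} {ξ : ℕ → K} {f : MvPolynomial ℕ K}
    (hr : ∀ h, 0 ≤ r h) (hf : F r θ (tr ξ f)) (μ : ℕ →₀ ℕ) :
    F r (θ - wt r μ) (tr ξ (Dt μ f)) := by
  classical
  have key : ∀ (n : ℕ) (μ : ℕ →₀ ℕ), μ.degree = n → F r (θ - wt r μ) (tr ξ (Rt.Dt μ f)) := by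
    intro n
    induction n with
    | zero =>
      intro μ hμ
      rw [Finsupp.degree_eq_zero_iff] at hμ
      subst hμ
      have : Rt.Dt 0 f = f := by ext J; simp [coeff_Dt, bn_zero]
      rw [this]
      simpa [wt] using hf
    | succ n ih =>
      intro μ hμ
      obtain ⟨h, hh⟩ : ∃ h, μ h ≠ 0 := by
        by_contra hcon
        push Not at hcon
        have : μ = 0 := by ext x; simp [hcon]
        rw [this] at hμ; simp at hμ
      obtain ⟨ν, rfl⟩ : ∃ ν, μ = ν + Finsupp.single h 1 := by
        refine ⟨μ - Finsupp.single h 1, ?_⟩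
        ext x; by_cases hx : h = x
        · subst hx; simp; omega
        · simp [hx]
      have hν : ν.degree = n := by
        simp at hμ; omega
      have ih' := ih ν hν
      have e1 : Rt.Dt (ν + Finsupp.single h 1) f =
          C (((ν h : K) + 1)⁻¹) * (X h * pderiv h (Rt.Dt ν f) + C (-(ν h : K)) * Rt.Dt ν f) := by
        ext J
        have hne : ((ν h : K) + 1) ≠ 0 := Nat.cast_add_one_ne_zero _
        rw [coeff_C_mul, coeff_add, eu_eq, coeff_dg, coeff_C_mul, coeff_Dt, coeff_Dt]
        have := congrArg (Nat.cast (R := K)) (bn_rec ν J h)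
        push_cast at this
        field_simp
        linear_combination (-(coeff J f)) * this
      rw [e1, map_mul, map_add, map_mul _ (C _), tr_C, tr_C]
      refine F.C_mul ?_ _
      have hw : 0 ≤ 1 / r h := div_nonneg zero_le_one (hr h)
      have hwt : wt r (ν + Finsupp.single h 1) = wt r ν + 1 / r h := by
        rw [wt_add, wt_single]; simp
      refine F.add ?_ ?_
      · refine (F.eu hr ih' h).mono ?_
        rw [hwt]; linarith
      · refine (F.C_mul ih' _).mono ?_
        rw [hwt]; linarith
  exact key _ μ rfl

theorem bn_le (μ I : ℕ →₀ ℕ) : bn μ I ≤ 2 ^ I.degree := by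
  classical
  rw [bn_eq μ I (μ.support ∪ I.support) Finset.subset_union_left]
  have : I.degree = ∑ h ∈ μ.support ∪ I.support, I h := by
    rw [Finsupp.degree]
    refine Finset.sum_subset Finset.subset_union_right ?_
    intro x _ hx; simpa using hx
  rw [this, ← Finset.prod_pow_eq_pow_sum]
  exact Finset.prod_le_prod' fun h _ => Nat.choose_le_two_pow _ _

theorem l1_Dt (a : AbsoluteValue K ℝ) (μ : ℕ →₀ ℕ) (f : MvPolynomial ℕ K) (m : ℕ)
    (hm : ∀ I ∈ f.support, I.degree ≤ m) : l1 a (Dt μ f) ≤ 2 ^ m * l1 a f := by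
  rw [l1_eq a _ _ (support_Dt μ f), l1, Finset.mul_sum]
  refine Finset.sum_le_sum fun I hI => ?_
  rw [coeff_Dt, map_mul]
  have h1 : a (bn μ I : K) ≤ 2 ^ m := by
    refine (SPl.av_natCast_le a _).trans ?_
    have := (bn_le μ I).trans (Nat.pow_le_pow_right (n := 2) (by norm_num) (hm I hI))
    exact_mod_cast this
  gcongr

theorem CO.Dt {O : Subring K} {f : MvPolynomial ℕ K} (hf : CO O f) (μ : ℕ →₀ ℕ) :
    CO O (Dt μ f) := fun I => by
  rw [coeff_Dt]; exact O.mul_mem (natCast_mem O _) (hf I)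

/-- product rule in disjoint variables -/
theorem Dt_mul_disj (A : Set ℕ) (μ ν : ℕ →₀ ℕ) (f g : MvPolynomial ℕ K)
    (hμ : ∀ x ∉ A, μ x = 0) (hν : ∀ x ∈ A, ν x = 0)
    (hf : ∀ I ∈ f.support, ∀ x ∉ A, I x = 0) (hg : ∀ I ∈ g.support, ∀ x ∈ A, I x = 0) :
    Dt (μ + ν) (f * g) = Dt μ f * Dt ν g := by
  classical
  conv_lhs => rw [← support_sum_monomial_coeff f, ← support_sum_monomial_coeff g,
    Finset.sum_mul_sum, Dt_sum]
  conv_rhs => rw [← support_sum_monomial_coeff f, ← support_sum_monomial_coeff g, Dt_sum, Dt_sum,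
    Finset.sum_mul_sum]
  refine Finset.sum_congr rfl fun I hI => ?_
  rw [Dt_sum]
  refine Finset.sum_congr rfl fun J hJ => ?_
  rw [monomial_mul, Dt_monomial, Dt_monomial, Dt_monomial, monomial_mul]
  congr 1
  have hb : bn (μ + ν) (I + J) = bn μ I * bn ν J := by
    rw [bn_eq (μ + ν) (I + J) (μ.support ∪ ν.support) Finsupp.support_add,
      bn_eq μ I _ (Finset.subset_union_left (s₂ := ν.support)),
      bn_eq ν J _ (Finset.subset_union_right (s₁ := μ.support)), ← Finset.prod_mul_distrib]
    refine Finset.prod_congr rfl fun x _ => ?_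
    by_cases hx : x ∈ A
    · simp [hν x hx, hg J hJ x hx]
    · simp [hμ x hx, hf I hI x hx]
  rw [hb]; push_cast; ring

/-! ### interpolation and the generalised Wronskian -/

theorem interp [CharZero K] {n : ℕ} (I : Fin n → (ℕ →₀ ℕ)) (hI : Function.Injective I) :
    ∃ μ : Fin n → (ℕ →₀ ℕ), (∀ i, (μ i).degree ≤ n - 1) ∧
      Matrix.det (Matrix.of fun i j => (bn (μ i) (I j) : K)) ≠ 0 := by
  classical
  let cv : (ℕ →₀ ℕ) → (Fin n → K) := fun μ j => (bn μ (I j) : K)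
  let Sp : ℕ → Submodule K (Fin n → K) := fun s => Submodule.span K (cv '' {μ | μ.degree ≤ s})
  have step : ∀ (s h : ℕ) (a : K) (u : Fin n → K), u ∈ Sp s →
      (fun j => ((I j h : K) - a) * u j) ∈ Sp (s + 1) := by
    intro s h a u hu
    induction hu using Submodule.span_induction with
    | mem x hx =>
      obtain ⟨μ, hμ, rfl⟩ := hx
      have : (fun j => ((I j h : K) - a) * cv μ j) =
          ((μ h : K) + 1) • cv (μ + Finsupp.single h 1) + ((μ h : K) - a) • cv μ := by
        ext j
        have := congrArg (Nat.cast (R := K)) (bn_rec μ (I j) h)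
        push_cast at this
        simp only [Pi.add_apply, Pi.smul_apply, smul_eq_mul, cv]
        linear_combination this
      rw [this]
      refine (Sp (s + 1)).add_mem ((Sp (s + 1)).smul_mem _ (Submodule.subset_span ⟨_, ?_, rfl⟩))
        ((Sp (s + 1)).smul_mem _ (Submodule.subset_span ⟨_, ?_, rfl⟩))
      · simp at hμ ⊢; exact hμ
      · simp at hμ ⊢; omega
    | zero =>
      have : (fun j => ((I j h : K) - a) * (0 : Fin n → K) j) = 0 := by ext; simp
      rw [this]; exact Submodule.zero_mem _
    | add x y _ _ hx hy =>
      have : (fun j => ((I j h : K) - a) * (x + y) j) =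
        (fun j => ((I j h : K) - a) * x j) + (fun j => ((I j h : K) - a) * y j) := by
        ext j; simp; ring
      rw [this]; exact Submodule.add_mem _ hx hy
    | smul c x _ hx =>
      have : (fun j => ((I j h : K) - a) * (c • x) j) =
        c • (fun j => ((I j h : K) - a) * x j) := by
        ext j; simp; ring
      rw [this]; exact Submodule.smul_mem _ _ hx
  have sep : ∀ (j0 : Fin n) (T : Finset (Fin n)), j0 ∉ T → ∃ u ∈ Sp T.card, u j0 ≠ 0 ∧
      ∀ j ∈ T, u j = 0 := by
    intro j0 T
    induction T using Finset.induction_on with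
    | empty =>
      intro _
      refine ⟨cv 0, Submodule.subset_span ⟨0, by simp, rfl⟩, ?_, by simp⟩
      simp [cv, bn_zero]
    | insert t T ht ih =>
      intro hj
      simp only [Finset.mem_insert, not_or] at hj
      obtain ⟨u, hu, hu0, huT⟩ := ih hj.2
      obtain ⟨h, hh⟩ : ∃ h, I j0 h ≠ I t h := by
        by_contra hcon
        push Not at hcon
        exact hj.1 (hI (Finsupp.ext hcon))
      refine ⟨_, by rw [Finset.card_insert_of_notMem ht]; exact step _ h (I t h : K) u hu, ?_, ?_⟩
      · refine mul_ne_zero ?_ hu0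
        rw [sub_ne_zero]; exact_mod_cast hh
      · intro j hj
        rcases Finset.mem_insert.1 hj with rfl | hj
        · simp
        · simp [huT j hj]
  have htop : Sp (n - 1) = ⊤ := by
    rw [eq_top_iff]
    intro u _
    have : u = ∑ j, u j • (Pi.single j (1 : K) : Fin n → K) := by
      ext i; simp [Finset.sum_apply, Pi.single_apply]
    rw [this]
    refine Submodule.sum_mem _ fun j _ => Submodule.smul_mem _ _ ?_
    obtain ⟨w, hw, hw0, hwT⟩ := sep j (Finset.univ.erase j) (by simp)
    rw [Finset.card_erase_of_mem (Finset.mem_univ j), Finset.card_univ, Fintype.card_fin] at hw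
    have : (Pi.single j (1 : K) : Fin n → K) = (w j)⁻¹ • w := by
      ext i
      by_cases hij : i = j
      · subst hij; simp [hw0]
      · simp [hij, hwT i (by simp [hij])]
    rw [this]
    exact Submodule.smul_mem _ _ hw
  obtain ⟨b, hbs, hbspan, hbli⟩ := exists_linearIndependent K (cv '' {μ | μ.degree ≤ n - 1})
  have hbtop : Submodule.span K b = ⊤ := by rw [hbspan]; exact htop
  have hfin : Finite b := hbli.finite
  have : Fintype b := Fintype.ofFinite b
  let B : Module.Basis b K (Fin n → K) := Module.Basis.mk hbli (by simp [hbtop])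
  have hcard : Fintype.card b = n := by
    have := Module.finrank_eq_card_basis B
    simpa using this.symm
  let e : Fin n ≃ b := (Fintype.equivFinOfCardEq hcard).symm
  have hch : ∀ i : Fin n, ∃ μ : ℕ →₀ ℕ, μ.degree ≤ n - 1 ∧ cv μ = (e i : Fin n → K) := by
    intro i
    obtain ⟨μ, hμ, h⟩ := hbs (e i).2
    exact ⟨μ, hμ, h⟩
  choose μ hμ hcv using hch
  refine ⟨μ, hμ, ?_⟩
  have hli : LinearIndependent K (fun i => (e i : Fin n → K)) := hbli.comp e e.injective
  have hM : LinearIndependent K (Matrix.of fun i j => (bn (μ i) (I j) : K)).row := by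
    convert hli using 1
    ext i j
    rw [← hcv i]; rfl
  have := Matrix.linearIndependent_rows_iff_isUnit.1 hM
  exact (((Matrix.isUnit_iff_isUnit_det _).1 this)).ne_zero

theorem coeff_mul_top {A B : ℕ →₀ ℕ} {f g : MvPolynomial ℕ K}
    (hf : ∀ J ∈ f.support, toLex J ≤ toLex A) (hg : ∀ J ∈ g.support, toLex J ≤ toLex B) :
    (∀ J ∈ (f * g).support, toLex J ≤ toLex (A + B)) ∧
      coeff (A + B) (f * g) = coeff A f * coeff B g := by
  classical
  constructor
  · intro J hJ
    obtain ⟨a, ha, b, hb, rfl⟩ := Finset.mem_add.1 (support_mul f g hJ)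
    exact add_le_add (hf a ha) (hg b hb)
  · rw [coeff_mul, Finset.sum_eq_single (A, B)]
    · rintro ⟨x, y⟩ hxy hne
      have hxy : x + y = A + B := Finset.HasAntidiagonal.mem_antidiagonal.1 hxy
      by_contra h
      have hx := hf x (mem_support_iff.2 (left_ne_zero_of_mul h))
      have hy := hg y (mem_support_iff.2 (right_ne_zero_of_mul h))
      have hs : toLex x + toLex y = toLex A + toLex B := congrArg toLex hxy
      have hxA : toLex x = toLex A := by
        refine le_antisymm hx ?_
        by_contra hlt
        exact absurd hs (ne_of_lt (add_lt_add_of_lt_of_le (not_le.1 hlt) hy))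
      have hxA' : x = A := hxA
      subst hxA'
      have : y = B := by exact add_left_cancel hxy
      exact hne (by rw [this])
    · intro h; simp at h

theorem coeff_prod_top {α : Type*} (s : Finset α) (E : α → (ℕ →₀ ℕ)) (f : α → MvPolynomial ℕ K)
    (hf : ∀ i ∈ s, ∀ J ∈ (f i).support, toLex J ≤ toLex (E i)) :
    (∀ J ∈ (∏ i ∈ s, f i).support, toLex J ≤ toLex (∑ i ∈ s, E i)) ∧
      coeff (∑ i ∈ s, E i) (∏ i ∈ s, f i) = ∏ i ∈ s, coeff (E i) (f i) := by
  classical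
  induction s using Finset.induction_on with
  | empty =>
    simp only [Finset.prod_empty, Finset.sum_empty, support_one, Finset.mem_singleton]
    simp
  | insert i s hi ih =>
    obtain ⟨h1, h2⟩ := ih fun j hj => hf j (by simp [hj])
    rw [Finset.prod_insert hi, Finset.sum_insert hi, Finset.prod_insert hi, ← h2]
    exact coeff_mul_top (hf i (by simp)) h1

theorem exists_lead (f : MvPolynomial ℕ K) (hf : f ≠ 0) :
    ∃ A ∈ f.support, ∀ J ∈ f.support, toLex J ≤ toLex A := by
  have hne : f.support.Nonempty := support_nonempty.2 hf
  exact Finset.exists_max_image f.support (fun J => toLex J) hne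

theorem wronsk [CharZero K] {n : ℕ} (φ : Fin n → MvPolynomial ℕ K)
    (hφ : LinearIndependent K φ) :
    ∃ μ : Fin n → (ℕ →₀ ℕ), (∀ i, (μ i).degree ≤ n - 1) ∧
      Matrix.det (Matrix.of fun i j => Dt (μ i) (φ j)) ≠ 0 := by
  classical
  let V := Submodule.span K (Set.range φ)
  let Ld : Set (ℕ →₀ ℕ) := {A | ∃ f ∈ V, A ∈ f.support ∧ ∀ J ∈ f.support, toLex J ≤ toLex A}
  have hrank : Module.finrank K V = n := by
    have := finrank_span_eq_card hφ
    simpa using this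
  have : Module.Finite K V := Module.Finite.span_of_finite K (Set.finite_range φ)
  have hcard : (n : ℕ∞) ≤ Ld.encard := by
    by_contra hlt
    rw [not_le] at hlt
    have hfin : Ld.Finite := Set.encard_lt_top_iff.1 (hlt.trans (ENat.natCast_lt_top n))
    have : Fintype Ld := hfin.fintype
    let Λ : V →ₗ[K] (Ld → K) :=
      { toFun := fun f A => coeff A.1 f.1
        map_add' := by intro f g; ext A; simp
        map_smul' := by intro c f; ext A; simp }
    have hinj : Function.Injective Λ := by
      rw [← LinearMap.ker_eq_bot, LinearMap.ker_eq_bot']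
      intro f hf
      by_contra hne
      obtain ⟨A, hA, hA'⟩ := exists_lead f.1 (fun h => hne (Subtype.ext h))
      have := congrFun hf ⟨A, f.1, f.2, hA, hA'⟩
      exact (mem_support_iff.1 hA) this
    have h1 := LinearMap.finrank_le_finrank_of_injective hinj
    rw [hrank] at h1
    rw [Module.finrank_fintype_fun_eq_card] at h1
    rw [Set.encard_eq_coe_toFinset_card, Set.toFinset_card] at hlt
    have : Fintype.card Ld < n := by exact_mod_cast hlt
    omega
  obtain ⟨t, htL, htc⟩ := Set.exists_subset_encard_eq hcard
  have htfin : t.Finite := Set.finite_of_encard_eq_coe htc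
  have : Fintype t := htfin.fintype
  have hct : Fintype.card t = n := by
    rw [Set.encard_eq_coe_toFinset_card, Set.toFinset_card] at htc
    exact_mod_cast htc
  let e : Fin n ≃ t := (Fintype.equivFinOfCardEq hct).symm
  have hch : ∀ i : Fin n, ∃ f ∈ V, (e i).1 ∈ f.support ∧
      ∀ J ∈ f.support, toLex J ≤ toLex (e i).1 := fun i => htL (e i).2
  choose ψ hψV hψ1 hψ2 using hch
  obtain ⟨μ, hμ, hdet⟩ := interp (K := K) (fun i => (e i).1)
    (fun i j hij => e.injective (Subtype.ext hij))
  refine ⟨μ, hμ, ?_⟩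
  have hT : ∀ j, ∃ T : Fin n → K, ∑ l, T l • φ l = ψ j := fun j =>
    (Submodule.mem_span_range_iff_exists_fun K).1 (hψV j)
  choose T hT using hT
  have hprod : (Matrix.of fun i j => Dt (μ i) (ψ j)) =
      (Matrix.of fun i j => Dt (μ i) (φ j)) * (Matrix.of fun l j => (C (T j l) : MvPolynomial ℕ K)) := by
    ext1 i j
    simp only [Matrix.mul_apply, Matrix.of_apply]
    rw [← hT j, Dt_sum]
    refine Finset.sum_congr rfl fun l _ => ?_
    rw [smul_eq_C_mul, Dt_C_mul, mul_comm]
  have hne : Matrix.det (Matrix.of fun i j => Dt (μ i) (ψ j)) ≠ 0 := by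
    intro h0
    have hc : coeff (∑ i, (e i).1) (Matrix.det (Matrix.of fun i j => Dt (μ i) (ψ j))) =
        Matrix.det (Matrix.of fun i j => (bn (μ i) (e j).1 : K)) * ∏ j, coeff (e j).1 (ψ j) := by
      rw [Matrix.det_apply, Matrix.det_apply, coeff_sum, Finset.sum_mul]
      refine Finset.sum_congr rfl fun σ _ => ?_
      have h1 := (coeff_prod_top Finset.univ (fun i => (e i).1)
        (fun i => Dt (μ (σ i)) (ψ i)) (fun i _ J hJ => hψ2 i J (support_Dt _ _ hJ))).2
      simp only [Matrix.of_apply]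
      rw [smul_mul_assoc, ← Finset.prod_mul_distrib]
      have h2 : ∏ i, (((bn (μ (σ i)) (e i).1 : ℕ) : K) * coeff (e i).1 (ψ i)) =
          ∏ i, coeff (e i).1 (Dt (μ (σ i)) (ψ i)) :=
        Finset.prod_congr rfl fun i _ => (coeff_Dt _ _ _).symm
      rw [h2, ← h1]
      rcases Int.units_eq_one_or (Equiv.Perm.sign σ) with h | h <;> rw [h] <;> simp
    rw [h0, coeff_zero] at hc
    refine (mul_ne_zero hdet (Finset.prod_ne_zero_iff.2 fun j _ => ?_)) hc.symm
    exact mem_support_iff.1 (hψ1 j)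
  intro h0
  apply hne
  rw [hprod, Matrix.det_mul, h0, zero_mul]

end Rt

end

section

namespace Rt

variable {K : Type*} [Field K] {ι : Type*} [Fintype ι]

theorem alt_choose (k i : ℕ) (hi : 1 ≤ i) (hik : i < k) :
    ∑ j ∈ Finset.range k, (-1 : ℤ) ^ j * (i.choose j : ℤ) = 0 := by
  have h := Int.alternating_sum_range_choose_of_ne (n := i) (by omega)
  rw [← h]
  symm
  refine Finset.sum_subset ?_ ?_
  · intro x hx; simp at hx ⊢; omega
  · intro x _ hx
    simp at hx
    rw [Nat.choose_eq_zero_of_lt (by omega)]; simp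

theorem zuni (S : SPl K ι) (p : Polynomial K) (hp : p ≠ 0) (r : ℕ) (hdeg : p.natDegree ≤ r)
    (hO : ∀ i, p.coeff i ∈ S.O) (T : ℝ) (hT : ∀ v i, S.av v (p.coeff i) ≤ T)
    (ξ : K) (hξ : ξ ≠ 0) (k : ℕ) (hk : 1 ≤ k) (hdvd : (Polynomial.X - Polynomial.C ξ) ^ k ∣ p)
    (v' : ι) (hξ1 : S.av v' ξ ≤ 1) :
    ∃ c ∈ S.O, c ≠ 0 ∧ (∀ v, S.av v c ≤ T) ∧ S.av v' c ≤ (r + 1) * (2 ^ r * T * S.av v' ξ ^ k) := by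
  classical
  obtain ⟨q, hq, hnd⟩ := Polynomial.exists_eq_pow_rootMultiplicity_mul_and_not_dvd p hp 0
  set m := p.rootMultiplicity 0
  rw [Polynomial.C_0, sub_zero] at hq hnd
  have hq0 : q.coeff 0 ≠ 0 := fun h => hnd (Polynomial.X_dvd_iff.2 h)
  have hqc : ∀ i, q.coeff i = p.coeff (i + m) := by
    intro i; rw [hq, Polynomial.coeff_X_pow_mul]
  have hT0 : 0 ≤ T := ((S.av v').nonneg _).trans (hT v' 0)
  have hcop : IsCoprime ((Polynomial.X - Polynomial.C ξ) ^ k) (Polynomial.X ^ m : Polynomial K) := by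
    refine IsCoprime.pow ?_
    have := Polynomial.isCoprime_X_sub_C_of_isUnit_sub (a := ξ) (b := 0) (by simpa using hξ)
    simpa using this
  have hdq : (Polynomial.X - Polynomial.C ξ) ^ k ∣ q := by
    rw [hq] at hdvd; exact hcop.dvd_of_dvd_mul_left hdvd
  obtain ⟨w, hw⟩ := hdq
  have htay : Polynomial.taylor ξ q = Polynomial.X ^ k * Polynomial.taylor ξ w := by
    rw [hw, Polynomial.taylor_mul]
    congr 1
    simp [Polynomial.taylor_apply]
  have hdegq : q.natDegree < r + 1 := by
    rcases eq_or_ne q 0 with h | h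
    · simp [h]
    · have := congrArg Polynomial.natDegree hq
      rw [Polynomial.natDegree_mul (pow_ne_zero _ Polynomial.X_ne_zero) h,
        Polynomial.natDegree_X_pow] at this
      omega
  have hz : ∀ j < k, ∑ i ∈ Finset.range (r + 1), (i.choose j : K) * q.coeff i * ξ ^ i = 0 := by
    intro j hj
    have h1 : (Polynomial.taylor ξ q).coeff j = 0 := by
      rw [htay, Polynomial.coeff_X_pow_mul', if_neg (by omega)]
    rw [Polynomial.taylor_coeff, Polynomial.hasseDeriv_apply, Polynomial.sum_over_range'
      (n := r + 1) _ (by simp) hdegq, Polynomial.eval_finsetSum] at h1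
    have h2 := congrArg (fun x => x * ξ ^ j) h1
    simp only [zero_mul, Finset.sum_mul] at h2
    rw [← h2]
    refine Finset.sum_congr rfl fun i _ => ?_
    rcases lt_or_ge i j with hij | hij
    · simp [Nat.choose_eq_zero_of_lt hij]
    · simp only [Polynomial.eval_monomial]
      rw [mul_assoc, mul_assoc, mul_assoc, ← pow_add, Nat.sub_add_cancel hij]
  let g : ℕ → ℤ := fun i => ∑ j ∈ Finset.range k, (-1 : ℤ) ^ j * (i.choose j : ℤ)
  have hsum : ∑ i ∈ Finset.range (r + 1), (g i : K) * q.coeff i * ξ ^ i = 0 := by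
    have : ∑ j ∈ Finset.range k, (-1 : K) ^ j *
        ∑ i ∈ Finset.range (r + 1), (i.choose j : K) * q.coeff i * ξ ^ i = 0 :=
      Finset.sum_eq_zero fun j hj => by rw [hz j (Finset.mem_range.1 hj), mul_zero]
    rw [← this]
    simp only [Finset.mul_sum]
    rw [Finset.sum_comm]
    refine Finset.sum_congr rfl fun i _ => ?_
    simp only [g]
    push_cast
    rw [Finset.sum_mul, Finset.sum_mul]
    refine Finset.sum_congr rfl fun j _ => ?_
    ring
  have hg0 : g 0 = 1 := by
    simp only [g]
    rw [Finset.sum_eq_single 0]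
    · simp
    · intro j _ hj; simp [Nat.choose_eq_zero_of_lt (Nat.pos_of_ne_zero hj)]
    · intro h; simp at h; omega
  have hgb : ∀ i, |(g i : ℝ)| ≤ 2 ^ i := by
    intro i
    have h1 : |g i| ≤ 2 ^ i := by
      refine (Finset.abs_sum_le_sum_abs _ _).trans ?_
      have : ∀ j ∈ Finset.range k, |(-1 : ℤ) ^ j * (i.choose j : ℤ)| = (i.choose j : ℤ) := by
        intro j _; rw [abs_mul, abs_pow]; simp
      rw [Finset.sum_congr rfl this]
      have h3 : ∑ j ∈ Finset.range k, i.choose j ≤ 2 ^ i := by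
        rw [← Nat.sum_range_choose i]
        calc ∑ j ∈ Finset.range k, i.choose j
            ≤ ∑ j ∈ Finset.range (max k (i + 1)), i.choose j :=
              Finset.sum_le_sum_of_subset (by intro x; simp; omega)
          _ = ∑ j ∈ Finset.range (i + 1), i.choose j := by
              symm
              refine Finset.sum_subset (by intro x; simp; omega) ?_
              intro x _ hx; simp at hx; exact Nat.choose_eq_zero_of_lt (by omega)
      exact_mod_cast h3
    exact_mod_cast h1
  refine ⟨q.coeff 0, hqc 0 ▸ hO _, hq0, fun v => hqc 0 ▸ hT v _, ?_⟩
  rw [Finset.sum_range_succ', hg0] at hsum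
  have he : q.coeff 0 = - ∑ i ∈ Finset.range r, (g (i + 1) : K) * q.coeff (i + 1) * ξ ^ (i + 1) := by
    simp only [Int.cast_one, one_mul, pow_zero, mul_one] at hsum
    exact eq_neg_of_add_eq_zero_right hsum
  rw [he, (S.av v').map_neg]
  refine ((S.av v').sum_le _ _).trans ?_
  have hterm : ∀ i ∈ Finset.range r, S.av v' ((g (i + 1) : K) * q.coeff (i + 1) * ξ ^ (i + 1)) ≤
      2 ^ r * T * S.av v' ξ ^ k := by
    intro i hi
    have hi := Finset.mem_range.1 hi
    rcases lt_or_ge (i + 1) k with h | h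
    · have : g (i + 1) = 0 := alt_choose k (i + 1) (by omega) h
      rw [this]; simp; positivity
    · rw [map_mul, map_mul, map_pow]
      have a1 : S.av v' (g (i + 1) : K) ≤ 2 ^ r := by
        refine ((SPl.av_intCast_le _ _).trans (hgb _)).trans ?_
        exact pow_le_pow_right₀ (by norm_num) (by omega)
      have a2 : S.av v' ξ ^ (i + 1) ≤ S.av v' ξ ^ k :=
        pow_le_pow_of_le_one ((S.av v').nonneg _) hξ1 h
      have a3 : S.av v' (q.coeff (i + 1)) ≤ T := by rw [hqc]; exact hT _ _
      have := (S.av v').nonneg ξ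
      have := (S.av v').nonneg (q.coeff (i + 1))
      gcongr
  refine (Finset.sum_le_sum hterm).trans ?_
  rw [Finset.sum_const, Finset.card_range, nsmul_eq_mul]
  have : 0 ≤ 2 ^ r * T * S.av v' ξ ^ k := by
    have := (S.av v').nonneg ξ
    positivity
  nlinarith

open MvPolynomial

theorem coeff_aeval_X (a : ℕ) (q : Polynomial K) (j : ℕ) :
    coeff (Finsupp.single a j) (Polynomial.aeval (X a : MvPolynomial ℕ K) q) = q.coeff j := by
  classical
  rw [Polynomial.aeval_eq_sum_range, coeff_sum]
  simp only [coeff_smul, coeff_X_pow, smul_eq_mul]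
  have : ∀ i, (Finsupp.single a i = Finsupp.single a j) ↔ i = j := fun i =>
    (Finsupp.single_injective a).eq_iff
  simp only [this, mul_ite, mul_one, mul_zero]
  rw [Finset.sum_ite_eq' (Finset.range (q.natDegree + 1)) j]
  split_ifs with h
  · rfl
  · simp at h; exact (Polynomial.coeff_eq_zero_of_natDegree_lt (by omega)).symm

theorem prod_pow_le (S : SPl K ι) (c : K) (v' : ι) (T b : ℝ) (hT : 1 ≤ T)
    (h : ∀ v, S.av v c ≤ T) (h' : S.av v' c ≤ b) :
    ∏ v, S.av v c ^ S.n v ≤ T ^ (∑ v, S.n v) * b ^ S.n v' := by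
  classical
  rw [← Finset.mul_prod_erase _ _ (Finset.mem_univ v'), mul_comm]
  have h0 : ∀ v, 0 ≤ S.av v c := fun v => (S.av v).nonneg _
  have h1 : ∏ v ∈ Finset.univ.erase v', S.av v c ^ S.n v ≤ T ^ (∑ v, S.n v) := by
    refine (Finset.prod_le_prod (fun v _ => pow_nonneg (h0 v) _)
      (fun v _ => pow_le_pow_left₀ (h0 v) (h v) _)).trans ?_
    rw [Finset.prod_pow_eq_pow_sum]
    exact pow_le_pow_right₀ hT (Finset.sum_le_sum_of_subset (Finset.erase_subset _ _))
  have := h0 v'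
  have : 0 ≤ T ^ (∑ v, S.n v) := by positivity
  gcongr

theorem z1 (S : SPl K ι) (ε : ℝ) (hε : 0 < ε) : ∃ κ : ℝ, 0 < κ ∧ κ ≤ 1 ∧
    ∀ (a : ℕ) (r : ℕ → ℕ) (B : ℝ) (f : MvPolynomial ℕ K) (ξ : ℕ → K) (v' : ι), 0 < B →
      0 < r a → (r a : ℝ) ≤ κ * B → (∀ I ∈ f.support, ∀ h, h ≠ a → I h = 0) →
      (∀ I ∈ f.support, I a ≤ r a) → f ≠ 0 → CO S.O f →
      (∀ v I, S.av v (coeff I f) ≤ Real.exp (κ * B)) → ξ a ≠ 0 →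
      S.av v' (ξ a) ^ (r a) ≤ Real.exp (-B) → ¬ F (fun h => (r h : ℝ)) ε (tr ξ f) := by
  classical
  set g : ℝ := ((∑ v, S.n v : ℕ) : ℝ) with hg
  have hg0 : 0 ≤ g := by positivity
  refine ⟨min 1 (ε / (2 * (g + 3 * g + 1))), by positivity, min_le_left _ _, ?_⟩
  set κ := min 1 (ε / (2 * (g + 3 * g + 1)))
  have hκ0 : 0 < κ := by positivity
  have hκ1 : κ * (2 * (g + 3 * g + 1)) ≤ ε := by
    rw [← le_div_iff₀ (by positivity)]; exact min_le_right _ _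
  intro a r B f ξ v' hB hr hrB hsupp hdeg hf hO hT hξ hξB hF
  have hsing : ∀ I ∈ f.support, I = Finsupp.single a (I a) := by
    intro I hI
    ext h
    by_cases hh : h = a
    · subst hh; simp
    · rw [hsupp I hI h hh]; simp [Ne.symm hh]
  let p : Polynomial K := ∑ i ∈ Finset.range (r a + 1),
    Polynomial.monomial i (coeff (Finsupp.single a i) f)
  have hpc : ∀ i, p.coeff i = coeff (Finsupp.single a i) f := by
    intro i
    simp only [p, Polynomial.finsetSum_coeff, Polynomial.coeff_monomial]
    rw [Finset.sum_ite_eq' (Finset.range (r a + 1)) i]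
    split_ifs with h
    · rfl
    · symm
      rw [← notMem_support_iff]
      intro hI
      have := hdeg _ hI
      simp at this h; omega
  have hfp : f = Polynomial.aeval (X a : MvPolynomial ℕ K) p := by
    conv_lhs => rw [← support_sum_monomial_coeff f]
    have : Polynomial.aeval (X a : MvPolynomial ℕ K) p =
        ∑ i ∈ Finset.range (r a + 1), monomial (Finsupp.single a i) (coeff (Finsupp.single a i) f) := by
      simp only [p, map_sum, Polynomial.aeval_monomial]
      refine Finset.sum_congr rfl fun i _ => ?_
      rw [X_pow_eq_monomial, algebraMap_eq, C_mul_monomial, mul_one]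
    rw [this]
    symm
    rw [← Finset.sum_image (s := Finset.range (r a + 1)) (g := fun i => Finsupp.single a i)
      (f := fun I => monomial I (coeff I f)) (fun x _ y _ h => Finsupp.single_injective a h)]
    symm
    refine Finset.sum_subset ?_ ?_
    · intro I hI
      rw [hsing I hI]
      exact Finset.mem_image.2 ⟨I a, by simpa using Nat.lt_succ_of_le (hdeg I hI), rfl⟩
    · intro I _ hI; rw [notMem_support_iff.1 hI, monomial_zero]
  have hp : p ≠ 0 := by
    intro h; apply hf; rw [hfp, h, map_zero]
  have htr : tr ξ f = Polynomial.aeval (X a : MvPolynomial ℕ K) (Polynomial.taylor (ξ a) p) := by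
    rw [hfp, Polynomial.taylor_apply, Polynomial.aeval_comp, ← Polynomial.aeval_algHom_apply]
    simp [tr_X]
  set k := ⌈ε * r a⌉₊ with hk
  have hrpos : (0 : ℝ) < r a := by exact_mod_cast hr
  have hkpos : 1 ≤ k := Nat.one_le_iff_ne_zero.2 (by
    rw [hk]; exact (Nat.ceil_pos.2 (by positivity)).ne')
  have hdvd : (Polynomial.X - Polynomial.C (ξ a)) ^ k ∣ p := by
    have h1 : Polynomial.X ^ k ∣ Polynomial.taylor (ξ a) p := by
      rw [Polynomial.X_pow_dvd_iff]
      intro j hj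
      by_contra hne
      rw [← coeff_aeval_X a, ← htr] at hne
      have := hF _ (mem_support_iff.2 hne)
      rw [wt_single, le_div_iff₀ hrpos] at this
      have h2 : j < ε * r a := by
        have := Nat.lt_ceil.1 hj
        exact this
      linarith
    obtain ⟨w, hw⟩ := h1
    refine ⟨Polynomial.taylor (-(ξ a)) w, ?_⟩
    have := congrArg (Polynomial.taylor (-(ξ a))) hw
    rw [Polynomial.taylor_taylor, Polynomial.taylor_mul] at this
    simp only [neg_add_cancel, Polynomial.taylor_zero] at this
    rw [this]
    congr 1
    simp [Polynomial.taylor_apply, sub_eq_add_neg]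
  have hξ1 : S.av v' (ξ a) ≤ 1 := by
    by_contra h
    push Not at h
    have h1 := one_le_pow₀ (n := r a) h.le
    have h2 : Real.exp (-B) < 1 := Real.exp_lt_one_iff.2 (by linarith)
    linarith
  have hdegp : p.natDegree ≤ r a := by
    refine Polynomial.natDegree_sum_le_of_forall_le _ _ fun i hi => ?_
    refine (Polynomial.natDegree_monomial_le _).trans ?_
    simp at hi; omega
  obtain ⟨c, hcO, hc0, hcT, hcv⟩ := zuni S p hp (r a) hdegp (fun i => hpc i ▸ hO _)
    (Real.exp (κ * B)) (fun v i => hpc i ▸ hT v _) (ξ a) hξ k hkpos hdvd v' hξ1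
  have h1 := S.prod_ge c hcO hc0
  -- bound the small absolute value
  have hξk : S.av v' (ξ a) ^ k ≤ Real.exp (-(ε * B)) := by
    have hpos : 0 < S.av v' (ξ a) := (S.av v').pos hξ
    have hl : (r a : ℝ) * Real.log (S.av v' (ξ a)) ≤ -B := by
      have := Real.log_le_log (by positivity) hξB
      rwa [Real.log_pow, Real.log_exp] at this
    rw [← Real.log_le_log_iff (by positivity) (Real.exp_pos _), Real.log_pow, Real.log_exp]
    have hlog : Real.log (S.av v' (ξ a)) ≤ 0 := Real.log_nonpos hpos.le hξ1
    have hk' : ε * r a ≤ k := Nat.le_ceil _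
    nlinarith
  have hr2 : ((r a : ℝ) + 1) ≤ Real.exp (r a) := Real.add_one_le_exp _
  have h2r : (2 : ℝ) ^ r a ≤ Real.exp (r a) := by
    have : (2 : ℝ) ≤ Real.exp 1 := by have := Real.add_one_le_exp 1; linarith
    calc (2 : ℝ) ^ r a ≤ Real.exp 1 ^ r a := pow_le_pow_left₀ (by norm_num) this _
      _ = Real.exp (r a) := by rw [← Real.exp_nat_mul, mul_one]
  have hcv' : S.av v' c ≤ Real.exp (3 * κ * B - ε * B) := by
    refine hcv.trans ?_
    calc ((r a : ℝ) + 1) * (2 ^ r a * Real.exp (κ * B) * S.av v' (ξ a) ^ k)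
        ≤ Real.exp (r a) * (Real.exp (r a) * Real.exp (κ * B) * Real.exp (-(ε * B))) := by
          gcongr
      _ = Real.exp (r a + (r a + κ * B + -(ε * B))) := by rw [← Real.exp_add, ← Real.exp_add, ← Real.exp_add]
      _ ≤ Real.exp (3 * κ * B - ε * B) := Real.exp_le_exp.2 (by linarith)
  have h2 := prod_pow_le S c v' _ _ (Real.one_le_exp (by positivity)) hcT hcv'
  rw [← Real.exp_nat_mul, ← Real.exp_nat_mul, ← Real.exp_add] at h2
  have h3 := h1.trans h2
  rw [← Real.exp_zero, Real.exp_le_exp] at h3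
  rw [← hg] at h3
  have hn1 : (1 : ℝ) ≤ S.n v' := by exact_mod_cast S.npos v'
  have hng : (S.n v' : ℝ) ≤ g := by
    rw [hg]
    exact_mod_cast Finset.single_le_sum (f := fun v => S.n v) (fun _ _ => Nat.zero_le _) (Finset.mem_univ v')
  have h4 : 3 * κ * B - ε * B ≤ 3 * κ * B - 2 * (g + 3 * g + 1) * κ * B := by nlinarith
  have h5 : 0 < κ * B := by positivity
  have h6 : (S.n v' : ℝ) * (3 * κ * B - ε * B) ≤ 3 * κ * B - 2 * (g + 3 * g + 1) * κ * B := by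
    have : 3 * κ * B - ε * B ≤ 0 := by
      have : 1 ≤ g := hn1.trans hng
      nlinarith
    nlinarith
  have h7 : 1 ≤ g := hn1.trans hng
  nlinarith

end Rt

end

section

namespace Rt
open MvPolynomial

variable {K : Type*} [Field K] {ι : Type*} [Fintype ι]

/-- partial degree bound -/
def Bd (r : ℕ → ℕ) (f : MvPolynomial ℕ K) : Prop := ∀ I ∈ f.support, ∀ h, I h ≤ r h

theorem Bd.mono {r r' : ℕ → ℕ} {f : MvPolynomial ℕ K} (hf : Bd r f) (h : ∀ x, r x ≤ r' x) :
    Bd r' f := fun I hI x => (hf I hI x).trans (h x)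

theorem Bd_zero (r : ℕ → ℕ) : Bd r (0 : MvPolynomial ℕ K) := by intro I hI; simp at hI

theorem Bd.add {r : ℕ → ℕ} {f g : MvPolynomial ℕ K} (hf : Bd r f) (hg : Bd r g) :
    Bd r (f + g) := by
  classical
  intro I hI
  rcases Finset.mem_union.1 (support_add hI) with h | h
  · exact hf I h
  · exact hg I h

theorem Bd.neg {r : ℕ → ℕ} {f : MvPolynomial ℕ K} (hf : Bd r f) : Bd r (-f) := by
  intro I hI; exact hf I (by simpa using hI)

theorem Bd.sum {r : ℕ → ℕ} {α : Type*} {s : Finset α} {f : α → MvPolynomial ℕ K}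
    (hf : ∀ i ∈ s, Bd r (f i)) : Bd r (∑ i ∈ s, f i) := by
  classical
  induction s using Finset.induction_on with
  | empty => simpa using Bd_zero r
  | insert i s hi ih =>
    rw [Finset.sum_insert hi]
    exact (hf i (by simp)).add (ih fun j hj => hf j (by simp [hj]))

theorem Bd.mul {r r' : ℕ → ℕ} {f g : MvPolynomial ℕ K} (hf : Bd r f) (hg : Bd r' g) :
    Bd (fun x => r x + r' x) (f * g) := by
  classical
  intro I hI h
  obtain ⟨a, ha, b, hb, rfl⟩ := Finset.mem_add.1 (support_mul f g hI)
  exact add_le_add (hf a ha h) (hg b hb h)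

theorem Bd.monomial {r : ℕ → ℕ} (I : ℕ →₀ ℕ) (c : K) (h : ∀ x, I x ≤ r x) :
    Bd r (monomial I c) := by
  classical
  intro J hJ
  have := support_monomial_subset hJ
  rw [Finset.mem_singleton] at this
  subst this; exact h

theorem Bd.C (r : ℕ → ℕ) (c : K) : Bd r (C c) := Bd.monomial 0 c (by simp)

theorem Bd.prod {α : Type*} {s : Finset α} {r : α → ℕ → ℕ} {f : α → MvPolynomial ℕ K}
    (hf : ∀ i ∈ s, Bd (r i) (f i)) : Bd (fun x => ∑ i ∈ s, r i x) (∏ i ∈ s, f i) := by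
  classical
  induction s using Finset.induction_on with
  | empty => simpa using Bd.C _ (1 : K)
  | insert i s hi ih =>
    rw [Finset.prod_insert hi]
    refine ((hf i (by simp)).mul (ih fun j hj => hf j (by simp [hj]))).mono fun x => ?_
    rw [Finset.sum_insert hi]

theorem Bd.det {n : ℕ} {r : ℕ → ℕ} (M : Matrix (Fin n) (Fin n) (MvPolynomial ℕ K))
    (hM : ∀ i j, Bd r (M i j)) : Bd (fun x => n * r x) M.det := by
  rw [Matrix.det_apply]
  refine Bd.sum fun σ _ => ?_
  have h1 : Bd (fun x => n * r x) (∏ i, M (σ i) i) := by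
    refine (Bd.prod fun i _ => hM (σ i) i).mono fun x => ?_
    simp
  rcases Int.units_eq_one_or (Equiv.Perm.sign σ) with h | h <;> rw [h]
  · simpa using h1
  · simpa using h1.neg

theorem Bd.pow {r : ℕ → ℕ} {f : MvPolynomial ℕ K} (hf : Bd r f) (m : ℕ) :
    Bd (fun x => m * r x) (f ^ m) := by
  have := Bd.prod (s := Finset.range m) (fun _ _ => hf)
  simpa using this

theorem Bd.tr {r : ℕ → ℕ} {f : MvPolynomial ℕ K} (hf : Bd r f) (ξ : ℕ → K) :
    Bd r (tr ξ f) := by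
  classical
  rw [← support_sum_monomial_coeff f, map_sum]
  refine Bd.sum fun I hI => ?_
  rw [monomial_eq, map_mul, tr_C, Finsupp.prod, map_prod]
  refine (((Bd.C (fun _ => 0) _).mul (Bd.prod (r := fun h => fun x => I h * (Finsupp.single h 1) x)
    (fun h _ => ?_)))).mono (r := fun x => 0 + ∑ h ∈ I.support, I h * (Finsupp.single h 1 : ℕ →₀ ℕ) x) ?_
  · rw [map_pow, tr_X]
    refine Bd.pow ?_ _
    exact (Bd.monomial (Finsupp.single h 1) 1 (fun _ => le_rfl)).add (Bd.C _ _)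
  · intro x
    rw [zero_add]
    refine le_trans ?_ (hf I hI x)
    simp only [Finsupp.single_apply, mul_ite, mul_one, mul_zero]
    rw [Finset.sum_ite_eq']
    split_ifs <;> simp

theorem Bd.Dt {r : ℕ → ℕ} {f : MvPolynomial ℕ K} (hf : Bd r f) (μ : ℕ →₀ ℕ) : Bd r (Dt μ f) :=
  fun I hI => hf I (support_Dt μ f hI)

theorem coeff_mul_disj (A : Set ℕ) (f g : MvPolynomial ℕ K)
    (hf : ∀ I ∈ f.support, ∀ x ∉ A, I x = 0) (hg : ∀ I ∈ g.support, ∀ x ∈ A, I x = 0)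
    (I J : ℕ →₀ ℕ) (hI : ∀ x ∉ A, I x = 0) (hJ : ∀ x ∈ A, J x = 0) :
    coeff (I + J) (f * g) = coeff I f * coeff J g := by
  classical
  rw [coeff_mul, Finset.sum_eq_single (I, J)]
  · rintro ⟨x, y⟩ hxy hne
    have hxy : x + y = I + J := Finset.HasAntidiagonal.mem_antidiagonal.1 hxy
    by_contra h
    have hx := hf x (mem_support_iff.2 (left_ne_zero_of_mul h))
    have hy := hg y (mem_support_iff.2 (right_ne_zero_of_mul h))
    have hxI : x = I := by
      ext t
      by_cases ht : t ∈ A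
      · have := DFunLike.congr_fun hxy t
        simp [hy t ht, hJ t ht] at this
        exact this
      · rw [hx t ht, hI t ht]
    subst hxI
    have : y = J := add_left_cancel hxy
    exact hne (by rw [this])
  · intro h; simp at h

theorem F_split {r : ℕ → ℝ} (A : Set ℕ) {f g : MvPolynomial ℕ K} {θ : ℝ}
    (hf : ∀ I ∈ f.support, ∀ x ∉ A, I x = 0) (hg : ∀ I ∈ g.support, ∀ x ∈ A, I x = 0)
    (h : F r (2 * θ) (f * g)) : F r θ f ∨ F r θ g := by
  by_contra hcon
  rw [not_or] at hcon
  obtain ⟨h1, h2⟩ := hcon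
  simp only [F, not_forall, not_le] at h1 h2
  obtain ⟨I, hI, hI'⟩ := h1
  obtain ⟨J, hJ, hJ'⟩ := h2
  have hc := coeff_mul_disj A f g hf hg I J (hf I hI) (hg J hJ)
  have hne : coeff (I + J) (f * g) ≠ 0 := by
    rw [hc]; exact mul_ne_zero (mem_support_iff.1 hI) (mem_support_iff.1 hJ)
  have := h _ (mem_support_iff.2 hne)
  rw [wt_add] at this
  linarith

theorem exists_le_of_Dt_ne_zero (μ : ℕ →₀ ℕ) (f : MvPolynomial ℕ K) (h : Dt μ f ≠ 0) :
    ∃ I ∈ f.support, ∀ x, μ x ≤ I x := by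
  classical
  obtain ⟨I, hI⟩ := support_nonempty.2 h
  refine ⟨I, support_Dt _ _ hI, fun x => ?_⟩
  rw [mem_support_iff, coeff_Dt] at hI
  have hb : bn μ I ≠ 0 := fun h0 => hI (by rw [h0]; simp)
  rw [bn_eq μ I (insert x μ.support) (Finset.subset_insert _ _), Finset.prod_ne_zero_iff] at hb
  have := hb x (Finset.mem_insert_self _ _)
  by_contra hlt
  exact this (Nat.choose_eq_zero_of_lt (not_le.1 hlt))

theorem wt_congr {r r' : ℕ → ℝ} {I : ℕ →₀ ℕ} (h : ∀ x, I x ≠ 0 → r x = r' x) :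
    wt r I = wt r' I := by
  refine Finset.sum_congr rfl fun x hx => ?_
  simp only
  rw [h x (Finsupp.mem_support_iff.1 hx)]

theorem l1_entry (a : AbsoluteValue K ℝ) (k : ℕ) (r : ℕ → ℕ) (hr0 : ∀ h, k ≤ h → r h = 0)
    (b : ℝ) (hrb : ∀ h < k, (r h : ℝ) ≤ b)
    (f : MvPolynomial ℕ K) (hf : Bd r f) (hc : ∀ I, a (coeff I f) ≤ Real.exp b) (μ : ℕ →₀ ℕ) :
    l1 a (Dt μ f) ≤ Real.exp ((2 * k + 1) * b) := by
  classical
  set m := ∑ h ∈ Finset.range k, r h with hm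
  have hsup : ∀ I ∈ f.support, I.support ⊆ Finset.range k := by
    intro I hI x hx
    by_contra hxk
    have h1 := hf I hI x
    rw [hr0 x (by simpa using hxk)] at h1
    simp at hx; omega
  have hdeg : ∀ I ∈ f.support, I.degree ≤ m := by
    intro I hI
    rw [Finsupp.degree_apply]
    exact (Finset.sum_le_sum_of_subset (hsup I hI)).trans
      (Finset.sum_le_sum fun h _ => hf I hI h)
  have hcard : f.support.card ≤ 2 ^ m := by
    let R : ℕ →₀ ℕ := Finsupp.onFinset (Finset.range k) r (by
      intro x hx; by_contra h; exact hx (hr0 x (by simpa using h)))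
    have h1 : f.support ⊆ Finset.Iic R := by
      intro I hI
      rw [Finset.mem_Iic]
      intro x; exact hf I hI x
    refine (Finset.card_le_card h1).trans ?_
    rw [Finsupp.card_Iic, hm, ← Finset.prod_pow_eq_pow_sum]
    have h2 : R.support ⊆ Finset.range k := Finsupp.support_onFinset_subset
    refine (Finset.prod_le_prod_of_subset_of_one_le' h2 ?_).trans ?_
    · intro i _ _; simp
    · refine Finset.prod_le_prod' fun i _ => ?_
      simp only [Nat.card_Iic]
      exact Nat.lt_two_pow_self
  have h1 := l1_Dt a μ f m hdeg
  have h2 : l1 a f ≤ 2 ^ m * Real.exp b := by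
    refine (Finset.sum_le_card_nsmul _ _ (Real.exp b) (fun I _ => hc I)).trans ?_
    rw [nsmul_eq_mul]
    gcongr
    exact_mod_cast hcard
  have h3 : (2 : ℝ) ^ m ≤ Real.exp (k * b) := by
    have : (2 : ℝ) ≤ Real.exp 1 := by have := Real.add_one_le_exp 1; linarith
    calc (2 : ℝ) ^ m ≤ Real.exp 1 ^ m := pow_le_pow_left₀ (by norm_num) this _
      _ = Real.exp m := by rw [← Real.exp_nat_mul, mul_one]
      _ ≤ Real.exp (k * b) := by
        rw [Real.exp_le_exp, hm]
        push_cast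
        refine (Finset.sum_le_card_nsmul _ _ b (fun h hh => hrb h (Finset.mem_range.1 hh))).trans ?_
        simp
  calc l1 a (Dt μ f) ≤ 2 ^ m * (2 ^ m * Real.exp b) := h1.trans (by gcongr)
    _ ≤ Real.exp (k * b) * (Real.exp (k * b) * Real.exp b) := by gcongr
    _ = Real.exp ((2 * k + 1) * b) := by rw [← Real.exp_add, ← Real.exp_add]; ring_nf

/-- decomposition with respect to the last variable -/
theorem decomp (k : ℕ) (r : ℕ → ℕ) (hr0 : ∀ h, k < h → r h = 0)
    (f : MvPolynomial ℕ K) (hf : f ≠ 0) (hb : Bd r f) :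
    ∃ (n : ℕ) (φ ψ : Fin n → MvPolynomial ℕ K), 0 < n ∧ n ≤ r k + 1 ∧ f = ∑ j, φ j * ψ j ∧
      LinearIndependent K φ ∧ LinearIndependent K ψ ∧
      (∀ j, Bd (fun h => if h < k then r h else 0) (φ j)) ∧
      (∀ j, Bd (fun h => if h = k then r h else 0) (ψ j)) ∧
      (∀ j I, ∃ J, coeff I (φ j) = coeff J f ∨ coeff I (φ j) = 0) := by
  classical
  let fa : ℕ → MvPolynomial ℕ K := fun a =>
    ∑ I ∈ f.support with I k = a, monomial (I.erase k) (coeff I f)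
  have hfa : ∀ a J, coeff J (fa a) = if J k = 0 then coeff (J + Finsupp.single k a) f else 0 := by
    intro a J
    simp only [fa, coeff_sum, coeff_monomial]
    split_ifs with hJ
    · have : ∀ I ∈ f.support.filter (fun I => I k = a),
          (if I.erase k = J then coeff I f else 0) =
          if I = J + Finsupp.single k a then coeff I f else 0 := by
        intro I hI
        have hIk := (Finset.mem_filter.1 hI).2
        congr 1
        apply propext
        constructor
        · intro h; rw [← h, ← hIk, Finsupp.erase_add_single]
        · intro h; rw [h]; ext x
          by_cases hx : x = k
          · subst hx; simp [hJ]
          · simp [hx]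
      rw [Finset.sum_congr rfl this, Finset.sum_ite_eq']
      split_ifs with h
      · rfl
      · by_contra hne
        apply h
        rw [Finset.mem_filter]
        exact ⟨mem_support_iff.2 (fun h0 => hne h0.symm), by simp [hJ]⟩
    · refine Finset.sum_eq_zero fun I _ => ?_
      rw [if_neg]
      intro h; apply hJ; rw [← h]; simp
  have hsum : f = ∑ a ∈ Finset.range (r k + 1), fa a * X k ^ a := by
    conv_lhs => rw [← support_sum_monomial_coeff f]
    rw [← Finset.sum_fiberwise_of_maps_to (t := Finset.range (r k + 1)) (g := fun I => I k)
      (fun I hI => by simpa using Nat.lt_succ_of_le (hb I hI k))]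
    refine Finset.sum_congr rfl fun a _ => ?_
    simp only [fa, Finset.sum_mul]
    refine Finset.sum_congr rfl fun I hI => ?_
    have hIk := (Finset.mem_filter.1 hI).2
    rw [X_pow_eq_monomial, monomial_mul, mul_one, ← hIk, Finsupp.erase_add_single]
  let s : Finset (MvPolynomial ℕ K) := (Finset.range (r k + 1)).image fa
  obtain ⟨b, hbs, hbspan, hbli⟩ := exists_linearIndependent K (s : Set (MvPolynomial ℕ K))
  have hbfin : b.Finite := s.finite_toSet.subset hbs
  have : Fintype b := hbfin.fintype
  set n := Fintype.card b with hn
  let e : Fin n ≃ b := (Fintype.equivFin b).symm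
  have hch : ∀ j : Fin n, ∃ a, a < r k + 1 ∧ fa a = (e j).1 := by
    intro j
    have := hbs (e j).2
    simp only [s, Finset.coe_image, Set.mem_image, Finset.mem_coe, Finset.mem_range] at this
    exact this
  choose α hα1 hα2 using hch
  have hLI : LinearIndependent K (fun j => fa (α j)) := by
    have : (fun j => fa (α j)) = (Subtype.val ∘ e : Fin n → MvPolynomial ℕ K) := by
      ext1 j; exact hα2 j
    rw [this]; exact hbli.comp e e.injective
  have hspan : ∀ a, ∃ c : Fin n → K, a < r k + 1 → ∑ j, c j • fa (α j) = fa a := by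
    intro a
    by_cases ha : a < r k + 1
    · have h1 : fa a ∈ Submodule.span K b := by
        rw [hbspan]; refine Submodule.subset_span ?_
        simp only [s, Finset.coe_image]; exact ⟨a, by simpa using ha, rfl⟩
      have h2 : Set.range (fun j => fa (α j)) = b := by
        ext x; constructor
        · rintro ⟨j, rfl⟩; simp only [hα2 j]; exact (e j).2
        · intro hx; exact ⟨e.symm ⟨x, hx⟩, by simp only [hα2]; simp⟩
      rw [← h2] at h1
      obtain ⟨c, hc⟩ := (Submodule.mem_span_range_iff_exists_fun K).1 h1
      exact ⟨c, fun _ => hc⟩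
    · exact ⟨0, fun h => absurd h ha⟩
  choose c hc using hspan
  have hcδ : ∀ i j, c (α i) j = if j = i then 1 else 0 := by
    intro i j
    have h1 := hc (α i) (hα1 i)
    have h2 : ∑ j, (c (α i) j - if j = i then (1 : K) else 0) • fa (α j) = 0 := by
      simp only [sub_smul, Finset.sum_sub_distrib, h1, ite_smul, one_smul, zero_smul]
      rw [Finset.sum_ite_eq']; simp
    have := Fintype.linearIndependent_iff.1 hLI _ h2 j
    exact sub_eq_zero.1 this
  let ψ : Fin n → MvPolynomial ℕ K := fun j =>
    ∑ a ∈ Finset.range (r k + 1), monomial (Finsupp.single k a) (c a j)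
  have hψc : ∀ j a, a < r k + 1 → coeff (Finsupp.single k a) (ψ j) = c a j := by
    intro j a ha
    simp only [ψ, coeff_sum, coeff_monomial]
    have : ∀ i, (Finsupp.single k i = Finsupp.single k a) ↔ i = a := fun i =>
      (Finsupp.single_injective k).eq_iff
    simp only [this]
    rw [Finset.sum_ite_eq', if_pos (by simpa using ha)]
  have hfeq : f = ∑ j, fa (α j) * ψ j := by
    conv_lhs => rw [hsum]
    simp only [ψ, Finset.mul_sum]
    rw [Finset.sum_comm]
    refine Finset.sum_congr rfl fun a ha => ?_
    rw [← hc a (Finset.mem_range.1 ha), Finset.sum_mul]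
    refine Finset.sum_congr rfl fun j _ => ?_
    rw [X_pow_eq_monomial, smul_mul_assoc, ← mul_smul_comm, smul_monomial, smul_eq_mul, mul_one]
  refine ⟨n, fun j => fa (α j), ψ, ?_, ?_, hfeq, hLI, ?_, ?_, ?_, ?_⟩
  · rcases Nat.eq_zero_or_pos n with h | h
    · exfalso; apply hf; rw [hfeq]
      have : IsEmpty (Fin n) := by rw [h]; infer_instance
      exact Fintype.sum_empty _
    · exact h
  · have h1 : n ≤ s.card := by
      rw [hn, ← Set.toFinset_card]
      refine Finset.card_le_card ?_
      intro x hx; exact hbs (by simpa using hx)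
    refine h1.trans (Finset.card_image_le.trans ?_)
    simp
  · rw [Fintype.linearIndependent_iff]
    intro g hg i
    have h1 := congrArg (coeff (Finsupp.single k (α i))) hg
    simp only [coeff_sum, coeff_smul, coeff_zero, smul_eq_mul] at h1
    rw [Finset.sum_congr rfl (fun j _ => by rw [hψc j _ (hα1 i), hcδ i j])] at h1
    simpa using h1
  · intro j
    refine Bd.sum fun I hI => Bd.monomial _ _ fun x => ?_
    have hI := (Finset.mem_filter.1 hI).1
    by_cases hx : x = k
    · subst hx; simp
    · rw [Finsupp.erase_ne hx]
      split_ifs with h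
      · exact hb I hI x
      · have := hb I hI x; rwa [hr0 x (by omega)] at this
  · intro j
    refine Bd.sum fun a ha => Bd.monomial _ _ fun x => ?_
    by_cases hx : x = k
    · subst hx; simp at ha ⊢; omega
    · simp [Ne.symm hx]
  · intro j I
    refine ⟨I + Finsupp.single k (α j), ?_⟩
    rw [hfa]
    split_ifs
    · exact Or.inl rfl
    · exact Or.inr rfl

end Rt

end

section

namespace Rt
open MvPolynomial

variable {K : Type*} [Field K] {ι : Type*} [Fintype ι]

/-- Roth type non-vanishing statement in `k` variables -/
def Zst (S : SPl K ι) (k : ℕ) : Prop := ∀ ε : ℝ, 0 < ε → ∃ κ : ℝ, 0 < κ ∧ κ ≤ 1 ∧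
    ∀ (r : ℕ → ℕ) (B : ℝ) (f : MvPolynomial ℕ K) (ξ : ℕ → K) (v' : ι), 0 < B →
      (∀ h < k, 0 < r h ∧ (r h : ℝ) ≤ κ * B) → (∀ h, k ≤ h → r h = 0) →
      (∀ h, h + 1 < k → (r (h + 1) : ℝ) ≤ κ * r h) → Bd r f → f ≠ 0 → CO S.O f →
      (∀ v I, S.av v (coeff I f) ≤ Real.exp (κ * B)) →
      (∀ h < k, ξ h ≠ 0 ∧ S.av v' (ξ h) ^ (r h) ≤ Real.exp (-B)) →
      ¬ F (fun h => (r h : ℝ)) ε (tr ξ f)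

theorem theta_sum (n r : ℕ) (hr : 0 < r) (hn : n ≤ r + 1) (E : ℝ) (hE0 : 0 < E) (hE1 : E ≤ 1) :
    n * (E ^ 2 / 16) ≤ ∑ m ∈ Finset.range n, max 0 (3 * E / 4 - m / r) := by
  have hr' : (0 : ℝ) < r := by exact_mod_cast hr
  set t := ⌊E * r / 4⌋₊ + 1 with ht
  have ht1 : E * r / 4 ≤ t := by
    rw [ht]; push_cast; exact (Nat.lt_floor_add_one _).le
  have hsub : Finset.range (min n t) ⊆ Finset.range n := by
    intro x hx; simp at hx ⊢; omega
  have h1 : ∑ m ∈ Finset.range (min n t), (E / 2) ≤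
      ∑ m ∈ Finset.range n, max 0 (3 * E / 4 - (m : ℝ) / r) := by
    refine le_trans ?_ (Finset.sum_le_sum_of_subset_of_nonneg hsub
      (fun _ _ _ => le_max_left _ _))
    refine Finset.sum_le_sum fun m hm => ?_
    refine le_trans ?_ (le_max_right _ _)
    have hmt : m ≤ ⌊E * r / 4⌋₊ := by simp at hm; omega
    have hm2 : (m : ℝ) ≤ E * r / 4 :=
      (Nat.cast_le.2 hmt).trans (Nat.floor_le (by positivity))
    have : (m : ℝ) / r ≤ E / 4 := by
      rw [div_le_iff₀ hr']; linarith
    linarith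
  refine le_trans ?_ h1
  rw [Finset.sum_const, Finset.card_range, nsmul_eq_mul]
  rcases le_total n t with h | h
  · rw [min_eq_left h]
    have : E ^ 2 / 16 ≤ E / 2 := by nlinarith
    gcongr
  · rw [min_eq_right h]
    have hnr : (n : ℝ) ≤ 2 * r := by
      have : n ≤ 2 * r := by omega
      exact_mod_cast this
    have : (n : ℝ) * (E / 8) ≤ t := by nlinarith
    nlinarith

theorem zst [CharZero K] (S : SPl K ι) (k : ℕ) : Zst S k := by
  classical
  induction k with
  | zero =>
    intro ε hε
    refine ⟨1, one_pos, le_rfl, ?_⟩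
    intro r B f ξ v' hB _ hr0 _ hb hf _ _ _ hF
    obtain ⟨I, hI⟩ := support_nonempty.2 (fun h : tr ξ f = 0 => by
      have hI0 : ∀ J ∈ f.support, J = 0 := by
        intro J hJ; ext x
        have := hb J hJ x
        rw [hr0 x (Nat.zero_le _)] at this
        simpa using this
      have hfC : f = C (coeff 0 f) := by
        ext J
        rw [coeff_C]
        split_ifs with hJ
        · rw [← hJ]
        · by_contra hne
          exact hJ (hI0 J (mem_support_iff.2 hne)).symm
      rw [hfC, tr_C] at h
      exact hf (by rw [hfC, h]))
    have h1 := hF I hI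
    have h2 := hb.tr ξ I hI
    have : I = 0 := by
      ext x
      have := h2 x
      rw [hr0 x (Nat.zero_le _)] at this
      simpa using this
    rw [this] at h1
    simp [wt] at h1
    linarith
  | succ k ih =>
    intro ε hε
    set E := min ε 1 with hE
    have hE0 : 0 < E := by positivity
    have hE1 : E ≤ 1 := min_le_right _ _
    obtain ⟨κ1, hκ1, hκ1', IH⟩ := ih (E ^ 2 / 32) (by positivity)
    obtain ⟨κ2, hκ2, hκ2', Z1⟩ := z1 S (E ^ 2 / 32) (by positivity)
    set κ0 := min (min κ1 κ2) (E / 4) with hκ0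
    have hκ0p : 0 < κ0 := by positivity
    set κ := κ0 / (2 * k + 4) with hκ
    have hκp : 0 < κ := by positivity
    have hκκ0 : (2 * k + 4) * κ = κ0 := by rw [hκ]; field_simp
    have hκle : κ ≤ κ0 := by
      rw [← hκκ0]
      have : (0 : ℝ) ≤ k := Nat.cast_nonneg _
      nlinarith
    have hκa : κ0 ≤ κ1 := (min_le_left _ _).trans (min_le_left _ _)
    have hκb : κ0 ≤ κ2 := (min_le_left _ _).trans (min_le_right _ _)
    have hκc : κ0 ≤ E / 4 := min_le_right _ _
    refine ⟨κ, hκp, by linarith, ?_⟩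
    intro r B f ξ v' hB hr hr0 hrat hbd hf hO hsz hξ hF
    have hr0' : ∀ h, k < h → r h = 0 := fun h hh => hr0 h hh
    obtain ⟨n, φ, ψ, hn0, hnr, hfeq, hφ, hψ, hφb, hψb, hφc⟩ := decomp k r hr0' f hf hbd
    obtain ⟨μ, hμd, hμ⟩ := wronsk φ hφ
    obtain ⟨ν, hνd, hν⟩ := wronsk ψ hψ
    set MU : Matrix (Fin n) (Fin n) (MvPolynomial ℕ K) := Matrix.of fun i j => Dt (μ i) (φ j)
    set MV : Matrix (Fin n) (Fin n) (MvPolynomial ℕ K) := Matrix.of fun i j => Dt (ν i) (ψ j)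
    set U := MU.det with hU
    set V := MV.det with hV
    let A : Set ℕ := {x | x < k}
    -- supports of μ, ν
    have hμs : ∀ i, ∀ x ∉ A, μ i x = 0 := by
      intro i x hx
      by_contra hne
      apply hμ
      refine Matrix.det_eq_zero_of_row_eq_zero i fun j => ?_
      by_contra hD
      obtain ⟨I, hI, hle⟩ := exists_le_of_Dt_ne_zero _ _ hD
      have h1 : I x ≤ if x < k then r x else 0 := hφb j I hI x
      rw [if_neg (show ¬ x < k from hx)] at h1
      have := hle x; omega
    have hνs : ∀ i, ∀ x, x ≠ k → ν i x = 0 := by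
      intro i x hx
      by_contra hne
      apply hν
      refine Matrix.det_eq_zero_of_row_eq_zero i fun j => ?_
      by_contra hD
      obtain ⟨I, hI, hle⟩ := exists_le_of_Dt_ne_zero _ _ hD
      have h1 : I x ≤ if x = k then r x else 0 := hψb j I hI x
      rw [if_neg hx] at h1
      have := hle x; omega
    let m : Fin n → ℕ := fun i => ν i k
    have hνm : ∀ i, ν i = Finsupp.single k (m i) := by
      intro i; ext x
      by_cases hx : x = k
      · subst hx; simp [m]
      · rw [hνs i x hx]; simp [Ne.symm hx]
    have hmn : ∀ i, m i < n := by
      intro i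
      have := hνd i
      rw [hνm i, Finsupp.degree_single] at this
      omega
    have hminj : Function.Injective m := by
      intro i j hij
      by_contra hne
      apply hν
      refine Matrix.det_zero_of_row_eq hne ?_
      ext1 l
      simp only [MV, Matrix.of_apply, hνm i, hνm j, hij]
    have hkA : k ∉ A := by simp [A]
    have hνA : ∀ i, ∀ x ∈ A, ν i x = 0 := fun i x hx => hνs i x (fun h => hkA (h ▸ hx))
    have hφA : ∀ j, ∀ I ∈ (φ j).support, ∀ x ∉ A, I x = 0 := by
      intro j I hI x hx
      have : I x ≤ if x < k then r x else 0 := hφb j I hI x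
      rwa [if_neg (show ¬ x < k from hx), Nat.le_zero] at this
    have hψA : ∀ j, ∀ I ∈ (ψ j).support, ∀ x ∈ A, I x = 0 := by
      intro j I hI x hx
      have : I x ≤ if x = k then r x else 0 := hψb j I hI x
      rwa [if_neg (show ¬ x = k from fun h => hkA (h ▸ hx)), Nat.le_zero] at this
    let W : Matrix (Fin n) (Fin n) (MvPolynomial ℕ K) := Matrix.of fun i l => Dt (μ i + ν l) f
    have hW : W = MU * MV.transpose := by
      ext1 i l
      simp only [W, Matrix.of_apply, Matrix.mul_apply, MU, MV, Matrix.transpose_apply]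
      conv_lhs => rw [hfeq, Dt_sum]
      refine Finset.sum_congr rfl fun j _ => ?_
      exact Dt_mul_disj A _ _ _ _ (hμs i) (hνA l) (hφA j) (hψA j)
    have hWd : W.det = U * V := by rw [hW, Matrix.det_mul, Matrix.det_transpose]
    -- sizes
    have hrk := hr k (by omega)
    have hnexp : (n : ℝ) ≤ Real.exp (κ * B) := by
      have h1 : (n : ℝ) ≤ r k + 1 := by exact_mod_cast hnr
      have h2 := Real.add_one_le_exp (r k : ℝ)
      exact h1.trans (h2.trans (Real.exp_le_exp.2 hrk.2))
    have hdetsize : ∀ (v : ι) (M : Matrix (Fin n) (Fin n) (MvPolynomial ℕ K)),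
        (∀ i j, l1 (S.av v) (M i j) ≤ Real.exp ((2 * (k + 1 : ℕ) + 1) * (κ * B))) →
        l1 (S.av v) M.det ≤ Real.exp (κ0 * (n * B)) := by
      intro v M hM
      refine (l1_det _ M _ hM).trans ?_
      have h1 : (n.factorial : ℝ) ≤ Real.exp (κ * B) ^ n := by
        refine le_trans ?_ (pow_le_pow_left₀ (Nat.cast_nonneg _) hnexp n)
        exact_mod_cast Nat.factorial_le_pow n
      calc (n.factorial : ℝ) * Real.exp ((2 * (k + 1 : ℕ) + 1) * (κ * B)) ^ n
          ≤ Real.exp (κ * B) ^ n * Real.exp ((2 * (k + 1 : ℕ) + 1) * (κ * B)) ^ n := by gcongr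
        _ = Real.exp (κ0 * (n * B)) := by
          rw [← mul_pow, ← Real.exp_add, ← Real.exp_nat_mul, ← hκκ0]
          push_cast; ring_nf
    have hr0k : ∀ h, k + 1 ≤ h → r h = 0 := hr0
    have hUsz : ∀ v, l1 (S.av v) U ≤ Real.exp (κ0 * (n * B)) := by
      intro v
      refine hdetsize v MU fun i j => ?_
      refine l1_entry (S.av v) (k + 1) r hr0k (κ * B) (fun h hh => (hr h hh).2) (φ j)
        ((hφb j).mono fun x => by split_ifs <;> simp) (fun I => ?_) _
      obtain ⟨J, h | h⟩ := hφc j I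
      · rw [h]; exact hsz v J
      · rw [h, map_zero]; positivity
    have hWsz : ∀ v, l1 (S.av v) W.det ≤ Real.exp (κ0 * (n * B)) := by
      intro v
      refine hdetsize v W fun i j => ?_
      exact l1_entry (S.av v) (k + 1) r hr0k (κ * B) (fun h hh => (hr h hh).2) f
        hbd (fun I => hsz v I) _
    have hWO : CO S.O W.det := CO.det _ fun i j => hO.Dt _
    have hUO : CO S.O U := by
      refine CO.det _ fun i j => CO.Dt (fun I => ?_) _
      obtain ⟨J, h | h⟩ := hφc j I
      · rw [h]; exact hO J
      · rw [h]; exact S.O.zero_mem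
    -- degrees
    have hUb : Bd (fun x => n * (if x < k then r x else 0)) U := Bd.det _ fun i j => (hφb j).Dt _
    have hVb : Bd (fun x => n * (if x = k then r x else 0)) V := Bd.det _ fun i j => (hψb j).Dt _
    -- index
    have hrle : ∀ j h, h + j = k → (r k : ℝ) ≤ κ ^ j * r h := by
      intro j
      induction j with
      | zero => intro h hh; simp at hh; simp [hh]
      | succ j ihj =>
        intro h hh
        have h1 := ihj (h + 1) (by omega)
        have h2 := hrat h (by omega)
        calc (r k : ℝ) ≤ κ ^ j * r (h + 1) := h1
          _ ≤ κ ^ j * (κ * r h) := by gcongr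
          _ = κ ^ (j + 1) * r h := by ring
    have hrkpos : (0 : ℝ) < r k := by exact_mod_cast hrk.1
    have hκ1'' : κ ≤ 1 := by linarith
    have hwtμ : ∀ i, wt (fun h => (r h : ℝ)) (μ i) ≤ κ := by
      intro i
      have h1 : wt (fun h => (r h : ℝ)) (μ i) ≤ (μ i).sum fun h a => (a : ℝ) * (κ / r k) := by
        refine Finset.sum_le_sum fun h hh => ?_
        have hhk : h < k := by
          by_contra hh'
          exact (Finsupp.mem_support_iff.1 hh) (hμs i h hh')
        have h2 := hrle (k - h) h (by omega)
        have hrh : (0 : ℝ) < r h := by exact_mod_cast (hr h (by omega)).1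
        have h3 : κ ^ (k - h) ≤ κ := by
          calc κ ^ (k - h) ≤ κ ^ 1 := pow_le_pow_of_le_one hκp.le hκ1'' (by omega)
            _ = κ := pow_one _
        have h4 : (r k : ℝ) ≤ κ * r h := h2.trans (by gcongr)
        simp only
        rw [div_eq_mul_inv]
        have : (r h : ℝ)⁻¹ ≤ κ / r k := by
          rw [inv_le_iff_one_le_mul₀ hrh, div_mul_eq_mul_div, le_div_iff₀ hrkpos]; linarith
        gcongr
      refine h1.trans ?_
      rw [Finsupp.sum, ← Finset.sum_mul]
      have h5 : (∑ h ∈ (μ i).support, ((μ i h : ℕ) : ℝ)) ≤ r k := by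
        have h6 := hμd i
        rw [Finsupp.degree_apply] at h6
        have : ∑ h ∈ (μ i).support, μ i h ≤ r k := by omega
        exact_mod_cast this
      calc (∑ h ∈ (μ i).support, ((μ i h : ℕ) : ℝ)) * (κ / r k) ≤ r k * (κ / r k) := by gcongr
        _ = κ := by field_simp
    have hrn : ∀ h, (0 : ℝ) ≤ (fun h => (r h : ℝ)) h := fun h => Nat.cast_nonneg _
    have hent : ∀ i l, F (fun h => (r h : ℝ)) (max 0 (3 * E / 4 - m l / r k)) (tr ξ (W i l)) := by
      intro i l
      rcases max_choice 0 (3 * E / 4 - (m l : ℝ) / r k) with h | h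
      · rw [h]; exact F_of_nonneg hrn _
      · rw [h]
        refine (hF.Dt hrn (μ i + ν l)).mono ?_
        rw [wt_add, hνm l, wt_single]
        have := hwtμ i
        have : E ≤ ε := min_le_left _ _
        have : κ ≤ E / 4 := hκle.trans hκc
        linarith
    have hFW : F (fun h => (r h : ℝ)) (n * (E ^ 2 / 16)) (tr ξ W.det) := by
      rw [Matrix.det_apply, map_sum]
      refine F.sum fun σ _ => ?_
      have h1 : F (fun h => (r h : ℝ)) (n * (E ^ 2 / 16)) (tr ξ (∏ i, W (σ i) i)) := by
        rw [map_prod]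
        refine (F.prod hrn (fun i _ => hent (σ i) i)).mono ?_
        refine (theta_sum n (r k) hrk.1 hnr E hE0 hE1).trans (le_of_eq ?_)
        have himg : Finset.univ.image m = Finset.range n := by
          refine Finset.eq_of_subset_of_card_le ?_ ?_
          · intro x hx
            obtain ⟨i, _, rfl⟩ := Finset.mem_image.1 hx
            simpa using hmn i
          · rw [Finset.card_image_of_injective _ hminj]; simp
        rw [← himg, Finset.sum_image (fun x _ y _ h => hminj h)]
      rcases Int.units_eq_one_or (Equiv.Perm.sign σ) with h | h <;> rw [h]
      · simpa using h1
      · simpa using h1.neg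
    rw [hWd, map_mul, show (n : ℝ) * (E ^ 2 / 16) = 2 * (n * (E ^ 2 / 32)) by ring] at hFW
    have hn0' : (0 : ℝ) < n := by exact_mod_cast hn0
    have hpowB : ∀ h, S.av v' (ξ h) ^ (r h) ≤ Real.exp (-B) →
        S.av v' (ξ h) ^ (n * r h) ≤ Real.exp (-(n * B)) := by
      intro h hh
      rw [mul_comm n, pow_mul]
      refine (pow_le_pow_left₀ (pow_nonneg ((S.av v').nonneg _) _) hh n).trans (le_of_eq ?_)
      rw [← Real.exp_nat_mul]; ring_nf
    have hsp1 : ∀ I ∈ (tr ξ U).support, ∀ x ∉ A, I x = 0 := by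
      intro I hI x hx
      have : I x ≤ n * (if x < k then r x else 0) := hUb.tr ξ I hI x
      rw [if_neg (show ¬ x < k from hx)] at this; simpa using this
    have hsp2 : ∀ I ∈ (tr ξ V).support, ∀ x ∈ A, I x = 0 := by
      intro I hI x hx
      have : I x ≤ n * (if x = k then r x else 0) := hVb.tr ξ I hI x
      rw [if_neg (show ¬ x = k from fun h => hkA (h ▸ hx))] at this; simpa using this
    rcases F_split A (f := tr ξ U) (g := tr ξ V) hsp1 hsp2 hFW
      with hFU | hFV
    · -- use induction hypothesis
      refine IH (fun x => n * (if x < k then r x else 0)) (n * B) U ξ v' (by positivity) ?_ ?_ ?_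
        hUb hμ hUO ?_ ?_ ?_
      · intro h hh
        have := hr h (by omega)
        simp only [if_pos hh]
        refine ⟨Nat.mul_pos hn0 this.1, ?_⟩
        push_cast
        have h2 : (r h : ℝ) ≤ κ1 * B := this.2.trans (by gcongr; linarith)
        nlinarith
      · intro h hh; show n * (if h < k then r h else 0) = 0; rw [if_neg (by omega)]; simp
      · intro h hh
        simp only [if_pos hh, if_pos (show h < k by omega)]
        push_cast
        have := hrat h (by omega)
        have h2 : (r (h + 1) : ℝ) ≤ κ1 * r h := this.trans (by gcongr; linarith)
        nlinarith
      · intro v I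
        refine ((coeff_le_l1 _ _ _).trans (hUsz v)).trans (Real.exp_le_exp.2 ?_)
        gcongr
      · intro h hh
        simp only [if_pos hh]
        exact ⟨(hξ h (by omega)).1, hpowB h (hξ h (by omega)).2⟩
      · intro I hI
        have h1 := hFU I hI
        have h2 : wt (fun h => (((n * (if h < k then r h else 0) : ℕ)) : ℝ)) I =
            wt (fun h => (r h : ℝ)) I / n := by
          rw [wt, wt, Finsupp.sum, Finsupp.sum, Finset.sum_div]
          refine Finset.sum_congr rfl fun x hx => ?_
          have hxk : x < k := by
            by_contra h
            have := hUb.tr ξ I hI x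
            rw [if_neg h] at this
            simp at hx; omega
          simp only [if_pos hxk]
          push_cast
          field_simp
        rw [h2, le_div_iff₀ hn0']; linarith
    · -- use the one variable case
      obtain ⟨I0, hI0⟩ := support_nonempty.2 hμ
      have hu0 : coeff I0 U ≠ 0 := mem_support_iff.1 hI0
      have hUA : ∀ I ∈ U.support, ∀ x ∉ A, I x = 0 := by
        intro I hI x hx
        have : I x ≤ n * (if x < k then r x else 0) := hUb I hI x
        rw [if_neg (show ¬ x < k from hx)] at this; simpa using this
      have hVA : ∀ I ∈ V.support, ∀ x ∈ A, I x = 0 := by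
        intro I hI x hx
        have : I x ≤ n * (if x = k then r x else 0) := hVb I hI x
        rw [if_neg (show ¬ x = k from fun h => hkA (h ▸ hx))] at this; simpa using this
      have hVco : ∀ J, coeff J (C (coeff I0 U) * V) = coeff (I0 + J) W.det ∨
          coeff J (C (coeff I0 U) * V) = 0 := by
        intro J
        by_cases hJ : J ∈ V.support
        · left
          rw [hWd, coeff_mul_disj A U V hUA hVA I0 J (hUA I0 hI0) (hVA J hJ), coeff_C_mul]
        · right; rw [coeff_C_mul, notMem_support_iff.1 hJ, mul_zero]
      have hsV : (C (coeff I0 U) * V).support ⊆ V.support := by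
        intro I hI
        rw [mem_support_iff, coeff_C_mul] at hI
        exact mem_support_iff.2 (right_ne_zero_of_mul hI)
      refine Z1 k (fun x => n * r x) (n * B) (C (coeff I0 U) * V) ξ v' (by positivity)
        (Nat.mul_pos hn0 hrk.1) ?_ ?_ ?_ ?_ ?_ ?_ (hξ k (by omega)).1
        (hpowB k (hξ k (by omega)).2) ?_
      · push_cast
        have h2 : (r k : ℝ) ≤ κ2 * B := hrk.2.trans (by gcongr; linarith)
        nlinarith
      · intro I hI h hh
        have : I h ≤ n * (if h = k then r h else 0) := hVb I (hsV hI) h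
        rw [if_neg hh] at this; simpa using this
      · intro I hI
        have : I k ≤ n * (if k = k then r k else 0) := hVb I (hsV hI) k
        rwa [if_pos rfl] at this
      · exact mul_ne_zero (by rwa [Ne, C_eq_zero]) hν
      · intro J
        rcases hVco J with h | h <;> rw [h]
        · exact hWO _
        · exact S.O.zero_mem
      · intro v J
        rcases hVco J with h | h <;> rw [h]
        · refine ((coeff_le_l1 _ _ _).trans (hWsz v)).trans (Real.exp_le_exp.2 ?_)
          gcongr
        · rw [map_zero]; positivity
      · rw [map_mul, tr_C]
        refine F.C_mul ?_ _
        intro I hI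
        have h1 := hFV I hI
        have h2 : wt (fun h => (((n * r h : ℕ)) : ℝ)) I =
            wt (fun h => (r h : ℝ)) I / n := by
          rw [wt, wt, Finsupp.sum, Finsupp.sum, Finset.sum_div]
          refine Finset.sum_congr rfl fun x hx => ?_
          push_cast
          field_simp
        rw [h2, le_div_iff₀ hn0']; linarith

end Rt

end

section

namespace Rt
open MvPolynomial

section wn
variable {R : Type*} [CommRing R] {σ : Type*}

theorem mprod_add (ρ : σ → ℝ) (I J : σ →₀ ℕ) :
    ((I + J).prod fun i k => ρ i ^ k) = (I.prod fun i k => ρ i ^ k) * J.prod fun i k => ρ i ^ k := by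
  classical
  exact Finsupp.prod_add_index' (fun _ => pow_zero _) (fun _ _ _ => pow_add _ _ _)

theorem mprod_nonneg {ρ : σ → ℝ} (hρ : ∀ i, 0 ≤ ρ i) (I : σ →₀ ℕ) :
    0 ≤ I.prod fun i k => ρ i ^ k := Finset.prod_nonneg fun i _ => pow_nonneg (hρ i) _

/-- weighted sum of the coefficient norms -/
noncomputable def wn0 (N : RingSeminorm R) (ρ : σ → ℝ) (f : MvPolynomial σ R) : ℝ :=
  ∑ I ∈ f.support, N (coeff I f) * I.prod fun i k => ρ i ^ k

theorem wn0_eq (N : RingSeminorm R) (ρ : σ → ℝ) (f : MvPolynomial σ R) (s : Finset (σ →₀ ℕ))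
    (h : f.support ⊆ s) :
    wn0 N ρ f = ∑ I ∈ s, N (coeff I f) * I.prod fun i k => ρ i ^ k := by
  refine Finset.sum_subset h ?_
  intro I _ hI
  rw [notMem_support_iff.1 hI, map_zero, zero_mul]

theorem wn0_add (N : RingSeminorm R) {ρ : σ → ℝ} (hρ : ∀ i, 0 ≤ ρ i) (f g : MvPolynomial σ R) :
    wn0 N ρ (f + g) ≤ wn0 N ρ f + wn0 N ρ g := by
  classical
  rw [wn0_eq N ρ (f + g) (f.support ∪ g.support) support_add,
    wn0_eq N ρ f (f.support ∪ g.support) Finset.subset_union_left,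
    wn0_eq N ρ g (f.support ∪ g.support) Finset.subset_union_right, ← Finset.sum_add_distrib]
  refine Finset.sum_le_sum fun I _ => ?_
  rw [coeff_add, ← add_mul]
  exact mul_le_mul_of_nonneg_right (map_add_le_add N _ _) (mprod_nonneg hρ I)

theorem wn0_zero (N : RingSeminorm R) (ρ : σ → ℝ) : wn0 N ρ (0 : MvPolynomial σ R) = 0 := by
  simp [wn0]

theorem wn0_sum (N : RingSeminorm R) {ρ : σ → ℝ} (hρ : ∀ i, 0 ≤ ρ i) {α : Type*} (s : Finset α)
    (f : α → MvPolynomial σ R) : wn0 N ρ (∑ i ∈ s, f i) ≤ ∑ i ∈ s, wn0 N ρ (f i) := by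
  classical
  induction s using Finset.induction_on with
  | empty => simp [wn0_zero]
  | insert i s hi ih =>
    rw [Finset.sum_insert hi, Finset.sum_insert hi]
    exact (wn0_add N hρ _ _).trans (by gcongr)

theorem wn0_monomial (N : RingSeminorm R) (ρ : σ → ℝ) (I : σ →₀ ℕ) (c : R) :
    wn0 N ρ (monomial I c) = N c * I.prod fun i k => ρ i ^ k := by
  classical
  rw [wn0_eq N ρ _ {I} support_monomial_subset]
  simp

theorem wn0_mul (N : RingSeminorm R) {ρ : σ → ℝ} (hρ : ∀ i, 0 ≤ ρ i) (f g : MvPolynomial σ R) :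
    wn0 N ρ (f * g) ≤ wn0 N ρ f * wn0 N ρ g := by
  classical
  conv_lhs => rw [← support_sum_monomial_coeff f, ← support_sum_monomial_coeff g,
    Finset.sum_mul_sum]
  refine (wn0_sum N hρ _ _).trans ?_
  rw [wn0, wn0, Finset.sum_mul_sum]
  refine Finset.sum_le_sum fun I _ => ?_
  refine (wn0_sum N hρ _ _).trans ?_
  refine Finset.sum_le_sum fun J _ => ?_
  rw [monomial_mul, wn0_monomial, mprod_add]
  have h1 := mprod_nonneg hρ I
  have h2 := mprod_nonneg hρ J
  calc _ ≤ (N (coeff I f) * N (coeff J g)) * _ :=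
        mul_le_mul_of_nonneg_right (map_mul_le_mul N _ _) (mul_nonneg h1 h2)
    _ = _ := by ring

/-- weighted sum of coefficient norms as a ring seminorm -/
noncomputable def wN (N : RingSeminorm R) (ρ : σ → ℝ) (hρ : ∀ i, 0 ≤ ρ i) :
    RingSeminorm (MvPolynomial σ R) where
  toFun := wn0 N ρ
  map_zero' := wn0_zero N ρ
  add_le' := wn0_add N hρ
  neg' f := by simp [wn0]
  mul_le' := wn0_mul N hρ

theorem wN_monomial (N : RingSeminorm R) {ρ : σ → ℝ} (hρ : ∀ i, 0 ≤ ρ i) (I : σ →₀ ℕ) (c : R) :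
    wN N ρ hρ (monomial I c) = N c * I.prod fun i k => ρ i ^ k := wn0_monomial N ρ I c

theorem wN_C (N : RingSeminorm R) {ρ : σ → ℝ} (hρ : ∀ i, 0 ≤ ρ i) (c : R) :
    wN N ρ hρ (C c) = N c := by
  have := wN_monomial N hρ 0 c
  simpa using this

theorem wN_X (N : RingSeminorm R) {ρ : σ → ℝ} (hρ : ∀ i, 0 ≤ ρ i) (i : σ) :
    wN N ρ hρ (X i) = N 1 * ρ i := by
  have := wN_monomial N hρ (Finsupp.single i 1) 1
  rw [Finsupp.prod_single_index (by simp)] at this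
  simpa [X] using this

theorem coeff_le_wN (N : RingSeminorm R) {ρ : σ → ℝ} (hρ : ∀ i, 0 ≤ ρ i) (f : MvPolynomial σ R)
    (I : σ →₀ ℕ) : N (coeff I f) * (I.prod fun i k => ρ i ^ k) ≤ wN N ρ hρ f := by
  have hn : ∀ I ∈ f.support, 0 ≤ N (coeff I f) * I.prod fun i k => ρ i ^ k :=
    fun I _ => mul_nonneg (apply_nonneg N _) (mprod_nonneg hρ I)
  by_cases h : I ∈ f.support
  · exact Finset.single_le_sum (f := fun I => N (coeff I f) * I.prod fun i k => ρ i ^ k) hn h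
  · rw [notMem_support_iff.1 h, map_zero, zero_mul]; exact apply_nonneg _ _

theorem rs_sum (N : RingSeminorm R) {α : Type*} (s : Finset α) (f : α → R) :
    N (∑ i ∈ s, f i) ≤ ∑ i ∈ s, N (f i) := by
  classical
  induction s using Finset.induction_on with
  | empty => simp
  | insert i s hi ih =>
    rw [Finset.sum_insert hi, Finset.sum_insert hi]
    exact (map_add_le_add N _ _).trans (by gcongr)

theorem rs_prod (N : RingSeminorm R) (h1 : N 1 ≤ 1) {α : Type*} (s : Finset α) (f : α → R) :
    N (∏ i ∈ s, f i) ≤ ∏ i ∈ s, N (f i) := by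
  classical
  induction s using Finset.induction_on with
  | empty => simpa using h1
  | insert i s hi ih =>
    rw [Finset.prod_insert hi, Finset.prod_insert hi]
    exact (map_mul_le_mul N _ _).trans (mul_le_mul_of_nonneg_left ih (apply_nonneg N _))

theorem rs_pow (N : RingSeminorm R) (h1 : N 1 ≤ 1) (f : R) (k : ℕ) : N (f ^ k) ≤ N f ^ k := by
  have := rs_prod N h1 (Finset.range k) (fun _ => f)
  simpa using this

end wn

/-- ring seminorm of an absolute value -/
noncomputable def avN {K : Type*} [Field K] (a : AbsoluteValue K ℝ) : RingSeminorm K where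
  toFun := a
  map_zero' := map_zero a
  add_le' := a.add_le
  neg' := a.map_neg
  mul_le' x y := (map_mul a x y).le

section cheb

/-- second moment bound -/
theorem second_moment {M : ℕ} {β : Type*} [DecidableEq β] (E : Fin M → Finset β)
    (Z : Fin M → β → ℝ) (h0 : ∀ h, ∑ b ∈ E h, Z h b = 0) (h1 : ∀ h, ∀ b ∈ E h, |Z h b| ≤ 1) :
    ∑ b ∈ Fintype.piFinset E, (∑ h, Z h (b h)) ^ 2 ≤ M * (Fintype.piFinset E).card := by
  have key : ∀ h h', ∑ b ∈ Fintype.piFinset E, Z h (b h) * Z h' (b h') ≤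
      if h = h' then ((Fintype.piFinset E).card : ℝ) else 0 := by
    intro h h'
    by_cases hh : h = h'
    · subst hh
      rw [if_pos rfl]
      calc _ ≤ ∑ b ∈ Fintype.piFinset E, (1 : ℝ) := by
            refine Finset.sum_le_sum fun b hb => ?_
            have := h1 h (b h) (Fintype.mem_piFinset.1 hb h)
            have h2 := abs_le.1 this
            nlinarith
        _ = _ := by simp
    · rw [if_neg hh]
      let g : Fin M → β → ℝ := fun k x => if k = h then Z h x else if k = h' then Z h' x else 1
      have e1 : ∀ b : Fin M → β, Z h (b h) * Z h' (b h') = ∏ k, g k (b k) := by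
        intro b
        rw [Fintype.prod_eq_mul h h' hh]
        · simp [g, Ne.symm hh]
        · intro k hk; simp [g, hk.1, hk.2]
      rw [Finset.sum_congr rfl (fun b _ => e1 b), ← Finset.prod_univ_sum]
      refine le_of_eq (Finset.prod_eq_zero (Finset.mem_univ h) ?_)
      simpa [g] using h0 h
  have e2 : ∀ b : Fin M → β, (∑ h, Z h (b h)) ^ 2 = ∑ h, ∑ h', Z h (b h) * Z h' (b h') := by
    intro b; rw [sq, Finset.sum_mul_sum]
  rw [Finset.sum_congr rfl (fun b _ => e2 b), Finset.sum_comm]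
  calc _ = ∑ h, ∑ h', ∑ b ∈ Fintype.piFinset E, Z h (b h) * Z h' (b h') :=
        Finset.sum_congr rfl fun h _ => Finset.sum_comm
    _ ≤ ∑ h, ∑ h', if h = h' then ((Fintype.piFinset E).card : ℝ) else 0 :=
        Finset.sum_le_sum fun h _ => Finset.sum_le_sum fun h' _ => key h h'
    _ = _ := by simp

theorem sum_antidiag (d r : ℕ) (i : Fin d) :
    (d : ℝ) * ∑ b ∈ Finset.piAntidiag (Finset.univ : Finset (Fin d)) r, (b i : ℝ) =
      r * (Finset.piAntidiag (Finset.univ : Finset (Fin d)) r).card := by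
  have h1 : ∀ j : Fin d, ∑ b ∈ Finset.piAntidiag (Finset.univ : Finset (Fin d)) r, (b j : ℝ) =
      ∑ b ∈ Finset.piAntidiag (Finset.univ : Finset (Fin d)) r, (b i : ℝ) := by
    intro j
    refine Finset.sum_bij' (fun b _ => b ∘ Equiv.swap i j) (fun b _ => b ∘ Equiv.swap i j)
      ?_ ?_ ?_ ?_ ?_
    · intro b hb
      simp only [Finset.mem_piAntidiag, Function.comp] at hb ⊢
      refine ⟨?_, by simp⟩
      rw [Equiv.sum_comp (Equiv.swap i j) b]; exact hb.1
    · intro b hb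
      simp only [Finset.mem_piAntidiag, Function.comp] at hb ⊢
      refine ⟨?_, by simp⟩
      rw [Equiv.sum_comp (Equiv.swap i j) b]; exact hb.1
    · intro b _; ext x; simp
    · intro b _; ext x; simp
    · intro b _; simp
  have h2 : ∑ j : Fin d, ∑ b ∈ Finset.piAntidiag (Finset.univ : Finset (Fin d)) r, (b j : ℝ) =
      r * (Finset.piAntidiag (Finset.univ : Finset (Fin d)) r).card := by
    rw [Finset.sum_comm]
    rw [Finset.sum_congr rfl (g := fun _ => (r : ℝ))]
    · simp [mul_comm]
    · intro b hb
      have := (Finset.mem_piAntidiag.1 hb).1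
      exact_mod_cast this
  rw [← h2, Finset.sum_congr rfl (fun j _ => h1 j)]
  simp

/-- index set of multihomogeneous monomials -/
def mons (M d : ℕ) (r : Fin M → ℕ) : Finset (Fin M → Fin d → ℕ) :=
  Fintype.piFinset fun h => Finset.piAntidiag Finset.univ (r h)

theorem mem_mons {M d : ℕ} {r : Fin M → ℕ} {b : Fin M → Fin d → ℕ} :
    b ∈ mons M d r ↔ ∀ h, ∑ i, b h i = r h := by
  simp [mons, Finset.mem_piAntidiag]

theorem card_bad (M d : ℕ) (hd : 0 < d) (r : Fin M → ℕ) (hr : ∀ h, 0 < r h) (η : ℝ) (hη : 0 < η)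
    (hM : 0 < M) :
    (((mons M d r).filter fun b => ∃ i, η * M < |∑ h, (b h i : ℝ) / r h - M / d|).card : ℝ) ≤
      d / (η ^ 2 * M) * (mons M d r).card := by
  classical
  have hd' : (0 : ℝ) < d := by exact_mod_cast hd
  have hM' : (0 : ℝ) < M := by exact_mod_cast hM
  have h1 : ∀ i : Fin d, ∑ b ∈ mons M d r, (∑ h, ((b h i : ℝ) / r h - 1 / d)) ^ 2 ≤
      M * (mons M d r).card := by
    intro i
    refine second_moment (fun h => Finset.piAntidiag Finset.univ (r h))
      (fun h x => (x i : ℝ) / r h - 1 / d) ?_ ?_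
    · intro h
      have := sum_antidiag d (r h) i
      have hr' : (0 : ℝ) < r h := by exact_mod_cast hr h
      rw [Finset.sum_sub_distrib, ← Finset.sum_div]
      simp only [Finset.sum_const, nsmul_eq_mul]
      field_simp
      linarith
    · intro h b hb
      have hr' : (0 : ℝ) < r h := by exact_mod_cast hr h
      have hb' := (Finset.mem_piAntidiag.1 hb).1
      have : b i ≤ r h := by
        rw [← hb']; exact Finset.single_le_sum (f := b) (fun _ _ => Nat.zero_le _) (Finset.mem_univ i)
      have h3 : (b i : ℝ) / r h ≤ 1 := by
        rw [div_le_one hr']; exact_mod_cast this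
      have h4 : 0 ≤ (b i : ℝ) / r h := by positivity
      have h5 : (1 : ℝ) / d ≤ 1 := by
        rw [div_le_one hd']; exact_mod_cast hd
      have h6 : 0 ≤ (1 : ℝ) / d := by positivity
      rw [abs_le]; constructor <;> linarith
  have h2 : ∑ b ∈ mons M d r, ∑ i : Fin d, (∑ h, ((b h i : ℝ) / r h - 1 / d)) ^ 2 ≤
      d * (M * (mons M d r).card) := by
    rw [Finset.sum_comm]
    refine (Finset.sum_le_sum fun i _ => h1 i).trans ?_
    simp
  set bad := (mons M d r).filter fun b => ∃ i, η * M < |∑ h, (b h i : ℝ) / r h - M / d|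
  have h3 : (bad.card : ℝ) * (η * M) ^ 2 ≤
      ∑ b ∈ mons M d r, ∑ i : Fin d, (∑ h, ((b h i : ℝ) / r h - 1 / d)) ^ 2 := by
    calc (bad.card : ℝ) * (η * M) ^ 2 = ∑ b ∈ bad, (η * M) ^ 2 := by simp
      _ ≤ ∑ b ∈ bad, ∑ i : Fin d, (∑ h, ((b h i : ℝ) / r h - 1 / d)) ^ 2 := by
          refine Finset.sum_le_sum fun b hb => ?_
          obtain ⟨i, hi⟩ := (Finset.mem_filter.1 hb).2
          refine le_trans ?_ (Finset.single_le_sum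
            (f := fun i => (∑ h, ((b h i : ℝ) / r h - 1 / d)) ^ 2)
            (fun _ _ => sq_nonneg _) (Finset.mem_univ i))
          have e : ∑ h, ((b h i : ℝ) / r h - 1 / d) = ∑ h, (b h i : ℝ) / r h - M / d := by
            rw [Finset.sum_sub_distrib]; simp [div_eq_mul_inv]
          simp only [e]
          rw [← sq_abs (∑ h, (b h i : ℝ) / r h - M / d)]
          exact pow_le_pow_left₀ (by positivity) hi.le 2
      _ ≤ _ := Finset.sum_le_sum_of_subset_of_nonneg (Finset.filter_subset _ _)
          (fun _ _ _ => Finset.sum_nonneg fun _ _ => sq_nonneg _)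
  have h4 := h3.trans h2
  rw [div_mul_eq_mul_div, le_div_iff₀ (by positivity)]
  have : (bad.card : ℝ) * (η ^ 2 * M) * M ≤ (d * (mons M d r).card) * M := by nlinarith
  exact le_of_mul_le_mul_right this hM'

theorem card_mons (M d : ℕ) (r : Fin M → ℕ) :
    ((mons M d r).card : ℝ) ≤ Real.exp (d * ∑ h, (r h : ℝ)) := by
  have h1 : (mons M d r).card ≤ ∏ h, (r h + 1) ^ d := by
    rw [mons, Fintype.card_piFinset]
    refine Finset.prod_le_prod' fun h _ => ?_
    have : Finset.piAntidiag (Finset.univ : Finset (Fin d)) (r h) ⊆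
        Fintype.piFinset fun _ => Finset.range (r h + 1) := by
      intro b hb
      rw [Fintype.mem_piFinset]
      intro i
      have hb' := (Finset.mem_piAntidiag.1 hb).1
      have : b i ≤ r h := by
        rw [← hb']; exact Finset.single_le_sum (f := b) (fun _ _ => Nat.zero_le _) (Finset.mem_univ i)
      simp; omega
    refine (Finset.card_le_card this).trans ?_
    simp
  calc ((mons M d r).card : ℝ) ≤ ∏ h, ((r h : ℝ) + 1) ^ d := by exact_mod_cast h1
    _ ≤ ∏ h, Real.exp (r h) ^ d :=
        Finset.prod_le_prod (fun _ _ => by positivity) fun h _ =>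
          pow_le_pow_left₀ (by positivity) (Real.add_one_le_exp _) d
    _ = _ := by
        rw [Finset.prod_pow, ← Real.exp_sum, ← Real.exp_nat_mul]

end cheb

end Rt

end

section

namespace Rt
open MvPolynomial

/-- exponent vector as a finsupp -/
noncomputable def fs {M d : ℕ} (b : Fin M → Fin d → ℕ) : (Fin M × Fin d) →₀ ℕ :=
  Finsupp.equivFunOnFinite.symm fun p => b p.1 p.2

theorem fs_apply {M d : ℕ} (b : Fin M → Fin d → ℕ) (p : Fin M × Fin d) : fs b p = b p.1 p.2 := rfl

theorem fs_inj {M d : ℕ} : Function.Injective (fs : (Fin M → Fin d → ℕ) → _) := by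
  intro b b' h
  funext x y
  have := DFunLike.congr_fun h (x, y)
  simpa [fs_apply] using this

/-- multihomogeneous of degree `r` -/
def MH {R : Type*} [CommRing R] {M d : ℕ} (r : Fin M → ℕ) (f : MvPolynomial (Fin M × Fin d) R) :
    Prop := ∀ b, coeff b f ≠ 0 → ∀ h, ∑ i, b (h, i) = r h

/-- multi-weight -/
def mw (M d : ℕ) : Fin M × Fin d → (Fin M → ℕ) := fun p => Pi.single p.1 1

theorem weight_mw {M d : ℕ} (b : (Fin M × Fin d) →₀ ℕ) (h : Fin M) :
    Finsupp.weight (mw M d) b h = ∑ i, b (h, i) := by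
  rw [Finsupp.weight_apply, Finsupp.sum_fintype _ _ (by simp), Finset.sum_apply,
    Fintype.sum_prod_type]
  rw [Finset.sum_eq_single h]
  · simp [mw]
  · intro h' _ hh
    refine Finset.sum_eq_zero fun i _ => ?_
    simp [mw, Ne.symm hh]
  · simp

theorem MH_iff {R : Type*} [CommRing R] {M d : ℕ} (r : Fin M → ℕ)
    (f : MvPolynomial (Fin M × Fin d) R) : MH r f ↔ IsWeightedHomogeneous (mw M d) f r := by
  constructor
  · intro h b hb
    funext x; rw [weight_mw]; exact h b hb x
  · intro h b hb x
    rw [← weight_mw, h hb]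

/-- block linear substitution -/
noncomputable def lsub {M d : ℕ} (A : Matrix (Fin d) (Fin d) ℤ) :
    MvPolynomial (Fin M × Fin d) ℤ →ₐ[ℤ] MvPolynomial (Fin M × Fin d) ℤ :=
  aeval fun p => ∑ j, C (A p.2 j) * X (p.1, j)

theorem lsub_monomial {M d : ℕ} (A : Matrix (Fin d) (Fin d) ℤ) (b : (Fin M × Fin d) →₀ ℕ) (c : ℤ) :
    lsub A (monomial b c) = C c * ∏ p, (∑ j, C (A p.2 j) * X (p.1, j)) ^ (b p) := by
  rw [lsub, aeval_monomial, Finsupp.prod_fintype _ _ (by simp)]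
  rfl

theorem MH_lsub_monomial {M d : ℕ} {r : Fin M → ℕ} (A : Matrix (Fin d) (Fin d) ℤ)
    (b : (Fin M × Fin d) →₀ ℕ) (hb : ∀ h, ∑ i, b (h, i) = r h) (c : ℤ) :
    MH r (lsub A (monomial b c)) := by
  rw [MH_iff, lsub_monomial]
  have h1 : ∀ p : Fin M × Fin d, IsWeightedHomogeneous (mw M d)
      ((∑ j, C (A p.2 j) * X (p.1, j) : MvPolynomial (Fin M × Fin d) ℤ) ^ (b p)) (b p • mw M d p) := by
    intro p
    refine IsWeightedHomogeneous.pow ?_ _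
    refine IsWeightedHomogeneous.sum _ _ _ fun j _ => ?_
    exact (isWeightedHomogeneous_X ℤ (mw M d) (p.1, j)).C_mul _
  have h2 := IsWeightedHomogeneous.prod Finset.univ _ _ (fun p _ => h1 p)
  have h3 : ∑ p, b p • mw M d p = r := by
    funext h
    rw [← hb h, ← weight_mw, Finsupp.weight_apply, Finsupp.sum_fintype _ _ (by simp)]
  rw [h3] at h2
  exact h2.C_mul c

theorem MH.sum {R : Type*} [CommRing R] {M d : ℕ} {r : Fin M → ℕ} {α : Type*} (s : Finset α)
    (f : α → MvPolynomial (Fin M × Fin d) R) (h : ∀ i ∈ s, MH r (f i)) : MH r (∑ i ∈ s, f i) := by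
  rw [MH_iff]
  exact IsWeightedHomogeneous.sum _ _ _ fun i hi => (MH_iff _ _).1 (h i hi)

theorem prod_mh_pow {M d : ℕ} {r : Fin M → ℕ} (b : (Fin M × Fin d) →₀ ℕ)
    (hb : ∀ h, ∑ i, b (h, i) = r h) (T : ℝ) : ∏ p, T ^ (b p) = T ^ (∑ h, r h) := by
  rw [Finset.prod_pow_eq_pow_sum, Fintype.sum_prod_type, Finset.sum_congr rfl fun h _ => hb h]

theorem lsub_monomial_coeff_le {M d : ℕ} {r : Fin M → ℕ} (A : Matrix (Fin d) (Fin d) ℤ)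
    (b : (Fin M × Fin d) →₀ ℕ) (hb : ∀ h, ∑ i, b (h, i) = r h) (T : ℝ)
    (hT : ∀ i, ∑ j, |(A i j : ℝ)| ≤ T) (b' : (Fin M × Fin d) →₀ ℕ) :
    |((coeff b' (lsub A (monomial b 1)) : ℤ) : ℝ)| ≤ T ^ (∑ h, r h) := by
  let N := normRingSeminorm ℤ
  have hN : ∀ x : ℤ, N x = |(x : ℝ)| := fun x => Int.norm_eq_abs x
  let W := wN N (fun _ : Fin M × Fin d => (1 : ℝ)) (fun _ => zero_le_one)
  have hN1 : N 1 = 1 := by rw [hN]; simp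
  have hW1 : W 1 ≤ 1 := by
    have := wN_C N (ρ := fun _ : Fin M × Fin d => (1 : ℝ)) (fun _ => zero_le_one) 1
    rw [C_1, hN1] at this
    exact this.le
  have h1 := coeff_le_wN N (ρ := fun _ : Fin M × Fin d => (1 : ℝ)) (fun _ => zero_le_one)
    (lsub A (monomial b 1)) b'
  rw [hN] at h1
  simp only [one_pow, Finsupp.prod, Finset.prod_const_one, mul_one] at h1
  refine h1.trans ?_
  change W _ ≤ _
  rw [lsub_monomial, C_1, one_mul, ← prod_mh_pow b hb T]
  refine (rs_prod W hW1 _ _).trans (Finset.prod_le_prod (fun _ _ => apply_nonneg _ _) fun p _ => ?_)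
  refine (rs_pow W hW1 _ _).trans (pow_le_pow_left₀ (apply_nonneg _ _) ?_ _)
  refine (rs_sum W _ _).trans (le_trans (Finset.sum_le_sum fun j _ => ?_) (hT p.2))
  refine (map_mul_le_mul W _ _).trans ?_
  have e1 : W (C (A p.2 j)) = |(A p.2 j : ℝ)| := by rw [← hN]; exact wN_C N _ _
  have e2 : W (X (p.1, j)) = 1 := by
    have := wN_X N (ρ := fun _ : Fin M × Fin d => (1 : ℝ)) (fun _ => zero_le_one) (p.1, j)
    rw [hN1, mul_one] at this; exact this
  rw [e1, e2, mul_one]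

attribute [local instance] Matrix.seminormedAddCommGroup

theorem siegel {α β : Type*} [Fintype α] [Fintype β] (A : Matrix α β ℤ)
    (h : 2 * Fintype.card α ≤ Fintype.card β) (hβ : 0 < Fintype.card β) (T : ℝ) (hT1 : 1 ≤ T)
    (hT : ∀ i j, |(A i j : ℝ)| ≤ T) :
    ∃ t : β → ℤ, t ≠ 0 ∧ A.mulVec t = 0 ∧ ∀ j, |(t j : ℝ)| ≤ Fintype.card β * T := by
  classical
  have hβ1 : (1 : ℝ) ≤ Fintype.card β := by exact_mod_cast hβ
  rcases Nat.eq_zero_or_pos (Fintype.card α) with h0 | h0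
  · have : IsEmpty α := Fintype.card_eq_zero_iff.1 h0
    obtain ⟨b⟩ := Fintype.card_pos_iff.1 hβ
    refine ⟨Pi.single b 1, ?_, Subsingleton.elim _ _, ?_⟩
    · intro hh
      have := congrFun hh b
      simp at this
    · intro j
      have : |((Pi.single b 1 : β → ℤ) j : ℝ)| ≤ 1 := by
        by_cases hj : j = b
        · subst hj; simp
        · simp [hj]
      nlinarith
  · obtain ⟨t, ht, hA, hn⟩ := Int.Matrix.exists_ne_zero_int_vec_norm_le A (by omega) h0
    refine ⟨t, ht, hA, fun j => ?_⟩
    have h1 : |(t j : ℝ)| ≤ ‖t‖ := by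
      rw [← Int.norm_eq_abs]; exact norm_le_pi_norm t j
    refine h1.trans (hn.trans ?_)
    have hmax : max 1 ‖A‖ ≤ T := by
      refine max_le hT1 ?_
      rw [Matrix.norm_le_iff (by linarith)]
      intro i j; rw [Int.norm_eq_abs]; exact hT i j
    have hbase : (1 : ℝ) ≤ Fintype.card β * max 1 ‖A‖ := by
      have := le_max_left 1 ‖A‖
      nlinarith
    have h2 : (2 : ℝ) * Fintype.card α ≤ Fintype.card β := by exact_mod_cast h
    have h3 : (0 : ℝ) < Fintype.card α := by exact_mod_cast h0
    calc _ ≤ ((Fintype.card β : ℝ) * max 1 ‖A‖) ^ (1 : ℝ) := by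
          refine Real.rpow_le_rpow_of_exponent_le hbase ?_
          rw [div_le_one (by linarith)]; linarith
      _ ≤ _ := by rw [Real.rpow_one]; gcongr

theorem auxpoly {ι : Type*} [Fintype ι] (M d : ℕ) (hM : 0 < M) (hd : 0 < d)
    (A : ι → Matrix (Fin d) (Fin d) ℤ) (η : ℝ) (hη : 0 < η)
    (hsm : 2 * (Fintype.card ι * (d / (η ^ 2 * M))) ≤ 1) :
    ∃ c : ℝ, 0 < c ∧ ∀ r : Fin M → ℕ, (∀ h, 0 < r h) →
      ∃ P : MvPolynomial (Fin M × Fin d) ℤ, P ≠ 0 ∧ MH r P ∧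
        (∀ b, |((coeff b P : ℤ) : ℝ)| ≤ Real.exp (c * ∑ h, (r h : ℝ))) ∧
        ∀ v, MH r (lsub (A v) P) ∧
          (∀ b, |((coeff b (lsub (A v) P) : ℤ) : ℝ)| ≤ Real.exp (c * ∑ h, (r h : ℝ))) ∧
          ∀ b, coeff b (lsub (A v) P) ≠ 0 → ∀ i, |∑ h, (b (h, i) : ℝ) / r h - M / d| ≤ η * M := by
  classical
  obtain ⟨T, hT1, hT⟩ : ∃ T : ℝ, 1 ≤ T ∧ ∀ v i, ∑ j, |(A v i j : ℝ)| ≤ T := by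
    refine ⟨1 + ∑ v, ∑ i, ∑ j, |(A v i j : ℝ)|, ?_, fun v i => ?_⟩
    · have : 0 ≤ ∑ v, ∑ i, ∑ j, |(A v i j : ℝ)| := by positivity
      linarith
    · have h1 : ∑ i, ∑ j, |(A v i j : ℝ)| ≤ ∑ v, ∑ i, ∑ j, |(A v i j : ℝ)| :=
        Finset.single_le_sum (f := fun v => ∑ i, ∑ j, |(A v i j : ℝ)|)
          (fun _ _ => by positivity) (Finset.mem_univ v)
      have h2 : ∑ j, |(A v i j : ℝ)| ≤ ∑ i, ∑ j, |(A v i j : ℝ)| :=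
        Finset.single_le_sum (f := fun i => ∑ j, |(A v i j : ℝ)|)
          (fun _ _ => by positivity) (Finset.mem_univ i)
      linarith
  set c1 := Real.log T with hc1
  have hc1n : 0 ≤ c1 := Real.log_nonneg hT1
  have hd' : (1 : ℝ) ≤ d := by exact_mod_cast hd
  refine ⟨2 * d + 2 * c1, by positivity, fun r hr => ?_⟩
  set s : ℝ := ∑ h, (r h : ℝ) with hs
  have hs0 : 0 ≤ s := by positivity
  set B := mons M d r with hB
  set bad := B.filter fun b => ∃ i, η * M < |∑ h, (b h i : ℝ) / r h - M / d| with hbad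
  have hTs : T ^ (∑ h, r h) = Real.exp (c1 * s) := by
    rw [← Real.rpow_natCast, Real.rpow_def_of_pos (by linarith), ← hc1, hs]
    push_cast; rfl
  have hBpos : 0 < B.card := by
    refine Finset.card_pos.2 ⟨fun h => Pi.single ⟨0, hd⟩ (r h), ?_⟩
    rw [hB, mem_mons]; intro h; simp
  have hBexp : (B.card : ℝ) ≤ Real.exp (d * s) := card_mons M d r
  have hfsr : ∀ b : B, ∀ h, ∑ i, fs b.1 (h, i) = r h := fun b h => mem_mons.1 b.2 h
  let Mx : Matrix (ι × bad) B ℤ := fun p b => coeff (fs p.2.1) (lsub (A p.1) (monomial (fs b.1) 1))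
  have hcard : 2 * Fintype.card (ι × bad) ≤ Fintype.card B := by
    have h1 := card_bad M d hd r hr η hη hM
    have h2 : (2 : ℝ) * (Fintype.card ι * bad.card) ≤ B.card := by
      calc (2 : ℝ) * (Fintype.card ι * bad.card) ≤
            2 * (Fintype.card ι * (d / (η ^ 2 * M) * B.card)) := by gcongr
        _ = 2 * (Fintype.card ι * (d / (η ^ 2 * M))) * B.card := by ring
        _ ≤ 1 * B.card := by gcongr
        _ = _ := one_mul _
    rw [Fintype.card_prod, Fintype.card_coe, Fintype.card_coe]
    exact_mod_cast h2
  obtain ⟨t, ht0, htA, htb⟩ := siegel Mx hcard (by simpa using hBpos) (Real.exp (c1 * s))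
    (Real.one_le_exp (by positivity)) (fun p b => by
      rw [← hTs]
      exact lsub_monomial_coeff_le (A p.1) _ (hfsr b) T (hT p.1) _)
  let P : MvPolynomial (Fin M × Fin d) ℤ := ∑ b : B, monomial (fs b.1) (t b)
  have hPc : ∀ b : B, coeff (fs b.1) P = t b := by
    intro b
    simp only [P, coeff_sum, coeff_monomial]
    rw [Finset.sum_eq_single b]
    · simp
    · intro b' _ hb'
      rw [if_neg]
      intro h; exact hb' (Subtype.ext (fs_inj h))
    · simp
  have htb' : ∀ b, |(t b : ℝ)| ≤ Real.exp ((d + c1) * s) := by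
    intro b
    refine (htb b).trans ?_
    rw [Fintype.card_coe, add_mul, Real.exp_add]
    gcongr
  have hLP : ∀ v, lsub (A v) P = ∑ b : B, C (t b) * lsub (A v) (monomial (fs b.1) 1) := by
    intro v
    simp only [P, map_sum]
    refine Finset.sum_congr rfl fun b _ => ?_
    rw [lsub_monomial, lsub_monomial, C_1, one_mul]
  have hMHL : ∀ v, MH r (lsub (A v) P) := by
    intro v
    simp only [P, map_sum]
    exact MH.sum _ _ fun b _ => MH_lsub_monomial _ _ (hfsr b) _
  have hfs : ∀ b : (Fin M × Fin d) →₀ ℕ, fs (fun h i => b (h, i)) = b := by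
    intro b; ext p; rfl
  refine ⟨P, ?_, ?_, ?_, fun v => ⟨hMHL v, ?_, ?_⟩⟩
  · intro h
    apply ht0
    funext b
    rw [← hPc b, h]; simp
  · refine MH.sum _ _ fun b _ => ?_
    intro b' hb' h
    rw [coeff_monomial] at hb'
    by_cases e : fs b.1 = b'
    · rw [← e]; exact hfsr b h
    · simp [e] at hb'
  · intro b
    by_cases hb : (fun h i => b (h, i)) ∈ B
    · have := hPc ⟨_, hb⟩
      simp only [hfs] at this
      rw [this]
      refine (htb' _).trans (Real.exp_le_exp.2 ?_)
      nlinarith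
    · have : coeff b P = 0 := by
        simp only [P, coeff_sum, coeff_monomial]
        refine Finset.sum_eq_zero fun b' _ => ?_
        rw [if_neg]
        intro h
        apply hb
        have := b'.2
        rw [← h]; exact this
      rw [this]; simp [Real.exp_nonneg]
  · intro b
    rw [hLP, coeff_sum]
    push_cast
    refine (Finset.abs_sum_le_sum_abs _ _).trans ?_
    have : ∀ b' : B, |((coeff b (C (t b') * lsub (A v) (monomial (fs b'.1) 1)) : ℤ) : ℝ)| ≤
        Real.exp ((d + c1) * s) * Real.exp (c1 * s) := by
      intro b'
      rw [coeff_C_mul]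
      push_cast
      rw [abs_mul]
      refine mul_le_mul (htb' b') ?_ (abs_nonneg _) (Real.exp_nonneg _)
      rw [← hTs]
      exact lsub_monomial_coeff_le (A v) _ (hfsr b') T (hT v) _
    refine (Finset.sum_le_sum fun b' _ => this b').trans ?_
    rw [Finset.sum_const, nsmul_eq_mul, Finset.card_univ, Fintype.card_coe]
    calc (B.card : ℝ) * (Real.exp ((d + c1) * s) * Real.exp (c1 * s)) ≤
          Real.exp (d * s) * (Real.exp ((d + c1) * s) * Real.exp (c1 * s)) := by gcongr
      _ = _ := by rw [← Real.exp_add, ← Real.exp_add]; congr 1; ring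
  · intro b hb i
    by_contra hcon
    rw [not_le] at hcon
    apply hb
    have hbB : (fun h i => b (h, i)) ∈ B := by
      rw [hB, mem_mons]; exact hMHL v b hb
    have hbb : (fun h i => b (h, i)) ∈ bad := by
      rw [hbad, Finset.mem_filter]; exact ⟨hbB, i, hcon⟩
    have h1 := congrFun htA (v, ⟨_, hbb⟩)
    rw [Matrix.mulVec, dotProduct] at h1
    simp only [Mx, hfs, Pi.zero_apply] at h1
    rw [hLP, coeff_sum, ← h1]
    refine Finset.sum_congr rfl fun b' _ => ?_
    rw [coeff_C_mul, mul_comm]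

end Rt

end

section

namespace Rt
open MvPolynomial

variable {K : Type*} [Field K]

theorem hom_aeval_int {σ R R' : Type*} [CommRing R] [CommRing R'] (g : R →+* R') (z : σ → R)
    (P : MvPolynomial σ ℤ) : g (aeval z P) = aeval (fun p => g (z p)) P := by
  induction P using MvPolynomial.induction_on with
  | C a => simp
  | add p q hp hq => simp [hp, hq]
  | mul_X p i hp => simp [hp]

/-- exponents of the distinguished variables -/
noncomputable def ex0 {M d : ℕ} (i0 : Fin d) (b : (Fin M × Fin d) →₀ ℕ) : ℕ →₀ ℕ :=
  ∑ h : Fin M, Finsupp.single (h : ℕ) (b (h, i0))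

theorem ex0_apply {M d : ℕ} (i0 : Fin d) (b : (Fin M × Fin d) →₀ ℕ) (h : Fin M) :
    ex0 i0 b h = b (h, i0) := by
  rw [ex0, Finsupp.finset_sum_apply, Finset.sum_eq_single h]
  · simp
  · intro h' _ hh
    rw [Finsupp.single_apply, if_neg]
    intro e; exact hh (Fin.ext e)
  · simp

theorem ex0_apply_ge {M d : ℕ} (i0 : Fin d) (b : (Fin M × Fin d) →₀ ℕ) (h : ℕ) (hh : M ≤ h) :
    ex0 i0 b h = 0 := by
  rw [ex0, Finsupp.finset_sum_apply]
  refine Finset.sum_eq_zero fun h' _ => ?_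
  rw [Finsupp.single_apply, if_neg]
  have := h'.2; omega

/-- remaining exponents -/
noncomputable def exr {M d : ℕ} (i0 i1 : Fin d) (b : (Fin M × Fin d) →₀ ℕ) : (Fin M × Fin d) →₀ ℕ :=
  b.filter fun p => p.2 ≠ i0 ∧ p.2 ≠ i1

theorem ex_inj {M d : ℕ} {i0 i1 : Fin d} {r : Fin M → ℕ} {b b' : (Fin M × Fin d) →₀ ℕ}
    (hb : ∀ h, ∑ i, b (h, i) = r h) (hb' : ∀ h, ∑ i, b' (h, i) = r h)
    (h0 : ex0 i0 b = ex0 i0 b') (h1 : exr i0 i1 b = exr i0 i1 b') : b = b' := by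
  have k0 : ∀ h i, i ≠ i1 → b (h, i) = b' (h, i) := by
    intro h i hi
    by_cases hi0 : i = i0
    · subst hi0
      rw [← ex0_apply, ← ex0_apply, h0]
    · have e := DFunLike.congr_fun h1 (h, i)
      simpa [exr, hi, hi0] using e
  ext ⟨h, i⟩
  by_cases hi : i = i1
  · subst hi
    have e1 := hb h
    have e2 := hb' h
    rw [← Finset.add_sum_erase _ _ (Finset.mem_univ i)] at e1 e2
    have e3 : ∑ x ∈ Finset.univ.erase i, b (h, x) = ∑ x ∈ Finset.univ.erase i, b' (h, x) :=
      Finset.sum_congr rfl fun x hx => k0 h x (Finset.ne_of_mem_erase hx)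
    omega
  · exact k0 h i hi

/-- dehomogenization point -/
noncomputable def zt0 (K : Type*) [Field K] {M d : ℕ} (i0 i1 : Fin d) (p : Fin M × Fin d) :
    MvPolynomial (Fin M × Fin d) (MvPolynomial ℕ K) :=
  if p.2 = i0 then C (X (p.1 : ℕ)) else if p.2 = i1 then 1 else X p

theorem zt0_monomial {M d : ℕ} (i0 i1 : Fin d) (b : (Fin M × Fin d) →₀ ℕ) (c : ℤ) :
    aeval (zt0 K i0 i1) (monomial b c) =
      monomial (exr i0 i1 b) (monomial (ex0 i0 b) (c : K)) := by
  have h1 : (b.prod fun p k => zt0 K i0 i1 p ^ k) =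
      monomial (exr i0 i1 b) (monomial (ex0 i0 b) (1 : K)) := by
    induction b using Finsupp.induction_linear with
    | zero =>
      rw [show exr i0 i1 (0 : (Fin M × Fin d) →₀ ℕ) = 0 from Finsupp.filter_zero _,
        show ex0 i0 (0 : (Fin M × Fin d) →₀ ℕ) = 0 by simp [ex0]]
      rfl
    | add f g hf hg =>
      rw [Finsupp.prod_add_index' (fun _ => pow_zero _) (fun _ _ _ => pow_add _ _ _), hf, hg,
        monomial_mul, monomial_mul, one_mul]
      congr 2
      · rw [exr, exr, exr, ← Finsupp.filter_add]
      · rw [ex0, ex0, ex0, ← Finset.sum_add_distrib]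
        congr 1
        refine Finset.sum_congr rfl fun h _ => ?_
        rw [← Finsupp.single_add]; rfl
    | single p k =>
      rw [Finsupp.prod_single_index (h := fun p k => zt0 K i0 i1 p ^ k) (pow_zero _)]
      obtain ⟨h, i⟩ := p
      by_cases hi : i = i0
      · have e0 : ex0 i0 (Finsupp.single (h, i) k) = Finsupp.single (h : ℕ) k := by
          rw [ex0, Finset.sum_eq_single h]
          · simp [hi]
          · intro h' _ hh
            simp [Ne.symm hh]
          · simp
        have e1 : exr i0 i1 (Finsupp.single (h, i) k) = 0 := by
          rw [exr]; exact Finsupp.filter_single_of_neg _ (by simp [hi])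
        rw [e0, e1, zt0, if_pos hi, ← C_pow, X_pow_eq_monomial]
        rfl
      · have e0 : ex0 i0 (Finsupp.single (h, i) k) = 0 := by
          rw [ex0]
          refine Finset.sum_eq_zero fun h' _ => ?_
          simp [hi]
        by_cases hi1 : i = i1
        · have e1 : exr i0 i1 (Finsupp.single (h, i) k) = 0 := by
            rw [exr]; exact Finsupp.filter_single_of_neg _ (by simp [hi1])
          rw [e0, e1, zt0, if_neg hi, if_pos hi1, one_pow]
          rfl
        · have e1 : exr i0 i1 (Finsupp.single (h, i) k) = Finsupp.single (h, i) k := by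
            rw [exr]; exact Finsupp.filter_single_of_pos _ ⟨hi, hi1⟩
          rw [e0, e1, zt0, if_neg hi, if_neg hi1, X_pow_eq_monomial]
          rfl
  rw [aeval_monomial, h1]
  have : (algebraMap ℤ (MvPolynomial (Fin M × Fin d) (MvPolynomial ℕ K))) c = C (C (c : K)) := by
    simp
  rw [this, C_mul_monomial, C_mul_monomial, mul_one]

theorem coeff_zt0 {M d : ℕ} (i0 i1 : Fin d) (P : MvPolynomial (Fin M × Fin d) ℤ)
    (β : (Fin M × Fin d) →₀ ℕ) (J : ℕ →₀ ℕ) :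
    coeff J (coeff β (aeval (zt0 K i0 i1) P)) =
      ∑ b ∈ P.support, if exr i0 i1 b = β ∧ ex0 i0 b = J then ((coeff b P : ℤ) : K) else 0 := by
  classical
  conv_lhs => rw [← support_sum_monomial_coeff P]
  rw [map_sum, coeff_sum, coeff_sum]
  refine Finset.sum_congr rfl fun b _ => ?_
  rw [zt0_monomial, coeff_monomial]
  by_cases h1 : exr i0 i1 b = β
  · rw [if_pos h1, coeff_monomial]; simp [h1]
  · rw [if_neg h1]; simp [h1]

theorem coeff_zt0_eq {M d : ℕ} {r : Fin M → ℕ} (i0 i1 : Fin d)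
    (P : MvPolynomial (Fin M × Fin d) ℤ) (hP : MH r P) (b : (Fin M × Fin d) →₀ ℕ)
    (hb : coeff b P ≠ 0) :
    coeff (ex0 i0 b) (coeff (exr i0 i1 b) (aeval (zt0 K i0 i1) P)) = ((coeff b P : ℤ) : K) := by
  rw [coeff_zt0, Finset.sum_eq_single b]
  · simp
  · intro b' hb' hne
    rw [if_neg]
    rintro ⟨h1, h2⟩
    exact hne (ex_inj (hP b' (mem_support_iff.1 hb')) (hP b hb) h2 h1)
  · intro h; simp [notMem_support_iff.1 h]

theorem coeff_zt0_cases {M d : ℕ} {r : Fin M → ℕ} (i0 i1 : Fin d)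
    (P : MvPolynomial (Fin M × Fin d) ℤ) (hP : MH r P) (β : (Fin M × Fin d) →₀ ℕ) (J : ℕ →₀ ℕ)
    (hJ : coeff J (coeff β (aeval (zt0 K i0 i1) P)) ≠ 0) :
    ∃ b, coeff b P ≠ 0 ∧ ex0 i0 b = J ∧
      coeff J (coeff β (aeval (zt0 K i0 i1) P)) = ((coeff b P : ℤ) : K) := by
  have h1 := hJ
  rw [coeff_zt0] at h1
  obtain ⟨b, hb, hne⟩ := Finset.exists_ne_zero_of_sum_ne_zero h1
  have h2 : exr i0 i1 b = β ∧ ex0 i0 b = J := by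
    by_contra h; rw [if_neg h] at hne; exact hne rfl
  refine ⟨b, mem_support_iff.1 hb, h2.2, ?_⟩
  have := coeff_zt0_eq (K := K) i0 i1 P hP b (mem_support_iff.1 hb)
  rwa [h2.1, h2.2] at this

/-- the auxiliary values off the distinguished coordinate -/
noncomputable def ztp (R : Type*) [CommRing R] {M d : ℕ} (i0 i1 : Fin d) (p : Fin M × Fin d) :
    MvPolynomial (Fin M × Fin d) R :=
  if p.2 = i0 then 0 else if p.2 = i1 then 1 else X p

/-- generic substitution -/
noncomputable def zG {M d e : ℕ} (i0 : Fin d) (y : Fin M → Fin e → Fin d → K) (p : Fin M × Fin d) :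
    MvPolynomial (Fin M × Fin e) (MvPolynomial ℕ K) :=
  ∑ j, C (C (y p.1 j p.2)) * X (p.1, j) + if p.2 = i0 then C (X (p.1 : ℕ)) else 0

theorem F_sub {M d e : ℕ} {rr : ℕ → ℝ} {θ : ℝ}
    (G : MvPolynomial (Fin M × Fin e) (MvPolynomial ℕ K))
    (hG : ∀ a, F rr θ (coeff a G)) (q : Fin M × Fin e → MvPolynomial (Fin M × Fin d) K)
    (β : (Fin M × Fin d) →₀ ℕ) :
    F rr θ (coeff β (aeval (fun p => map (C : K →+* MvPolynomial ℕ K) (q p)) G)) := by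
  classical
  conv => rw [← support_sum_monomial_coeff G]
  rw [map_sum, coeff_sum]
  refine F.sum fun a _ => ?_
  rw [aeval_monomial]
  have : (a.prod fun p k => (map (C : K →+* MvPolynomial ℕ K) (q p)) ^ k) =
      map C (a.prod fun p k => q p ^ k) := by
    rw [Finsupp.prod, Finsupp.prod, map_prod]
    simp
  rw [this, algebraMap_eq, coeff_C_mul, coeff_map, mul_comm]
  exact (hG a).C_mul _

theorem extract [CharZero K] {M d e : ℕ} (r : ℕ → ℕ) (hr : ∀ h, M ≤ h → r h = 0)
    (P : MvPolynomial (Fin M × Fin d) ℤ)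
    (hP0 : P ≠ 0) (hP : MH (fun h : Fin M => r h) P) (i0 i1 : Fin d) (hi : i1 ≠ i0)
    (x : ℕ → Fin d → K) (y : Fin M → Fin e → Fin d → K)
    (hT : ∀ h : Fin M, ∀ i, i ≠ i0 → ∃ T : Fin e → K, ∀ k,
      (if k = i then 1 else 0) - (if k = i0 then x h i else 0) = ∑ j, T j * y h j k)
    (rr : ℕ → ℝ) (θ : ℝ) (hG : ∀ a, F rr θ (coeff a (aeval (zG i0 y) P))) :
    ∃ f : MvPolynomial ℕ K, f ≠ 0 ∧ Bd r f ∧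
      (∀ I, coeff I f ≠ 0 → ∃ b, coeff I f = ((coeff b P : ℤ) : K)) ∧
      F rr θ (tr (fun h => - x h i1) f) := by
  classical
  set Q := aeval (zt0 K i0 i1) P with hQ
  obtain ⟨b1, hb1⟩ := support_nonempty.2 hP0
  have hb1' := mem_support_iff.1 hb1
  have hQ0 : Q ≠ 0 := by
    intro h
    have := coeff_zt0_eq (K := K) i0 i1 P hP b1 hb1'
    rw [← hQ, h] at this
    simp only [coeff_zero] at this
    exact hb1' (by exact_mod_cast this.symm)
  obtain ⟨β, hβ⟩ := (Q.support).exists_minimal (support_nonempty.2 hQ0)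
  have hβm : β ∈ Q.support := hβ.1
  refine ⟨coeff β Q, mem_support_iff.1 hβm, ?_, ?_, ?_⟩
  · intro I hI h
    obtain ⟨b, hb, h0, _⟩ := coeff_zt0_cases (K := K) i0 i1 P hP β I (mem_support_iff.1 hI)
    rcases lt_or_ge h M with hh | hh
    · rw [← h0, show h = ((⟨h, hh⟩ : Fin M) : ℕ) from rfl, ex0_apply]
      refine le_trans ?_ (hP b hb ⟨h, hh⟩).le
      exact Finset.single_le_sum (f := fun i => b (⟨h, hh⟩, i)) (fun _ _ => Nat.zero_le _)
        (Finset.mem_univ i0)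
    · rw [← h0, ex0_apply_ge _ _ _ hh]; exact Nat.zero_le _
  · intro I hI
    obtain ⟨b, hb, _, h1⟩ := coeff_zt0_cases (K := K) i0 i1 P hP β I hI
    exact ⟨b, h1⟩
  · choose T hT using hT
    let T' : Fin M → Fin d → Fin e → K := fun h i => if hh : i ≠ i0 then T h i hh else 0
    let R2 := MvPolynomial (Fin M × Fin d) (MvPolynomial ℕ K)
    let zx : ℕ → R2 := fun h => if hh : h < M then
      C (X h) - ∑ i, C (C (x h i)) * ztp (MvPolynomial ℕ K) i0 i1 (⟨h, hh⟩, i)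
      else C (X h) - C (C (x h i1))
    let th : MvPolynomial ℕ K →ₐ[K] R2 := aeval zx
    have hth : ∀ g, constantCoeff (th g) = tr (fun h => - x h i1) g := by
      intro g
      induction g using MvPolynomial.induction_on with
      | C a =>
        rw [tr_C]
        have : th (C a) = C (C a) := by
          rw [show th (C a) = algebraMap K R2 a from th.commutes a]; rfl
        rw [this, constantCoeff_C]
      | add p q hp hq => rw [map_add, map_add, map_add, hp, hq]
      | mul_X p i hp =>
        rw [map_mul, map_mul, map_mul, hp, tr_X]
        congr 1
        rw [show th (X i) = zx i from aeval_X _ _]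
        simp only [zx]
        by_cases hh : i < M
        · rw [dif_pos hh, map_sub, map_sum, constantCoeff_C, Finset.sum_eq_single i1]
          · simp [ztp, hi, sub_eq_add_neg]
          · intro k _ hk
            rw [map_mul, ztp]
            by_cases hk0 : k = i0
            · simp [hk0]
            · simp [hk0, hk]
          · simp
        · rw [dif_neg hh]; simp [sub_eq_add_neg]
    let ps : R2 →+* R2 := eval₂Hom (th : MvPolynomial ℕ K →+* R2) X
    have hps1 : coeff β (ps Q) = tr (fun h => - x h i1) (coeff β Q) := by
      have e1 : ps Q = ∑ b ∈ Q.support, th (coeff b Q) * monomial b 1 := by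
        show eval₂ (th : MvPolynomial ℕ K →+* R2) X Q = _
        rw [eval₂_eq]
        refine Finset.sum_congr rfl fun b _ => ?_
        congr 1
        rw [monomial_eq, C_1, one_mul]; rfl
      rw [e1, coeff_sum, Finset.sum_eq_single β]
      · rw [coeff_mul_monomial', if_pos le_rfl, mul_one, tsub_self]
        exact hth _
      · intro b hb hne
        rw [coeff_mul_monomial', if_neg]
        intro hle
        exact hne (le_antisymm hle (hβ.2 hb hle))
      · intro h; exact absurd hβm h
    have hps2 : ps Q = aeval (fun p : Fin M × Fin e => map (C : K →+* MvPolynomial ℕ K)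
        (∑ i, C (T' p.1 i p.2) * ztp K i0 i1 (p.1, i))) (aeval (zG i0 y) P) := by
      rw [hQ]
      refine (hom_aeval_int ps _ P).trans ?_
      refine Eq.trans ?_ (hom_aeval_int (AlgHom.toRingHom (aeval (fun p : Fin M × Fin e =>
        map (C : K →+* MvPolynomial ℕ K) (∑ i, C (T' p.1 i p.2) * ztp K i0 i1 (p.1, i))) :
          _ →ₐ[MvPolynomial ℕ K] R2)) _ P).symm
      congr 2
      funext ⟨h, k⟩
      have hmz : ∀ i, map (C : K →+* MvPolynomial ℕ K) (ztp K i0 i1 (h, i)) =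
          ztp (MvPolynomial ℕ K) i0 i1 (h, i) := by
        intro i
        simp only [ztp]
        split_ifs <;> simp
      have hz0 : ztp (MvPolynomial ℕ K) i0 i1 (h, i0) = 0 := by simp [ztp]
      have e2 : (aeval (fun p : Fin M × Fin e => map (C : K →+* MvPolynomial ℕ K)
          (∑ i, C (T' p.1 i p.2) * ztp K i0 i1 (p.1, i))) : _ →ₐ[MvPolynomial ℕ K] R2)
            (zG i0 y (h, k)) =
          ztp (MvPolynomial ℕ K) i0 i1 (h, k) + (if k = i0 then
            C (X (h : ℕ)) - ∑ i, C (C (x h i)) * ztp (MvPolynomial ℕ K) i0 i1 (h, i) else 0) := by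
        rw [zG, map_add, map_sum]
        have e3 : ∀ j, (aeval (fun p : Fin M × Fin e => map (C : K →+* MvPolynomial ℕ K)
          (∑ i, C (T' p.1 i p.2) * ztp K i0 i1 (p.1, i))) : _ →ₐ[MvPolynomial ℕ K] R2)
            (C (C (y h j k)) * X (h, j)) =
            ∑ i, C (C (T' h i j * y h j k)) * ztp (MvPolynomial ℕ K) i0 i1 (h, i) := by
          intro j
          rw [map_mul, aeval_X, map_sum, Finset.mul_sum]
          refine Finset.sum_congr rfl fun i _ => ?_
          rw [map_mul, hmz, map_C]
          rw [show (aeval (fun p : Fin M × Fin e => map (C : K →+* MvPolynomial ℕ K)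
            (∑ i, C (T' p.1 i p.2) * ztp K i0 i1 (p.1, i))) : _ →ₐ[MvPolynomial ℕ K] R2)
            (C (C (y h j k))) = C (C (y h j k)) from AlgHom.commutes _ _]
          rw [C_mul, C_mul]; ring
        rw [Finset.sum_congr rfl fun j _ => e3 j, Finset.sum_comm]
        have e4 : ∀ i, ∑ j, C (C (T' h i j * y h j k)) * ztp (MvPolynomial ℕ K) i0 i1 (h, i) =
            (if k = i then ztp (MvPolynomial ℕ K) i0 i1 (h, i) else 0) -
            if k = i0 then C (C (x h i)) * ztp (MvPolynomial ℕ K) i0 i1 (h, i) else 0 := by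
          intro i
          by_cases hi0 : i = i0
          · subst hi0; simp [hz0]
          · rw [← Finset.sum_mul]
            have : ∑ j, (C (C (T' h i j * y h j k)) : R2) =
                C (C ((if k = i then 1 else 0) - (if k = i0 then x h i else 0))) := by
              rw [hT h i hi0 k, map_sum, map_sum]
              simp [T', hi0]
            rw [this]
            split_ifs <;> simp
            · ring
        rw [Finset.sum_congr rfl fun i _ => e4 i, Finset.sum_sub_distrib]
        rw [Finset.sum_ite_eq Finset.univ k, if_pos (Finset.mem_univ _)]
        by_cases hk : k = i0
        · subst hk
          simp only [if_true]
          rw [show (aeval (fun p : Fin M × Fin e => map (C : K →+* MvPolynomial ℕ K)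
            (∑ i, C (T' p.1 i p.2) * ztp K k i1 (p.1, i))) : _ →ₐ[MvPolynomial ℕ K] R2)
            (C (X (h : ℕ))) = C (X (h : ℕ)) from AlgHom.commutes _ _]
          ring
        · simp [hk]
      refine Eq.trans ?_ e2.symm
      by_cases hk : k = i0
      · subst hk
        rw [hz0, zero_add, if_pos rfl, zt0, if_pos rfl]
        show eval₂ (th : MvPolynomial ℕ K →+* R2) X (C (X (h : ℕ))) = _
        rw [eval₂_C]
        show th (X (h : ℕ)) = _
        rw [show th (X (h : ℕ)) = zx h from aeval_X _ _]
        simp [zx]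
      · rw [zt0, if_neg hk, if_neg hk, add_zero, ztp, if_neg hk]
        by_cases hk1 : k = i1
        · rw [if_pos hk1, map_one]
        · rw [if_neg hk1]
          exact eval₂_X _ _ _
    rw [← hps1, hps2]
    exact F_sub _ hG _ β

end Rt

end

section

namespace Rt
open MvPolynomial

variable {K : Type*} [Field K] {ι : Type*} [Fintype ι]

theorem zG_CO {M d e : ℕ} (O : Subring K) (i0 : Fin d) (y : Fin M → Fin e → Fin d → K)
    (hy : ∀ h j i, y h j i ∈ O) (P : MvPolynomial (Fin M × Fin d) ℤ)
    (α : (Fin M × Fin e) →₀ ℕ) : CO O (coeff α (aeval (zG i0 y) P)) := by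
  classical
  let y' : Fin M → Fin e → Fin d → O := fun h j i => ⟨y h j i, hy h j i⟩
  let z' : Fin M × Fin d → MvPolynomial (Fin M × Fin e) (MvPolynomial ℕ O) := fun p =>
    ∑ j, C (C (y' p.1 j p.2)) * X (p.1, j) + if p.2 = i0 then C (X (p.1 : ℕ)) else 0
  have h1 : aeval (zG i0 y) P = map (map O.subtype) (aeval z' P) := by
    refine Eq.trans ?_ (hom_aeval_int (map (map O.subtype) :
      MvPolynomial (Fin M × Fin e) (MvPolynomial ℕ O) →+*
        MvPolynomial (Fin M × Fin e) (MvPolynomial ℕ K)) z' P).symm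
    congr 2
    funext p
    simp only [zG, z', map_add, map_sum, map_mul, map_C, map_X]
    congr 1
    split_ifs <;> simp
  intro I
  rw [h1, coeff_map, coeff_map]
  exact SetLike.coe_mem _

theorem aeval_lsub {M d : ℕ} {R : Type*} [CommRing R] (A A' : Matrix (Fin d) (Fin d) ℤ)
    (hA : A' * A = 1) (z : Fin M × Fin d → R) (P : MvPolynomial (Fin M × Fin d) ℤ) :
    aeval z P = aeval (fun p : Fin M × Fin d => ∑ k, (A p.2 k : R) * z (p.1, k)) (lsub A' P) := by
  rw [lsub]
  have := hom_aeval_int ((aeval (fun p : Fin M × Fin d => ∑ k, (A p.2 k : R) * z (p.1, k)) :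
    _ →ₐ[ℤ] R) : MvPolynomial (Fin M × Fin d) ℤ →+* R)
    (fun p : Fin M × Fin d => ∑ j, C (A' p.2 j) * X (p.1, j)) P
  refine Eq.trans ?_ this.symm
  congr 2
  funext ⟨h, i⟩
  simp only [RingHom.coe_coe, map_sum, map_mul, aeval_X, aeval_C, algebraMap_int_eq, eq_intCast,
    map_intCast, Finset.mul_sum]
  rw [Finset.sum_comm]
  have : ∀ k, ∑ j, (A' i j : R) * ((A j k : R) * z (h, k)) = if i = k then z (h, k) else 0 := by
    intro k
    simp_rw [← mul_assoc]
    rw [← Finset.sum_mul]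
    have h2 : ∑ j, (A' i j : R) * (A j k : R) = (((A' * A) i k : ℤ) : R) := by
      rw [Matrix.mul_apply]; push_cast; rfl
    rw [h2, hA, Matrix.one_apply]
    split_ifs <;> simp
  rw [Finset.sum_congr rfl fun k _ => this k]
  simp

theorem aeval_bound {M d : ℕ} {R' : Type*} [CommRing R'] (r : Fin M → ℕ) (N : RingSeminorm R')
    (hN : N 1 ≤ 1) (hintg : ∀ m : ℤ, N (m : R') ≤ |(m : ℝ)|)
    (L : Fin M × Fin d → R') (R : Fin M → Fin d → ℝ) (c2 : ℝ) (hc2 : 0 ≤ c2)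
    (hL : ∀ p, N (L p) ≤ c2 * R p.1 p.2) (Q : MvPolynomial (Fin M × Fin d) ℤ)
    (hP : MH r Q) (T : ℝ) (hT : ∀ b, |((coeff b Q : ℤ) : ℝ)| ≤ T) (E : ℝ)
    (hE0 : 0 ≤ E) (hE : ∀ b, coeff b Q ≠ 0 → ∏ p : Fin M × Fin d, R p.1 p.2 ^ b p ≤ E) :
    N (aeval L Q) ≤ (mons M d r).card * (T * (c2 ^ (∑ h, r h) * E)) := by
  classical
  conv_lhs => rw [← support_sum_monomial_coeff Q]
  rw [map_sum]
  refine (rs_sum N _ _).trans ?_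
  have hT0 : 0 ≤ T := (abs_nonneg _).trans (hT 0)
  have hterm : ∀ b ∈ Q.support, N (aeval L (monomial b (coeff b Q))) ≤
      T * (c2 ^ (∑ h, r h) * E) := by
    intro b hb
    have hb' := mem_support_iff.1 hb
    rw [aeval_monomial, Finsupp.prod_fintype _ _ (by simp)]
    refine (map_mul_le_mul N _ _).trans ?_
    refine mul_le_mul ?_ ?_ (apply_nonneg _ _) hT0
    · rw [algebraMap_int_eq, eq_intCast]; exact (hintg _).trans (hT b)
    · refine (rs_prod N hN _ _).trans ?_
      calc _ ≤ ∏ p : Fin M × Fin d, (c2 * R p.1 p.2) ^ b p :=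
            Finset.prod_le_prod (fun _ _ => apply_nonneg _ _) fun p _ =>
              (rs_pow N hN _ _).trans (pow_le_pow_left₀ (apply_nonneg _ _) (hL p) _)
        _ = c2 ^ (∑ h, r h) * ∏ p : Fin M × Fin d, R p.1 p.2 ^ b p := by
            rw [← prod_mh_pow b (hP b hb') c2, ← Finset.prod_mul_distrib]
            exact Finset.prod_congr rfl fun p _ => mul_pow _ _ _
        _ ≤ _ := mul_le_mul_of_nonneg_left (hE b hb') (pow_nonneg hc2 _)
  refine (Finset.sum_le_sum hterm).trans ?_
  rw [Finset.sum_const, nsmul_eq_mul]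
  have hx : 0 ≤ T * (c2 ^ (∑ h, r h) * E) := mul_nonneg hT0 (mul_nonneg (pow_nonneg hc2 _) hE0)
  refine mul_le_mul_of_nonneg_right ?_ hx
  have : Q.support.card ≤ (mons M d r).card := by
    refine Finset.card_le_card_of_injOn (fun b h i => b (h, i)) ?_ ?_
    · intro b hb
      simp only [Finset.mem_coe] at hb ⊢
      rw [mem_mons]; exact hP b (mem_support_iff.1 hb)
    · intro b _ b' _ h
      ext ⟨h', i⟩
      exact congrFun (congrFun h h') i
  exact_mod_cast this

set_option maxHeartbeats 800000 in
theorem G_bound {M d e : ℕ} (r : Fin M → ℕ) (a : AbsoluteValue K ℝ)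
    (A A' : Matrix (Fin d) (Fin d) ℤ) (hA : A' * A = 1) (i0 : Fin d)
    (y : Fin M → Fin e → Fin d → K) (R : Fin M → Fin d → ℝ) (ρ : ℕ → ℝ) (hρ : ∀ h, 0 ≤ ρ h)
    (hρR : ∀ (h : Fin M) i, ρ h ≤ R h i)
    (hy : ∀ h j i, a (∑ k, (A i k : K) * y h j k) ≤ R h i) (c2 : ℝ)
    (hc2 : ∀ i, e + |(A i i0 : ℝ)| ≤ c2) (P : MvPolynomial (Fin M × Fin d) ℤ)
    (hP : MH r (lsub A' P)) (T : ℝ) (hT : ∀ b, |((coeff b (lsub A' P) : ℤ) : ℝ)| ≤ T) (E : ℝ)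
    (hE0 : 0 ≤ E) (hE : ∀ b, coeff b (lsub A' P) ≠ 0 → ∏ p : Fin M × Fin d, R p.1 p.2 ^ b p ≤ E)
    (α : (Fin M × Fin e) →₀ ℕ) (I : ℕ →₀ ℕ) :
    a (coeff I (coeff α (aeval (zG i0 y) P))) * (I.prod fun h k => ρ h ^ k) ≤
      (mons M d r).card * (T * (c2 ^ (∑ h, r h) * E)) := by
  classical
  set Q := lsub A' P with hQ
  let N1 := wN (avN a) ρ hρ
  let N := wN N1 (fun _ : Fin M × Fin e => (1 : ℝ)) (fun _ => zero_le_one)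
  have hC1 : ∀ c : K, N1 (C c) = a c := fun c => wN_C (avN a) hρ c
  have hN1 : N1 1 = 1 := by rw [← C_1, hC1, map_one]
  have hC : ∀ c : MvPolynomial ℕ K, N (C c) = N1 c := fun c => wN_C N1 _ c
  have hN : N 1 = 1 := by rw [← C_1, hC, hN1]
  have hX : ∀ p, N (X p) = 1 := by
    intro p
    have := wN_X N1 (ρ := fun _ : Fin M × Fin e => (1 : ℝ)) (fun _ => zero_le_one) p
    rw [hN1, mul_one] at this; exact this
  have hX1 : ∀ h, N1 (X h) = ρ h := by
    intro h
    have := wN_X (avN a) hρ h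
    rw [show avN a 1 = 1 from map_one a, one_mul] at this; exact this
  have hintg : ∀ m : ℤ, N (m : MvPolynomial (Fin M × Fin e) (MvPolynomial ℕ K)) ≤ |(m : ℝ)| := by
    intro m
    have : (m : MvPolynomial (Fin M × Fin e) (MvPolynomial ℕ K)) = C (C (m : K)) := by simp
    rw [this, hC, hC1]; exact SPl.av_intCast_le a m
  have hL : ∀ p : Fin M × Fin d,
      N (∑ k, (A p.2 k : MvPolynomial (Fin M × Fin e) (MvPolynomial ℕ K)) * zG i0 y (p.1, k)) ≤
        c2 * R p.1 p.2 := by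
    rintro ⟨h, i⟩
    have e1 : ∑ k, (A i k : MvPolynomial (Fin M × Fin e) (MvPolynomial ℕ K)) * zG i0 y (h, k) =
        ∑ j, C (C (∑ k, (A i k : K) * y h j k)) * X (h, j) +
          (A i i0 : MvPolynomial (Fin M × Fin e) (MvPolynomial ℕ K)) * C (X (h : ℕ)) := by
      simp only [zG, mul_add, Finset.sum_add_distrib]
      congr 1
      · simp only [Finset.mul_sum, map_sum, Finset.sum_mul]
        rw [Finset.sum_comm]
        refine Finset.sum_congr rfl fun j _ => Finset.sum_congr rfl fun k _ => ?_
        simp [mul_assoc]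
      · simp
    simp only
    rw [e1]
    refine (map_add_le_add N _ _).trans ?_
    have e2 : N (∑ j, C (C (∑ k, (A i k : K) * y h j k)) * X (h, j)) ≤ e * R h i := by
      refine (rs_sum N _ _).trans ?_
      refine (Finset.sum_le_sum (g := fun _ => R h i) fun j _ => ?_).trans ?_
      · refine (map_mul_le_mul N _ _).trans ?_
        rw [hX, mul_one, hC, hC1]; exact hy h j i
      · simp
    have e3 : N ((A i i0 : MvPolynomial (Fin M × Fin e) (MvPolynomial ℕ K)) * C (X (h : ℕ))) ≤
        |(A i i0 : ℝ)| * R h i := by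
      refine (map_mul_le_mul N _ _).trans ?_
      rw [hC, hX1]
      exact mul_le_mul (hintg _) (hρR h i) (hρ _) (abs_nonneg _)
    have hR0 : 0 ≤ R h i := (hρ _).trans (hρR h i)
    have := hc2 i
    nlinarith
  have h0 : a (coeff I (coeff α (aeval (zG i0 y) P))) * (I.prod fun h k => ρ h ^ k) ≤
      N (aeval (zG i0 y) P) := by
    refine (coeff_le_wN (avN a) hρ (coeff α (aeval (zG i0 y) P)) I).trans ?_
    have := coeff_le_wN N1 (ρ := fun _ : Fin M × Fin e => (1 : ℝ)) (fun _ => zero_le_one)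
      (aeval (zG i0 y) P) α
    simpa [Finsupp.prod] using this
  refine h0.trans ?_
  have hGQ : N (aeval (zG i0 y) P) = N (aeval (fun p : Fin M × Fin d =>
      ∑ k, (A p.2 k : MvPolynomial (Fin M × Fin e) (MvPolynomial ℕ K)) * zG i0 y (p.1, k)) Q) := by
    congr 1
    exact aeval_lsub A A' hA (zG i0 y) P
  rw [hGQ]
  refine aeval_bound r N hN.le hintg _ R c2 ?_ hL Q hP T hT E hE0 hE
  have := hc2 i0
  have h3 : 0 ≤ |(A i0 i0 : ℝ)| := abs_nonneg _
  have h4 : (0 : ℝ) ≤ e := Nat.cast_nonneg _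
  linarith

end Rt

end

section

namespace Rt
open MvPolynomial

variable {K : Type*} [Field K] {ι : Type*} [Fintype ι]

theorem exp_est {M d : ℕ} (r : Fin M → ℕ) (hr : ∀ h, 0 < r h) (B ζ η W : ℝ) (hB : 0 ≤ B)
    (Nn : Fin M → ℝ) (h1 : ∀ h, B ≤ r h * Nn h) (h2 : ∀ h, r h * Nn h ≤ (1 + ζ) * B)
    (w : Fin d → ℝ) (hw : ∀ i, |w i| ≤ W) (b : (Fin M × Fin d) →₀ ℕ)
    (hb : ∀ h, ∑ i, b (h, i) = r h) (hbi : ∀ i, |∑ h, (b (h, i) : ℝ) / r h - M / d| ≤ η * M) :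
    ∏ p : Fin M × Fin d, (Real.exp (Nn p.1 * w p.2)) ^ b p ≤
      Real.exp (B * (M / d * ∑ i, w i + d * (W * M * (η + ζ)))) := by
  have e1 : ∏ p : Fin M × Fin d, (Real.exp (Nn p.1 * w p.2)) ^ b p =
      Real.exp (∑ i, ∑ h, (b (h, i) : ℝ) * (Nn h * w i)) := by
    rw [Finset.sum_comm, ← Fintype.sum_prod_type' (f := fun h i => (b (h, i) : ℝ) * (Nn h * w i)),
      Real.exp_sum]
    refine Finset.prod_congr rfl fun p _ => ?_
    rw [Real.exp_nat_mul]
  rw [e1, Real.exp_le_exp]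
  have key : ∀ i, ∑ h, (b (h, i) : ℝ) * (Nn h * w i) ≤ B * (M / d * w i + W * M * (η + ζ)) := by
    intro i
    have hW : 0 ≤ W := (abs_nonneg _).trans (hw i)
    have a1 : ∑ h, (b (h, i) : ℝ) * (Nn h * w i) - B * (w i * ∑ h, (b (h, i) : ℝ) / r h) ≤
        M * (B * W * ζ) := by
      have : ∑ h, (b (h, i) : ℝ) * (Nn h * w i) - B * (w i * ∑ h, (b (h, i) : ℝ) / r h) =
          ∑ h, (r h * Nn h - B) * ((b (h, i) : ℝ) / r h) * w i := by
        rw [Finset.mul_sum, Finset.mul_sum, ← Finset.sum_sub_distrib]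
        refine Finset.sum_congr rfl fun h _ => ?_
        have : (r h : ℝ) ≠ 0 := by exact_mod_cast (hr h).ne'
        field_simp
      rw [this]
      refine (Finset.sum_le_sum (g := fun _ => B * W * ζ) fun h _ => ?_).trans (by simp)
      have hrp : (0 : ℝ) < r h := by exact_mod_cast (hr h)
      have t0 : 0 ≤ (b (h, i) : ℝ) / r h := by positivity
      have t1 : (b (h, i) : ℝ) / r h ≤ 1 := by
        rw [div_le_one hrp]
        exact_mod_cast (Finset.single_le_sum (f := fun i => b (h, i)) (fun _ _ => Nat.zero_le _)
          (Finset.mem_univ i)).trans (hb h).le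
      have t2 : 0 ≤ r h * Nn h - B := by linarith [h1 h]
      have t3 : r h * Nn h - B ≤ ζ * B := by linarith [h2 h]
      have t4 := t2.trans t3
      calc (r h * Nn h - B) * ((b (h, i) : ℝ) / r h) * w i
          ≤ (r h * Nn h - B) * ((b (h, i) : ℝ) / r h) * W :=
            mul_le_mul_of_nonneg_left ((le_abs_self _).trans (hw i)) (by positivity)
        _ ≤ (ζ * B) * 1 * W := by gcongr
        _ = B * W * ζ := by ring
    have a2 : w i * ∑ h, (b (h, i) : ℝ) / r h ≤ M / d * w i + W * (η * M) := by
      have : w i * (∑ h, (b (h, i) : ℝ) / r h - M / d) ≤ W * (η * M) := by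
        refine (le_abs_self _).trans ?_
        rw [abs_mul]
        exact mul_le_mul (hw i) (hbi i) (abs_nonneg _) hW
      linarith
    have a3 := mul_le_mul_of_nonneg_left a2 hB
    linarith
  refine (Finset.sum_le_sum fun i _ => key i).trans (le_of_eq ?_)
  rw [← Finset.mul_sum, Finset.sum_add_distrib, ← Finset.mul_sum]
  simp

theorem prod_rho (r : ℕ → ℕ) (ρ : ℕ → ℝ) (X : ℝ) (hX : ∀ h m : ℕ, Real.exp (- (X * ((m : ℝ) / r h))) ≤ ρ h ^ m)
    (hX0 : 0 ≤ X) (I : ℕ →₀ ℕ) (θ : ℝ) (hI : wt (fun h => (r h : ℝ)) I ≤ θ) :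
    Real.exp (-(X * θ)) ≤ I.prod fun h k => ρ h ^ k := by
  have : Real.exp (-(X * wt (fun h => (r h : ℝ)) I)) ≤ I.prod fun h k => ρ h ^ k := by
    rw [wt, Finsupp.sum, Finset.mul_sum, ← Finset.sum_neg_distrib, Real.exp_sum]
    exact Finset.prod_le_prod (fun _ _ => (Real.exp_pos _).le) fun h _ => hX h _
  refine le_trans ?_ this
  rw [Real.exp_le_exp]
  have := mul_le_mul_of_nonneg_left hI hX0
  linarith

theorem rm_F (S : SPl K ι) {M d e : ℕ} (A A' : ι → Matrix (Fin d) (Fin d) ℤ)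
    (hA : ∀ v, A' v * A v = 1) (i0 : Fin d) (w : ι → Fin d → ℝ) (W : ℝ) (hW : ∀ v i, |w v i| ≤ W)
    (hW0 : 0 ≤ W)
    (r : ℕ → ℕ) (hr : ∀ h : Fin M, 0 < r h) (hr0 : ∀ h, M ≤ h → r h = 0) (B ζ η c c2 ε : ℝ)
    (hB : 0 ≤ B) (hζ : ζ ≤ 1) (Nn : ℕ → ℝ) (hN0 : ∀ h, 0 ≤ Nn h)
    (h1 : ∀ h < M, B ≤ r h * Nn h) (h2 : ∀ h < M, r h * Nn h ≤ (1 + ζ) * B)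
    (P : MvPolynomial (Fin M × Fin d) ℤ)
    (hP1 : ∀ v, MH (fun h : Fin M => r h) (lsub (A' v) P))
    (hP2 : ∀ v b, |((coeff b (lsub (A' v) P) : ℤ) : ℝ)| ≤ Real.exp (c * ∑ h : Fin M, (r h : ℝ)))
    (hP3 : ∀ v b, coeff b (lsub (A' v) P) ≠ 0 → ∀ i,
      |∑ h : Fin M, (b (h, i) : ℝ) / r h - M / d| ≤ η * M)
    (y : Fin M → Fin e → Fin d → K) (hyO : ∀ h j i, y h j i ∈ S.O)
    (hy : ∀ v h j i, S.av v (∑ k, (A v i k : K) * y h j k) ≤ Real.exp (Nn h * w v i))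
    (hc2 : ∀ v i, e + |(A v i i0 : ℝ)| ≤ c2) (hc21 : 1 ≤ c2)
    (hneg : ∑ v, (S.n v : ℝ) * ((d + c + Real.log c2) * ∑ h : Fin M, (r h : ℝ) +
      B * (M / d * ∑ i, w v i + d * (W * M * (η + ζ))) + 2 * W * B * (ε * M)) < 0)
    (α : (Fin M × Fin e) →₀ ℕ) :
    F (fun h => (r h : ℝ)) (ε * M) (coeff α (aeval (zG i0 y) P)) := by
  classical
  intro I hI
  by_contra hlt
  push Not at hlt
  have hne := mem_support_iff.1 hI
  have hO := zG_CO S.O i0 y hyO P α I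
  have hge := S.prod_ge _ hO hne
  set ρ : ℕ → ℝ := fun h => if h < M then Real.exp (- (Nn h * W)) else 1 with hρ
  have hρ0 : ∀ h, 0 ≤ ρ h := by
    intro h; simp only [hρ]; split_ifs
    · exact (Real.exp_pos _).le
    · exact zero_le_one
  have hρX : ∀ h m : ℕ, Real.exp (- (2 * W * B * ((m : ℝ) / r h))) ≤ ρ h ^ m := by
    intro h m
    by_cases hM : h < M
    · simp only [hρ, if_pos hM]
      rw [← Real.exp_nat_mul, Real.exp_le_exp]
      have hrp : (0 : ℝ) < r h := by exact_mod_cast (hr ⟨h, hM⟩)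
      have h3 : r h * Nn h ≤ 2 * B := (h2 h hM).trans (by nlinarith)
      have h4 : (m : ℝ) * (Nn h * W) = W * (r h * Nn h) * ((m : ℝ) / r h) := by field_simp
      have h5 : W * (r h * Nn h) * ((m : ℝ) / r h) ≤ W * (2 * B) * ((m : ℝ) / r h) := by gcongr
      linarith
    · simp only [hρ, if_neg hM]
      rw [hr0 h (not_lt.1 hM)]; simp
  have hb : ∀ v, S.av v (coeff I (coeff α (aeval (zG i0 y) P))) ≤
      Real.exp ((d + c + Real.log c2) * ∑ h : Fin M, (r h : ℝ) +
      B * (M / d * ∑ i, w v i + d * (W * M * (η + ζ))) + 2 * W * B * (ε * M)) := by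
    intro v
    have hg := G_bound (fun h : Fin M => r h) (S.av v) (A v) (A' v) (hA v) i0 y
      (fun h i => Real.exp (Nn h * w v i)) ρ hρ0 ?_ (fun h j i => hy v h j i) c2 (hc2 v) P (hP1 v)
      _ (hP2 v) (Real.exp (B * (M / d * ∑ i, w v i + d * (W * M * (η + ζ))))) (Real.exp_pos _).le
      ?_ α I
    · have hρI := prod_rho r ρ (2 * W * B) hρX (by positivity) I _ hlt.le
      have hcm := card_mons M d (fun h : Fin M => r h)
      have hc : c2 ^ (∑ h : Fin M, r h) = Real.exp (Real.log c2 * ∑ h : Fin M, (r h : ℝ)) := by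
        rw [← Nat.cast_sum, mul_comm, Real.exp_nat_mul, Real.exp_log (by linarith)]
      rw [hc] at hg
      have hL := mul_le_mul_of_nonneg_left hρI ((S.av v).nonneg (coeff I (coeff α (aeval (zG i0 y) P))))
      have hR := mul_le_mul_of_nonneg_right hcm (b := ((mons M d fun h : Fin M => r h).card : ℝ))
        (a := Real.exp (c * ∑ h : Fin M, (r h : ℝ)) * (Real.exp (Real.log c2 * ∑ h : Fin M, (r h : ℝ)) *
          (Real.exp (B * (M / d * ∑ i, w v i + d * (W * M * (η + ζ))))))) (by positivity)
      have h6 := hL.trans (hg.trans hR)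
      rw [← Real.exp_add, ← Real.exp_add, ← Real.exp_add] at h6
      have h7 := mul_le_mul_of_nonneg_right h6 (Real.exp_pos (2 * W * B * (ε * M))).le
      rw [mul_assoc, ← Real.exp_add, ← Real.exp_add, neg_add_cancel, Real.exp_zero, mul_one] at h7
      refine h7.trans (le_of_eq ?_)
      congr 1; ring
    · intro h i
      simp only [hρ, if_pos h.2]
      rw [Real.exp_le_exp]
      have := (abs_le.1 (hW v i)).1
      nlinarith [hN0 h]
    · intro b hb
      exact exp_est (fun h : Fin M => r h) hr B ζ η W hB (fun h => Nn h) (fun h => h1 h h.2)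
        (fun h => h2 h h.2) (w v) (hW v) b (hP1 v b hb) (hP3 v b hb)
  have : ∏ v, S.av v (coeff I (coeff α (aeval (zG i0 y) P))) ^ S.n v ≤ ∏ v, Real.exp ((S.n v : ℝ) *
    ((d + c + Real.log c2) * ∑ h : Fin M, (r h : ℝ) +
      B * (M / d * ∑ i, w v i + d * (W * M * (η + ζ))) + 2 * W * B * (ε * M))) := by
    refine Finset.prod_le_prod (fun v _ => pow_nonneg ((S.av v).nonneg _) _) fun v _ => ?_
    rw [Real.exp_nat_mul]
    exact pow_le_pow_left₀ ((S.av v).nonneg _) (hb v) _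
  rw [← Real.exp_sum] at this
  have h8 := Real.exp_lt_exp.2 hneg
  rw [Real.exp_zero] at h8
  linarith

set_option maxHeartbeats 1600000 in
theorem rm [CharZero K] (S : SPl K ι) {d e : ℕ} (A A' : ι → Matrix (Fin d) (Fin d) ℤ)
    (hA : ∀ v, A' v * A v = 1) (i0 i1 : Fin d) (hi : i1 ≠ i0) (v' : ι) (w : ι → Fin d → ℝ)
    (hw : ∑ v, (S.n v : ℝ) * ∑ i, w v i < 0) (c0 : ℝ) (hc0 : 0 < c0) :
    ∃ N0 : ℝ, ∀ N : ℝ, N0 ≤ N → ∀ (y : Fin e → Fin d → K) (x : Fin d → K),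
      (∀ j i, y j i ∈ S.O) →
      (∀ v i j, S.av v (∑ k, (A v i k : K) * y j k) ≤ Real.exp (N * w v i)) →
      x i1 ≠ 0 → S.av v' (x i1) ≤ Real.exp (-(c0 * N)) →
      (∀ i, i ≠ i0 → ∃ T : Fin e → K, ∀ k,
        (if k = i then 1 else 0) - (if k = i0 then x i else 0) = ∑ j, T j * y j k) → False := by
  classical
  set g : ℝ := ∑ v, (S.n v : ℝ) with hg
  have hg0 : 0 < g := by
    have : (S.n v' : ℝ) ≤ g := Finset.single_le_sum (f := fun v => (S.n v : ℝ))
      (fun _ _ => Nat.cast_nonneg _) (Finset.mem_univ v')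
    have h2 : (0 : ℝ) < S.n v' := by exact_mod_cast S.npos v'
    linarith
  set W : ℝ := 1 + ∑ v, ∑ i, |w v i| with hWd
  have hWs : 0 ≤ ∑ v, ∑ i, |w v i| := by positivity
  have hW1 : 1 ≤ W := by linarith
  have hW : ∀ v i, |w v i| ≤ W := by
    intro v i
    have h1 : ∑ i, |w v i| ≤ ∑ v, ∑ i, |w v i| := Finset.single_le_sum
      (f := fun v => ∑ i, |w v i|) (fun _ _ => by positivity) (Finset.mem_univ v)
    have h2 : |w v i| ≤ ∑ i, |w v i| := Finset.single_le_sum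
      (f := fun i => |w v i|) (fun _ _ => by positivity) (Finset.mem_univ i)
    linarith
  set δ : ℝ := - ∑ v, (S.n v : ℝ) * ∑ i, w v i with hδ
  have hδ0 : 0 < δ := by linarith
  have hd : 0 < d := i0.pos
  have hdr : (0 : ℝ) < d := by exact_mod_cast hd
  set η := δ / (8 * d ^ 2 * g * W) with hη
  have hη0 : 0 < η := by positivity
  obtain ⟨M, hM1⟩ := exists_nat_gt (2 * (Fintype.card ι * d) / η ^ 2)
  have hMr : (0 : ℝ) < M := lt_of_le_of_lt (by positivity) hM1
  have hM0 : 0 < M := by exact_mod_cast hMr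
  obtain ⟨c, hc, haux⟩ := auxpoly M d hM0 hd A' η hη0 (by
    rw [div_lt_iff₀ (by positivity)] at hM1
    rw [← mul_div_assoc, ← mul_div_assoc, div_le_one (by positivity)]
    nlinarith)
  set c2 : ℝ := 1 + e + ∑ v, ∑ i, |(A v i i0 : ℝ)| with hc2d
  have hs0 : 0 ≤ ∑ v, ∑ i, |(A v i i0 : ℝ)| := by positivity
  have hc21 : 1 ≤ c2 := by
    have : (0 : ℝ) ≤ e := Nat.cast_nonneg _
    linarith
  have hc2 : ∀ v i, e + |(A v i i0 : ℝ)| ≤ c2 := by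
    intro v i
    have h1 : ∑ i, |(A v i i0 : ℝ)| ≤ ∑ v, ∑ i, |(A v i i0 : ℝ)| := Finset.single_le_sum
      (f := fun v => ∑ i, |(A v i i0 : ℝ)|) (fun _ _ => by positivity) (Finset.mem_univ v)
    have h2 : |(A v i i0 : ℝ)| ≤ ∑ i, |(A v i i0 : ℝ)| := Finset.single_le_sum
      (f := fun i => |(A v i i0 : ℝ)|) (fun _ _ => by positivity) (Finset.mem_univ i)
    linarith
  set c3 := Real.log c2 with hc3
  have hc30 : 0 ≤ c3 := Real.log_nonneg hc21
  set ε := δ / (16 * d * g * W) with hε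
  have hε0 : 0 < ε := by positivity
  obtain ⟨κ, hκ0, hκ1, hZ⟩ := zst S M (ε * M) (by positivity)
  set Nm : ℝ := 1 + 2 / (κ * c0) + 2 * c * M / (κ * c0) + 16 * d * g * (d + c + c3) / δ with hNm
  have hNm1 : 1 ≤ Nm := by
    have : 0 ≤ 2 / (κ * c0) + 2 * c * M / (κ * c0) + 16 * d * g * (d + c + c3) / δ := by positivity
    linarith
  have hNm2 : 2 / (κ * c0) ≤ Nm := by
    have : 0 ≤ 2 * c * M / (κ * c0) + 16 * d * g * (d + c + c3) / δ := by positivity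
    linarith
  have hNm3 : 2 * c * M / (κ * c0) ≤ Nm := by
    have : 0 ≤ 2 / (κ * c0) + 16 * d * g * (d + c + c3) / δ := by positivity
    linarith
  have hNm4 : 16 * d * g * (d + c + c3) / δ ≤ Nm := by
    have : 0 ≤ 2 / (κ * c0) + 2 * c * M / (κ * c0) := by positivity
    linarith
  by_contra hcon
  push Not at hcon
  choose Nf hNf y0 x0 hyO hy hx0 hx hT using hcon
  let s : ℕ → ℝ := fun h => Nat.rec Nm (fun _ t => max Nm (2 / κ * Nf t)) h
  have hs : ∀ h, Nm ≤ s h := by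
    intro h
    cases h with
    | zero => exact le_rfl
    | succ h => exact le_max_left _ _
  set Nn : ℕ → ℝ := fun h => Nf (s h) with hNn
  have hN1 : ∀ h, Nm ≤ Nn h := fun h => (hs h).trans (hNf _)
  have hN0 : ∀ h, 0 < Nn h := fun h => by linarith [hN1 h]
  have hNs : ∀ h, 2 / κ * Nn h ≤ Nn (h + 1) := fun h => (le_max_right _ _).trans (hNf (s (h + 1)))
  set ζ := min η 1 with hζ
  have hζ0 : 0 < ζ := lt_min hη0 one_pos
  have hζ1 : ζ ≤ 1 := min_le_right _ _
  have hζη : ζ ≤ η := min_le_left _ _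
  set B : ℝ := (∑ h : Fin M, Nn h) / ζ + 1 with hB
  have hB0 : 0 < B := by
    have : 0 ≤ (∑ h : Fin M, Nn h) / ζ := div_nonneg (Finset.sum_nonneg fun h _ => (hN0 h).le) hζ0.le
    linarith
  have hNB : ∀ h < M, Nn h ≤ ζ * B := by
    intro h hh
    have : Nn h ≤ ∑ h : Fin M, Nn h := Finset.single_le_sum (f := fun h : Fin M => Nn h)
      (fun h _ => (hN0 h).le) (Finset.mem_univ (⟨h, hh⟩ : Fin M))
    have h2 : ζ * B = ∑ h : Fin M, Nn h + ζ := by rw [hB]; field_simp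
    linarith
  set r : ℕ → ℕ := fun h => if h < M then ⌈B / Nn h⌉₊ else 0 with hr
  have hr0 : ∀ h, M ≤ h → r h = 0 := fun h hh => by simp only [hr]; rw [if_neg (not_lt.2 hh)]
  have hrp : ∀ h < M, 0 < r h := fun h hh => by
    simp only [hr]; rw [if_pos hh]; exact Nat.ceil_pos.2 (div_pos hB0 (hN0 h))
  have h1 : ∀ h < M, B ≤ r h * Nn h := fun h hh => by
    simp only [hr]; rw [if_pos hh, ← div_le_iff₀ (hN0 h)]; exact Nat.le_ceil _
  have h2 : ∀ h < M, r h * Nn h ≤ (1 + ζ) * B := fun h hh => by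
    simp only [hr]; rw [if_pos hh]
    have := (Nat.ceil_lt_add_one (div_pos hB0 (hN0 h)).le).le
    have h3 := mul_le_mul_of_nonneg_right this (hN0 h).le
    rw [add_mul, div_mul_cancel₀ _ (hN0 h).ne'] at h3
    linarith [hNB h hh]
  have h2' : ∀ h < M, r h * Nn h ≤ 2 * B := fun h hh => (h2 h hh).trans (by nlinarith)
  have hrNm : ∀ h < M, (r h : ℝ) * Nm ≤ 2 * B := fun h hh =>
    (mul_le_mul_of_nonneg_left (hN1 h) (Nat.cast_nonneg _)).trans (h2' h hh)
  have hsr : (∑ h : Fin M, (r h : ℝ)) * Nm ≤ M * (2 * B) := by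
    rw [Finset.sum_mul]
    refine (Finset.sum_le_sum (g := fun _ => 2 * B) fun (h : Fin M) _ => hrNm h h.2).trans (by simp)
  have hsr0 : 0 ≤ ∑ h : Fin M, (r h : ℝ) := by positivity
  obtain ⟨P, hP0, hPM, hPc, hPv⟩ := haux (fun h : Fin M => r h) fun h => hrp h h.2
  have hG := rm_F S A A' hA i0 w W hW (by linarith) r (fun h => hrp h h.2) hr0 B ζ η c c2 ε hB0.le
    hζ1 Nn (fun h => (hN0 h).le) h1 h2 P (fun v => (hPv v).1) (fun v => (hPv v).2.1)
    (fun v => (hPv v).2.2) (fun h : Fin M => y0 (s h)) (fun h => hyO (s h))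
    (fun v h j i => hy (s h) v i j) hc2 hc21 (by
      have e1 : ∑ v, (S.n v : ℝ) * ((d + c + Real.log c2) * ∑ h : Fin M, (r h : ℝ) +
          B * (M / d * ∑ i, w v i + d * (W * M * (η + ζ))) + 2 * W * B * (ε * M)) =
          g * ((d + c + c3) * ∑ h : Fin M, (r h : ℝ) + B * (d * (W * M * (η + ζ))) +
            2 * W * B * (ε * M)) - B * (M / d) * δ := by
        rw [hδ, hg, mul_neg, sub_neg_eq_add, Finset.sum_mul,
          Finset.mul_sum (f := fun v => (S.n v : ℝ) * ∑ i, w v i), ← Finset.sum_add_distrib]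
        refine Finset.sum_congr rfl fun v _ => ?_
        rw [← hc3]; ring
      rw [e1]
      have a1 : g * ((d + c + c3) * ∑ h : Fin M, (r h : ℝ)) ≤ B * (M / d) * δ * (1 / 8) := by
        have hh : 16 * d * g * (d + c + c3) ≤ Nm * δ := by
          rwa [div_le_iff₀ hδ0] at hNm4
        have hh2 := mul_le_mul_of_nonneg_left hh hsr0
        have hh3 := mul_le_mul_of_nonneg_right hsr hδ0.le
        have : 16 * d * (g * ((d + c + c3) * ∑ h : Fin M, (r h : ℝ))) ≤ M * (2 * B) * δ := by
          linarith
        have e : B * (M / d) * δ * (1 / 8) = (M * (2 * B) * δ) / (16 * d) := by field_simp; ring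
        rw [e, le_div_iff₀ (by positivity)]
        linarith
      have a2 : g * (B * (d * (W * M * (η + ζ)))) ≤ B * (M / d) * δ * (1 / 4) := by
        have : g * (B * (d * (W * M * (η + ζ)))) ≤ g * (B * (d * (W * M * (η + η)))) := by
          gcongr
        refine this.trans (le_of_eq ?_)
        rw [hη]; field_simp; ring
      have a3 : g * (2 * W * B * (ε * M)) = B * (M / d) * δ * (1 / 8) := by
        rw [hε]; field_simp; ring
      have a4 : 0 < B * (M / d) * δ := by positivity
      linarith)
  obtain ⟨f, hf0, hfB, hfc, hfF⟩ := extract r hr0 P hP0 hPM i0 i1 hi (fun h => x0 (s h))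
    (fun h : Fin M => y0 (s h)) (fun h => (hT (s h)).1) (fun h => (r h : ℝ)) (ε * M) hG
  refine hZ r (c0 * B) f _ v' (by positivity) ?_ hr0 ?_ hfB hf0 ?_ ?_ ?_ hfF
  · intro h hh
    refine ⟨hrp h hh, ?_⟩
    have hh2 : 2 ≤ Nm * (κ * c0) := by rwa [div_le_iff₀ (by positivity)] at hNm2
    have hh3 := hrNm h hh
    have : (r h : ℝ) * Nm ≤ Nm * (κ * (c0 * B)) := hh3.trans (by
      have := mul_le_mul_of_nonneg_left hh2 hB0.le
      linarith)
    rw [mul_comm] at this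
    exact le_of_mul_le_mul_left this (by linarith)
  · intro h hh
    have q1 := h2' (h + 1) hh
    have q2 := h1 h (by omega)
    have q3 := mul_le_mul_of_nonneg_left (hNs h) (Nat.cast_nonneg (r (h + 1)) : (0 : ℝ) ≤ _)
    have q4 : (r (h + 1) : ℝ) * (2 / κ * Nn h) ≤ 2 * (r h * Nn h) := by linarith
    have q5 : (r (h + 1) : ℝ) * (2 / κ * Nn h) = (2 * Nn h / κ) * r (h + 1) := by ring
    have q6 : 2 * (r h * Nn h) = (2 * Nn h / κ) * (κ * r h) := by field_simp
    rw [q5, q6] at q4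
    exact le_of_mul_le_mul_left q4 (by have := hN0 h; positivity)
  · intro I
    by_cases h0 : coeff I f = 0
    · rw [h0]; exact S.O.zero_mem
    · obtain ⟨b, hb⟩ := hfc I h0
      rw [hb]; exact intCast_mem S.O _
  · intro v I
    by_cases h0 : coeff I f = 0
    · rw [h0, map_zero]; exact (Real.exp_pos _).le
    · obtain ⟨b, hb⟩ := hfc I h0
      rw [hb]
      refine (SPl.av_intCast_le _ _).trans ((hPc b).trans (Real.exp_le_exp.2 ?_))
      have hh2 : 2 * c * M ≤ Nm * (κ * c0) := by rwa [div_le_iff₀ (by positivity)] at hNm3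
      have : Nm * (c * ∑ h : Fin M, (r h : ℝ)) ≤ Nm * (κ * (c0 * B)) := by
        have q1 := mul_le_mul_of_nonneg_left hsr hc.le
        have q2 := mul_le_mul_of_nonneg_left hh2 hB0.le
        linarith
      exact le_of_mul_le_mul_left this (by linarith)
  · intro h hh
    refine ⟨neg_ne_zero.2 (hx0 _), ?_⟩
    rw [(S.av v').map_neg]
    refine (pow_le_pow_left₀ ((S.av v').nonneg _) (hx (s h)) _).trans ?_
    rw [← Real.exp_nat_mul, Real.exp_le_exp]
    have := mul_le_mul_of_nonneg_left (h1 h hh) hc0.le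
    simp only [hNn] at this
    linarith

end Rt

end

section

namespace Rt

variable {K : Type*} [Field K] {ι : Type*} [Fintype ι]

/-- integral linear form -/
noncomputable def lf {d : ℕ} (K : Type*) [Field K] (A : Matrix (Fin d) (Fin d) ℤ) (i : Fin d) :
    (Fin d → K) →ₗ[K] K :=
  ∑ k, (A i k : K) • LinearMap.proj k

theorem lf_apply {d : ℕ} (A : Matrix (Fin d) (Fin d) ℤ) (i : Fin d) (z : Fin d → K) :
    lf K A i z = ∑ k, (A i k : K) * z k := by
  simp [lf]

/-- near minima data -/
structure Mn {d : ℕ} (S : SPl K ι) (A : ι → Matrix (Fin d) (Fin d) ℤ) (s : ι → Fin d → ℝ)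
    (U : ℕ → Submodule K (Fin d → K)) (b : ℕ → Fin d → K) (ν : ℕ → ℝ) : Prop where
  U0 : U 0 = ⊥
  Us : ∀ j, U (j + 1) = U j ⊔ Submodule.span K {b j}
  notin : ∀ j < d, b j ∉ U j
  bO : ∀ j < d, ∀ i, b j i ∈ S.O
  pos : ∀ j, 0 < ν j
  sm : ∀ j < d, ∀ v i, S.av v (lf K (A v) i (b j)) ≤ ν j * s v i
  min : ∀ j < d, ∀ z : Fin d → K, (∀ i, z i ∈ S.O) → z ∉ U j → ∀ μ : ℝ, 0 < μ →
    (∀ v i, S.av v (lf K (A v) i z) ≤ μ * s v i) → ν j ≤ 2 * μ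

theorem inv_form {d : ℕ} (A A' : Matrix (Fin d) (Fin d) ℤ) (hA : A' * A = 1) (z : Fin d → K)
    (i : Fin d) : z i = ∑ j, (A' i j : K) * lf K A j z := by
  simp_rw [lf_apply, Finset.mul_sum]
  rw [Finset.sum_comm]
  have : ∀ k, ∑ j, (A' i j : K) * ((A j k : K) * z k) = if i = k then z k else 0 := by
    intro k
    simp_rw [← mul_assoc]
    rw [← Finset.sum_mul]
    have h2 : ∑ j, (A' i j : K) * (A j k : K) = (((A' * A) i k : ℤ) : K) := by
      rw [Matrix.mul_apply]; push_cast; rfl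
    rw [h2, hA, Matrix.one_apply]
    split_ifs <;> simp
  rw [Finset.sum_congr rfl fun k _ => this k]
  simp

/-- integral linear forms: constant bounding everything -/
theorem exists_D {d : ℕ} (A : ι → Matrix (Fin d) (Fin d) ℤ) :
    ∃ D : ℝ, 1 ≤ D ∧ ∀ v i, ∑ j, |(A v i j : ℝ)| ≤ D := by
  refine ⟨1 + ∑ v, ∑ i, ∑ j, |(A v i j : ℝ)|, ?_, fun v i => ?_⟩
  · have : 0 ≤ ∑ v, ∑ i, ∑ j, |(A v i j : ℝ)| := by positivity
    linarith
  · have h1 : ∑ i, ∑ j, |(A v i j : ℝ)| ≤ ∑ v, ∑ i, ∑ j, |(A v i j : ℝ)| :=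
      Finset.single_le_sum (f := fun v => ∑ i, ∑ j, |(A v i j : ℝ)|)
        (fun _ _ => by positivity) (Finset.mem_univ v)
    have h2 : ∑ j, |(A v i j : ℝ)| ≤ ∑ i, ∑ j, |(A v i j : ℝ)| :=
      Finset.single_le_sum (f := fun i => ∑ j, |(A v i j : ℝ)|)
        (fun _ _ => by positivity) (Finset.mem_univ i)
    linarith

theorem av_sum_le (a : AbsoluteValue K ℝ) {α : Type*} (s : Finset α) (f : α → K) :
    a (∑ i ∈ s, f i) ≤ ∑ i ∈ s, a (f i) := by
  classical
  induction s using Finset.induction_on with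
  | empty => simp
  | insert x s hx ih =>
    rw [Finset.sum_insert hx, Finset.sum_insert hx]
    exact (a.add_le _ _).trans (by linarith)

theorem av_comb_le (a : AbsoluteValue K ℝ) {d : ℕ} (c : Fin d → ℤ) (f : Fin d → K) (m : ℝ)
    (D : ℝ) (hm : 0 ≤ m) (hf : ∀ j, a (f j) ≤ m) (hc : ∑ j, |(c j : ℝ)| ≤ D) :
    a (∑ j, (c j : K) * f j) ≤ D * m := by
  refine (av_sum_le a _ _).trans ?_
  refine (Finset.sum_le_sum (g := fun j => |(c j : ℝ)| * m) fun j _ => ?_).trans ?_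
  · rw [map_mul]
    exact mul_le_mul (SPl.av_intCast_le _ _) (hf j) (a.nonneg _) (abs_nonneg _)
  · rw [← Finset.sum_mul]; exact mul_le_mul_of_nonneg_right hc hm

theorem g_pos (S : SPl K ι) [Nonempty ι] : 0 < ∑ v, S.n v :=
  Finset.sum_pos (fun v _ => S.npos v) Finset.univ_nonempty

theorem low_bd [Nonempty ι] (S : SPl K ι) {d : ℕ} (A A' : ι → Matrix (Fin d) (Fin d) ℤ)
    (hA : ∀ v, A' v * A v = 1) (D : ℝ) (hD : 1 ≤ D) (hD' : ∀ v i, ∑ j, |(A' v i j : ℝ)| ≤ D)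
    (s : ι → Fin d → ℝ) (t : ℝ) (hs : ∀ v i, s v i ≤ t) (ht : 0 < t)
    (z : Fin d → K) (hz : ∀ i, z i ∈ S.O) (hz0 : z ≠ 0)
    (μ : ℝ) (hμ : 0 < μ) (hzs : ∀ v i, S.av v (lf K (A v) i z) ≤ μ * s v i) :
    1 / (D * t) ≤ μ := by
  obtain ⟨i, hi⟩ := Function.ne_iff.1 hz0
  have h1 : ∀ v, S.av v (z i) ≤ D * (μ * t) := by
    intro v
    rw [inv_form (A v) (A' v) (hA v) z i]
    exact av_comb_le _ _ _ _ _ (by positivity) (fun j => (hzs v j).trans (by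
      exact mul_le_mul_of_nonneg_left (hs v j) hμ.le)) (hD' v i)
  have h2 := S.prod_ge _ (hz i) hi
  have h3 : ∏ v, S.av v (z i) ^ S.n v ≤ ∏ v, (D * (μ * t)) ^ S.n v :=
    Finset.prod_le_prod (fun v _ => pow_nonneg ((S.av v).nonneg _) _) fun v _ =>
      pow_le_pow_left₀ ((S.av v).nonneg _) (h1 v) _
  rw [Finset.prod_pow_eq_pow_sum] at h3
  have h4 : 1 ≤ D * (μ * t) := by
    by_contra hlt
    push Not at hlt
    have := pow_lt_one₀ (by positivity) hlt (g_pos S).ne'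
    linarith
  rw [div_le_iff₀ (by positivity)]
  linarith

theorem exists_Mn [Nonempty ι] (S : SPl K ι) {d : ℕ} (A A' : ι → Matrix (Fin d) (Fin d) ℤ)
    (hA : ∀ v, A' v * A v = 1) (D : ℝ) (hD : 1 ≤ D) (hD' : ∀ v i, ∑ j, |(A' v i j : ℝ)| ≤ D)
    (hDA : ∀ v i, ∑ j, |(A v i j : ℝ)| ≤ D)
    (s : ι → Fin d → ℝ) (t : ℝ) (hs : ∀ v i, s v i ≤ t) (hs' : ∀ v i, 1 / t ≤ s v i)
    (ht : 0 < t) :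
    ∃ U b ν, Mn S A s U b ν ∧ ∀ j < d, 1 / (D * t) ≤ ν j ∧ ν j ≤ 2 * (D * t) := by
  classical
  have key : ∀ U : Submodule K (Fin d → K), ∃ (b : Fin d → K) (ν : ℝ), U ≠ ⊤ →
      (b ∉ U ∧ (∀ i, b i ∈ S.O) ∧ 0 < ν ∧ (∀ v i, S.av v (lf K (A v) i b) ≤ ν * s v i) ∧
      (∀ z : Fin d → K, (∀ i, z i ∈ S.O) → z ∉ U → ∀ μ : ℝ, 0 < μ →
        (∀ v i, S.av v (lf K (A v) i z) ≤ μ * s v i) → ν ≤ 2 * μ) ∧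
      1 / (D * t) ≤ ν ∧ ν ≤ 2 * (D * t)) := by
    intro U
    by_cases hU : U = ⊤
    · exact ⟨0, 0, fun h => (h hU).elim⟩
    set X : Set ℝ := {μ | 0 < μ ∧ ∃ z : Fin d → K, (∀ i, z i ∈ S.O) ∧ z ∉ U ∧
      ∀ v i, S.av v (lf K (A v) i z) ≤ μ * s v i} with hX
    have hlow : ∀ μ ∈ X, 1 / (D * t) ≤ μ := by
      rintro μ ⟨h0, z, hz, hzU, hzs⟩
      exact low_bd S A A' hA D hD hD' s t hs ht z hz (fun h => hzU (h ▸ U.zero_mem)) μ h0 hzs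
    have hup : D * t ∈ X := by
      obtain ⟨i, hi⟩ : ∃ i : Fin d, (Pi.single i (1 : K)) ∉ U := by
        by_contra hcon
        push Not at hcon
        apply hU
        rw [eq_top_iff]
        intro z _
        rw [pi_eq_sum_univ' z]
        refine U.sum_mem fun i _ => U.smul_mem _ ?_
        convert hcon i using 1
      refine ⟨by positivity, Pi.single i 1, ?_, hi, ?_⟩
      · intro k
        rw [Pi.single_apply]; split_ifs
        · exact S.O.one_mem
        · exact S.O.zero_mem
      · intro v k
        have h1 : S.av v (lf K (A v) k (Pi.single i 1)) ≤ D * 1 := by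
          rw [lf_apply]
          refine av_comb_le _ _ _ _ _ zero_le_one (fun j => ?_) (hDA v k)
          rw [Pi.single_apply]; split_ifs <;> simp
        have h2 := mul_le_mul_of_nonneg_left (hs' v k) (show 0 ≤ D * t by positivity)
        have h3 : D * t * (1 / t) = D := by field_simp
        linarith
    have hb : BddBelow X := ⟨_, hlow⟩
    have hinf : 1 / (D * t) ≤ sInf X := le_csInf ⟨_, hup⟩ hlow
    have hinf0 : 0 < sInf X := lt_of_lt_of_le (by positivity) hinf
    obtain ⟨μ, hμX, hμ⟩ := exists_lt_of_csInf_lt ⟨_, hup⟩ (show sInf X < 2 * sInf X by linarith)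
    have hμ2 : ∀ μ' ∈ X, μ ≤ 2 * μ' := fun μ' h => by
      have := csInf_le hb h
      linarith
    have hlm := hlow μ hμX
    obtain ⟨h0, z, hz, hzU, hzs⟩ := hμX
    exact ⟨z, μ, fun _ => ⟨hzU, hz, h0, hzs, fun z' h1 h2 μ' h3 h4 => hμ2 μ' ⟨h3, z', h1, h2, h4⟩,
      hlm, hμ2 _ hup⟩⟩
  choose B N hBN using key
  set U : ℕ → Submodule K (Fin d → K) := fun j =>
    Nat.rec ⊥ (fun _ W => W ⊔ Submodule.span K {B W}) j
  have hUs : ∀ j, U (j + 1) = U j ⊔ Submodule.span K {B (U j)} := fun j => rfl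
  have hrk : ∀ j, Module.finrank K ↥(U j) ≤ j := by
    intro j
    induction j with
    | zero => simp [U]
    | succ j ih =>
      rw [hUs]
      refine (Submodule.finrank_add_le_finrank_add_finrank _ _).trans ?_
      have := finrank_span_le_card (R := K) ({B (U j)} : Set (Fin d → K))
      simp only [Set.toFinset_singleton, Finset.card_singleton] at this
      omega
  have hne : ∀ j < d, U j ≠ ⊤ := by
    intro j hj h
    have := hrk j
    rw [h, finrank_top, Module.finrank_fin_fun] at this
    omega
  refine ⟨U, fun j => B (U j), fun j => if j < d then N (U j) else 1, ⟨rfl, hUs, ?_, ?_, ?_, ?_, ?_⟩, ?_⟩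
  · exact fun j hj => (hBN _ (hne j hj)).1
  · exact fun j hj => (hBN _ (hne j hj)).2.1
  · intro j
    split_ifs with hj
    · exact (hBN _ (hne j hj)).2.2.1
    · exact one_pos
  · intro j hj
    simp only [if_pos hj]
    exact (hBN _ (hne j hj)).2.2.2.1
  · intro j hj
    simp only [if_pos hj]
    exact (hBN _ (hne j hj)).2.2.2.2.1
  · intro j hj
    simp only [if_pos hj]
    exact (hBN _ (hne j hj)).2.2.2.2.2

end Rt

end

section

namespace Rt

variable {K : Type*} [Field K] {ι : Type*} [Fintype ι]

namespace Mn

variable {d : ℕ} {S : SPl K ι} {A : ι → Matrix (Fin d) (Fin d) ℤ} {s : ι → Fin d → ℝ}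
    {U : ℕ → Submodule K (Fin d → K)} {b : ℕ → Fin d → K} {ν : ℕ → ℝ}

theorem mono (h : Mn S A s U b ν) : Monotone U :=
  monotone_nat_of_le_succ fun j => by rw [h.Us]; exact le_sup_left

theorem b_mem (h : Mn S A s U b ν) (j : ℕ) : b j ∈ U (j + 1) := by
  rw [h.Us]; exact Submodule.mem_sup_right (Submodule.mem_span_singleton_self _)

theorem U_eq (h : Mn S A s U b ν) (j : ℕ) : U j = Submodule.span K (b '' Set.Iio j) := by
  induction j with
  | zero => rw [h.U0]; simp
  | succ j ih =>
    rw [h.Us, ih, ← Submodule.span_union]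
    congr 1
    have : Set.Iio (j + 1) = Set.Iio j ∪ {j} := by
      ext x; simp
    rw [this, Set.image_union, Set.image_singleton]

theorem finrank (h : Mn S A s U b ν) (j : ℕ) (hj : j ≤ d) : Module.finrank K ↥(U j) = j := by
  induction j with
  | zero => rw [h.U0]; simp
  | succ j ih =>
    have h1 : U j < U (j + 1) := by
      refine lt_of_le_of_ne (h.mono (Nat.le_succ j)) fun he => h.notin j (by omega) ?_
      rw [he]; exact h.b_mem j
    have h2 := Submodule.finrank_lt_finrank_of_lt h1
    have h3 : Module.finrank K ↥(U (j + 1)) ≤ j + 1 := by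
      rw [h.Us]
      refine (Submodule.finrank_add_le_finrank_add_finrank _ _).trans ?_
      have := finrank_span_le_card (R := K) ({b j} : Set (Fin d → K))
      simp only [Set.toFinset_singleton, Finset.card_singleton] at this
      have := ih (by omega)
      omega
    have := ih (by omega)
    omega

theorem top (h : Mn S A s U b ν) : U d = ⊤ := by
  apply Submodule.eq_top_of_finrank_eq
  rw [h.finrank d le_rfl, Module.finrank_fin_fun]

theorem linInd (h : Mn S A s U b ν) (j : ℕ) (hj : j ≤ d) :
    LinearIndependent K (fun l : Fin j => b l) := by
  rw [linearIndependent_iff_card_eq_finrank_span, Fintype.card_fin, Set.finrank]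
  have : Set.range (fun l : Fin j => b l) = b '' Set.Iio j := by
    ext x; constructor
    · rintro ⟨l, rfl⟩; exact ⟨l, l.2, rfl⟩
    · rintro ⟨l, hl, rfl⟩; exact ⟨⟨l, hl⟩, rfl⟩
  rw [this, ← h.U_eq, h.finrank j hj]

theorem nu_le (h : Mn S A s U b ν) {l j : ℕ} (hlj : l ≤ j) (hj : j < d) : ν l ≤ 2 * ν j :=
  h.min l (by omega) (b j) (h.bO j hj) (fun hm => h.notin j hj (h.mono hlj hm)) (ν j) (h.pos j)
    (h.sm j hj)

end Mn

/-- pivot ordering -/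
theorem pivot {d : ℕ} (a : AbsoluteValue K ℝ) (l : Fin d → (Fin d → K) →ₗ[K] K) (s : Fin d → ℝ)
    (hs : ∀ i, 0 < s i) (U : ℕ → Submodule K (Fin d → K)) (hU : Monotone U)
    (hr : ∀ j ≤ d, Module.finrank K ↥(U j) ≤ j) :
    ∀ n, ∀ J : Finset (Fin d), J.card = n → ∃ p : Fin d → ℕ, J.image p = Finset.range n ∧
      ∀ j ≤ n, ∀ z ∈ U j, ∀ m : ℝ, 0 ≤ m → (∀ i ∈ J, p i < j → a (l i z) ≤ m * s i) →
        ∀ i ∈ J, a (l i z) ≤ ((d : ℝ) ^ n * m) * s i := by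
  classical
  intro n
  induction n with
  | zero =>
    intro J hJ
    rw [Finset.card_eq_zero] at hJ
    subst hJ
    exact ⟨fun _ => 0, by simp, by simp⟩
  | succ n ih =>
    intro J hJ
    have hnd : n + 1 ≤ d := by
      rw [← hJ]; simpa using Finset.card_le_univ J
    have hd1 : (1 : ℝ) ≤ d := by exact_mod_cast (by omega : 1 ≤ d)
    obtain ⟨c, hc, i0, hi0⟩ : ∃ c : J → K, (∑ i, c i • (l i).domRestrict (U n) = 0) ∧
        ∃ i, c i ≠ 0 := by
      refine (Fintype.not_linearIndependent_iff (v := fun i : J => (l i).domRestrict (U n))).1 ?_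
      intro hl
      have h1 := hl.fintype_card_le_finrank
      rw [Fintype.card_coe, hJ, Subspace.dual_finrank_eq] at h1
      have := hr n (by omega)
      omega
    obtain ⟨i1, -, hi1⟩ := Finset.exists_max_image (Finset.univ : Finset J)
      (fun i => a (c i) * s i) ⟨i0, Finset.mem_univ _⟩
    have hc1 : 0 < a (c i1) := by
      have h1 := hi1 i0 (Finset.mem_univ _)
      have h2 : 0 < a (c i0) * s i0 := mul_pos (a.pos hi0) (hs _)
      have h3 : 0 < a (c i1) * s i1 := lt_of_lt_of_le h2 h1
      exact pos_of_mul_pos_left h3 (hs _).le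
    obtain ⟨p, hp, hpz⟩ := ih (J.erase i1) (by rw [Finset.card_erase_of_mem i1.2, hJ]; rfl)
    refine ⟨Function.update p i1 n, ?_, ?_⟩
    · have hins : J = insert (i1 : Fin d) (J.erase i1) := (Finset.insert_erase i1.2).symm
      generalize (i1 : Fin d) = q at *
      rw [hins, Finset.image_insert, Function.update_self,
        Finset.range_add_one, ← hp]
      congr 1
      refine Finset.image_congr fun x hx => ?_
      rw [Function.update_of_ne]
      exact (Finset.mem_erase.1 hx).1
    · intro j hj z hz m hm hJm
      have hpow : (d : ℝ) ^ n * m ≤ (d : ℝ) ^ (n + 1) * m :=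
        mul_le_mul_of_nonneg_right (pow_le_pow_right₀ hd1 (Nat.le_succ n)) hm
      have hplt : ∀ i ∈ J.erase i1, p i < n := by
        intro i hi
        rw [← Finset.mem_range, ← hp]; exact Finset.mem_image_of_mem p hi
      by_cases hjn : j ≤ n
      · have h1 : ∀ i ∈ J.erase i1, a (l i z) ≤ ((d : ℝ) ^ n * m) * s i := by
          refine hpz j hjn z hz m hm fun i hi hpi => ?_
          refine hJm i (Finset.mem_of_mem_erase hi) ?_
          rwa [Function.update_of_ne (Finset.mem_erase.1 hi).1]
        have h2 : ∑ i : J, c i * l i z = 0 := by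
          have := LinearMap.congr_fun hc ⟨z, hU hjn hz⟩
          simpa using this
        have h3 : a (l i1 z) ≤ ((d : ℝ) ^ (n + 1) * m) * s i1 := by
          rw [← Finset.add_sum_erase _ _ (Finset.mem_univ i1)] at h2
          have h4 : c i1 * l i1 z = - ∑ x ∈ Finset.univ.erase i1, c x * l x z := by
            linear_combination h2
          have h5 : a (c i1) * a (l i1 z) ≤ ∑ x ∈ Finset.univ.erase i1, a (c x) * a (l x z) := by
            rw [← map_mul, h4, a.map_neg]
            refine (av_sum_le a _ _).trans (Finset.sum_le_sum fun x _ => ?_)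
            rw [map_mul]
          have h6 : ∀ x ∈ Finset.univ.erase i1, a (c x) * a (l x z) ≤
              a (c i1) * s i1 * ((d : ℝ) ^ n * m) := by
            intro x hx
            have hx1 : (x : Fin d) ∈ J.erase i1 := by
              refine Finset.mem_erase.2 ⟨fun h => (Finset.mem_erase.1 hx).1 (Subtype.ext h), x.2⟩
            have h7 := h1 x hx1
            have h8 := hi1 x (Finset.mem_univ _)
            calc a (c x) * a (l x z) ≤ a (c x) * (((d : ℝ) ^ n * m) * s x) :=
                  mul_le_mul_of_nonneg_left h7 (a.nonneg _)
              _ = (a (c x) * s x) * ((d : ℝ) ^ n * m) := by ring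
              _ ≤ _ := mul_le_mul_of_nonneg_right h8 (by positivity)
          have h9 := h5.trans (Finset.sum_le_sum h6)
          rw [Finset.sum_const, nsmul_eq_mul] at h9
          have h10 : (((Finset.univ.erase i1 : Finset J).card : ℕ) : ℝ) ≤ d := by
            rw [Finset.card_erase_of_mem (Finset.mem_univ _), Finset.card_univ, Fintype.card_coe, hJ]
            exact_mod_cast (by omega : n + 1 - 1 ≤ d)
          have h11 := h9.trans (mul_le_mul_of_nonneg_right h10 (by
            have := hs i1; positivity))
          refine le_of_mul_le_mul_left (h11.trans (le_of_eq ?_)) hc1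
          rw [pow_succ]; ring
        intro i hi
        by_cases hii : i = i1
        · rw [hii]; exact h3
        · exact (h1 i (Finset.mem_erase.2 ⟨hii, hi⟩)).trans
            (mul_le_mul_of_nonneg_right hpow (hs i).le)
      · have hjn' : j = n + 1 := by omega
        intro i hi
        refine (hJm i hi ?_).trans (mul_le_mul_of_nonneg_right ?_ (hs i).le)
        · by_cases hii : i = i1
          · rw [hii, Function.update_self]; omega
          · rw [Function.update_of_ne hii]
            have := hplt i (Finset.mem_erase.2 ⟨hii, hi⟩)
            omega
        · exact le_mul_of_one_le_left hm (one_le_pow₀ hd1)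

end Rt

end

section

namespace Rt

variable {K : Type*} [Field K] {ι : Type*} [Fintype ι]

theorem det_bound {d : ℕ} (a : AbsoluteValue K ℝ) (M : Matrix (Fin d) (Fin d) K)
    (c r : Fin d → ℝ) (h : ∀ i j, a (M i j) ≤ c j * r i) :
    a M.det ≤ d.factorial * ((∏ j, c j) * ∏ i, r i) := by
  classical
  rw [Matrix.det_apply]
  refine (av_sum_le a _ _).trans ?_
  refine (Finset.sum_le_sum (g := fun _ => (∏ j, c j) * ∏ i, r i) fun σ _ => ?_).trans ?_
  · have h1 : a (Equiv.Perm.sign σ • ∏ i, M (σ i) i) = ∏ i, a (M (σ i) i) := by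
      rw [Units.smul_def, zsmul_eq_mul, map_mul, map_prod]
      rcases Int.units_eq_one_or (Equiv.Perm.sign σ) with h | h <;> simp [h]
    rw [h1]
    refine (Finset.prod_le_prod (fun _ _ => a.nonneg _) fun i _ => h (σ i) i).trans (le_of_eq ?_)
    rw [Finset.prod_mul_distrib, Equiv.prod_comp σ r]
  · simp [Fintype.card_perm]

theorem det_mem {d : ℕ} (O : Subring K) (M : Matrix (Fin d) (Fin d) K) (h : ∀ i j, M i j ∈ O) :
    M.det ∈ O := by
  rw [Matrix.det_apply]
  refine O.sum_mem fun σ _ => ?_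
  rw [Units.smul_def]
  exact O.zsmul_mem (O.prod_mem fun i _ => h _ _) _

theorem av_det_unimod {d : ℕ} (a : AbsoluteValue K ℝ) (A A' : Matrix (Fin d) (Fin d) ℤ)
    (hA : A' * A = 1) : a ((A.map (fun x : ℤ => (x : K))).det) = 1 := by
  have h1 : (A.map (fun x : ℤ => (x : K))).det = ((A.det : ℤ) : K) := by
    have := (RingHom.map_det (Int.castRingHom K) A).symm
    simpa using this
  have h2 : A'.det * A.det = 1 := by rw [← Matrix.det_mul, hA, Matrix.det_one]
  rw [h1]
  rcases Int.isUnit_iff.1 (IsUnit.of_mul_eq_one A'.det (by rw [mul_comm]; exact h2)) with h | h <;> simp [h]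

section
variable {d : ℕ} {S : SPl K ι} {A : ι → Matrix (Fin d) (Fin d) ℤ} {s : ι → Fin d → ℝ}
    {U : ℕ → Submodule K (Fin d → K)} {b : ℕ → Fin d → K} {ν : ℕ → ℝ}

theorem Mn.vol_ge (h : Mn S A s U b ν) (A' : ι → Matrix (Fin d) (Fin d) ℤ)
    (hA : ∀ v, A' v * A v = 1) (hs : ∀ v i, 0 < s v i) :
    1 ≤ (d.factorial : ℝ) ^ (∑ v, S.n v) * ((∏ v, ∏ i, s v i ^ S.n v) *
      (∏ l ∈ Finset.range d, ν l) ^ (∑ v, S.n v)) := by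
  classical
  set M : Matrix (Fin d) (Fin d) K := Matrix.of fun i j => b j i with hM
  have hdet : M.det ≠ 0 := by
    have h1 := h.linInd d le_rfl
    have : LinearIndependent K (Matrix.transpose M).row := h1
    rw [Matrix.linearIndependent_rows_iff_isUnit, Matrix.isUnit_transpose,
      Matrix.isUnit_iff_isUnit_det] at this
    exact this.ne_zero
  have hO : M.det ∈ S.O := det_mem S.O M fun i j => h.bO j j.2 i
  have h1 := S.prod_ge _ hO hdet
  have h2 : ∀ v, S.av v M.det ≤ d.factorial * ((∏ l ∈ Finset.range d, ν l) * ∏ i, s v i) := by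
    intro v
    have e1 : S.av v M.det = S.av v (((A v).map (fun x : ℤ => (x : K))) * M).det := by
      rw [Matrix.det_mul, map_mul, av_det_unimod _ _ _ (hA v), one_mul]
    rw [e1, Finset.prod_range]
    refine det_bound _ _ _ _ fun i j => ?_
    have e2 : (((A v).map (fun x : ℤ => (x : K))) * M) i j = lf K (A v) i (b j) := by
      rw [lf_apply, Matrix.mul_apply]; rfl
    rw [e2]; exact h.sm j j.2 v i
  refine h1.trans ((Finset.prod_le_prod (fun v _ => pow_nonneg ((S.av v).nonneg _) _) fun v _ =>
    pow_le_pow_left₀ ((S.av v).nonneg _) (h2 v) _).trans (le_of_eq ?_))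
  simp_rw [mul_pow, Finset.prod_mul_distrib, Finset.prod_pow_eq_pow_sum, ← Finset.prod_pow]
  ring

/-- pivots at a place -/
def Piv (S : SPl K ι) (A : ι → Matrix (Fin d) (Fin d) ℤ) (s : ι → Fin d → ℝ)
    (U : ℕ → Submodule K (Fin d → K)) (p : ι → Fin d → ℕ) : Prop :=
  ∀ v, Finset.univ.image (p v) = Finset.range d ∧
    ∀ j ≤ d, ∀ z ∈ U j, ∀ m : ℝ, 0 ≤ m →
      (∀ i, p v i < j → S.av v (lf K (A v) i z) ≤ m * s v i) →
        ∀ i, S.av v (lf K (A v) i z) ≤ ((d : ℝ) ^ d * m) * s v i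

theorem Mn.exists_piv (h : Mn S A s U b ν) (hs : ∀ v i, 0 < s v i) : ∃ p, Piv S A s U p := by
  have : ∀ v, ∃ p : Fin d → ℕ, _ := fun v => pivot (S.av v) (fun i => lf K (A v) i) (s v) (hs v) U
    h.mono (fun j hj => (h.finrank j hj).le) d Finset.univ (by simp)
  choose p hp using this
  refine ⟨p, fun v => ⟨(hp v).1, fun j hj z hz m hm hi i => ?_⟩⟩
  exact (hp v).2 j hj z hz m hm (fun i _ => hi i) i (Finset.mem_univ i)

theorem Piv.prod {p : ι → Fin d → ℕ} (hp : Piv S A s U p) (f : ℕ → ℝ) (v : ι) :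
    ∏ i, f (p v i) = ∏ l ∈ Finset.range d, f l := by
  rw [← (hp v).1, Finset.prod_image]
  rw [← Finset.card_image_iff, (hp v).1]; simp

theorem Piv.prod_all {p : ι → Fin d → ℕ} (hp : Piv S A s U p) (f : ℕ → ℝ) :
    ∏ v, ∏ i, (s v i * f (p v i)) ^ S.n v = (∏ v, ∏ i, s v i ^ S.n v) *
      (∏ l ∈ Finset.range d, f l) ^ (∑ v, S.n v) := by
  simp_rw [mul_pow, Finset.prod_mul_distrib]
  congr 1
  rw [← Finset.prod_pow_eq_pow_sum]
  refine Finset.prod_congr rfl fun v _ => ?_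
  rw [← hp.prod f v, Finset.prod_pow]

theorem Mn.small (h : Mn S A s U b ν) (hd : 0 < d) {p : ι → Fin d → ℕ} (hp : Piv S A s U p)
    (hs : ∀ v i, 0 < s v i)
    (f : ℕ → ℝ) (τ : ℝ) (hτ : 0 < τ) (z : Fin d → K) (hz0 : z ≠ 0) (hz : ∀ i, z i ∈ S.O)
    (hzs : ∀ v i, S.av v (lf K (A v) i z) ≤ τ * (s v i * f (p v i))) :
    ∃ j < d, z ∈ U (j + 1) ∧ z ∉ U j ∧ ∀ m : ℝ, 0 < m → (∀ l ≤ j, f l ≤ m) →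
      ν j ≤ 2 * ((d : ℝ) ^ d * (τ * m)) := by
  classical
  have hex : ∃ k, z ∈ U k := ⟨d, by rw [h.top]; trivial⟩
  obtain ⟨k, hk, hmin⟩ : ∃ k, z ∈ U k ∧ ∀ l < k, z ∉ U l :=
    ⟨Nat.find hex, Nat.find_spec hex, fun l hl => Nat.find_min hex hl⟩
  have hk0 : k ≠ 0 := by
    rintro rfl
    rw [h.U0] at hk; exact hz0 (by simpa using hk)
  have hkd : k ≤ d := by
    by_contra hlt
    push Not at hlt
    exact hmin d hlt (by rw [h.top]; trivial)
  obtain ⟨j, rfl⟩ := Nat.exists_eq_succ_of_ne_zero hk0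
  have hdr : (0 : ℝ) < d := by exact_mod_cast hd
  refine ⟨j, by omega, hk, hmin j (Nat.lt_succ_self j), fun m hm hf => ?_⟩
  refine h.min j (by omega) z hz (hmin j (Nat.lt_succ_self j)) _ (by positivity) fun v i => ?_
  refine (hp v).2 (j + 1) hkd z hk (τ * m) (by positivity) (fun i hi => ?_) i
  refine (hzs v i).trans ?_
  have := mul_le_mul_of_nonneg_left (hf (p v i) (by omega)) (mul_pos hτ (hs v i)).le
  linarith

end

theorem vol_le (S : SPl K ι) {d : ℕ} (hd : 0 < d) (A : ι → Matrix (Fin d) (Fin d) ℤ) :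
    ∃ C : ℝ, 1 ≤ C ∧ ∀ (s : ι → Fin d → ℝ) (U : ℕ → Submodule K (Fin d → K)) (b : ℕ → Fin d → K)
      (ν : ℕ → ℝ), Mn S A s U b ν → (∀ v i, 0 < s v i) →
      (∏ v, ∏ i, s v i ^ S.n v) * (∏ l ∈ Finset.range d, ν l) ^ (∑ v, S.n v) ≤ C := by
  classical
  obtain ⟨C, hC, hm⟩ := S.mink d A
  have hdr : (0 : ℝ) < d := by exact_mod_cast hd
  set τ : ℝ := 1 / (8 * (d : ℝ) ^ d) with hτ
  have hτ0 : 0 < τ := by positivity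
  refine ⟨max 1 (C / (τ ^ d) ^ (∑ v, S.n v)), le_max_left _ _, ?_⟩
  intro s U b ν h hs
  refine le_max_of_le_right ?_
  by_contra hlt
  push Not at hlt
  obtain ⟨p, hp⟩ := h.exists_piv hs
  have e := hp.prod_all (f := fun l => τ * ν l)
  rw [Finset.prod_mul_distrib, Finset.prod_const, Finset.card_range, mul_pow] at e
  rw [div_lt_iff₀ (by positivity)] at hlt
  obtain ⟨z, hz0, hzO, hzs⟩ := hm (fun v i => s v i * (τ * ν (p v i)))
    (fun v i => mul_pos (hs v i) (mul_pos hτ0 (h.pos _))) (by rw [e]; linarith)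
  obtain ⟨j, hj, -, -, hjm⟩ := h.small hd hp hs ν τ hτ0 z hz0 hzO (fun v i => by
    rw [lf_apply]; exact (hzs v i).trans (le_of_eq (by ring)))
  have h2 := hjm (2 * ν j) (by have := h.pos j; positivity) fun l hl => h.nu_le hl hj
  have h3 : 2 * ((d : ℝ) ^ d * (τ * (2 * ν j))) = ν j / 2 := by rw [hτ]; field_simp; ring
  have := h.pos j
  linarith

end Rt

end

section

namespace Rt

variable {K : Type*} [Field K] {ι : Type*} [Fintype ι]

theorem le_max_of_pow {X C : ℝ} {g : ℕ} (hg : 0 < g) (hX : X ^ g ≤ C) (hC : 1 ≤ C) : X ≤ C := by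
  by_contra hlt
  push Not at hlt
  have h1 : 1 ≤ X := by linarith
  have := le_self_pow₀ h1 hg.ne'
  linarith

theorem prod_min {d : ℕ} (hd : 2 ≤ d) (ν : ℕ → ℝ) :
    (∏ l ∈ Finset.range d, ν (min l (d - 2))) * ν (d - 1) =
      (∏ l ∈ Finset.range d, ν l) * ν (d - 2) := by
  obtain ⟨e, rfl⟩ : ∃ e, d = e + 1 := ⟨d - 1, by omega⟩
  rw [Finset.prod_range_succ, Finset.prod_range_succ]
  have e1 : ∏ l ∈ Finset.range e, ν (min l (e + 1 - 2)) = ∏ l ∈ Finset.range e, ν l :=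
    Finset.prod_congr rfl fun l hl => by
      rw [min_eq_left]; have := Finset.mem_range.1 hl; omega
  have e2 : ν (min e (e + 1 - 2)) = ν (e + 1 - 2) := by congr 1; omega
  rw [e1, e2]; simp only [Nat.add_sub_cancel]; ring

theorem gap_aux [Nonempty ι] (S : SPl K ι) {d : ℕ} (hd : 2 ≤ d)
    (A A' : ι → Matrix (Fin d) (Fin d) ℤ) (hA : ∀ v, A' v * A v = 1) :
    ∃ C : ℝ, 1 ≤ C ∧ ∀ (s : ι → Fin d → ℝ) (t : ℝ), 1 ≤ t → (∀ v i, s v i ≤ t) →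
      (∀ v i, 1 / t ≤ s v i) → ∀ U b ν, Mn S A s U b ν →
      ∀ T : ℝ, 1 ≤ T → (∀ j < d, 1 / T ≤ ν j ∧ ν j ≤ T) →
      C * ν (d - 2) < ν (d - 1) → ∃ C' : ℝ, 1 ≤ C' ∧ C' ≤ C ∧ ∃ (p : ι → Fin d → ℕ) (y : ℕ → Fin d → K), Piv S A s U p ∧
        (∀ j < d - 1, y j ∈ U (d - 1) ∧ (∀ i, y j i ∈ S.O) ∧
          ∀ v i, S.av v (lf K (A v) i (y j)) ≤ C' * (s v i * ν (min (p v i) (d - 2)))) ∧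
        LinearIndependent K (fun j : Fin (d - 1) => y j) := by
  classical
  obtain ⟨C1, hC1, hvol⟩ := vol_le S (by omega : 0 < d) A
  obtain ⟨D1, hD1, hDA⟩ := exists_D A
  obtain ⟨D2, hD2, hDA'⟩ := exists_D A'
  set g := ∑ v, S.n v with hg
  have hgp : 0 < g := g_pos S
  have hdr : (0 : ℝ) < d := by exact_mod_cast (by omega : 0 < d)
  set C2 : ℝ := (d.factorial : ℝ) ^ g with hC2
  have hC21 : 1 ≤ C2 := one_le_pow₀ (by exact_mod_cast Nat.factorial_pos d)
  set C3 := C1 * C2 with hC3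
  have hC31 : 1 ≤ C3 := one_le_mul_of_one_le_of_one_le hC1 hC21
  set c : ℝ := 1 / (4 * (d : ℝ) ^ d) with hc
  have hc0 : 0 < c := by positivity
  have hc1 : c ≤ 1 := by
    rw [hc, div_le_one (by positivity)]
    have : (1 : ℝ) ≤ (d : ℝ) ^ d := one_le_pow₀ (by exact_mod_cast (by omega : 1 ≤ d))
    linarith
  set C4 : ℝ := 2 * C3 / c ^ (d - 1) with hC4
  have hcp : c ^ (d - 1) ≤ 1 := pow_le_one₀ hc0.le hc1
  have hC41 : 1 ≤ C4 := by
    rw [hC4, le_div_iff₀ (by positivity)]; linarith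
  have hCc : C4 ≤ C4 / c := by
    rw [le_div_iff₀ hc0]; nlinarith
  refine ⟨C4 / c, by linarith, ?_⟩
  intro s t ht hst hst' U b ν h T hT hν hgap
  have hT0 : 0 < T := by linarith
  refine ⟨C4, hC41, hCc, ?_⟩
  have ht0 : 0 < t := by linarith
  have hs : ∀ v i, 0 < s v i := fun v i => lt_of_lt_of_le (by positivity) (hst' v i)
  obtain ⟨p, hp⟩ := h.exists_piv hs
  set f : ℕ → ℝ := fun l => ν (min l (d - 2)) with hf
  have hfpos : ∀ l, 0 < f l := fun l => h.pos _
  set s'' : ι → Fin d → ℝ := fun v i => s v i * f (p v i) with hs''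
  have hs0 : ∀ v i, 0 < s'' v i := fun v i => mul_pos (hs v i) (hfpos _)
  -- existence of second minima
  set Cx := C4 / c with hCx
  have hCx1 : 1 ≤ Cx := by linarith
  obtain ⟨U2, b2, ν2, h2, -⟩ := exists_Mn S A A' hA (max D1 D2) (le_max_of_le_left hD1)
    (fun v i => (hDA' v i).trans (le_max_right _ _)) (fun v i => (hDA v i).trans (le_max_left _ _))
    s'' (T * t) (fun v i => by
      have h3 : f (p v i) ≤ T := (hν _ (by omega)).2
      have := mul_le_mul (hst v i) h3 (hfpos _).le ht0.le
      simp only [hs'']; linarith)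
    (fun v i => by
      have h3 : 1 / T ≤ f (p v i) := (hν _ (by omega)).1
      have h4 := mul_le_mul (hst' v i) h3 (by positivity) (hs v i).le
      refine le_trans (le_of_eq ?_) h4
      field_simp) (by positivity)
  have hQ1 : ν (d - 2) < ν (d - 1) := by
    have := h.pos (d - 2)
    nlinarith
  have hsm : ∀ z : Fin d → K, z ≠ 0 → (∀ i, z i ∈ S.O) → ∀ τ : ℝ, 0 < τ →
      (∀ v i, S.av v (lf K (A v) i z) ≤ τ * s'' v i) → c ≤ τ ∧
      (z ∉ U (d - 1) → c * ν (d - 1) ≤ τ * ν (d - 2)) := by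
    intro z hz0 hzO τ hτ hzs
    obtain ⟨j, hj, hj1, hj2, hjm⟩ := h.small (by omega) hp hs f τ hτ z hz0 hzO hzs
    by_cases hjd : j ≤ d - 2
    · have h3 := hjm (2 * ν j) (by have := h.pos j; positivity) fun l hl => by
        simp only [hf]; exact h.nu_le (by omega) hj
      constructor
      · rw [hc, div_le_iff₀ (by positivity)]
        refine le_of_mul_le_mul_right ?_ (h.pos j)
        linarith
      · intro hz
        exact (hz (h.mono (by omega) hj1)).elim
    · have hjd' : j = d - 1 := by omega
      subst hjd'
      have h3 := hjm (2 * ν (d - 2)) (by have := h.pos (d - 2); positivity) fun l hl => by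
        simp only [hf]; exact h.nu_le (by omega) (by omega)
      have h4 : c * ν (d - 1) ≤ τ * ν (d - 2) := by
        rw [hc, div_mul_eq_mul_div, one_mul, div_le_iff₀ (by positivity)]
        linarith
      refine ⟨?_, fun _ => h4⟩
      have h5 : c * ν (d - 2) ≤ c * ν (d - 1) := mul_le_mul_of_nonneg_left hQ1.le hc0.le
      exact le_of_mul_le_mul_right (h5.trans h4) (h.pos _)
  have hb20 : ∀ j < d, b2 j ≠ 0 := fun j hj h0 => h2.notin j hj (h0 ▸ (U2 j).zero_mem)
  have hν2c : ∀ j < d, c ≤ ν2 j := fun j hj =>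
    (hsm (b2 j) (hb20 j hj) (h2.bO j hj) (ν2 j) (h2.pos j) (h2.sm j hj)).1
  have hν2n : ∀ j < d, b2 j ∉ U (d - 1) → c * ν (d - 1) ≤ ν2 j * ν (d - 2) := fun j hj =>
    (hsm (b2 j) (hb20 j hj) (h2.bO j hj) (ν2 j) (h2.pos j) (h2.sm j hj)).2
  have hlast : c * ν (d - 1) ≤ (2 * ν2 (d - 1)) * ν (d - 2) := by
    obtain ⟨j0, hj0, hj0'⟩ : ∃ j < d, b2 j ∉ U (d - 1) := by
      by_contra hcon
      push Not at hcon
      have h3 : U2 d ≤ U (d - 1) := by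
        rw [h2.U_eq, Submodule.span_le]
        rintro x ⟨l, hl, rfl⟩
        exact hcon l hl
      rw [h2.top, top_le_iff] at h3
      have h4 := h.finrank (d - 1) (by omega)
      rw [h3, finrank_top, Module.finrank_fin_fun] at h4
      omega
    refine (hν2n j0 hj0 hj0').trans ?_
    exact mul_le_mul_of_nonneg_right (h2.nu_le (by omega) (by omega)) (h.pos _).le
  -- volume
  have hv1 := hvol s'' U2 b2 ν2 h2 hs0
  have hv2 := h.vol_ge A' hA hs
  rw [hp.prod_all f] at hv1
  have hfp : (∏ l ∈ Finset.range d, f l) * ν (d - 1) = (∏ l ∈ Finset.range d, ν l) * ν (d - 2) :=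
    prod_min hd ν
  set V := ∏ v, ∏ i, s v i ^ S.n v with hV
  have hV0 : 0 < V := Finset.prod_pos fun v _ => Finset.prod_pos fun i _ => pow_pos (hs v i) _
  set P2 := ∏ l ∈ Finset.range d, ν2 l with hP2
  have hP20 : 0 < P2 := Finset.prod_pos fun l _ => h2.pos l
  have hPf0 : 0 < ∏ l ∈ Finset.range d, f l := Finset.prod_pos fun l _ => hfpos l
  have hP0 : 0 < ∏ l ∈ Finset.range d, ν l := Finset.prod_pos fun l _ => h.pos l
  have hX : ν (d - 2) * P2 ≤ C3 * ν (d - 1) := by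
    have hw : (ν (d - 2) * P2 / ν (d - 1)) ^ g ≤ C3 := by
      have e1 : ∏ l ∈ Finset.range d, f l = (∏ l ∈ Finset.range d, ν l) * (ν (d - 2) / ν (d - 1)) := by
        have := (h.pos (d - 1)).ne'
        field_simp; linarith
      rw [e1, mul_pow] at hv1
      have e2 : (ν (d - 2) * P2 / ν (d - 1)) ^ g = (ν (d - 2) / ν (d - 1)) ^ g * P2 ^ g := by
        rw [← mul_pow]; congr 1; ring
      rw [e2]
      have e3 : 0 ≤ (ν (d - 2) / ν (d - 1)) ^ g * P2 ^ g := by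
        have := h.pos (d - 2); have := h.pos (d - 1); positivity
      have e4 := mul_le_mul_of_nonneg_right hv2 e3
      have e5 := mul_le_mul_of_nonneg_left hv1 (show 0 ≤ C2 by linarith)
      rw [one_mul] at e4
      refine e4.trans ((le_of_eq ?_).trans (e5.trans (le_of_eq ?_)))
      · ring
      · rw [hC3]; ring
    have := le_max_of_pow hgp hw hC31
    rwa [div_le_iff₀ (h.pos _)] at this
  have hup : ∀ j < d - 1, ν2 j ≤ C4 := by
    intro j hj
    have e0 : P2 = ν2 (d - 1) * ∏ l ∈ Finset.range (d - 1), ν2 l := by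
      rw [hP2]
      obtain ⟨e, rfl⟩ : ∃ e, d = e + 1 := ⟨d - 1, by omega⟩
      rw [Finset.prod_range_succ]; simp only [Nat.add_sub_cancel]; ring
    have e1 : ν2 j * c ^ (d - 2) ≤ ∏ l ∈ Finset.range (d - 1), ν2 l := by
      rw [← Finset.mul_prod_erase _ _ (Finset.mem_range.2 hj)]
      refine mul_le_mul_of_nonneg_left ?_ (h2.pos j).le
      have : ((Finset.range (d - 1)).erase j).card = d - 2 := by
        rw [Finset.card_erase_of_mem (Finset.mem_range.2 hj), Finset.card_range]; omega
      rw [← this, ← Finset.prod_const]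
      refine Finset.prod_le_prod (fun _ _ => hc0.le) fun l hl => hν2c l ?_
      have := Finset.mem_range.1 (Finset.mem_of_mem_erase hl); omega
    have e2 : ν2 (d - 1) * (ν2 j * c ^ (d - 2)) ≤ P2 := by
      rw [e0]; exact mul_le_mul_of_nonneg_left e1 (h2.pos _).le
    have e3 : c * ν (d - 1) * (ν2 j * c ^ (d - 2)) ≤ 2 * C3 * ν (d - 1) := by
      have q1 := mul_le_mul_of_nonneg_right hlast (show 0 ≤ ν2 j * c ^ (d - 2) by
        have := h2.pos j; positivity)
      have q2 := mul_le_mul_of_nonneg_left e2 (h.pos (d - 2)).le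
      linarith
    have e4 : c ^ (d - 1) = c * c ^ (d - 2) := by
      rw [← pow_succ']; congr 1; omega
    rw [hC4, le_div_iff₀ (by positivity), e4]
    refine le_of_mul_le_mul_right ?_ (h.pos (d - 1))
    linarith
  refine ⟨p, b2, hp, ?_, h2.linInd (d - 1) (by omega)⟩
  intro j hj
  refine ⟨?_, h2.bO j (by omega), fun v i => ?_⟩
  · by_contra hn
    have q1 := hν2n j (by omega) hn
    have q2 := mul_le_mul_of_nonneg_right (hup j hj) (h.pos (d - 2)).le
    rw [hCx, div_mul_eq_mul_div, div_lt_iff₀ hc0] at hgap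
    linarith
  · exact (h2.sm j (by omega) v i).trans (mul_le_mul_of_nonneg_right (hup j hj) (hs0 v i).le)

theorem gap [Nonempty ι] (S : SPl K ι) {d : ℕ} (hd : 2 ≤ d)
    (A A' : ι → Matrix (Fin d) (Fin d) ℤ) (hA : ∀ v, A' v * A v = 1) :
    ∃ C : ℝ, 1 ≤ C ∧ ∀ (s : ι → Fin d → ℝ) (t : ℝ), 1 ≤ t → (∀ v i, s v i ≤ t) →
      (∀ v i, 1 / t ≤ s v i) → ∃ U b ν, Mn S A s U b ν ∧
      (∀ j < d, 1 / (C * t) ≤ ν j ∧ ν j ≤ C * t) ∧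
      (∏ v, ∏ i, s v i ^ S.n v) * (∏ l ∈ Finset.range d, ν l) ^ (∑ v, S.n v) ≤ C ∧
      (C * ν (d - 2) < ν (d - 1) → ∃ (y : ℕ → Fin d → K) (R : ι → Fin d → ℝ),
        (∀ j < d - 1, y j ∈ U (d - 1) ∧ (∀ i, y j i ∈ S.O) ∧
          ∀ v i, S.av v (lf K (A v) i (y j)) ≤ R v i) ∧
        LinearIndependent K (fun j : Fin (d - 1) => y j) ∧
        (∀ v i, 1 / (C * t ^ 2) ≤ R v i ∧ R v i ≤ C * t ^ 2) ∧
        ∏ v, ∏ i, R v i ^ S.n v ≤ C * (ν (d - 2) / ν (d - 1)) ^ (∑ v, S.n v)) := by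
  classical
  obtain ⟨C0, hC0, hgap⟩ := gap_aux S hd A A' hA
  obtain ⟨C1, hC1, hvol⟩ := vol_le S (by omega : 0 < d) A
  obtain ⟨D1, hD1, hDA⟩ := exists_D A
  obtain ⟨D2, hD2, hDA'⟩ := exists_D A'
  set D := max D1 D2 with hD
  have hDge : 1 ≤ D := le_max_of_le_left hD1
  set g := ∑ v, S.n v with hg
  have hE : 1 ≤ (C0 ^ d) ^ g := one_le_pow₀ (one_le_pow₀ hC0)
  set C := C0 + C1 + 2 * D * C0 + (C0 ^ d) ^ g * C1 with hC
  have hDC : 1 ≤ D * C0 := one_le_mul_of_one_le_of_one_le hDge hC0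
  have hEC : 1 ≤ (C0 ^ d) ^ g * C1 := one_le_mul_of_one_le_of_one_le hE hC1
  have hC1' : 1 ≤ C := by linarith
  have hDC2 : D ≤ D * C0 := le_mul_of_one_le_right (by linarith) hC0
  refine ⟨C, hC1', ?_⟩
  intro s t ht hst hst'
  have ht0 : 0 < t := by linarith
  have hs : ∀ v i, 0 < s v i := fun v i => lt_of_lt_of_le (by positivity) (hst' v i)
  obtain ⟨U, b, ν, h, hν⟩ := exists_Mn S A A' hA D hDge
    (fun v i => (hDA' v i).trans (le_max_right _ _)) (fun v i => (hDA v i).trans (le_max_left _ _))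
    s t hst hst' ht0
  have hν' : ∀ j < d, 1 / (2 * (D * t)) ≤ ν j ∧ ν j ≤ 2 * (D * t) := fun j hj =>
    ⟨le_trans (one_div_le_one_div_of_le (by positivity) (by nlinarith)) (hν j hj).1, (hν j hj).2⟩
  refine ⟨U, b, ν, h, fun j hj => ⟨?_, ?_⟩, ?_, ?_⟩
  · refine le_trans (one_div_le_one_div_of_le (by positivity) ?_) (hν j hj).1
    exact mul_le_mul_of_nonneg_right (by linarith) ht0.le
  · refine (hν j hj).2.trans ?_
    rw [← mul_assoc]
    exact mul_le_mul_of_nonneg_right (by linarith) ht0.le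
  · exact (hvol s U b ν h hs).trans (by linarith)
  · intro hlt
    obtain ⟨C', hC'1, hC'0, p, y, hp, hy, hli⟩ := hgap s t ht hst hst' U b ν h (2 * (D * t))
      (by nlinarith) hν' (lt_of_le_of_lt (mul_le_mul_of_nonneg_right (by linarith) (h.pos _).le) hlt)
    refine ⟨y, fun v i => s v i * (C' * ν (min (p v i) (d - 2))), fun j hj => ⟨(hy j hj).1,
      (hy j hj).2.1, fun v i => ((hy j hj).2.2 v i).trans (le_of_eq (by ring))⟩, hli, ?_, ?_⟩
    · intro v i
      have h1 := hν' (min (p v i) (d - 2)) (by omega)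
      have hνp := h.pos (min (p v i) (d - 2))
      constructor
      · have h2 : (1 / t) * (1 / (2 * (D * t))) ≤ s v i * ν (min (p v i) (d - 2)) :=
          mul_le_mul (hst' v i) h1.1 (by positivity) (hs v i).le
        have h3 : 1 / (C * t ^ 2) ≤ (1 / t) * (1 / (2 * (D * t))) := by
          rw [one_div_mul_one_div]
          refine one_div_le_one_div_of_le (by positivity) ?_
          have : t * (2 * (D * t)) = (2 * D) * t ^ 2 := by ring
          rw [this]
          exact mul_le_mul_of_nonneg_right (by linarith) (by positivity)
        have h4 : s v i * ν (min (p v i) (d - 2)) ≤ C' * (s v i * ν (min (p v i) (d - 2))) :=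
          le_mul_of_one_le_left (by have := hs v i; positivity) hC'1
        linarith
      · have h2 : s v i * ν (min (p v i) (d - 2)) ≤ t * (2 * (D * t)) :=
          mul_le_mul (hst v i) h1.2 hνp.le ht0.le
        have h3 : C' * (s v i * ν (min (p v i) (d - 2))) ≤ C0 * (t * (2 * (D * t))) :=
          mul_le_mul hC'0 h2 (by have := hs v i; positivity) (by linarith)
        have h4 : C0 * (t * (2 * (D * t))) = (2 * D * C0) * t ^ 2 := by ring
        have h5 : (2 * D * C0) * t ^ 2 ≤ C * t ^ 2 :=
          mul_le_mul_of_nonneg_right (by linarith) (by positivity)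
        linarith
    · rw [hp.prod_all (fun l => C' * ν (min l (d - 2))), Finset.prod_mul_distrib,
        Finset.prod_const, Finset.card_range]
      have e1 : ∏ l ∈ Finset.range d, ν (min l (d - 2)) =
          (∏ l ∈ Finset.range d, ν l) * (ν (d - 2) / ν (d - 1)) := by
        have := (h.pos (d - 1)).ne'
        have := prod_min hd ν
        field_simp; linarith
      rw [e1, mul_pow, mul_pow]
      have hQ : 0 ≤ (ν (d - 2) / ν (d - 1)) ^ g := by
        have := h.pos (d - 2); have := h.pos (d - 1); positivity
      have e2 := hvol s U b ν h hs
      have e3 : (C' ^ d) ^ g ≤ (C0 ^ d) ^ g := by gcongr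
      have e4 : (C' ^ d) ^ g * ((∏ v, ∏ i, s v i ^ S.n v) * (∏ l ∈ Finset.range d, ν l) ^ g) ≤
          (C0 ^ d) ^ g * C1 := by
        refine mul_le_mul e3 e2 ?_ (by linarith)
        exact mul_nonneg (Finset.prod_nonneg fun v _ => Finset.prod_nonneg fun i _ =>
          pow_nonneg (hs v i).le _) (pow_nonneg (Finset.prod_nonneg fun l _ => (h.pos l).le) _)
      have e5 := mul_le_mul_of_nonneg_right (e4.trans (show _ ≤ C by linarith)) hQ
      refine le_trans (le_of_eq ?_) e5
      ring

end Rt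

end

section

namespace Rt
open Filter

variable {K : Type*} [Field K] {ι : Type*} [Fintype ι]

/-- growth type of a sequence along an ultrafilter -/
def Typ (S : SPl K ι) (𝒰 : Ultrafilter ℕ) (N : ℕ → ℝ) (x : ℕ → K) (e : ι → ℝ) : Prop :=
  ∀ ε : ℝ, 0 < ε → ∀ᶠ m in (𝒰 : Filter ℕ), ∀ v, S.av v (x m) ≤ Real.exp (N m * (e v + ε))

theorem ult_exists {α : Type*} [Finite α] (𝒰 : Ultrafilter ℕ) {p : α → ℕ → Prop}
    (h : ∀ᶠ m in (𝒰 : Filter ℕ), ∃ a, p a m) : ∃ a, ∀ᶠ m in (𝒰 : Filter ℕ), p a m := by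
  by_contra hc
  push Not at hc
  have : ∀ᶠ m in (𝒰 : Filter ℕ), ∀ a, ¬ p a m :=
    eventually_all.2 fun a => by
      have := hc a
      exact this
  obtain ⟨m, h1, h2⟩ := (h.and this).exists
  obtain ⟨a, ha⟩ := h1
  exact h2 a ha

theorem ult_const {α : Type*} [Finite α] (𝒰 : Ultrafilter ℕ) (f : ℕ → α) :
    ∃ a, ∀ᶠ m in (𝒰 : Filter ℕ), f m = a :=
  ult_exists 𝒰 (p := fun a m => f m = a) (Eventually.of_forall fun m => ⟨f m, rfl⟩)

theorem ult_not {𝒰 : Ultrafilter ℕ} {p : ℕ → Prop} :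
    (¬ ∀ᶠ m in (𝒰 : Filter ℕ), p m) ↔ ∀ᶠ m in (𝒰 : Filter ℕ), ¬ p m :=
  Ultrafilter.eventually_not.symm

/-- diagonalisation -/
theorem diag {α : Type*} [Nonempty α] (𝒰 : Ultrafilter ℕ) (N : ℕ → ℝ)
    (hN : Tendsto N 𝒰 atTop) (P : ℝ → ℕ → α → Prop)
    (hmono : ∀ m δ δ' a, δ ≤ δ' → P δ m a → P δ' m a)
    (h : ∀ δ, 0 < δ → ∀ᶠ m in (𝒰 : Filter ℕ), ∃ a, P δ m a) :
    ∃ a : ℕ → α, ∀ δ, 0 < δ → ∀ᶠ m in (𝒰 : Filter ℕ), P δ m (a m) := by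
  classical
  let Q : ℕ → ℕ → Prop := fun m k => ∃ a, P (1 / ((k : ℝ) + 1)) m a
  let κ : ℕ → ℕ := fun m => Nat.findGreatest (Q m) ⌊N m⌋₊
  let a : ℕ → α := fun m => if hh : Q m (κ m) then hh.choose else Classical.arbitrary α
  refine ⟨a, fun δ hδ => ?_⟩
  obtain ⟨k, hk⟩ := exists_nat_one_div_lt hδ
  have h1 := h (1 / ((k : ℝ) + 1)) (by positivity)
  filter_upwards [h1, hN.eventually_ge_atTop (k : ℝ)] with m hm hNm
  have hkN : k ≤ ⌊N m⌋₊ := Nat.le_floor hNm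
  have hQ : Q m (κ m) := Nat.findGreatest_spec (P := Q m) hkN hm
  have hle : k ≤ κ m := Nat.le_findGreatest hkN hm
  have ha : a m = hQ.choose := by simp only [a, dif_pos hQ]
  rw [ha]
  refine hmono m _ _ _ ?_ hQ.choose_spec
  refine le_trans ?_ hk.le
  have : (k : ℝ) ≤ κ m := by exact_mod_cast hle
  gcongr

/-- constants are absorbed -/
theorem ev_const {𝒰 : Ultrafilter ℕ} {N : ℕ → ℝ} (hN : Tendsto N 𝒰 atTop) (C : ℝ) {ε : ℝ}
    (hε : 0 < ε) : ∀ᶠ m in (𝒰 : Filter ℕ), C ≤ Real.exp (N m * ε) := by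
  have : Tendsto (fun m => N m * ε) 𝒰 atTop := hN.atTop_mul_const hε
  exact (Real.tendsto_exp_atTop.comp this).eventually_ge_atTop C

section
variable {S : SPl K ι} {𝒰 : Ultrafilter ℕ} {N : ℕ → ℝ}

theorem Typ.mul {x y : ℕ → K} {e f : ι → ℝ} (hx : Typ S 𝒰 N x e) (hy : Typ S 𝒰 N y f) :
    Typ S 𝒰 N (fun m => x m * y m) (fun v => e v + f v) := by
  intro ε hε
  filter_upwards [hx (ε / 2) (by positivity), hy (ε / 2) (by positivity)] with m h1 h2 v
  rw [map_mul]
  calc S.av v (x m) * S.av v (y m) ≤ Real.exp (N m * (e v + ε / 2)) *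
        Real.exp (N m * (f v + ε / 2)) :=
        mul_le_mul (h1 v) (h2 v) ((S.av v).nonneg _) (Real.exp_pos _).le
    _ = _ := by rw [← Real.exp_add]; congr 1; ring

theorem Typ.sum (hN : Tendsto N 𝒰 atTop) {α : Type*} (s : Finset α) {x : α → ℕ → K} {e : ι → ℝ}
    (hx : ∀ i ∈ s, Typ S 𝒰 N (x i) e) : Typ S 𝒰 N (fun m => ∑ i ∈ s, x i m) e := by
  intro ε hε
  have h0 : ∀ᶠ m in (𝒰 : Filter ℕ), ∀ i ∈ s, ∀ v,
      S.av v (x i m) ≤ Real.exp (N m * (e v + ε / 2)) :=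
    (Finset.eventually_all s).2 fun i hi => hx i hi (ε / 2) (by positivity)
  filter_upwards [h0, ev_const hN (s.card) (half_pos hε)] with m h1 h2 v
  calc S.av v (∑ i ∈ s, x i m) ≤ ∑ i ∈ s, S.av v (x i m) := av_sum_le _ _ _
    _ ≤ ∑ i ∈ s, Real.exp (N m * (e v + ε / 2)) := Finset.sum_le_sum fun i hi => h1 i hi v
    _ = s.card * Real.exp (N m * (e v + ε / 2)) := by simp
    _ ≤ Real.exp (N m * (ε / 2)) * Real.exp (N m * (e v + ε / 2)) := by gcongr
    _ = _ := by rw [← Real.exp_add]; congr 1; ring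

theorem Typ.neg {x : ℕ → K} {e : ι → ℝ} (hx : Typ S 𝒰 N x e) : Typ S 𝒰 N (fun m => - x m) e := by
  intro ε hε
  filter_upwards [hx ε hε] with m h v
  rw [(S.av v).map_neg]; exact h v

theorem Typ.sub (hN : Tendsto N 𝒰 atTop) {x y : ℕ → K} {e : ι → ℝ} (hx : Typ S 𝒰 N x e)
    (hy : Typ S 𝒰 N y e) : Typ S 𝒰 N (fun m => x m - y m) e := by
  have := Typ.sum hN (Finset.univ : Finset (Fin 2)) (x := ![x, fun m => - y m]) (e := e) (S := S)
    (fun i _ => by fin_cases i; exacts [hx, hy.neg])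
  simpa [sub_eq_add_neg] using this

theorem Typ.congr {x y : ℕ → K} {e : ι → ℝ} (hx : Typ S 𝒰 N x e)
    (h : ∀ᶠ m in (𝒰 : Filter ℕ), y m = x m) : Typ S 𝒰 N y e := by
  intro ε hε
  filter_upwards [hx ε hε, h] with m h1 h2
  rwa [h2]

theorem Typ.lower [DecidableEq ι] {x : ℕ → K} {e : ι → ℝ} (hx : Typ S 𝒰 N x e)
    (he : ∑ v, (S.n v : ℝ) * e v = 0) (hO : ∀ᶠ m in (𝒰 : Filter ℕ), x m ∈ S.O)
    (h0 : ∀ᶠ m in (𝒰 : Filter ℕ), x m ≠ 0) (hN : Tendsto N 𝒰 atTop) :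
    ∀ ε : ℝ, 0 < ε → ∀ᶠ m in (𝒰 : Filter ℕ), ∀ v, Real.exp (N m * (e v - ε)) ≤ S.av v (x m) := by
  intro ε hε
  rcases isEmpty_or_nonempty ι with hι | hι
  · exact Eventually.of_forall fun m v => hι.elim v
  have hg := g_pos S
  set g := ∑ v, S.n v with hgdef
  have hg' : (0 : ℝ) < g := by exact_mod_cast hg
  filter_upwards [hx (ε / g) (by positivity), hO, h0, hN.eventually_ge_atTop 0] with m h1 h2 h3 h4 v
  have hp := S.prod_ge _ h2 h3
  have hpos : 0 < S.av v (x m) := (S.av v).pos h3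
  rw [← Finset.mul_prod_erase _ _ (Finset.mem_univ v)] at hp
  have h5 : ∏ w ∈ Finset.univ.erase v, S.av w (x m) ^ S.n w ≤
      Real.exp (∑ w ∈ Finset.univ.erase v, S.n w * (N m * (e w + ε / g))) := by
    rw [Real.exp_sum]
    refine Finset.prod_le_prod (fun w _ => pow_nonneg ((S.av w).nonneg _) _) fun w _ => ?_
    rw [Real.exp_nat_mul]
    exact pow_le_pow_left₀ ((S.av w).nonneg _) (h1 w) _
  have h6 : ∑ w ∈ Finset.univ.erase v, S.n w * (N m * (e w + ε / g)) ≤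
      S.n v * (N m * (ε - e v)) := by
    have a1 : ∑ w, S.n w * (N m * (e w + ε / g)) = N m * ε := by
      have : ∑ w, S.n w * (N m * (e w + ε / g)) =
          N m * (∑ w, (S.n w : ℝ) * e w) + N m * (ε / g) * ∑ w, (S.n w : ℝ) := by
        rw [Finset.mul_sum, Finset.mul_sum, ← Finset.sum_add_distrib]
        exact Finset.sum_congr rfl fun w _ => by ring
      rw [this, he]
      have : (∑ w, (S.n w : ℝ)) = g := by rw [hgdef]; push_cast; rfl
      rw [this]; field_simp; ring
    rw [← Finset.add_sum_erase _ _ (Finset.mem_univ v)] at a1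
    have a2 : (1 : ℝ) ≤ S.n v := by exact_mod_cast S.npos v
    have a3 : 0 ≤ S.n v * (N m * (ε / g)) := by positivity
    have a4 : N m * ε ≤ S.n v * (N m * ε) := le_mul_of_one_le_left (by positivity) a2
    nlinarith
  have h7 : 1 ≤ S.av v (x m) ^ S.n v * Real.exp (N m * (ε - e v)) ^ S.n v := by
    refine hp.trans ?_
    rw [← Real.exp_nat_mul]
    exact mul_le_mul_of_nonneg_left (h5.trans (Real.exp_le_exp.2 h6)) (by positivity)
  rw [← mul_pow] at h7
  have h8 : 1 ≤ S.av v (x m) * Real.exp (N m * (ε - e v)) := by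
    by_contra hlt
    push Not at hlt
    exact absurd h7 (not_le.2 (pow_lt_one₀ (by positivity) hlt (S.npos v).ne'))
  have h9 : Real.exp (N m * (e v - ε)) = (Real.exp (N m * (ε - e v)))⁻¹ := by
    rw [← Real.exp_neg]; congr 1; ring
  rw [h9, inv_le_iff_one_le_mul₀ (Real.exp_pos _)]
  exact h8

end

/-- Statement of Theorem A for `n` summands -/
def ThmA (S : SPl K ι) (𝒰 : Ultrafilter ℕ) (N : ℕ → ℝ) (n : ℕ) : Prop :=
  ∀ (x : Fin n → ℕ → K) (e : Fin n → ι → ℝ), (∀ i, ∀ᶠ m in (𝒰 : Filter ℕ), x i m ∈ S.O) →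
    (∀ i, ∀ᶠ m in (𝒰 : Filter ℕ), x i m ≠ 0) → (∀ i, Typ S 𝒰 N (x i) (e i)) →
    (∀ i, ∑ v, (S.n v : ℝ) * e i v = 0) → Function.Injective e →
    ¬ ∀ᶠ m in (𝒰 : Filter ℕ), ∑ i, x i m = 0

theorem ThmA.finset {S : SPl K ι} {𝒰 : Ultrafilter ℕ} {N : ℕ → ℝ} {α : Type*} (σ : Finset α)
    (h : ThmA S 𝒰 N σ.card) (x : α → ℕ → K) (e : α → ι → ℝ)
    (hO : ∀ i ∈ σ, ∀ᶠ m in (𝒰 : Filter ℕ), x i m ∈ S.O)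
    (h0 : ∀ i ∈ σ, ∀ᶠ m in (𝒰 : Filter ℕ), x i m ≠ 0) (ht : ∀ i ∈ σ, Typ S 𝒰 N (x i) (e i))
    (he : ∀ i ∈ σ, ∑ v, (S.n v : ℝ) * e i v = 0) (hinj : Set.InjOn e σ) :
    ¬ ∀ᶠ m in (𝒰 : Filter ℕ), ∑ i ∈ σ, x i m = 0 := by
  intro hs
  let φ := σ.equivFin
  refine h (fun i => x (φ.symm i)) (fun i => e (φ.symm i)) (fun i => hO _ (φ.symm i).2)
    (fun i => h0 _ (φ.symm i).2) (fun i => ht _ (φ.symm i).2) (fun i => he _ (φ.symm i).2) ?_ ?_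
  · intro i j hij
    exact φ.symm.injective (Subtype.ext (hinj (φ.symm i).2 (φ.symm j).2 hij))
  · filter_upwards [hs] with m hm
    rw [← hm, ← Finset.sum_coe_sort σ (fun i => x i m)]
    exact Equiv.sum_comp φ.symm (fun i => x i.1 m)

/-- Consequence of the induction hypothesis. -/
theorem ih_par (S : SPl K ι) (𝒰 : Ultrafilter ℕ) (N : ℕ → ℝ) (hN : Tendsto N 𝒰 atTop) (n : ℕ)
    (IH : ∀ n' < n, 0 < n' → ThmA S 𝒰 N n')
    (x : Fin n → ℕ → K) (e : Fin n → ι → ℝ) (hO : ∀ i, ∀ᶠ m in (𝒰 : Filter ℕ), x i m ∈ S.O)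
    (ht : ∀ i, Typ S 𝒰 N (x i) (e i))
    (he : ∀ i, ∑ v, (S.n v : ℝ) * e i v = 0) (hinj : Function.Injective e)
    (hs : ∀ᶠ m in (𝒰 : Filter ℕ), ∑ i, x i m = 0) :
    ∃ δ : ℝ, 0 < δ ∧ ∀ᶠ m in (𝒰 : Filter ℕ), ∀ ξ : Fin n → K, (∀ i, ξ i ∈ S.O) → ∑ i, ξ i = 0 →
      (∀ i v, S.av v (ξ i) ≤ Real.exp (N m * (e i v + δ))) → ∀ i l, x l m * ξ i = ξ l * x i m := by
  classical
  by_contra hc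
  push Not at hc
  let P : ℝ → ℕ → (Fin n → K) → Prop := fun δ m ξ => 0 ≤ N m ∧ (∀ i, ξ i ∈ S.O) ∧ ∑ i, ξ i = 0 ∧
    (∀ i v, S.av v (ξ i) ≤ Real.exp (N m * (e i v + δ))) ∧ ∃ i l, x l m * ξ i ≠ ξ l * x i m
  obtain ⟨ξ, hξ⟩ := diag 𝒰 N hN P
    (by
      rintro m δ δ' a hδ ⟨h1, h2, h3, h4, h5⟩
      refine ⟨h1, h2, h3, fun i v => (h4 i v).trans (Real.exp_le_exp.2 ?_), h5⟩
      gcongr)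
    (by
      intro δ hδ
      have h1 := hc δ hδ
      filter_upwards [h1, hN.eventually_ge_atTop 0] with m h2 h3
      obtain ⟨ξ, a1, a2, a3, a4⟩ := h2
      exact ⟨ξ, h3, a1, a2, a3, a4⟩)
  have h1 := hξ 1 one_pos
  obtain ⟨i0, hi0⟩ := ult_exists 𝒰 (h1.mono fun m hm => hm.2.2.2.2)
  obtain ⟨l, hl⟩ := ult_exists 𝒰 hi0
  let y : Fin n → ℕ → K := fun i m => x l m * ξ m i - ξ m l * x i m
  have hξt : ∀ i, Typ S 𝒰 N (fun m => ξ m i) (e i) := fun i ε hε =>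
    (hξ ε hε).mono fun m hm v => hm.2.2.2.1 i v
  have hyt : ∀ i, Typ S 𝒰 N (y i) (fun v => e l v + e i v) := fun i =>
    Typ.sub hN ((ht l).mul (hξt i)) ((hξt l).mul (ht i))
  obtain ⟨σ, hσ⟩ := ult_const 𝒰 (fun m => Finset.univ.filter fun i => y i m ≠ 0)
  have hl' : l ∉ σ := by
    obtain ⟨m, hm⟩ := hσ.exists
    rw [← hm]; simp [y, mul_comm]
  have hi' : i0 ∈ σ := by
    obtain ⟨m, hm, hm2⟩ := (hσ.and hl).exists
    rw [← hm]; simpa [y, sub_eq_zero] using hm2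
  have hcard : σ.card < n := by
    have : σ.card < Finset.univ.card := Finset.card_lt_card
      ⟨Finset.subset_univ _, fun h => hl' (h (Finset.mem_univ l))⟩
    simpa using this
  refine ThmA.finset σ (IH _ hcard (Finset.card_pos.2 ⟨i0, hi'⟩)) y (fun i v => e l v + e i v)
    ?_ ?_ (fun i _ => hyt i) ?_ ?_ ?_
  · intro i _
    filter_upwards [h1, hO i, hO l] with m hm h2 h3
    exact S.O.sub_mem (S.O.mul_mem h3 (hm.2.1 i)) (S.O.mul_mem (hm.2.1 l) h2)
  · intro i hi
    filter_upwards [hσ] with m hm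
    rw [← hm] at hi; simpa using hi
  · intro i _
    simp_rw [mul_add]
    rw [Finset.sum_add_distrib, he, he, add_zero]
  · intro i _ j _ hij
    apply hinj
    funext v
    have := congrFun hij v
    simpa using this
  · filter_upwards [hσ, h1, hs] with m hm h2 h3
    rw [← hm, Finset.sum_filter_ne_zero]
    simp only [y, Finset.sum_sub_distrib, ← Finset.mul_sum, h3, h2.2.2.1]
    ring

end Rt

end

section

namespace Rt
open Filter

variable {K : Type*} [Field K] {ι : Type*} [Fintype ι]

/-- difference forms -/
def Am {d : ℕ} (p : Fin (d + 1)) : Matrix (Fin d) (Fin d) ℤ :=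
  Matrix.of fun j k => (if p.succAbove j = k.castSucc then 1 else 0) -
    (if p = k.castSucc then 1 else 0)

/-- inverse of the difference forms -/
def Ami {d : ℕ} (p : Fin (d + 1)) : Matrix (Fin d) (Fin d) ℤ :=
  Matrix.of fun k j => (if k.castSucc = p.succAbove j then 1 else 0) -
    (if Fin.last d = p.succAbove j then 1 else 0)

theorem sum_sa {R : Type*} [CommRing R] {d : ℕ} (p c : Fin (d + 1)) (f : Fin (d + 1) → R)
    (hf : f p = 0) :
    ∑ j, (if c = p.succAbove j then 1 else 0) * f (p.succAbove j) = f c := by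
  have := Fin.sum_univ_succAbove (fun i => (if c = i then (1 : R) else 0) * f i) p
  simp only [hf, mul_zero, zero_add] at this
  rw [← this]; simp

theorem Ami_mul {d : ℕ} (p : Fin (d + 1)) : Ami p * Am p = 1 := by
  ext k l
  rw [Matrix.mul_apply]
  simp only [Ami, Am, Matrix.of_apply]
  let f : Fin (d + 1) → ℤ := fun i => (if i = l.castSucc then 1 else 0) -
    (if p = l.castSucc then 1 else 0)
  have hf : f p = 0 := by simp [f]
  have h1 := sum_sa p k.castSucc f hf
  have h2 := sum_sa p (Fin.last d) f hf
  have : ∀ j, ((if k.castSucc = p.succAbove j then (1 : ℤ) else 0) -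
    (if Fin.last d = p.succAbove j then 1 else 0)) *
    ((if p.succAbove j = l.castSucc then 1 else 0) -
    (if p = l.castSucc then 1 else 0)) =
      (if k.castSucc = p.succAbove j then 1 else 0) * f (p.succAbove j) -
      (if Fin.last d = p.succAbove j then 1 else 0) * f (p.succAbove j) := by
    intro j; simp only [f]; ring
  rw [Finset.sum_congr rfl fun j _ => this j, Finset.sum_sub_distrib, h1, h2]
  have h3 : Fin.last d ≠ l.castSucc := (Fin.castSucc_lt_last l).ne'
  simp only [f, if_neg h3, Matrix.one_apply, Fin.castSucc_inj]
  ring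

/-- extension by zero -/
def ext0 {d : ℕ} (z : Fin d → K) : Fin (d + 1) → K := Fin.snoc z 0

theorem lf_Am {d : ℕ} (p : Fin (d + 1)) (j : Fin d) (z : Fin d → K) :
    lf K (Am p) j z = ext0 z (p.succAbove j) - ext0 z p := by
  have key : ∀ i : Fin (d + 1), ext0 z i = ∑ k, (if i = Fin.castSucc k then 1 else 0) * z k := by
    intro i
    refine Fin.lastCases ?_ (fun k => ?_) i
    · have : ∀ k : Fin d, Fin.last d ≠ k.castSucc := fun k => (Fin.castSucc_lt_last k).ne'
      simp [ext0, this]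
    · simp [ext0]
  rw [lf_apply, key, key, ← Finset.sum_sub_distrib]
  refine Finset.sum_congr rfl fun k _ => ?_
  simp only [Am, Matrix.of_apply]
  push_cast
  ring

theorem pair_eq {d : ℕ} (p : Fin (d + 1)) (x : Fin (d + 1) → K) (hx : ∑ i, x i = 0)
    (z : Fin d → K) :
    ∑ k, x (Fin.castSucc k) * z k = ∑ j, x (p.succAbove j) * lf K (Am p) j z := by
  have h1 : ∑ k, x (Fin.castSucc k) * z k = ∑ i, x i * ext0 z i := by
    rw [Fin.sum_univ_castSucc]; simp [ext0]
  have h2 : ∑ i, x i * ext0 z i = ∑ i, x i * (ext0 z i - ext0 z p) := by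
    simp_rw [mul_sub]
    rw [Finset.sum_sub_distrib, ← Finset.sum_mul, hx]; ring
  rw [h1, h2, Fin.sum_univ_succAbove _ p]
  simp [lf_Am]

theorem F1 [Nonempty ι] (S : SPl K ι) {d : ℕ} (p : ι → Fin (d + 1)) (x : Fin (d + 1) → K)
    (hx : ∑ i, x i = 0)
    (hO : ∀ i, x i ∈ S.O) (N ε : ℝ) (e : Fin (d + 1) → ι → ℝ)
    (hb : ∀ i v, S.av v (x i) ≤ Real.exp (N * (e i v + ε))) (z : Fin d → K) (hz : ∀ i, z i ∈ S.O)
    (μ : ℝ) (hμ : 0 < μ)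
    (hm : ∀ v j, S.av v (lf K (Am (p v)) j z) ≤ μ * Real.exp (- (N * e ((p v).succAbove j) v)))
    (hne : ∑ k, x (Fin.castSucc k) * z k ≠ 0) : 1 ≤ d * μ * Real.exp (N * ε) := by
  set c := ∑ k, x (Fin.castSucc k) * z k with hc
  have hcO : c ∈ S.O := S.O.sum_mem fun k _ => S.O.mul_mem (hO _) (hz _)
  have h1 := S.prod_ge c hcO hne
  have h2 : ∀ v, S.av v c ≤ d * μ * Real.exp (N * ε) := by
    intro v
    rw [hc, pair_eq (p v) x hx]
    refine (av_sum_le _ _ _).trans ?_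
    refine (Finset.sum_le_sum (g := fun _ => μ * Real.exp (N * ε)) fun j _ => ?_).trans
      (le_of_eq (by simp; ring))
    rw [map_mul]
    calc S.av v (x ((p v).succAbove j)) * S.av v (lf K (Am (p v)) j z)
        ≤ Real.exp (N * (e ((p v).succAbove j) v + ε)) *
          (μ * Real.exp (- (N * e ((p v).succAbove j) v))) :=
          mul_le_mul (hb _ _) (hm _ _) ((S.av v).nonneg _) (Real.exp_pos _).le
      _ = μ * (Real.exp (N * (e ((p v).succAbove j) v + ε)) *
          Real.exp (- (N * e ((p v).succAbove j) v))) := by ring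
      _ = μ * Real.exp (N * ε) := by rw [← Real.exp_add]; congr 2; ring
  by_contra hlt
  push Not at hlt
  have h3 : ∏ v, S.av v c ^ S.n v ≤ (d * μ * Real.exp (N * ε)) ^ (∑ v, S.n v) := by
    rw [← Finset.prod_pow_eq_pow_sum]
    exact Finset.prod_le_prod (fun v _ => pow_nonneg ((S.av v).nonneg _) _)
      fun v _ => pow_le_pow_left₀ ((S.av v).nonneg _) (h2 v) _
  have := pow_lt_one₀ (by positivity) hlt (g_pos S).ne'
  linarith

/-- element of the sum-zero hyperplane from the first coordinates -/
def xiv {d : ℕ} (a : Fin d → K) : Fin (d + 1) → K := Fin.snoc a (- ∑ k, a k)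

theorem sum_xiv {d : ℕ} (a : Fin d → K) : ∑ i, xiv a i = 0 := by
  rw [Fin.sum_univ_castSucc]; simp [xiv]

theorem xiv_castSucc {d : ℕ} (a : Fin d → K) (k : Fin d) : xiv a k.castSucc = a k := by
  simp [xiv]

theorem xiv_sa {d : ℕ} (p : Fin (d + 1)) (a : Fin d → K) (i : Fin d) :
    xiv a (p.succAbove i) = ∑ k, a k * (Ami p k i : K) := by
  have key : ∀ c : Fin (d + 1), xiv a c =
      ∑ k, a k * ((if Fin.castSucc k = c then 1 else 0) - (if Fin.last d = c then 1 else 0)) := by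
    intro c
    refine Fin.lastCases ?_ (fun l => ?_) c
    · have : ∀ k : Fin d, k.castSucc ≠ Fin.last d := fun k => (Fin.castSucc_lt_last k).ne
      simp [xiv, this]
    · have : Fin.last d ≠ l.castSucc := (Fin.castSucc_lt_last l).ne'
      simp [xiv, this]
  rw [key]
  refine Finset.sum_congr rfl fun k _ => ?_
  simp only [Ami, Matrix.of_apply]
  push_cast
  ring

theorem adj_bound {d : ℕ} (a : AbsoluteValue K ℝ) (A A' : Matrix (Fin d) (Fin d) ℤ)
    (hA : A' * A = 1) (b : Fin d → Fin d → K) (ν s : Fin d → ℝ) (hν : ∀ l, 0 < ν l)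
    (hs : ∀ i, 0 < s i) (h : ∀ l i, a (lf K A i (b l)) ≤ ν l * s i) (j i : Fin d) :
    a (∑ k, (Matrix.of fun k l => b l k).adjugate j k * (A' k i : K)) ≤
      d.factorial * ((∏ l, ν l) * ∏ i, s i) / (ν j * s i) := by
  set B : Matrix (Fin d) (Fin d) K := Matrix.of fun k l => b l k with hB
  set AK : Matrix (Fin d) (Fin d) K := A.map (fun x : ℤ => (x : K)) with hAK
  set AK' : Matrix (Fin d) (Fin d) K := A'.map (fun x : ℤ => (x : K)) with hAK'
  have h1 : AK' * AK = 1 := by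
    have : AK' * AK = (A' * A).map (fun x : ℤ => (x : K)) := by
      ext i j
      simp [Matrix.mul_apply, AK, AK']
    rw [this, hA]
    ext i j
    simp only [Matrix.map_apply, Matrix.one_apply]
    split_ifs <;> simp
  have h2 : AK * AK' = 1 := mul_eq_one_comm.1 h1
  have h3 : AK.adjugate = AK.det • AK' := by
    calc AK.adjugate = AK.adjugate * (AK * AK') := by rw [h2, mul_one]
      _ = (AK.adjugate * AK) * AK' := by rw [mul_assoc]
      _ = _ := by rw [Matrix.adjugate_mul]; simp
  have h4 : (AK * B).adjugate j i = AK.det * ∑ k, B.adjugate j k * (A' k i : K) := by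
    rw [Matrix.adjugate_mul_distrib, h3, Matrix.mul_smul, Matrix.smul_apply, Matrix.mul_apply,
      smul_eq_mul]
    rfl
  have h5 : a (∑ k, B.adjugate j k * (A' k i : K)) = a ((AK * B).adjugate j i) := by
    rw [h4, map_mul, hAK, av_det_unimod a A A' hA, one_mul]
  rw [h5, Matrix.adjugate_apply]
  have h6 : ∀ i' l, (AK * B) i' l = lf K A i' (b l) := by
    intro i' l
    rw [lf_apply, Matrix.mul_apply]; rfl
  refine (det_bound a _ ν (Function.update s i (1 / ν j)) ?_).trans (le_of_eq ?_)
  · intro i' l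
    by_cases hi : i' = i
    · subst hi
      rw [Matrix.updateRow_self, Function.update_self, Pi.single_apply]
      split_ifs with hl
      · subst hl; rw [map_one, mul_one_div_cancel (hν l).ne']
      · rw [map_zero]; have := hν l; have := hν j; positivity
    · rw [Matrix.updateRow_ne hi, Function.update_of_ne hi, h6]
      exact h l i'
  · rw [Finset.prod_update_of_mem (Finset.mem_univ i), ← Finset.mul_prod_erase _ s (Finset.mem_univ i),
      Finset.sdiff_singleton_eq_erase]
    have := (hν j).ne'; have := (hs i).ne'
    field_simp

end Rt

end

section

namespace Rt
open Filter

variable {K : Type*} [Field K] {ι : Type*} [Fintype ι]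

theorem cramer_xi [Nonempty ι] (S : SPl K ι) (d : ℕ) (C : ℝ) (hC : 1 ≤ C) :
    ∃ C' : ℝ, 1 ≤ C' ∧ ∀ (p : ι → Fin (d + 1)) (e : Fin (d + 1) → ι → ℝ) (N δ : ℝ)
      (U : ℕ → Submodule K (Fin d → K)) (b : ℕ → Fin d → K) (ν : ℕ → ℝ), 0 ≤ N → 0 ≤ δ →
      (∀ v i, e i v ≤ e (p v) v) →
      Mn S (fun v => Am (p v)) (fun v j => Real.exp (-(N * e ((p v).succAbove j) v))) U b ν →
      (∏ v, ∏ i, Real.exp (-(N * e ((p v).succAbove i) v)) ^ S.n v) *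
        (∏ l ∈ Finset.range d, ν l) ^ (∑ v, S.n v) ≤ C →
      ∀ j < d, Real.exp (-(N * δ)) ≤ ν j →
      ∃ ξ : Fin (d + 1) → K, (∀ i, ξ i ∈ S.O) ∧ ∑ i, ξ i = 0 ∧
        (∀ i v, S.av v (ξ i) ≤ C' * Real.exp (N * (e i v + δ))) ∧
        ∃ Δ : K, Δ ≠ 0 ∧ ∀ l < d, ∑ k, ξ (Fin.castSucc k) * b l k = if l = j then Δ else 0 := by
  classical
  obtain ⟨C1, hC1, hmink⟩ := S.mink 1 (fun _ => 1)
  set C2 : ℝ := max 1 (C * C1) with hC2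
  have hC21 : 1 ≤ C2 := le_max_left _ _
  have hfac : (1 : ℝ) ≤ d.factorial := by exact_mod_cast Nat.factorial_pos d
  refine ⟨(d + 1) * (d.factorial * C2), ?_, ?_⟩
  · have : (1 : ℝ) ≤ d.factorial * C2 := one_le_mul_of_one_le_of_one_le hfac hC21
    have hd0 : (0 : ℝ) ≤ d := by positivity
    nlinarith
  intro p e N δ U b ν hN hδ hp hM hvol j hj hνj
  set g := ∑ v, S.n v with hg
  have hgpos : 0 < g := g_pos S
  set s : ι → Fin d → ℝ := fun v j => Real.exp (-(N * e ((p v).succAbove j) v)) with hs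
  have hspos : ∀ v i, 0 < s v i := fun v i => Real.exp_pos _
  set Pn := ∏ l ∈ Finset.range d, ν l with hPn
  have hPnpos : 0 < Pn := Finset.prod_pos fun l _ => hM.pos l
  let P : ι → ℝ := fun v => Pn * (∏ i, s v i) / ν j
  have hP : ∀ v, 0 < P v := fun v =>
    div_pos (mul_pos hPnpos (Finset.prod_pos fun i _ => hspos v i)) (hM.pos j)
  have hPprod : ∏ v, P v ^ S.n v = ((∏ v, ∏ i, s v i ^ S.n v) * Pn ^ g) / ν j ^ g := by
    have : ∀ v, P v ^ S.n v = (Pn ^ S.n v * ∏ i, s v i ^ S.n v) / ν j ^ S.n v := by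
      intro v
      simp only [P]
      rw [div_pow, mul_pow, Finset.prod_pow]
    rw [Finset.prod_congr rfl fun v _ => this v, Finset.prod_div_distrib, Finset.prod_mul_distrib,
      Finset.prod_pow_eq_pow_sum, Finset.prod_pow_eq_pow_sum]
    rw [mul_comm]
  have hE : 0 < Real.exp (N * δ) := Real.exp_pos _
  have hνE : 1 ≤ ν j * Real.exp (N * δ) := by
    have := mul_le_mul_of_nonneg_right hνj hE.le
    rwa [← Real.exp_add, neg_add_cancel, Real.exp_zero] at this
  have hPle : ∏ v, P v ^ S.n v ≤ C * Real.exp (N * δ) ^ g := by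
    rw [hPprod, div_le_iff₀ (pow_pos (hM.pos j) _), mul_assoc, ← mul_pow, mul_comm (Real.exp _)]
    have := one_le_pow₀ hνE (n := g)
    nlinarith
  have hτ : C1 ≤ ∏ v, ∏ _i : Fin 1, (C2 * Real.exp (N * δ) / P v) ^ S.n v := by
    have e1 : ∏ v, ∏ _i : Fin 1, (C2 * Real.exp (N * δ) / P v) ^ S.n v =
        (C2 * Real.exp (N * δ)) ^ g / ∏ v, P v ^ S.n v := by
      simp_rw [Finset.univ_unique, Finset.prod_singleton, div_pow]
      rw [Finset.prod_div_distrib, Finset.prod_pow_eq_pow_sum]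
    rw [e1, le_div_iff₀ (Finset.prod_pos fun v _ => pow_pos (hP v) _)]
    have h2 : C2 ≤ C2 ^ g := le_self_pow₀ hC21 hgpos.ne'
    have h3 : C * C1 ≤ C2 := le_max_right _ _
    calc C1 * ∏ v, P v ^ S.n v ≤ C1 * (C * Real.exp (N * δ) ^ g) := by gcongr
      _ = (C * C1) * Real.exp (N * δ) ^ g := by ring
      _ ≤ C2 ^ g * Real.exp (N * δ) ^ g := by gcongr; exact h3.trans h2
      _ = _ := by rw [mul_pow]
  obtain ⟨z, hz0, hzO, hzb⟩ := hmink (fun v _ => C2 * Real.exp (N * δ) / P v)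
    (fun v _ => div_pos (by positivity) (hP v)) hτ
  have hzb' : ∀ v, S.av v (z 0) ≤ C2 * Real.exp (N * δ) / P v := by
    intro v
    have := hzb v 0
    simpa using this
  have hz0' : z 0 ≠ 0 := by
    intro h
    apply hz0
    funext i
    rw [Subsingleton.elim i 0, h]; rfl
  let b' : Fin d → Fin d → K := fun l => b l
  set B : Matrix (Fin d) (Fin d) K := Matrix.of fun k l => b' l k with hB
  let j' : Fin d := ⟨j, hj⟩
  let a : Fin d → K := fun k => B.adjugate j' k
  have hBdet : B.det ≠ 0 := by
    have h1 := hM.linInd d le_rfl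
    have h2 : LinearIndependent K B.col := h1
    have h3 := Matrix.linearIndependent_cols_iff_isUnit.1 h2
    exact ((Matrix.isUnit_iff_isUnit_det B).1 h3).ne_zero
  have hBO : ∀ k l, B k l ∈ S.O := fun k l => hM.bO l l.2 k
  have haO : ∀ k, a k ∈ S.O := by
    intro k
    simp only [a]
    rw [Matrix.adjugate_apply]
    refine det_mem S.O _ fun i l => ?_
    rw [Matrix.updateRow_apply]
    split_ifs
    · rw [Pi.single_apply]; split_ifs
      exacts [S.O.one_mem, S.O.zero_mem]
    · exact hBO _ _
  have hxO : ∀ i, xiv a i ∈ S.O := by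
    intro i
    refine Fin.lastCases ?_ (fun k => ?_) i
    · simp only [xiv, Fin.snoc_last]
      exact S.O.neg_mem (S.O.sum_mem fun k _ => haO k)
    · rw [xiv_castSucc]; exact haO k
  have hb1 : ∀ v i, S.av v (z 0 * xiv a ((p v).succAbove i)) ≤
      d.factorial * C2 * Real.exp (N * (e ((p v).succAbove i) v + δ)) := by
    intro v i
    have h1 := adj_bound (S.av v) (Am (p v)) (Ami (p v)) (Ami_mul _) b' (fun l => ν l) (s v)
      (fun l => hM.pos l) (hspos v) (fun l i => hM.sm l l.2 v i) j' i
    rw [map_mul, xiv_sa (p v) a i]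
    have h2 : (∏ l : Fin d, ν l) = Pn := by rw [hPn, Finset.prod_range]
    rw [h2] at h1
    calc S.av v (z 0) * S.av v (∑ k, a k * (Ami (p v) k i : K)) ≤
        (C2 * Real.exp (N * δ) / P v) * (d.factorial * (Pn * ∏ i, s v i) / (ν j' * s v i)) :=
          mul_le_mul (hzb' v) h1 ((S.av v).nonneg _) (div_nonneg (by positivity) (hP v).le)
      _ = d.factorial * C2 * (Real.exp (N * δ) * (s v i)⁻¹) := by
          have hp1 : ∏ i, s v i ≠ 0 := (Finset.prod_pos fun i _ => hspos v i).ne'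
          have hp2 := hPnpos.ne'
          have hp3 := (hM.pos j).ne'
          have hp4 := (hspos v i).ne'
          simp only [P, j']
          field_simp
      _ = _ := by
          simp only [s]
          rw [← Real.exp_neg, ← Real.exp_add]
          congr 2; ring
  refine ⟨fun i => z 0 * xiv a i, fun i => S.O.mul_mem (hzO 0) (hxO i), ?_, ?_, z 0 * B.det,
    mul_ne_zero hz0' hBdet, ?_⟩
  · rw [← Finset.mul_sum, sum_xiv, mul_zero]
  · intro i v
    by_cases hi : i = p v
    · have h1 : xiv a (p v) = - ∑ i, xiv a ((p v).succAbove i) := by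
        have := sum_xiv a
        rw [Fin.sum_univ_succAbove _ (p v)] at this
        exact eq_neg_of_add_eq_zero_left this
      subst hi
      beta_reduce
      rw [h1, mul_neg, (S.av v).map_neg, Finset.mul_sum]
      refine (av_sum_le _ _ _).trans ?_
      refine (Finset.sum_le_sum (g := fun _ =>
        d.factorial * C2 * Real.exp (N * (e (p v) v + δ))) fun i _ => (hb1 v i).trans ?_).trans ?_
      · gcongr
        exact hp v _
      · simp only [Finset.sum_const, Finset.card_univ, Fintype.card_fin, nsmul_eq_mul]
        have : 0 ≤ d.factorial * C2 * Real.exp (N * (e (p v) v + δ)) := by positivity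
        nlinarith
    · obtain ⟨i', rfl⟩ := Fin.exists_succAbove_eq hi
      refine (hb1 v i').trans ?_
      have : 0 ≤ d.factorial * C2 * Real.exp (N * (e ((p v).succAbove i') v + δ)) := by positivity
      have hd0 : (0 : ℝ) ≤ d := by positivity
      nlinarith
  · intro l hl
    simp_rw [xiv_castSucc, mul_assoc]
    rw [← Finset.mul_sum]
    have h1 : (B.adjugate * B) j' ⟨l, hl⟩ = ∑ k, a k * b l k := by
      rw [Matrix.mul_apply]; rfl
    rw [← h1, Matrix.adjugate_mul, Matrix.smul_apply, Matrix.one_apply]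
    by_cases hjl : l = j
    · subst hjl; simp [j']
    · have : j' ≠ ⟨l, hl⟩ := fun h => hjl (by simpa [j'] using (Fin.mk.inj_iff.1 h).symm)
      simp [this, hjl]

/-- Case A contradiction. -/
theorem caseA {d : ℕ} (x ξ ξ' : Fin (d + 1) → K) (b : ℕ → Fin d → K) (hx : ∀ i, x i ≠ 0)
    (j j' : ℕ) (hj : j < d) (hj' : j' < d) (hjj : j ≠ j')
    (h : ∃ Δ : K, Δ ≠ 0 ∧ ∀ l < d, ∑ k, ξ (Fin.castSucc k) * b l k = if l = j then Δ else 0)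
    (h' : ∃ Δ : K, Δ ≠ 0 ∧ ∀ l < d, ∑ k, ξ' (Fin.castSucc k) * b l k = if l = j' then Δ else 0)
    (hp : ∀ i l, x l * ξ i = ξ l * x i) (hp' : ∀ i l, x l * ξ' i = ξ' l * x i) : False := by
  obtain ⟨Δ, hΔ, h1⟩ := h
  obtain ⟨Δ', hΔ', h2⟩ := h'
  have key : ∀ (η : Fin (d + 1) → K), (∀ i l, x l * η i = η l * x i) → ∀ l (w : Fin d → K),
      x l * ∑ k, η (Fin.castSucc k) * w k = η l * ∑ k, x (Fin.castSucc k) * w k := by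
    intro η hη l w
    rw [Finset.mul_sum, Finset.mul_sum]
    refine Finset.sum_congr rfl fun k _ => ?_
    rw [← mul_assoc, hη, mul_assoc]
  have a1 : ∑ k, x (Fin.castSucc k) * b j' k ≠ 0 := by
    intro h0
    have := key ξ' hp' 0 (b j')
    rw [h0, h2 j' hj', if_pos rfl, mul_zero] at this
    exact (mul_ne_zero (hx 0) hΔ') this
  have a2 : ∀ l, ξ l = 0 := by
    intro l
    have := key ξ hp l (b j')
    rw [h1 j' hj', if_neg (Ne.symm hjj), mul_zero] at this
    exact (mul_eq_zero.1 this.symm).resolve_right a1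
  have a3 := h1 j hj
  simp only [a2, zero_mul, Finset.sum_const_zero, if_true] at a3
  exact hΔ a3.symm

end Rt

end

section

namespace Rt
open Filter

variable {K : Type*} [Field K] {ι : Type*} [Fintype ι]

theorem Mn.U_le_ker {d : ℕ} {S : SPl K ι} {A : ι → Matrix (Fin d) (Fin d) ℤ} {s : ι → Fin d → ℝ}
    {U : ℕ → Submodule K (Fin d → K)} {b : ℕ → Fin d → K} {ν : ℕ → ℝ} (hM : Mn S A s U b ν)
    (φ : (Fin d → K) →ₗ[K] K) (j : ℕ) (h : ∀ l < j, φ (b l) = 0) : U j ≤ LinearMap.ker φ := by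
  rw [hM.U_eq, Submodule.span_le]
  rintro _ ⟨l, hl, rfl⟩
  exact h l hl

/-- pairing functional -/
noncomputable def prf {d : ℕ} (x : Fin (d + 1) → K) : (Fin d → K) →ₗ[K] K :=
  ∑ k, x (Fin.castSucc k) • LinearMap.proj k

theorem prf_apply {d : ℕ} (x : Fin (d + 1) → K) (z : Fin d → K) :
    prf x z = ∑ k, x (Fin.castSucc k) * z k := by
  simp [prf]

theorem prf_ne {d : ℕ} (hd : 0 < d) (x : Fin (d + 1) → K) (hx : ∀ i, x i ≠ 0) :
    LinearMap.ker (prf x) ≠ ⊤ := by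
  intro h
  have h1 : Pi.single (⟨0, hd⟩ : Fin d) (1 : K) ∈ LinearMap.ker (prf x) := by rw [h]; trivial
  rw [LinearMap.mem_ker, prf_apply] at h1
  simp [Pi.single_apply] at h1
  exact hx _ h1

theorem ker_span {d : ℕ} (hd : 2 ≤ d) (φ : (Fin d → K) →ₗ[K] K) (hφ : LinearMap.ker φ ≠ ⊤)
    (y : Fin (d - 1) → Fin d → K) (hy : LinearIndependent K y) (h0 : ∀ j, φ (y j) = 0)
    (w : Fin d → K) (hw : φ w = 0) : ∃ T : Fin (d - 1) → K, w = ∑ j, T j • y j := by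
  have h1 : Submodule.span K (Set.range y) ≤ LinearMap.ker φ := by
    rw [Submodule.span_le]; rintro _ ⟨j, rfl⟩; exact h0 j
  have h2 : Module.finrank K (LinearMap.ker φ) < d := by
    have := Submodule.finrank_lt hφ
    simpa using this
  have h3 : Module.finrank K (Submodule.span K (Set.range y)) = d - 1 := by
    simpa using finrank_span_eq_card hy
  have h4 := Submodule.eq_of_le_of_finrank_le h1 (by omega)
  have h5 : w ∈ Submodule.span K (Set.range y) := by rw [h4]; exact hw
  obtain ⟨T, hT⟩ := (Submodule.mem_span_range_iff_exists_fun K).1 h5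
  exact ⟨T, hT.symm⟩

theorem ult_lim (𝒰 : Ultrafilter ℕ) (f : ℕ → ℝ) (B : ℝ)
    (h : ∀ᶠ m in (𝒰 : Filter ℕ), |f m| ≤ B) : ∃ ω, Tendsto f 𝒰 (nhds ω) := by
  have hc : IsCompact (Set.Icc (-B) B) := isCompact_Icc
  obtain ⟨ω, _, h2⟩ := hc.ultrafilter_le_nhds (𝒰.map f) (by
    rw [le_principal_iff]
    exact h.mono fun m hm => abs_le.1 hm)
  exact ⟨ω, h2⟩

theorem caseB [CharZero K] [Nonempty ι] (S : SPl K ι) (𝒰 : Ultrafilter ℕ) (N : ℕ → ℝ)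
    (hN : Tendsto N 𝒰 atTop) (d : ℕ) (hd : 2 ≤ d) (A A' : ι → Matrix (Fin d) (Fin d) ℤ)
    (hA : ∀ v, A' v * A v = 1) (x : Fin (d + 1) → ℕ → K)
    (h0 : ∀ᶠ m in (𝒰 : Filter ℕ), ∀ i, x i m ≠ 0)
    (i0 i1 : Fin d) (hi : i1 ≠ i0) (v' : ι) (c0 : ℝ) (hc0 : 0 < c0)
    (hr : ∀ᶠ m in (𝒰 : Filter ℕ), S.av v' (x i1.castSucc m / x i0.castSucc m) ≤
      Real.exp (-(c0 * N m)))
    (C M η : ℝ) (hC : 1 ≤ C) (hη : 0 < η)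
    (y : ℕ → ℕ → Fin d → K) (R : ℕ → ι → Fin d → ℝ)
    (h1 : ∀ᶠ m in (𝒰 : Filter ℕ), ∀ j < d - 1, prf (fun i => x i m) (y m j) = 0 ∧
      (∀ i, y m j i ∈ S.O) ∧ ∀ v i, S.av v (lf K (A v) i (y m j)) ≤ R m v i)
    (h2 : ∀ᶠ m in (𝒰 : Filter ℕ), LinearIndependent K (fun j : Fin (d - 1) => y m j))
    (h3 : ∀ᶠ m in (𝒰 : Filter ℕ), ∀ v i, 1 / (C * Real.exp (N m * M) ^ 2) ≤ R m v i ∧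
      R m v i ≤ C * Real.exp (N m * M) ^ 2)
    (h4 : ∀ᶠ m in (𝒰 : Filter ℕ), ∏ v, ∏ i, R m v i ^ S.n v ≤ Real.exp (-(N m * η))) : False := by
  have hRpos : ∀ᶠ m in (𝒰 : Filter ℕ), ∀ v i, 0 < R m v i := by
    filter_upwards [h3] with m hm v i
    have : 0 < C := by linarith
    exact lt_of_lt_of_le (by positivity) (hm v i).1
  have hlim : ∀ v i, ∃ ω, Tendsto (fun m => Real.log (R m v i) / N m) 𝒰 (nhds ω) := by
    intro v i
    refine ult_lim 𝒰 _ (Real.log C + 2 * |M|) ?_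
    filter_upwards [h3, hN.eventually_ge_atTop 1] with m hm hNm
    have hCpos : 0 < C := by linarith
    have hE := Real.exp_pos (N m * M)
    have hlogC : 0 ≤ Real.log C := Real.log_nonneg hC
    have hl : Real.log (C * Real.exp (N m * M) ^ 2) = Real.log C + 2 * (N m * M) := by
      rw [Real.log_mul hCpos.ne' (by positivity), Real.log_pow, Real.log_exp]; push_cast; ring
    have hpos : 0 < R m v i := lt_of_lt_of_le (by positivity) (hm v i).1
    have u1 : Real.log (R m v i) ≤ Real.log C + 2 * (N m * M) := by
      rw [← hl]; exact Real.log_le_log hpos (hm v i).2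
    have u2 : -(Real.log C + 2 * (N m * M)) ≤ Real.log (R m v i) := by
      rw [← hl, ← Real.log_inv, ← one_div]; exact Real.log_le_log (by positivity) (hm v i).1
    have hNpos : 0 < N m := by linarith
    rw [abs_div, abs_of_pos hNpos, div_le_iff₀ hNpos]
    have u3 : |Real.log (R m v i)| ≤ Real.log C + 2 * (N m * |M|) := by
      have := mul_le_mul_of_nonneg_left (le_abs_self M) hNpos.le
      rw [abs_le]; constructor <;> linarith
    nlinarith
  choose ω hω using hlim
  have hsum : ∑ v, (S.n v : ℝ) * ∑ i, ω v i ≤ -η := by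
    have ht : Tendsto (fun m => ∑ v, (S.n v : ℝ) * ∑ i, Real.log (R m v i) / N m) 𝒰
        (nhds (∑ v, (S.n v : ℝ) * ∑ i, ω v i)) :=
      tendsto_finsetSum _ fun v _ => (tendsto_finsetSum _ fun i _ => hω v i).const_mul _
    refine le_of_tendsto ht ?_
    filter_upwards [h4, hRpos, hN.eventually_ge_atTop 1] with m hm hp hNm
    have hNpos : 0 < N m := by linarith
    have e1 : ∑ v, (S.n v : ℝ) * ∑ i, Real.log (R m v i) / N m =
        Real.log (∏ v, ∏ i, R m v i ^ S.n v) / N m := by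
      rw [Real.log_prod (fun v _ => (Finset.prod_pos fun i _ => pow_pos (hp v i) _).ne'),
        Finset.sum_div]
      refine Finset.sum_congr rfl fun v _ => ?_
      rw [Real.log_prod (fun i _ => (pow_pos (hp v i) _).ne'), Finset.mul_sum, Finset.sum_div]
      refine Finset.sum_congr rfl fun i _ => ?_
      rw [Real.log_pow]; ring
    rw [e1, div_le_iff₀ hNpos]
    have := Real.log_le_log (Finset.prod_pos fun v _ => Finset.prod_pos fun i _ =>
      pow_pos (hp v i) _) hm
    rw [Real.log_exp] at this
    linarith
  have hg := g_pos S
  set g := ∑ v, S.n v with hgd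
  have hg' : (0 : ℝ) < g := by exact_mod_cast hg
  have hd' : (0 : ℝ) < d := by exact_mod_cast (by omega : 0 < d)
  set θ := η / (2 * g * d) with hθ
  have hθpos : 0 < θ := by positivity
  have hw : ∑ v, (S.n v : ℝ) * ∑ i, (ω v i + θ) < 0 := by
    have : ∑ v, (S.n v : ℝ) * ∑ i, (ω v i + θ) = ∑ v, (S.n v : ℝ) * ∑ i, ω v i + g * (d * θ) := by
      rw [hgd]; push_cast
      rw [Finset.sum_mul, ← Finset.sum_add_distrib]
      refine Finset.sum_congr rfl fun v _ => ?_
      rw [Finset.sum_add_distrib]; simp; ring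
    rw [this]
    have : (g : ℝ) * (d * θ) = η / 2 := by rw [hθ]; field_simp
    linarith
  obtain ⟨N0, hrm⟩ := rm S (e := d - 1) A A' hA i0 i1 hi v' (fun v i => ω v i + θ) hw c0 hc0
  have hR : ∀ᶠ m in (𝒰 : Filter ℕ), ∀ v i, R m v i ≤ Real.exp (N m * (ω v i + θ)) := by
    rw [eventually_all]; intro v
    rw [eventually_all]; intro i
    have := (hω v i).eventually_lt_const (by linarith : ω v i < ω v i + θ)
    filter_upwards [this, hRpos, hN.eventually_ge_atTop 1] with m hm hp hNm
    have hNpos : 0 < N m := by linarith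
    rw [div_lt_iff₀ hNpos] at hm
    rw [← Real.log_le_iff_le_exp (hp v i)]
    linarith
  obtain ⟨m, k1, k2, k3, k4, k5, k6⟩ := (h0.and (hr.and (h1.and (h2.and (hR.and
    (hN.eventually_ge_atTop N0)))))).exists
  refine hrm (N m) k6 (fun j => y m j) (fun i => x i.castSucc m / x i0.castSucc m)
    (fun j i => (k3 j j.2).2.1 i) ?_ (div_ne_zero (k1 _) (k1 _)) k2 ?_
  · intro v i j
    rw [← lf_apply]
    exact ((k3 j j.2).2.2 v i).trans (k5 v i)
  · intro i hi
    obtain ⟨T, hT⟩ := ker_span hd (prf fun i => x i m) (prf_ne (by omega) _ k1)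
      (fun j => y m j) k4 (fun j => (k3 j j.2).1)
      (fun k => (if k = i then 1 else 0) -
        (if k = i0 then x i.castSucc m / x i0.castSucc m else 0)) (by
        rw [prf_apply]
        simp only [mul_sub, Finset.sum_sub_distrib, mul_ite, mul_one, mul_zero,
          Finset.sum_ite_eq', Finset.mem_univ, if_true]
        rw [mul_div_cancel₀ _ (k1 i0.castSucc), sub_self])
    refine ⟨T, fun k => ?_⟩
    have := congrFun hT k
    simpa [Finset.sum_apply] using this

end Rt

end

section

namespace Rt
open Filter

variable {K : Type*} [Field K] {ι : Type*} [Fintype ι]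

theorem thmA_step [CharZero K] [Nonempty ι] (S : SPl K ι) (𝒰 : Ultrafilter ℕ) (N : ℕ → ℝ)
    (hN : Tendsto N 𝒰 atTop) (d : ℕ) (hd : 2 ≤ d)
    (IH : ∀ n' < d + 1, 0 < n' → ThmA S 𝒰 N n') : ThmA S 𝒰 N (d + 1) := by
  classical
  intro x e hO h0 ht he hinj hs
  obtain ⟨δ, hδ, hpar⟩ := ih_par S 𝒰 N hN (d + 1) IH x e hO ht he hinj hs
  have hO' := eventually_all.2 hO
  have h0' := eventually_all.2 h0
  have htt : ∀ ε : ℝ, 0 < ε → ∀ᶠ m in (𝒰 : Filter ℕ), ∀ i v,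
      S.av v (x i m) ≤ Real.exp (N m * (e i v + ε)) := fun ε hε =>
    eventually_all.2 fun i => ht i ε hε
  have hpex : ∀ v, ∃ p, ∀ i, e i v ≤ e p v := fun v => Finite.exists_max fun i => e i v
  choose p hp using hpex
  obtain ⟨C, hC, hgap⟩ := gap S hd (fun v => Am (p v)) (fun v => Ami (p v)) (fun v => Ami_mul _)
  obtain ⟨C', hC', hcr⟩ := cramer_xi S d C hC
  set M : ℝ := ∑ i, ∑ v, |e i v| with hMdef
  have hM0 : 0 ≤ M := by positivity
  have hM : ∀ i v, |e i v| ≤ M := by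
    intro i v
    have h1 : |e i v| ≤ ∑ v, |e i v| :=
      Finset.single_le_sum (f := fun v => |e i v|) (fun _ _ => abs_nonneg _) (Finset.mem_univ v)
    have h2 : ∑ v, |e i v| ≤ M :=
      Finset.single_le_sum (f := fun i => ∑ v, |e i v|) (fun _ _ => by positivity)
        (Finset.mem_univ i)
    linarith
  have hG : ∀ m, ∃ U b ν, 0 ≤ N m → Mn S (fun v => Am (p v))
      (fun v j => Real.exp (-(N m * e ((p v).succAbove j) v))) U b ν ∧
      (∏ v, ∏ i, Real.exp (-(N m * e ((p v).succAbove i) v)) ^ S.n v) *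
        (∏ l ∈ Finset.range d, ν l) ^ (∑ v, S.n v) ≤ C ∧
      (C * ν (d-2) < ν (d-1) → ∃ (y : ℕ → Fin d → K) (R : ι → Fin d → ℝ),
        (∀ j<d-1, y j ∈ U (d-1) ∧ (∀ i, y j i ∈ S.O) ∧
          ∀ v i, S.av v (lf K (Am (p v)) i (y j)) ≤ R v i) ∧
        LinearIndependent K (fun j : Fin (d-1) => y j) ∧
        (∀ v i, 1/(C*Real.exp (N m * M)^2) ≤ R v i ∧ R v i ≤ C*Real.exp (N m * M)^2) ∧
        ∏ v, ∏ i, R v i ^ S.n v ≤ C * (ν (d-2)/ν (d-1))^(∑ v, S.n v)) := by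
    intro m
    by_cases hNm : 0 ≤ N m
    · obtain ⟨U, b, ν, a1, _, a3, a4⟩ := hgap
        (fun v j => Real.exp (-(N m * e ((p v).succAbove j) v))) (Real.exp (N m * M))
        (Real.one_le_exp (by positivity))
        (fun v i => by
          rw [Real.exp_le_exp]
          have := mul_le_mul_of_nonneg_left ((neg_le_abs _).trans (hM ((p v).succAbove i) v)) hNm
          linarith)
        (fun v i => by
          rw [one_div, ← Real.exp_neg, Real.exp_le_exp]
          have := mul_le_mul_of_nonneg_left ((le_abs_self _).trans (hM ((p v).succAbove i) v)) hNm
          linarith)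
      exact ⟨U, b, ν, fun _ => ⟨a1, a3, a4⟩⟩
    · exact ⟨fun _ => ⊥, fun _ => 0, fun _ => 0, fun h => absurd h hNm⟩
  choose U b ν hUbν using hG
  have hN0 := hN.eventually_ge_atTop 0
  have hd' : (0 : ℝ) < d := by exact_mod_cast (by omega : 0 < d)
  -- nonvanishing pairing forces a large minimum
  have hF : ∀ ε : ℝ, 0 < ε → ∀ᶠ m in (𝒰 : Filter ℕ), ∀ l < d,
      prf (fun i => x i m) (b m l) ≠ 0 → Real.exp (-(N m * ε)) ≤ ν m l := by
    intro ε hε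
    filter_upwards [htt (ε / 2) (by positivity), hs, hO', hN0, ev_const hN d (half_pos hε)]
      with m h1 h2 h3 h4 h5 l hl hne
    obtain ⟨hMn, -, -⟩ := hUbν m h4
    have := F1 S p (fun i => x i m) h2 h3 (N m) (ε / 2) e h1 (b m l) (hMn.bO l hl) (ν m l)
      (hMn.pos l) (hMn.sm l hl) (by rwa [prf_apply] at hne)
    have hνp := hMn.pos l
    have h6 : d * ν m l * Real.exp (N m * (ε / 2)) ≤ ν m l * Real.exp (N m * ε) := by
      calc d * ν m l * Real.exp (N m * (ε / 2))
          ≤ Real.exp (N m * (ε / 2)) * ν m l * Real.exp (N m * (ε / 2)) := by gcongr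
        _ = ν m l * (Real.exp (N m * (ε / 2)) * Real.exp (N m * (ε / 2))) := by ring
        _ = _ := by rw [← Real.exp_add]; congr 2; ring
    rw [Real.exp_neg, inv_le_iff_one_le_mul₀ (Real.exp_pos _)]
    linarith
  have hlast : ∀ ε : ℝ, 0 < ε → ∀ᶠ m in (𝒰 : Filter ℕ), Real.exp (-(N m * ε)) ≤ ν m (d - 1) := by
    intro ε hε
    filter_upwards [hF (ε / 2) (half_pos hε), h0', hN0, ev_const hN 2 (half_pos hε)]
      with m h1 h2 h3 h4
    obtain ⟨hMn, -, -⟩ := hUbν m h3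
    have : ∃ l < d, prf (fun i => x i m) (b m l) ≠ 0 := by
      by_contra hc
      push Not at hc
      have := hMn.U_le_ker _ d hc
      rw [hMn.top] at this
      exact prf_ne (by omega) _ h2 (top_le_iff.1 this)
    obtain ⟨l, hl, hne⟩ := this
    have k1 := h1 l hl hne
    have k2 := hMn.nu_le (by omega : l ≤ d - 1) (by omega)
    have k3 : Real.exp (-(N m * (ε / 2))) = Real.exp (-(N m * ε)) * Real.exp (N m * (ε / 2)) := by
      rw [← Real.exp_add]; congr 1; ring
    have k4 : Real.exp (-(N m * ε)) * 2 ≤ Real.exp (-(N m * ε)) * Real.exp (N m * (ε / 2)) := by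
      gcongr
    linarith
  by_cases hA : ∀ᶠ m in (𝒰 : Filter ℕ), Real.exp (-(N m * (δ / 2))) ≤ ν m (d - 2)
  · obtain ⟨m, k1, k2, k3, k4, k5, k6⟩ := (hA.and ((hlast (δ / 2) (half_pos hδ)).and (hN0.and
      (hpar.and (h0'.and (ev_const hN C' (half_pos hδ))))))).exists
    obtain ⟨hMn, hvol, -⟩ := hUbν m k3
    obtain ⟨ξ, a1, a2, a3, a4⟩ := hcr p e (N m) (δ / 2) (U m) (b m) (ν m) k3 (half_pos hδ).le hp hMn
      hvol (d - 2) (by omega) k1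
    obtain ⟨ξ', b1, b2, b3, b4⟩ := hcr p e (N m) (δ / 2) (U m) (b m) (ν m) k3 (half_pos hδ).le hp
      hMn hvol (d - 1) (by omega) k2
    have hbd : ∀ i v, C' * Real.exp (N m * (e i v + δ / 2)) ≤ Real.exp (N m * (e i v + δ)) := by
      intro i v
      calc C' * Real.exp (N m * (e i v + δ / 2)) ≤
          Real.exp (N m * (δ / 2)) * Real.exp (N m * (e i v + δ / 2)) := by gcongr
        _ = _ := by rw [← Real.exp_add]; congr 1; ring
    exact caseA (fun i => x i m) ξ ξ' (b m) k5 (d - 2) (d - 1) (by omega) (by omega) (by omega)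
      a4 b4 (k4 ξ a1 a2 fun i v => (a3 i v).trans (hbd i v))
      (k4 ξ' b1 b2 fun i v => (b3 i v).trans (hbd i v))
  · rw [ult_not] at hA
    -- choose the two indices
    obtain ⟨i0, i1, v', hi, hv⟩ : ∃ (i0 i1 : Fin d) (v' : ι), i1 ≠ i0 ∧
        e i1.castSucc v' < e i0.castSucc v' := by
      let i0 : Fin d := ⟨0, by omega⟩
      let i1 : Fin d := ⟨1, by omega⟩
      have hne : i0 ≠ i1 := by simp [i0, i1]
      have : e i0.castSucc ≠ e i1.castSucc := fun h => hne (Fin.castSucc_injective _ (hinj h))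
      obtain ⟨v, hv⟩ := Function.ne_iff.1 this
      rcases lt_or_gt_of_ne hv with h | h
      · exact ⟨i1, i0, v, hne, h⟩
      · exact ⟨i0, i1, v, hne.symm, h⟩
    set c0 : ℝ := (e i0.castSucc v' - e i1.castSucc v') / 2 with hc0d
    have hc0 : 0 < c0 := by rw [hc0d]; linarith
    have hr : ∀ᶠ m in (𝒰 : Filter ℕ), S.av v' (x i1.castSucc m / x i0.castSucc m) ≤
        Real.exp (-(c0 * N m)) := by
      filter_upwards [ht i1.castSucc (c0 / 2) (half_pos hc0),
        (ht i0.castSucc).lower (he _) (hO _) (h0 _) hN (c0 / 2) (half_pos hc0), h0'] with m k1 k2 k3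
      rw [map_div₀, div_le_iff₀ ((S.av v').pos (k3 _))]
      calc S.av v' (x i1.castSucc m) ≤ Real.exp (N m * (e i1.castSucc v' + c0 / 2)) := k1 v'
        _ = Real.exp (-(c0 * N m)) * Real.exp (N m * (e i0.castSucc v' - c0 / 2)) := by
          rw [← Real.exp_add]; congr 1; rw [hc0d]; ring
        _ ≤ _ := by gcongr; exact k2 v'
    have hgapm : ∀ᶠ m in (𝒰 : Filter ℕ), C * ν m (d - 2) < ν m (d - 1) := by
      filter_upwards [hA, hlast (δ / 4) (by positivity), ev_const hN C (by positivity : 0 < δ / 4)]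
        with m k1 k2 k3
      push Not at k1
      calc C * ν m (d - 2) < C * Real.exp (-(N m * (δ / 2))) := by
            have : 0 < C := by linarith
            gcongr
        _ ≤ Real.exp (N m * (δ / 4)) * Real.exp (-(N m * (δ / 2))) := by gcongr
        _ = Real.exp (-(N m * (δ / 4))) := by rw [← Real.exp_add]; congr 1; ring
        _ ≤ _ := k2
    have hyR : ∀ m, ∃ (y : ℕ → Fin d → K) (R : ι → Fin d → ℝ), 0 ≤ N m →
        C * ν m (d-2) < ν m (d-1) →
        (∀ j<d-1, y j ∈ U m (d-1) ∧ (∀ i, y j i ∈ S.O) ∧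
          ∀ v i, S.av v (lf K (Am (p v)) i (y j)) ≤ R v i) ∧
        LinearIndependent K (fun j : Fin (d-1) => y j) ∧
        (∀ v i, 1/(C*Real.exp (N m * M)^2) ≤ R v i ∧ R v i ≤ C*Real.exp (N m * M)^2) ∧
        ∏ v, ∏ i, R v i ^ S.n v ≤ C * (ν m (d-2)/ν m (d-1))^(∑ v, S.n v) := by
      intro m
      by_cases hh : 0 ≤ N m ∧ C * ν m (d-2) < ν m (d-1)
      · obtain ⟨y, R, h⟩ := (hUbν m hh.1).2.2 hh.2
        exact ⟨y, R, fun _ _ => h⟩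
      · exact ⟨0, 0, fun h1 h2 => absurd ⟨h1, h2⟩ hh⟩
    choose y R hyR' using hyR
    refine caseB S 𝒰 N hN d hd (fun v => Am (p v)) (fun v => Ami (p v)) (fun v => Ami_mul _) x h0'
      i0 i1 hi v' c0 hc0 hr C M (δ / 8) hC (by positivity) y R ?_ ?_ ?_ ?_
    · filter_upwards [hN0, hgapm, hA, hF (δ / 4) (by positivity),
        ev_const hN 2 (by positivity : 0 < δ / 4)] with m k1 k2 k3 k4 k5 j hj
      obtain ⟨a1, -, -, -⟩ := hyR' m k1 k2
      obtain ⟨hMn, -, -⟩ := hUbν m k1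
      refine ⟨?_, (a1 j hj).2⟩
      have hker := hMn.U_le_ker (prf fun i => x i m) (d - 1) (by
        intro l hl
        by_contra hne
        have u1 := k4 l (by omega) hne
        have u2 := hMn.nu_le (by omega : l ≤ d - 2) (by omega)
        push Not at k3
        have u3 : 2 * Real.exp (-(N m * (δ / 2))) ≤ Real.exp (-(N m * (δ / 4))) := by
          calc 2 * Real.exp (-(N m * (δ / 2))) ≤
              Real.exp (N m * (δ / 4)) * Real.exp (-(N m * (δ / 2))) := by gcongr
            _ = _ := by rw [← Real.exp_add]; congr 1; ring
        linarith)
      exact hker (a1 j hj).1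
    · filter_upwards [hN0, hgapm] with m k1 k2
      exact (hyR' m k1 k2).2.1
    · filter_upwards [hN0, hgapm] with m k1 k2
      exact (hyR' m k1 k2).2.2.1
    · filter_upwards [hN0, hgapm, hA, hlast (δ / 4) (by positivity),
        ev_const hN C (by positivity : 0 < δ / 8)] with m k1 k2 k3 k4 k5
      obtain ⟨hMn, -, -⟩ := hUbν m k1
      refine (hyR' m k1 k2).2.2.2.trans ?_
      push Not at k3
      have hg := g_pos S
      have p1 := hMn.pos (d - 1)
      have p2 := hMn.pos (d - 2)
      have q1 : ν m (d - 2) / ν m (d - 1) ≤ Real.exp (-(N m * (δ / 4))) := by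
        rw [div_le_iff₀ p1]
        calc ν m (d - 2) ≤ Real.exp (-(N m * (δ / 2))) := k3.le
          _ = Real.exp (-(N m * (δ / 4))) * Real.exp (-(N m * (δ / 4))) := by
              rw [← Real.exp_add]; congr 1; ring
          _ ≤ _ := by gcongr
      have q2 : Real.exp (-(N m * (δ / 4))) ≤ 1 := by
        rw [Real.exp_le_one_iff]
        have : 0 ≤ N m * (δ / 4) := by positivity
        linarith
      have q3 : (ν m (d-2)/ν m (d-1))^(∑ v, S.n v) ≤ Real.exp (-(N m * (δ / 4))) :=
        (pow_le_of_le_one (by positivity) (q1.trans q2) hg.ne').trans q1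
      calc C * (ν m (d-2)/ν m (d-1))^(∑ v, S.n v) ≤
          Real.exp (N m * (δ / 8)) * Real.exp (-(N m * (δ / 4))) := by gcongr
        _ = _ := by rw [← Real.exp_add]; congr 1; ring

/-- Theorem A -/
theorem thmA [CharZero K] [Nonempty ι] (S : SPl K ι) (𝒰 : Ultrafilter ℕ) (N : ℕ → ℝ)
    (hN : Tendsto N 𝒰 atTop) (n : ℕ) (hn : 0 < n) : ThmA S 𝒰 N n := by
  classical
  induction n using Nat.strong_induction_on with
  | _ n IH =>
  match n, hn, IH with
  | 1, _, _ =>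
    intro x e hO h0 ht he hinj hs
    obtain ⟨m, k1, k2⟩ := (hs.and (h0 0)).exists
    simp at k1
    exact k2 k1
  | 2, _, _ =>
    intro x e hO h0 ht he hinj hs
    have hne : e 0 ≠ e 1 := fun h => absurd (hinj h) (by decide)
    obtain ⟨v, hv⟩ := Function.ne_iff.1 hne
    have key : ∀ i j : Fin 2, (∀ᶠ m in (𝒰 : Filter ℕ), x i m = - x j m) → e j v ≤ e i v := by
      intro i j hij
      by_contra hlt
      push Not at hlt
      set c := (e j v - e i v) / 4 with hc
      have hcp : 0 < c := by rw [hc]; linarith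
      obtain ⟨m, k1, k2, k3, k4⟩ := ((ht i c hcp).and (((ht j).lower (he j) (hO j) (h0 j) hN c
        hcp).and (hij.and (hN.eventually_ge_atTop 1)))).exists
      have u1 := k1 v
      have u2 := k2 v
      rw [k3, (S.av v).map_neg] at u1
      have u3 := Real.exp_le_exp.1 (u2.trans u1)
      have u4 := le_of_mul_le_mul_left u3 (by linarith)
      rw [hc] at u4
      linarith
    have hs' : ∀ᶠ m in (𝒰 : Filter ℕ), x 0 m = - x 1 m := hs.mono fun m hm => by
      rw [Fin.sum_univ_two] at hm; exact eq_neg_of_add_eq_zero_left hm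
    have hs'' : ∀ᶠ m in (𝒰 : Filter ℕ), x 1 m = - x 0 m := hs.mono fun m hm => by
      rw [Fin.sum_univ_two] at hm; exact eq_neg_of_add_eq_zero_right hm
    exact hv (le_antisymm (key 1 0 hs'') (key 0 1 hs'))
  | (d + 3), _, IH =>
    exact thmA_step S 𝒰 N hN (d + 2) (by omega) fun n' hn' h0 => IH n' hn' h0

end Rt

end

section

namespace Rt

/-- sup norm -/
def nm {k : ℕ} (x : Fin k → ℤ) : ℕ := Finset.univ.sup fun i => (x i).natAbs

theorem nm_le {k : ℕ} (x : Fin k → ℤ) (B : ℕ) : nm x ≤ B ↔ ∀ i, (x i).natAbs ≤ B := by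
  simp [nm, Finset.sup_le_iff]

theorem le_nm {k : ℕ} (x : Fin k → ℤ) (i : Fin k) : (x i).natAbs ≤ nm x :=
  (nm_le x _).1 le_rfl i

theorem nm_add {k : ℕ} (x y : Fin k → ℤ) : nm (x + y) ≤ nm x + nm y := by
  rw [nm_le]
  intro i
  have := le_nm x i
  have := le_nm y i
  have := Int.natAbs_add_le (x i) (y i)
  simp only [Pi.add_apply]
  omega

theorem nm_neg {k : ℕ} (x : Fin k → ℤ) : nm (-x) = nm x := by
  simp [nm]

theorem selection (k m : ℕ) (hm : 1 ≤ m) (L : ℕ) : ∃ W : ℕ, ∀ X : Finset (Fin k → ℤ), W ≤ X.card →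
    ∃ p : ℕ → (Fin k → ℤ), (∀ i ≤ L, p i ∈ X) ∧
      ∀ i < L, m * max 1 (nm (p i - p 0)) ≤ nm (p (i + 1) - p 0) := by
  classical
  induction L with
  | zero =>
    refine ⟨1, fun X hX => ?_⟩
    obtain ⟨x, hx⟩ := Finset.card_pos.1 hX
    exact ⟨fun _ => x, fun _ _ => hx, fun i hi => absurd hi (by omega)⟩
  | succ L ih =>
    obtain ⟨W', hW'⟩ := ih
    refine ⟨(8 * m + 2) ^ k * W' + (4 * m + 1) ^ k + 1, fun X hX => ?_⟩
    have hne : X.Nonempty := Finset.card_pos.1 (by omega)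
    obtain ⟨q0, hq0⟩ := hne
    obtain ⟨q1, hq1, hmax⟩ := X.exists_max_image (fun x => nm (x - q0)) ⟨q0, hq0⟩
    set R := nm (q1 - q0) with hR
    have hR2 : 2 * m ≤ R := by
      by_contra hlt
      push Not at hlt
      have h1 : X.card ≤ (Fintype.piFinset fun _ : Fin k =>
          Finset.Icc (-(2 * m : ℤ)) (2 * m)).card := by
        refine Finset.card_le_card_of_injOn (fun x => x - q0) ?_ ?_
        · intro x hx
          simp only [Finset.mem_coe, Fintype.mem_piFinset, Finset.mem_Icc, Pi.sub_apply]
          intro i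
          have h2 := hmax x hx
          have h3 := le_nm (x - q0) i
          simp only [Pi.sub_apply] at h3
          omega
        · intro x _ y _ hxy
          simpa using hxy
      rw [Fintype.card_piFinset] at h1
      simp only [Int.card_Icc, Finset.prod_const, Finset.card_univ, Fintype.card_fin] at h1
      have h4 : ((2 * m + 1 - -(2 * m) : ℤ)).toNat = 4 * m + 1 := by omega
      rw [h4] at h1
      omega
    set s := R / (2 * m) with hs
    have hs1 : 1 ≤ s := by rw [hs, Nat.one_le_div_iff (by omega)]; exact hR2
    have hs2 : 2 * m * s ≤ R := Nat.mul_div_le R (2 * m)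
    have hs3 : R < 2 * m * (s + 1) := by
      have := Nat.lt_mul_div_succ R (by omega : 0 < 2 * m)
      simpa [hs] using this
    have hs4 : R ≤ 4 * m * s := by nlinarith
    let key : (Fin k → ℤ) → (Fin k → ℤ) := fun x i => (x i - q0 i) / (s : ℤ)
    have hkey : ∀ x ∈ X, key x ∈ Fintype.piFinset fun _ : Fin k =>
        Finset.Icc (-(4 * m + 1 : ℤ)) (4 * m) := by
      intro x hx
      simp only [Fintype.mem_piFinset, Finset.mem_Icc, key]
      intro i
      have h2 := hmax x hx
      have h3 := le_nm (x - q0) i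
      simp only [Pi.sub_apply] at h3
      have h4 : (x i - q0 i).natAbs ≤ 4 * m * s := by omega
      have h5 : ((x i - q0 i).natAbs : ℤ) ≤ 4 * m * s := by exact_mod_cast h4
      have hsp : (0 : ℤ) < s := by exact_mod_cast hs1
      constructor
      · rw [Int.le_ediv_iff_mul_le hsp]
        have := abs_le.1 (by rwa [← Int.natCast_natAbs] : |x i - q0 i| ≤ 4 * m * s)
        nlinarith
      · have := abs_le.1 (by rwa [← Int.natCast_natAbs] : |x i - q0 i| ≤ 4 * m * s)
        exact Int.ediv_le_of_le_mul hsp (by linarith)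
    obtain ⟨y, _, hy⟩ := Finset.exists_lt_card_fiber_of_mul_lt_card_of_maps_to (n := W') hkey (by
      rw [Fintype.card_piFinset]
      simp only [Int.card_Icc, Finset.prod_const, Finset.card_univ, Fintype.card_fin]
      have h4 : ((4 * m + 1 - -(4 * m + 1) : ℤ)).toNat = 8 * m + 2 := by omega
      rw [h4]
      omega)
    obtain ⟨p, hp1, hp2⟩ := hW' _ hy.le
    have hp1' : ∀ i ≤ L, p i ∈ X ∧ key (p i) = y := fun i hi => by
      simpa using hp1 i hi
    have hclose : ∀ i ≤ L, nm (p i - p 0) ≤ s := by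
      intro i hi
      rw [nm_le]
      intro a
      have h1 := congrFun ((hp1' i hi).2.trans (hp1' 0 (Nat.zero_le _)).2.symm) a
      simp only [key] at h1
      have hsp : (0 : ℤ) < s := by exact_mod_cast hs1
      have e1 := Int.emod_add_mul_ediv (p i a - q0 a) s
      have e2 := Int.emod_add_mul_ediv (p 0 a - q0 a) s
      have f1 := Int.emod_nonneg (p i a - q0 a) hsp.ne'
      have f2 := Int.emod_nonneg (p 0 a - q0 a) hsp.ne'
      have g1 := Int.emod_lt_of_pos (p i a - q0 a) hsp
      have g2 := Int.emod_lt_of_pos (p 0 a - q0 a) hsp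
      rw [h1] at e1
      simp only [Pi.sub_apply]
      have : |p i a - p 0 a| ≤ s := by rw [abs_le]; constructor <;> linarith
      rw [← Int.natCast_natAbs] at this
      exact_mod_cast this
    have hfar : ∃ q ∈ X, m * s ≤ nm (q - p 0) ∧ m ≤ nm (q - p 0) := by
      have htri : R ≤ nm (q1 - p 0) + nm (q0 - p 0) := by
        have := nm_add (q1 - p 0) (-(q0 - p 0))
        rw [nm_neg] at this
        have e : q1 - p 0 + -(q0 - p 0) = q1 - q0 := by abel
        rwa [e] at this
      by_contra hc
      push Not at hc
      have h1 : nm (q1 - p 0) < m * s := by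
        by_contra h
        push Not at h
        have := hc q1 hq1 h
        nlinarith
      have h2 : nm (q0 - p 0) < m * s := by
        by_contra h
        push Not at h
        have := hc q0 hq0 h
        nlinarith
      nlinarith
    obtain ⟨q, hqX, hq1, hq2⟩ := hfar
    refine ⟨fun i => if i ≤ L then p i else q, ?_, ?_⟩
    · intro i hi
      beta_reduce
      split_ifs with h
      · exact (hp1' i h).1
      · exact hqX
    · intro i hi
      simp only [Nat.zero_le, if_true]
      rw [if_pos (by omega : i ≤ L)]
      by_cases h : i + 1 ≤ L
      · rw [if_pos h]; exact hp2 i (by omega)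
      · rw [if_neg h]
        have := hclose i (by omega)
        rcases le_total 1 (nm (p i - p 0)) with h1 | h1
        · rw [max_eq_right h1]; nlinarith
        · rw [max_eq_left h1]; omega

end Rt

end

section

namespace Rt
open Matrix

section
variable {R : Type*} [CommRing R] {Col : Type*} [Fintype Col] [DecidableEq Col]

/-- the vector orthogonal to the first `t` rows with pivot columns `c`, and extra column `j` -/
noncomputable def gm (Z : ℕ → Col → R) (t : ℕ) (c : Fin t → Col) (j col : Col) : R :=
  (if col = j then (Matrix.of fun a b : Fin t => Z a (c b)).det else 0) -
    ∑ b : Fin t, (if col = c b then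
      ∑ a : Fin t, (Matrix.of fun a b : Fin t => Z a (c b)).adjugate b a * Z a j else 0)

theorem gm_sum (Z : ℕ → Col → R) (t : ℕ) (c : Fin t → Col) (j : Col) (f : Col → R) :
    ∑ col, f col * gm Z t c j col =
      f j * (Matrix.of fun a b : Fin t => Z a (c b)).det - ∑ b : Fin t, f (c b) *
        ∑ a : Fin t, (Matrix.of fun a b : Fin t => Z a (c b)).adjugate b a * Z a j := by
  simp only [gm, mul_sub, Finset.sum_sub_distrib, Finset.mul_sum]
  congr 1
  · simp
  · rw [Finset.sum_comm]
    refine Finset.sum_congr rfl fun b _ => ?_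
    simp [Finset.mul_sum]

theorem gm_orth (Z : ℕ → Col → R) (t : ℕ) (c : Fin t → Col) (j : Col) (i : ℕ) (hi : i < t) :
    ∑ col, Z i col * gm Z t c j col = 0 := by
  rw [gm_sum]
  set Q := (Matrix.of fun a b : Fin t => Z a (c b)) with hQ
  have h1 : ∑ b : Fin t, Z i (c b) * ∑ a : Fin t, Q.adjugate b a * Z a j =
      (Q *ᵥ (Q.adjugate *ᵥ fun a => Z a j)) ⟨i, hi⟩ := rfl
  rw [h1, Matrix.mulVec_mulVec, Matrix.mul_adjugate, Matrix.smul_mulVec, Matrix.one_mulVec]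
  simp [mul_comm]

theorem gm_comb (Z : ℕ → Col → R) (t : ℕ) (c : Fin t → Col) (κ : Col → R)
    (hκ : ∀ i < t, ∑ col, Z i col * κ col = 0) (col : Col) :
    (Matrix.of fun a b : Fin t => Z a (c b)).det * κ col = ∑ j, κ j * gm Z t c j col := by
  set Q := (Matrix.of fun a b : Fin t => Z a (c b)) with hQ
  simp only [gm, mul_sub, Finset.sum_sub_distrib, ← hQ]
  have h1 : ∑ j, κ j * ∑ b : Fin t, (if col = c b then ∑ a : Fin t, Q.adjugate b a * Z a j else 0) =
      ∑ b : Fin t, if col = c b then ∑ a : Fin t, Q.adjugate b a * ∑ j, Z a j * κ j else 0 := by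
    simp_rw [Finset.mul_sum]
    rw [Finset.sum_comm]
    refine Finset.sum_congr rfl fun b _ => ?_
    split_ifs
    · simp_rw [Finset.mul_sum]
      rw [Finset.sum_comm]
      refine Finset.sum_congr rfl fun a _ => Finset.sum_congr rfl fun j _ => by ring
    · simp
  rw [h1]
  have h2 : ∀ a : Fin t, ∑ j, Z a j * κ j = 0 := fun a => hκ a a.2
  simp [h2, mul_comm]

theorem gm_map {R' : Type*} [CommRing R'] (φ : R →+* R') (Z : ℕ → Col → R) (t : ℕ)
    (c : Fin t → Col) (j col : Col) :
    φ (gm Z t c j col) = gm (fun i col => φ (Z i col)) t c j col := by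
  have e : (Matrix.of fun a b : Fin t => φ (Z a (c b))) =
      φ.mapMatrix (Matrix.of fun a b : Fin t => Z a (c b)) := rfl
  simp only [gm, e]
  rw [← RingHom.map_det, ← RingHom.map_adjugate]
  simp only [map_sub, map_sum, apply_ite φ, map_zero, map_mul, RingHom.mapMatrix_apply,
    Matrix.map_apply]

end

theorem exists_cols {K : Type*} [Field K] {Col : Type*} [Fintype Col] (t : ℕ)
    (Z : ℕ → Col → K) (h : LinearIndependent K (fun a : Fin t => Z a)) :
    ∃ c : Fin t → Col, (Matrix.of fun a b : Fin t => Z a (c b)).det ≠ 0 := by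
  classical
  let A : Matrix (Fin t) Col K := Matrix.of fun a col => Z a col
  obtain ⟨κ, f, hf, hspan, hli⟩ := exists_linearIndependent' K A.col
  have hr : A.rank = t := by
    rw [Matrix.rank_eq_finrank_span_row]
    have := finrank_span_eq_card (R := K) (b := A.row) h
    simpa using this
  rw [Matrix.rank_eq_finrank_span_cols, ← hspan] at hr
  haveI : Finite κ := Finite.of_injective f hf
  haveI := Fintype.ofFinite κ
  rw [finrank_span_eq_card hli] at hr
  let φ : Fin t ≃ κ := (Fintype.equivFinOfCardEq hr).symm
  refine ⟨fun b => f (φ b), ?_⟩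
  have h2 : LinearIndependent K (Matrix.of fun a b : Fin t => Z a (f (φ b))).col :=
    hli.comp φ φ.injective
  have h3 := Matrix.linearIndependent_cols_iff_isUnit.1 h2
  exact ((Matrix.isUnit_iff_isUnit_det _).1 h3).ne_zero

theorem stagnation {K : Type*} [Field K] {Col : Type*} [Fintype Col] [DecidableEq Col]
    (Z : ℕ → Col → K) (h0 : Z 0 ≠ 0) :
    ∃ t, 1 ≤ t ∧ t ≤ Fintype.card Col ∧ ∃ c : Fin t → Col,
      (Matrix.of fun a b : Fin t => Z a (c b)).det ≠ 0 ∧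
      ∀ j, ∑ col, Z t col * gm Z t c j col = 0 := by
  classical
  let P : ℕ → Prop := fun t => ¬ LinearIndependent K (fun a : Fin t => Z a)
  have hP : ∃ t, P t := by
    refine ⟨Fintype.card Col + 1, fun h => ?_⟩
    have := h.fintype_card_le_finrank
    simp at this
  have hf := Nat.find_spec hP
  have hmin := fun t => @Nat.find_min _ _ hP t
  have hle : Nat.find hP ≤ Fintype.card Col + 1 := Nat.find_min' hP (by
    intro h
    have := h.fintype_card_le_finrank
    simp at this)
  set T := Nat.find hP with hT
  have hT0 : T ≠ 0 := by
    intro h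
    rw [h] at hf
    exact hf linearIndependent_empty_type
  obtain ⟨t, ht⟩ := Nat.exists_eq_succ_of_ne_zero hT0
  have ht1 : 1 ≤ t := by
    by_contra h
    have : t = 0 := by omega
    subst this
    rw [ht] at hf
    apply hf
    rw [linearIndependent_unique_iff]
    exact h0
  have hli : LinearIndependent K (fun a : Fin t => Z a) := by
    have := hmin t (by omega)
    exact not_not.1 this
  obtain ⟨c, hc⟩ := exists_cols t Z hli
  refine ⟨t, ht1, by omega, c, hc, fun j => ?_⟩
  have hmem : Z t ∈ Submodule.span K (Set.range fun a : Fin t => Z a) := by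
    by_contra hn
    rw [ht] at hf
    apply hf
    have : (fun a : Fin (t + 1) => Z a) = Fin.snoc (fun a : Fin t => Z a) (Z t) := by
      funext a
      refine Fin.lastCases ?_ (fun b => ?_) a
      · simp
      · simp
    change LinearIndependent K (fun a : Fin (t + 1) => Z a)
    rw [this, linearIndependent_finSnoc]
    exact ⟨hli, hn⟩
  obtain ⟨T', hT'⟩ := (Submodule.mem_span_range_iff_exists_fun K).1 hmem
  rw [← hT']
  simp only [Finset.sum_apply, Pi.smul_apply, smul_eq_mul, Finset.sum_mul]
  rw [Finset.sum_comm]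
  refine Finset.sum_eq_zero fun a _ => ?_
  simp_rw [mul_assoc]
  rw [← Finset.mul_sum, gm_orth Z t c j a a.2, mul_zero]

end Rt

end

section

namespace Rt
open Filter

variable {K : Type*} [Field K] {ι : Type*} [Fintype ι]

section
variable {S : SPl K ι} {𝒰 : Ultrafilter ℕ} {N : ℕ → ℝ}

theorem typ_int (hN : Tendsto N 𝒰 atTop) (a : ℕ → ℤ)
    (ha : ∀ᶠ m in (𝒰 : Filter ℕ), |(a m : ℝ)| ≤ N m) :
    Typ S 𝒰 N (fun m => (a m : K)) (fun _ => 0) := by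
  intro ε hε
  have h1 : ∀ᶠ y : ℝ in atTop, y ≤ Real.exp (y * ε) := by
    have := (tendsto_exp_mul_div_rpow_atTop 1 ε hε).eventually_ge_atTop 1
    filter_upwards [this, eventually_gt_atTop 0] with y hy h0
    rw [Real.rpow_one, le_div_iff₀ h0] at hy
    rw [mul_comm]; linarith
  filter_upwards [ha, hN.eventually h1] with m h2 h3 v
  refine (SPl.av_intCast_le _ _).trans (h2.trans ?_)
  simpa using h3

theorem typ_one (hN : Tendsto N 𝒰 atTop) : Typ S 𝒰 N (fun _ => (1 : K)) (fun _ => 0) := by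
  intro ε hε
  filter_upwards [hN.eventually_ge_atTop 0] with m h v
  rw [map_one]
  apply Real.one_le_exp
  have : 0 ≤ N m * ε := by positivity
  simpa using this

theorem typ_pow (hN : Tendsto N 𝒰 atTop) {x : ℕ → K} (hx : Typ S 𝒰 N x (fun _ => 0)) (p : ℕ) :
    Typ S 𝒰 N (fun m => x m ^ p) (fun _ => 0) := by
  induction p with
  | zero => simpa using typ_one hN
  | succ p ih =>
    have := ih.mul hx
    simpa [pow_succ] using this

theorem typ_zpow (hN : Tendsto N 𝒰 atTop) (a : ℕ → ℤ) (τ : ℝ)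
    (ha : Tendsto (fun m => (a m : ℝ) / N m) 𝒰 (nhds τ)) (l : K) (hl : l ≠ 0) :
    Typ S 𝒰 N (fun m => l ^ (a m)) (fun v => τ * Real.log (S.av v l)) := by
  intro ε hε
  refine eventually_all.2 fun v => ?_
  have h1 : Tendsto (fun m => (a m : ℝ) / N m * Real.log (S.av v l)) 𝒰
      (nhds (τ * Real.log (S.av v l))) := ha.mul_const _
  have h2 := h1.eventually_le_const (show τ * Real.log (S.av v l) <
    τ * Real.log (S.av v l) + ε by linarith)
  filter_upwards [h2, hN.eventually_gt_atTop 0] with m h3 h4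
  have hp : 0 < S.av v l := (S.av v).pos hl
  have hp2 : 0 < S.av v l ^ a m := zpow_pos hp _
  rw [map_zpow₀, ← Real.exp_log hp2, Real.log_zpow]
  apply Real.exp_le_exp.2
  calc (a m : ℝ) * Real.log (S.av v l) = N m * ((a m : ℝ) / N m * Real.log (S.av v l)) := by
        field_simp
    _ ≤ _ := by gcongr

/-- the ring of sequences of type zero -/
def T0 (S : SPl K ι) (𝒰 : Ultrafilter ℕ) (N : ℕ → ℝ) (hN : Tendsto N 𝒰 atTop) :
    Subring (ℕ → K) where
  carrier := {x | (∀ᶠ m in (𝒰 : Filter ℕ), x m ∈ S.O) ∧ Typ S 𝒰 N x (fun _ => 0)}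
  mul_mem' := by
    rintro x y ⟨h1, h2⟩ ⟨h3, h4⟩
    refine ⟨?_, ?_⟩
    · filter_upwards [h1, h3] with m a b using S.O.mul_mem a b
    · have := h2.mul h4
      simp only [add_zero] at this
      exact this
  one_mem' := ⟨Eventually.of_forall fun m => S.O.one_mem, typ_one hN⟩
  add_mem' := by
    rintro x y ⟨h1, h2⟩ ⟨h3, h4⟩
    refine ⟨?_, ?_⟩
    · filter_upwards [h1, h3] with m a b using S.O.add_mem a b
    · have := h2.sub hN h4.neg
      simp only [sub_neg_eq_add] at this
      exact this
  zero_mem' := ⟨Eventually.of_forall fun m => S.O.zero_mem, by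
    intro ε hε
    refine Eventually.of_forall fun m v => ?_
    simp [Real.exp_nonneg]⟩
  neg_mem' := by
    rintro x ⟨h1, h2⟩
    refine ⟨?_, h2.neg⟩
    filter_upwards [h1] with m a using S.O.neg_mem a

theorem gm_mem {R : Type*} [CommRing R] {Col : Type*} [Fintype Col] [DecidableEq Col]
    (T : Subring R) (Z : ℕ → Col → R) (t : ℕ) (h : ∀ i < t, ∀ col, Z i col ∈ T)
    (c : Fin t → Col) (j col : Col) : gm Z t c j col ∈ T := by
  have h1 : gm Z t c j col = gm (fun i col => T.subtype
      (if hi : i < t then (⟨Z i col, h i hi col⟩ : T) else 0)) t c j col := by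
    simp [gm]
  rw [h1, ← gm_map]
  exact Subtype.property _

theorem class_zero [CharZero K] [Nonempty ι] (hN : Tendsto N 𝒰 atTop) {Col : Type*} [Fintype Col]
    (u : Col → ℕ → K) (e : Col → ι → ℝ) (hO : ∀ i, ∀ᶠ m in (𝒰 : Filter ℕ), u i m ∈ S.O)
    (ht : ∀ i, Typ S 𝒰 N (u i) (e i)) (he : ∀ i, ∑ v, (S.n v : ℝ) * e i v = 0)
    (hs : ∀ᶠ m in (𝒰 : Filter ℕ), ∑ i, u i m = 0) (E : ι → ℝ) [DecidableEq (ι → ℝ)] :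
    ∀ᶠ m in (𝒰 : Filter ℕ), ∑ i with e i = E, u i m = 0 := by
  classical
  let x : (ι → ℝ) → ℕ → K := fun E m => ∑ i with e i = E, u i m
  let img : Finset (ι → ℝ) := Finset.univ.image e
  let σ := img.filter fun E => ¬ ∀ᶠ m in (𝒰 : Filter ℕ), x E m = 0
  have hσ : σ = ∅ := by
    by_contra hne
    have hcard : 0 < σ.card := Finset.card_pos.2 (Finset.nonempty_iff_ne_empty.2 hne)
    refine ThmA.finset σ (thmA S 𝒰 N hN _ hcard) x (fun E => E) ?_ ?_ ?_ ?_ ?_ ?_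
    · intro E _
      have : ∀ᶠ m in (𝒰 : Filter ℕ), ∀ i, u i m ∈ S.O := eventually_all.2 hO
      filter_upwards [this] with m hm using S.O.sum_mem fun i _ => hm i
    · intro E hE
      exact ult_not.1 (Finset.mem_filter.1 hE).2
    · intro E _
      refine Typ.sum hN _ fun i hi => ?_
      rw [← (Finset.mem_filter.1 hi).2]; exact ht i
    · intro E hE
      obtain ⟨i, _, rfl⟩ := Finset.mem_image.1 (Finset.mem_filter.1 hE).1
      exact he i
    · exact fun a _ b _ h => h
    · have h0 : ∀ᶠ m in (𝒰 : Filter ℕ), ∀ E ∈ img.filter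
          (fun E => ∀ᶠ m in (𝒰 : Filter ℕ), x E m = 0), x E m = 0 :=
        (Finset.eventually_all _).2 fun E hE => (Finset.mem_filter.1 hE).2
      filter_upwards [hs, h0] with m h1 h2
      have h3 : ∑ i, u i m = ∑ E ∈ img, x E m :=
        (Finset.sum_fiberwise_of_maps_to (fun i _ => Finset.mem_image_of_mem e (Finset.mem_univ i))
          _).symm
      rw [h1, ← Finset.sum_filter_add_sum_filter_not img
        (fun E => ∀ᶠ m in (𝒰 : Filter ℕ), x E m = 0), Finset.sum_eq_zero h2, zero_add] at h3
      exact h3.symm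
  by_cases hE : E ∈ img
  · by_contra hc
    have : E ∈ σ := Finset.mem_filter.2 ⟨hE, by convert hc⟩
    rw [hσ] at this
    simp at this
  · refine Eventually.of_forall fun m => ?_
    rw [Finset.filter_false_of_mem]
    · simp
    · intro i _ hi
      exact hE (Finset.mem_image.2 ⟨i, Finset.mem_univ _, hi⟩)

end

end Rt

end

section

namespace Rt
open Filter

variable {K : Type*} [Field K] {ι : Type*} [Fintype ι]

theorem zpow_mem_O (O : Subring K) (l : K) (h1 : l ∈ O) (h2 : l⁻¹ ∈ O) (a : ℤ) : l ^ a ∈ O := by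
  rcases Int.eq_nat_or_neg a with ⟨n, rfl | rfl⟩
  · rw [zpow_natCast]; exact O.pow_mem h1 n
  · rw [zpow_neg, zpow_natCast, ← inv_pow]; exact O.pow_mem h2 n

theorem unit_sum (S : SPl K ι) (l : K) (hl : l ≠ 0) (h1 : l ∈ S.O) (h2 : l⁻¹ ∈ S.O) :
    ∑ v, (S.n v : ℝ) * Real.log (S.av v l) = 0 := by
  have a1 := S.prod_ge l h1 hl
  have a2 := S.prod_ge _ h2 (inv_ne_zero hl)
  have hpos : ∀ v, 0 < S.av v l := fun v => (S.av v).pos hl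
  simp only [map_inv₀, inv_pow, Finset.prod_inv_distrib] at a2
  have hp : 0 < ∏ v, S.av v l ^ S.n v := Finset.prod_pos fun v _ => pow_pos (hpos v) _
  have a3 : ∏ v, S.av v l ^ S.n v = 1 := by
    refine le_antisymm ?_ a1
    rwa [one_le_inv₀ hp] at a2
  have := congrArg Real.log a3
  rw [Real.log_prod fun v _ => (pow_pos (hpos v) _).ne', Real.log_one] at this
  simpa [Real.log_pow] using this

theorem sel_mono {k : ℕ} (a : ℕ → Fin k → ℤ) (m L : ℕ)
    (h : ∀ i < L, (m + 1) * max 1 (nm (a i)) ≤ nm (a (i + 1))) (t : ℕ) (ht : t ≤ L) (i : ℕ)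
    (hi : i < t) : (m + 1) * max 1 (nm (a i)) ≤ nm (a t) := by
  induction t with
  | zero => omega
  | succ t ih =>
    rcases Nat.lt_succ_iff_lt_or_eq.1 hi with h1 | rfl
    · refine (ih (by omega) h1).trans (le_trans ?_ (h t (by omega)))
      calc nm (a t) ≤ max 1 (nm (a t)) := le_max_right _ _
        _ ≤ (m + 1) * max 1 (nm (a t)) := Nat.le_mul_of_pos_left _ (by omega)
    · exact h i (by omega)

/-- the rows -/
def row {k E : ℕ} (lam : Fin k → K) (a : Fin k → ℤ) : Option (Fin k × Fin (E + 1)) → K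
  | none => 1
  | some (x, p) => (a x : K) ^ (p : ℕ) * lam x ^ (a x)

/-- the coefficient vector -/
noncomputable def kap {k E : ℕ} (lam : Fin k → K) (f : Fin k → Polynomial K) (r : K)
    (q : Fin k → ℕ) : Option (Fin k × Fin (E + 1)) → K
  | none => - r
  | some (x, p) => (Polynomial.taylor (q x : K) (f x)).coeff p * lam x ^ (q x)

theorem blk {k E : ℕ} (lam : Fin k → K) (hl : ∀ x, lam x ≠ 0) (f : Fin k → Polynomial K)
    (hE : ∀ x, (f x).natDegree ≤ E) (r : K) (q q' : Fin k → ℕ) (a : Fin k → ℤ)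
    (ha : ∀ x, a x = (q' x : ℤ) - q x) (x : Fin k) :
    ∑ p : Fin (E + 1), row (E := E) lam a (some (x, p)) * kap lam f r q (some (x, p)) =
      (f x).eval (q' x : K) * lam x ^ q' x := by
  have h1 : (f x).eval (q' x : K) = (Polynomial.taylor (q x : K) (f x)).eval (a x : K) := by
    rw [Polynomial.taylor_eval, ha]; push_cast; ring_nf
  have h2 : lam x ^ q' x = lam x ^ (a x) * lam x ^ q x := by
    rw [← zpow_natCast, ← zpow_natCast, ← zpow_add₀ (hl x), ha]; congr 1; ring
  rw [h1, h2, Polynomial.eval_eq_sum_range' (n := E + 1)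
    (by rw [Polynomial.natDegree_taylor]; exact Nat.lt_succ_of_le (hE x)), Finset.sum_range,
    Finset.sum_mul]
  refine Finset.sum_congr rfl fun p _ => ?_
  simp only [row, kap]; ring

theorem row_kap {k E : ℕ} (lam : Fin k → K) (hl : ∀ x, lam x ≠ 0) (f : Fin k → Polynomial K)
    (hE : ∀ x, (f x).natDegree ≤ E) (r : K) (q q' : Fin k → ℕ) (a : Fin k → ℤ)
    (ha : ∀ x, a x = (q' x : ℤ) - q x) (h : ∑ x, (f x).eval (q' x : K) * lam x ^ q' x = r) :
    ∑ col, row (E := E) lam a col * kap lam f r q col = 0 := by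
  rw [Fintype.sum_option, Fintype.sum_prod_type]
  simp only [blk lam hl f hE r q q' a ha, h]
  simp [row, kap]

theorem core [CharZero K] [Nonempty ι] (S : SPl K ι) {k E : ℕ} (lam : Fin k → K)
    (hl : ∀ x, lam x ≠ 0) (hO : ∀ x, lam x ∈ S.O) (hO' : ∀ x, (lam x)⁻¹ ∈ S.O)
    (hne : ∀ x, ∃ v, S.av v (lam x) ≠ 1)
    (f : Fin k → Polynomial K) (hE : ∀ x, (f x).natDegree ≤ E) (hk : 1 ≤ k) (L : ℕ)
    (hL : L = Fintype.card (Option (Fin k × Fin (E + 1))))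
    (r : ℕ → K) (hr : ∀ m, r m ≠ 0) (P : ℕ → ℕ → Fin k → ℕ)
    (hP : ∀ m, ∀ i ≤ L, ∑ x, (f x).eval (P m i x : K) * lam x ^ P m i x = r m)
    (hP' : ∀ m, ∀ i ≤ L, ∀ I : Finset (Fin k), I.Nonempty → I ≠ Finset.univ →
      ∑ x ∈ I, (f x).eval (P m i x : K) * lam x ^ P m i x ≠ 0)
    (a : ℕ → ℕ → Fin k → ℤ) (ha : ∀ m i x, a m i x = (P m i x : ℤ) - P m 0 x)
    (hsel : ∀ m, ∀ i < L, (m + 1) * max 1 (nm (a m i)) ≤ nm (a m (i + 1))) : False := by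
  classical
  let Col := Option (Fin k × Fin (E + 1))
  let 𝒰 : Ultrafilter ℕ := hyperfilter ℕ
  let Z : ℕ → ℕ → Col → K := fun m i => row lam (a m i)
  let κ : ℕ → Col → K := fun m => kap lam f (r m) (P m 0)
  have hκ : ∀ m, ∀ i ≤ L, ∑ col, Z m i col * κ m col = 0 := fun m i hi =>
    row_kap lam hl f hE (r m) (P m 0) (P m i) (a m i) (ha m i) (hP m i hi)
  have hst : ∀ m, ∃ s : (Σ t : Fin (L + 1), (Fin t → Col)), 1 ≤ (s.1 : ℕ) ∧
      (Matrix.of fun a b : Fin s.1 => Z m a (s.2 b)).det ≠ 0 ∧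
      ∀ j, ∑ col, Z m s.1 col * gm (Z m) s.1 s.2 j col = 0 := by
    intro m
    obtain ⟨t, h1, h2, c, h3, h4⟩ := stagnation (Z m) (fun h => one_ne_zero (congrFun h none))
    exact ⟨⟨⟨t, by rw [hL]; exact Nat.lt_succ_of_le h2⟩, c⟩, h1, h3, h4⟩
  obtain ⟨⟨⟨t, htL⟩, c⟩, hs⟩ := ult_exists 𝒰 (Eventually.of_forall hst)
  simp only at hs c
  have ht1 : 1 ≤ t := by obtain ⟨m, hm⟩ := hs.exists; exact hm.1
  have htL' : t ≤ L := by omega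
  let N : ℕ → ℝ := fun m => (nm (a m t) : ℝ)
  have hNm : ∀ (m : ℕ) (i : ℕ), i < t → ((m : ℝ) + 1) * max 1 (nm (a m i) : ℝ) ≤ N m := fun m i hi => by
    have := sel_mono (a m) m L (hsel m) t htL' i hi
    have h2 : (((m + 1) * max 1 (nm (a m i)) : ℕ) : ℝ) ≤ (nm (a m t) : ℝ) := by exact_mod_cast this
    push_cast at h2
    exact h2
  have hN1 : ∀ m : ℕ, (m : ℝ) + 1 ≤ N m := fun m => by
    have := hNm m 0 (by omega)
    refine le_trans ?_ this
    have h1 : (1 : ℝ) ≤ max 1 (nm (a m 0) : ℝ) := le_max_left _ _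
    nlinarith [Nat.cast_nonneg (α := ℝ) m]
  have hat : Tendsto (fun m : ℕ => (m : ℝ)) 𝒰 atTop :=
    tendsto_natCast_atTop_atTop.mono_left Nat.hyperfilter_le_atTop
  have hN : Tendsto N 𝒰 atTop := tendsto_atTop_mono (fun m => by linarith [hN1 m]) hat
  have hNpos : ∀ m, 0 < N m := fun m => by linarith [hN1 m, Nat.cast_nonneg (α := ℝ) m]
  have hab : ∀ m i x, |(a m i x : ℝ)| ≤ nm (a m i) := fun m i x => by
    have := le_nm (a m i) x
    rw [← Int.cast_abs, Int.abs_eq_natAbs]; exact_mod_cast this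
  have hlow : ∀ i < t, ∀ m x, |(a m i x : ℝ)| * (m + 1) ≤ N m := fun i hi m x => by
    refine le_trans ?_ (hNm m i hi)
    rw [mul_comm]
    have : |(a m i x : ℝ)| ≤ max 1 (nm (a m i) : ℝ) := (hab m i x).trans (le_max_right _ _)
    gcongr
  have hmem : ∀ i m col, Z m i col ∈ S.O := by
    intro i m col
    rcases col with _ | ⟨x, p⟩
    · exact S.O.one_mem
    · exact S.O.mul_mem (S.O.pow_mem (intCast_mem _ _) _) (zpow_mem_O _ _ (hO x) (hO' x) _)
  -- lower rows
  have hlowT : ∀ i < t, ∀ col, (fun m => Z m i col) ∈ T0 S 𝒰 N hN := by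
    intro i hi col
    refine ⟨Eventually.of_forall fun m => hmem i m col, ?_⟩
    rcases col with _ | ⟨x, p⟩
    · exact typ_one hN
    · have h1 : Typ S 𝒰 N (fun m => (a m i x : K)) (fun _ => 0) :=
        typ_int hN (fun m => a m i x) (Eventually.of_forall fun m => by
          have h2 := hlow i hi m x
          have h3 := abs_nonneg (a m i x : ℝ)
          have h4 := Nat.cast_nonneg (α := ℝ) m
          nlinarith)
      have h2 : Tendsto (fun m => (a m i x : ℝ) / N m) 𝒰 (nhds 0) := by
        refine squeeze_zero_norm (a := fun m : ℕ => 1 / ((m : ℝ) + 1)) (fun m => ?_)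
          (tendsto_one_div_add_atTop_nhds_zero_nat.mono_left Nat.hyperfilter_le_atTop)
        rw [Real.norm_eq_abs, abs_div, abs_of_pos (hNpos m), div_le_div_iff₀ (hNpos m) (by positivity),
          one_mul]
        exact hlow i hi m x
      have h3 := (typ_pow hN h1 p).mul (typ_zpow (S := S) hN (fun m => a m i x) 0 h2 (lam x) (hl x))
      simp only [zero_mul, add_zero] at h3
      exact h3
  have hgmT : ∀ j col, (fun m => gm (Z m) t c j col) ∈ T0 S 𝒰 N hN := by
    intro j col
    have h1 := gm_mem (T0 S 𝒰 N hN) (fun i col m => Z m i col) t hlowT c j col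
    have h2 : (fun m => gm (Z m) t c j col) = gm (fun i col m => Z m i col) t c j col := by
      funext m
      exact (gm_map (Pi.evalRingHom (fun _ : ℕ => K) m) (fun i col m => Z m i col) t c j col).symm
    rw [h2]; exact h1
  -- top row
  have hτ : ∀ x, ∃ τ, Tendsto (fun m => (a m t x : ℝ) / N m) 𝒰 (nhds τ) := fun x =>
    ult_lim 𝒰 _ 1 (Eventually.of_forall fun m => by
      rw [abs_div, abs_of_pos (hNpos m), div_le_one (hNpos m)]; exact hab m t x)
  choose τ hτ using hτ
  let e : Col → ι → ℝ := fun col => match col with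
    | none => fun _ => 0
    | some (x, _) => fun v => τ x * Real.log (S.av v (lam x))
  have htop : ∀ col, Typ S 𝒰 N (fun m => Z m t col) (e col) := by
    intro col
    rcases col with _ | ⟨x, p⟩
    · exact typ_one hN
    · have h1 : Typ S 𝒰 N (fun m => (a m t x : K)) (fun _ => 0) :=
        typ_int hN (fun m => a m t x) (Eventually.of_forall fun m => hab m t x)
      have h3 := (typ_pow hN h1 p).mul (typ_zpow (S := S) hN (fun m => a m t x) _ (hτ x) (lam x) (hl x))
      simp only [zero_add] at h3
      exact h3
  have he : ∀ col, ∑ v, (S.n v : ℝ) * e col v = 0 := by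
    intro col
    rcases col with _ | ⟨x, p⟩
    · simp [e]
    · have := unit_sum S (lam x) (hl x) (hO x) (hO' x)
      calc ∑ v, (S.n v : ℝ) * (τ x * Real.log (S.av v (lam x))) =
          τ x * ∑ v, (S.n v : ℝ) * Real.log (S.av v (lam x)) := by
            rw [Finset.mul_sum]; exact Finset.sum_congr rfl fun v _ => by ring
        _ = 0 := by rw [this, mul_zero]
  have hcls : ∀ E0 : ι → ℝ, ∀ j, ∀ᶠ m in (𝒰 : Filter ℕ),
      ∑ col with e col = E0, Z m t col * gm (Z m) t c j col = 0 := by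
    intro E0 j
    refine class_zero (S := S) hN (fun col m => Z m t col * gm (Z m) t c j col) e ?_ ?_ he ?_ E0
    · intro col
      filter_upwards [(hgmT j col).1] with m hm using S.O.mul_mem (hmem t m col) hm
    · intro col
      have := (htop col).mul (hgmT j col).2
      simp only [add_zero] at this
      exact this
    · filter_upwards [hs] with m hm using hm.2.2 j
  -- the extremal index
  obtain ⟨x0, hx0⟩ : ∃ x, ∀ᶠ m in (𝒰 : Filter ℕ), (a m t x).natAbs = nm (a m t) := by
    refine ult_exists 𝒰 (Eventually.of_forall fun m => ?_)
    have : Nonempty (Fin k) := ⟨⟨0, hk⟩⟩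
    obtain ⟨x, _, hx⟩ := Finset.exists_mem_eq_sup (Finset.univ : Finset (Fin k))
      Finset.univ_nonempty (fun i => (a m t i).natAbs)
    exact ⟨x, hx.symm⟩
  have hτ0 : τ x0 ≠ 0 := by
    intro h0
    have h1 := (hτ x0).abs
    rw [h0, abs_zero] at h1
    have h2 : Tendsto (fun m => |(a m t x0 : ℝ) / N m|) 𝒰 (nhds 1) := by
      refine tendsto_const_nhds.congr' ?_
      filter_upwards [hx0] with m hm
      rw [abs_div, abs_of_pos (hNpos m), ← Int.cast_abs, Int.abs_eq_natAbs, hm]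
      exact (div_self (hNpos m).ne').symm
    exact zero_ne_one (tendsto_nhds_unique h1 h2)
  let E0 : ι → ℝ := fun v => τ x0 * Real.log (S.av v (lam x0))
  have hE0 : E0 ≠ fun _ => 0 := by
    obtain ⟨v, hv⟩ := hne x0
    intro h
    have h1 := congrFun h v
    rcases mul_eq_zero.1 h1 with h2 | h2
    · exact hτ0 h2
    · have hp : 0 < S.av v (lam x0) := (S.av v).pos (hl x0)
      exact hv (Real.eq_one_of_pos_of_log_eq_zero hp h2)
  let I : Finset (Fin k) := Finset.univ.filter fun x => (fun v => τ x * Real.log (S.av v (lam x))) = E0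
  have hI : I.Nonempty := ⟨x0, by simp [I, E0]⟩
  have hall : ∀ᶠ m in (𝒰 : Filter ℕ), ∀ j,
      ∑ col with e col = E0, Z m t col * gm (Z m) t c j col = 0 := eventually_all.2 (hcls E0)
  obtain ⟨m, hm, hm2⟩ := (hall.and hs).exists
  have hdet := hm2.2.1
  have hsum : ∑ col with e col = E0, Z m t col * κ m col = 0 := by
    have h1 : (Matrix.of fun a b : Fin t => Z m a (c b)).det *
        ∑ col with e col = E0, Z m t col * κ m col = 0 := by
      calc _ = ∑ col with e col = E0, Z m t col *
            ((Matrix.of fun a b : Fin t => Z m a (c b)).det * κ m col) := by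
            rw [Finset.mul_sum]; exact Finset.sum_congr rfl fun col _ => by ring
        _ = ∑ col with e col = E0, Z m t col * ∑ j, κ m j * gm (Z m) t c j col := by
            refine Finset.sum_congr rfl fun col _ => ?_
            rw [gm_comb (Z m) t c (κ m) (fun i hi => hκ m i (by omega)) col]
        _ = ∑ j, κ m j * ∑ col with e col = E0, Z m t col * gm (Z m) t c j col := by
            simp_rw [Finset.mul_sum]
            rw [Finset.sum_comm]
            exact Finset.sum_congr rfl fun j _ => Finset.sum_congr rfl fun col _ => by ring
        _ = 0 := by simp [hm]
    exact (mul_eq_zero.1 h1).resolve_left hdet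
  have hfin : ∑ x ∈ I, (f x).eval (P m t x : K) * lam x ^ P m t x = 0 := by
    rw [← hsum, Finset.sum_filter (fun col => e col = E0), Fintype.sum_option, Fintype.sum_prod_type]
    have h0 : ¬ (e none = E0) := fun h => hE0 h.symm
    rw [if_neg h0, zero_add, Finset.sum_filter]
    refine Finset.sum_congr rfl fun x _ => ?_
    have h1 : ∀ p : Fin (E + 1), e (some (x, p)) = fun v => τ x * Real.log (S.av v (lam x)) :=
      fun p => rfl
    simp only [h1]
    split_ifs with hx
    · exact (blk lam hl f hE (r m) (P m 0) (P m t) (a m t) (ha m t) x).symm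
    · simp
  by_cases hu : I = Finset.univ
  · rw [hu, hP m t htL'] at hfin
    exact hr m hfin
  · exact hP' m t htL' I hI hu hfin

theorem abstract_bound [CharZero K] [Nonempty ι] (S : SPl K ι) {k : ℕ} (lam : Fin k → K)
    (hl : ∀ x, lam x ≠ 0) (hO : ∀ x, lam x ∈ S.O) (hO' : ∀ x, (lam x)⁻¹ ∈ S.O)
    (hne : ∀ x, ∃ v, S.av v (lam x) ≠ 1)
    (f : Fin k → Polynomial K) (hk : 1 ≤ k) :
    ∃ w : ℕ, ∀ r : K, r ≠ 0 → ∀ X : Finset (Fin k → ℕ),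
      (∀ n ∈ X, ∑ x, (f x).eval (n x : K) * lam x ^ n x = r ∧
        ∀ I : Finset (Fin k), I.Nonempty → I ≠ Finset.univ →
          ∑ x ∈ I, (f x).eval (n x : K) * lam x ^ n x ≠ 0) → X.card ≤ w := by
  classical
  by_contra hc
  push Not at hc
  let E := Finset.univ.sup fun x => (f x).natDegree
  have hE : ∀ x, (f x).natDegree ≤ E := fun x =>
    Finset.le_sup (f := fun x => (f x).natDegree) (Finset.mem_univ x)
  let L := Fintype.card (Option (Fin k × Fin (E + 1)))
  have key : ∀ m : ℕ, ∃ (r : K) (P : ℕ → Fin k → ℕ), r ≠ 0 ∧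
      (∀ i ≤ L, ∑ x, (f x).eval (P i x : K) * lam x ^ P i x = r) ∧
      (∀ i ≤ L, ∀ I : Finset (Fin k), I.Nonempty → I ≠ Finset.univ →
        ∑ x ∈ I, (f x).eval (P i x : K) * lam x ^ P i x ≠ 0) ∧
      ∀ i < L, (m + 1) * max 1 (nm (fun x => (P i x : ℤ) - P 0 x)) ≤
        nm (fun x => (P (i + 1) x : ℤ) - P 0 x) := by
    intro m
    obtain ⟨W, hW⟩ := selection k (m + 1) (by omega) L
    obtain ⟨r, hr, X, hX, hcard⟩ := hc W
    let g : (Fin k → ℕ) → (Fin k → ℤ) := fun n x => (n x : ℤ)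
    have hg : Function.Injective g := fun n n' h => by
      funext x; have : (n x : ℤ) = (n' x : ℤ) := congrFun h x
      exact_mod_cast this
    obtain ⟨p, hp, hp2⟩ := hW (X.image g) (by
      rw [Finset.card_image_of_injective _ hg]; exact hcard.le)
    have h3 : ∀ i, ∃ q : Fin k → ℕ, i ≤ L → q ∈ X ∧ g q = p i := fun i => by
      by_cases hi : i ≤ L
      · obtain ⟨q, hq, hq2⟩ := Finset.mem_image.1 (hp i hi)
        exact ⟨q, fun _ => ⟨hq, hq2⟩⟩
      · exact ⟨0, fun h => absurd h hi⟩
    choose q hq using h3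
    refine ⟨r, q, hr, fun i hi => (hX _ (hq i hi).1).1, fun i hi => (hX _ (hq i hi).1).2, ?_⟩
    intro i hi
    have := hp2 i hi
    rw [← (hq i hi.le).2, ← (hq 0 (by omega)).2, ← (hq (i + 1) (by omega)).2] at this
    exact this
  choose r P h1 h2 h3 h4 using key
  exact core S lam hl hO hO' hne f hE hk L rfl r h1 P h2 h3 (fun m i x => (P m i x : ℤ) - P m 0 x)
    (fun _ _ _ => rfl) h4

end Rt

end

section

namespace Rt
open NumberField

theorem cell_close {R s x y : ℝ} (hs : 0 < s) (hx : |x| ≤ R) (hy : |y| ≤ R)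
    (h : ⌊(x + R) * (2 / s)⌋₊ = ⌊(y + R) * (2 / s)⌋₊) : |x - y| ≤ s / 2 := by
  have hx' := abs_le.1 hx
  have hy' := abs_le.1 hy
  have hc : 0 < 2 / s := by positivity
  have a1 := Nat.floor_le (mul_nonneg (by linarith : 0 ≤ x + R) hc.le)
  have a2 := Nat.lt_floor_add_one ((x + R) * (2 / s))
  have b1 := Nat.floor_le (mul_nonneg (by linarith : 0 ≤ y + R) hc.le)
  have b2 := Nat.lt_floor_add_one ((y + R) * (2 / s))
  rw [h] at a1 a2
  have h1 : (x - y) * (2 / s) ≤ 1 := by linarith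
  have h2 : (y - x) * (2 / s) ≤ 1 := by linarith
  rw [mul_div_assoc', div_le_one hs] at h1 h2
  rw [abs_le]; constructor <;> linarith

theorem cell_lt {R s x : ℝ} (hs : 0 < s) (hx : |x| ≤ R) :
    ⌊(x + R) * (2 / s)⌋₊ < ⌊4 * R / s⌋₊ + 1 := by
  have hx' := abs_le.1 hx
  refine Nat.lt_succ_of_le (Nat.floor_le_floor ?_)
  calc (x + R) * (2 / s) ≤ (R + R) * (2 / s) := by gcongr; exact hx'.2
    _ = 4 * R / s := by ring

variable {K : Type*} [Field K] [NumberField K]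

theorem fin_pow_le (v : FinitePlace K) (x : 𝓞 K) (k : ℕ) (hx : x ∈ v.maximalIdeal.asIdeal ^ k) :
    v x * (Ideal.absNorm v.maximalIdeal.asIdeal : ℝ) ^ k ≤ 1 := by
  by_cases h0 : x = 0
  · simp [h0]
  have h1 := v.apply_mul_absNorm_pow_eq_one h0
  have hq : (1 : ℝ) ≤ (Ideal.absNorm v.maximalIdeal.asIdeal : ℝ) := by
    exact_mod_cast (HeightOneSpectrum.one_lt_absNorm v.maximalIdeal).le
  have hk : k ≤ multiplicity v.maximalIdeal.asIdeal (Ideal.span {x}) := by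
    have hd : v.maximalIdeal.asIdeal ^ k ∣ Ideal.span {x} := by
      rw [Ideal.dvd_span_singleton]; exact hx
    have hfin : FiniteMultiplicity v.maximalIdeal.asIdeal (Ideal.span {x}) :=
      FiniteMultiplicity.of_prime_left v.maximalIdeal.prime (by
        intro h
        have h' : Ideal.span {x} = (⊥ : Ideal (𝓞 K)) := h
        exact h0 (Ideal.span_singleton_eq_bot.1 h'))
    exact hfin.le_multiplicity_of_pow_dvd hd
  rw [← h1]
  gcongr

theorem card_quot_pow (v : FinitePlace K) (k : ℕ) :
    Nat.card (𝓞 K ⧸ v.maximalIdeal.asIdeal ^ k) = Ideal.absNorm v.maximalIdeal.asIdeal ^ k := by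
  rw [← map_pow, Ideal.absNorm_apply, Submodule.cardQuot_apply]

/-- Minkowski by pigeonhole -/
theorem mink0 {Φ : Type*} [Fintype Φ] (fp : Φ → FinitePlace K) (d : ℕ)
    (A : InfinitePlace K → Matrix (Fin d) (Fin d) ℤ) (A' : Φ → Matrix (Fin d) (Fin d) ℤ) :
    ∃ C : ℝ, 0 < C ∧ ∀ (s : InfinitePlace K → Fin d → ℝ) (s' : Φ → Fin d → ℝ),
      (∀ w i, 0 < s w i) → (∀ v i, 0 < s' v i) → (∀ v i, s' v i ≤ 1) →
      C ≤ (∏ w, ∏ i, s w i ^ w.mult) * ∏ v, ∏ i, s' v i →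
      ∃ z : Fin d → 𝓞 K, z ≠ 0 ∧ (∀ w i, w (∑ j, (A w i j : K) * (z j : K)) ≤ s w i) ∧
        ∀ v i, fp v (∑ j, (A' v i j : K) * (z j : K)) ≤ s' v i := by
  classical
  let κ := Module.Free.ChooseBasisIndex ℤ (𝓞 K)
  let b : Module.Basis κ ℤ (𝓞 K) := RingOfIntegers.basis K
  let g := Module.finrank ℚ K
  have hκ : Fintype.card κ = g := by
    rw [← Module.finrank_eq_card_chooseBasisIndex]; exact RingOfIntegers.rank K
  let q : Φ → ℕ := fun v => Ideal.absNorm (fp v).maximalIdeal.asIdeal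
  have hq1 : ∀ v, (1 : ℝ) < q v := fun v => by
    exact_mod_cast HeightOneSpectrum.one_lt_absNorm (fp v).maximalIdeal
  let B : ℝ := 1 + ∑ w : InfinitePlace K, ∑ i, ∑ j, |(A w i j : ℝ)| * ∑ l, w (b l : K)
  have hBn : ∀ w : InfinitePlace K, ∀ i, 0 ≤ ∑ j, |(A w i j : ℝ)| * ∑ l, w (b l : K) := fun w i =>
    Finset.sum_nonneg fun j _ => mul_nonneg (abs_nonneg _)
      (Finset.sum_nonneg fun l _ => apply_nonneg _ _)
  have hB : ∀ (w : InfinitePlace K) (i : Fin d),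
      ∑ j, |(A w i j : ℝ)| * ∑ l, w (b l : K) ≤ B := fun w i => by
    have h1 : ∑ j, |(A w i j : ℝ)| * ∑ l, w (b l : K) ≤
        ∑ i, ∑ j, |(A w i j : ℝ)| * ∑ l, w (b l : K) :=
      Finset.single_le_sum (f := fun i => ∑ j, |(A w i j : ℝ)| * ∑ l, w (b l : K))
        (fun i _ => hBn w i) (Finset.mem_univ i)
    have h2 : ∑ i, ∑ j, |(A w i j : ℝ)| * ∑ l, w (b l : K) ≤
        ∑ w : InfinitePlace K, ∑ i, ∑ j, |(A w i j : ℝ)| * ∑ l, w (b l : K) :=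
      Finset.single_le_sum (f := fun w : InfinitePlace K => ∑ i, ∑ j, |(A w i j : ℝ)| * ∑ l, w (b l : K))
        (fun w _ => Finset.sum_nonneg fun i _ => hBn w i) (Finset.mem_univ w)
    simp only [B]; linarith
  have hB1 : 1 ≤ B := by
    have : 0 ≤ ∑ w : InfinitePlace K, ∑ i, ∑ j, |(A w i j : ℝ)| * ∑ l, w (b l : K) :=
      Finset.sum_nonneg fun w _ => Finset.sum_nonneg fun i _ => hBn w i
    simp only [B]; linarith
  let C0 : ℝ := (5 * B) ^ (g * d) * ∏ v, ∏ _i : Fin d, (q v : ℝ)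
  have hC0 : 0 ≤ C0 := mul_nonneg (by positivity)
    (Finset.prod_nonneg fun v _ => Finset.prod_nonneg fun i _ => Nat.cast_nonneg _)
  refine ⟨C0 + 1, by linarith, fun s s' hs hs' hs1 hC => ?_⟩
  -- choose `T`
  obtain ⟨T, hT1, hT⟩ : ∃ T : ℕ, 1 ≤ T ∧ ∀ w i, s w i ≤ T := by
    obtain ⟨T, hT⟩ := exists_nat_ge (1 + ∑ w, ∑ i, s w i)
    have hpos : ∀ w, 0 ≤ ∑ i, s w i := fun w => Finset.sum_nonneg fun i _ => (hs w i).le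
    refine ⟨T, ?_, fun w i => ?_⟩
    · have : 0 ≤ ∑ w, ∑ i, s w i := Finset.sum_nonneg fun w _ => hpos w
      have h2 : (1 : ℝ) ≤ T := by linarith
      exact_mod_cast h2
    · have h1 : s w i ≤ ∑ i, s w i :=
        Finset.single_le_sum (f := fun i => s w i) (fun i _ => (hs w i).le) (Finset.mem_univ i)
      have h2 : ∑ i, s w i ≤ ∑ w, ∑ i, s w i :=
        Finset.single_le_sum (f := fun w => ∑ i, s w i) (fun w _ => hpos w) (Finset.mem_univ w)
      linarith
  have hT0 : (0 : ℝ) < T := by exact_mod_cast hT1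
  -- choose exponents
  have hk : ∀ v i, ∃ k : ℕ, 1 ≤ s' v i * (q v : ℝ) ^ k ∧ s' v i * (q v : ℝ) ^ k ≤ q v := by
    intro v i
    obtain ⟨n, h1, h2⟩ := exists_nat_pow_near (one_le_one_div (hs' v i) (hs1 v i)) (hq1 v)
    refine ⟨n + 1, ?_, ?_⟩
    · rw [div_lt_iff₀ (hs' v i)] at h2; linarith
    · rw [le_div_iff₀ (hs' v i)] at h1
      rw [pow_succ]
      have : (0 : ℝ) < q v := by linarith [hq1 v]
      nlinarith
  choose k hk1 hk2 using hk
  let R : ℝ := B * T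
  let M : InfinitePlace K → Fin d → ℕ := fun w i => ⌊4 * R / s w i⌋₊ + 1
  have hR : 0 < R := by positivity
  have hM : ∀ w i, (M w i : ℝ) ≤ 5 * B * T / s w i := by
    intro w i
    have h1 : ((⌊4 * R / s w i⌋₊ : ℕ) : ℝ) ≤ 4 * R / s w i :=
      Nat.floor_le (by have := hs w i; positivity)
    have h2 : 1 ≤ B * T / s w i := by
      rw [le_div_iff₀ (hs w i), one_mul]
      refine (hT w i).trans ?_
      nlinarith
    calc ((M w i : ℕ) : ℝ) = (⌊4 * R / s w i⌋₊ : ℕ) + 1 := by simp [M]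
      _ ≤ 4 * R / s w i + B * T / s w i := by linarith
      _ = _ := by simp only [R]; ring
  -- the points
  let Y := Fin d → κ → Fin T
  let z : Y → Fin d → 𝓞 K := fun y j => ∑ l, ((y j l : ℕ) : ℤ) • b l
  let form : Y → InfinitePlace K → Fin d → K := fun y w i => ∑ j, (A w i j : K) * (z y j : K)
  have hform : ∀ (y : Y) (w : InfinitePlace K) (i : Fin d), w (form y w i) ≤ R := by
    intro y w i
    calc w (form y w i) ≤ ∑ j, w ((A w i j : K) * (z y j : K)) := av_sum_le w.1 _ _
      _ ≤ ∑ j, |(A w i j : ℝ)| * (T * ∑ l, w (b l : K)) := by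
          refine Finset.sum_le_sum fun j _ => ?_
          rw [map_mul]
          refine mul_le_mul (SPl.av_intCast_le w.1 _) ?_ (apply_nonneg _ _) (abs_nonneg _)
          have e : (z y j : K) = ∑ l, ((y j l : ℕ) : K) * (b l : K) := by
            simp [z, zsmul_eq_mul]
          rw [e, Finset.mul_sum]
          refine (av_sum_le w.1 _ _).trans (Finset.sum_le_sum fun l _ => ?_)
          rw [map_mul]
          refine mul_le_mul_of_nonneg_right ((SPl.av_natCast_le w.1 _).trans ?_) (apply_nonneg w _)
          exact_mod_cast (y j l).2.le
      _ = (∑ j, |(A w i j : ℝ)| * ∑ l, w (b l : K)) * T := by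
          rw [Finset.sum_mul]; exact Finset.sum_congr rfl fun j _ => by ring
      _ ≤ B * T := by gcongr; exact hB w i
  have hre : ∀ y w i, |(InfinitePlace.embedding w (form y w i)).re| ≤ R := fun y w i =>
    (Complex.abs_re_le_norm _).trans (by rw [InfinitePlace.norm_embedding_eq]; exact hform y w i)
  have him : ∀ y w i, |(InfinitePlace.embedding w (form y w i)).im| ≤ R := fun y w i =>
    (Complex.abs_im_le_norm _).trans (by rw [InfinitePlace.norm_embedding_eq]; exact hform y w i)
  have hfin : ∀ v i, Finite (𝓞 K ⧸ (fp v).maximalIdeal.asIdeal ^ (k v i)) := fun v i =>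
    Ideal.finiteQuotientOfFreeOfNeBot _ (pow_ne_zero _ (fp v).maximalIdeal.ne_bot)
  let β := ((w : InfinitePlace K) → (i : Fin d) → Fin w.mult → Fin (M w i)) ×
    ((v : Φ) → (i : Fin d) → 𝓞 K ⧸ (fp v).maximalIdeal.asIdeal ^ (k v i))
  let G : Y → β := fun y => ⟨fun w i e => if e.1 = 0 then ⟨_, cell_lt (hs w i) (hre y w i)⟩ else
    ⟨_, cell_lt (hs w i) (him y w i)⟩, fun v i => Ideal.Quotient.mk _ (∑ j, (A' v i j : 𝓞 K) * z y j)⟩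
  have hβ : Finite β := inferInstance
  have hcard : Nat.card β < Nat.card Y := by
    have e1 : Nat.card β = (∏ w, ∏ i, M w i ^ w.mult) * ∏ v, ∏ i, q v ^ k v i := by
      rw [Nat.card_prod, Nat.card_pi, Nat.card_pi]
      congr 1
      · refine Finset.prod_congr rfl fun w _ => ?_
        rw [Nat.card_pi]
        refine Finset.prod_congr rfl fun i _ => ?_
        rw [Nat.card_pi]
        simp
      · refine Finset.prod_congr rfl fun v _ => ?_
        rw [Nat.card_pi]
        exact Finset.prod_congr rfl fun i _ => card_quot_pow _ _
    have e2 : Nat.card Y = T ^ (g * d) := by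
      simp [Y, Nat.card_eq_fintype_card, hκ, pow_mul]
    have hS : 0 < (∏ w, ∏ i, s w i ^ w.mult) * ∏ v, ∏ i, s' v i :=
      mul_pos (Finset.prod_pos fun w _ => Finset.prod_pos fun i _ => pow_pos (hs w i) _)
        (Finset.prod_pos fun v _ => Finset.prod_pos fun i _ => hs' v i)
    have e3 : (Nat.card β : ℝ) * ((∏ w, ∏ i, s w i ^ w.mult) * ∏ v, ∏ i, s' v i) ≤
        C0 * (T : ℝ) ^ (g * d) := by
      rw [e1]
      push_cast
      calc _ = (∏ w : InfinitePlace K, ∏ i, (M w i * s w i) ^ w.mult) *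
            ∏ v, ∏ i, s' v i * (q v : ℝ) ^ k v i := by
            simp only [Finset.prod_mul_distrib, mul_pow]; ring
        _ ≤ (∏ w : InfinitePlace K, ∏ _i : Fin d, (5 * B * T) ^ w.mult) *
            ∏ v, ∏ _i : Fin d, (q v : ℝ) := by
            have p1 : ∀ w i, 0 ≤ (M w i * s w i : ℝ) := fun w i =>
              mul_nonneg (Nat.cast_nonneg _) (hs w i).le
            have p2 : ∀ v i, 0 ≤ s' v i * (q v : ℝ) ^ k v i := fun v i => by
              have := hs' v i; positivity
            refine mul_le_mul ?_ ?_ (Finset.prod_nonneg fun v _ => Finset.prod_nonneg fun i _ => p2 v i)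
              (Finset.prod_nonneg fun v _ => Finset.prod_nonneg fun i _ => by positivity)
            · refine Finset.prod_le_prod (fun w _ => Finset.prod_nonneg fun i _ =>
                pow_nonneg (p1 w i) _) fun w _ => Finset.prod_le_prod (fun i _ =>
                pow_nonneg (p1 w i) _) fun i _ => ?_
              have := hM w i
              rw [le_div_iff₀ (hs w i)] at this
              exact pow_le_pow_left₀ (p1 w i) this _
            · exact Finset.prod_le_prod (fun v _ => Finset.prod_nonneg fun i _ => p2 v i) fun v _ =>
                Finset.prod_le_prod (fun i _ => p2 v i) fun i _ => hk2 v i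
        _ = _ := by
            have : ∏ w : InfinitePlace K, ∏ _i : Fin d, (5 * B * T) ^ w.mult =
                (5 * B * T) ^ (g * d) := by
              simp only [Finset.prod_const, Finset.card_univ, Fintype.card_fin]
              rw [Finset.prod_pow, Finset.prod_pow_eq_pow_sum, InfinitePlace.sum_mult_eq, ← pow_mul]
            rw [this]
            simp only [C0, mul_pow]; ring
    have e4 : (Nat.card β : ℝ) < Nat.card Y := by
      rw [e2]
      push_cast
      have hTp : 0 < (T : ℝ) ^ (g * d) := by positivity
      by_contra hcon
      push Not at hcon
      have h5 : (T : ℝ) ^ (g * d) * (C0 + 1) ≤ C0 * (T : ℝ) ^ (g * d) :=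
        (mul_le_mul hcon hC (by linarith) (Nat.cast_nonneg _)).trans e3
      nlinarith
    exact_mod_cast e4
  letI : Fintype β := Fintype.ofFinite β
  rw [Nat.card_eq_fintype_card, Nat.card_eq_fintype_card] at hcard
  obtain ⟨y1, y2, hne, heq⟩ := Fintype.exists_ne_map_eq_of_card_lt G hcard
  refine ⟨fun j => z y1 j - z y2 j, ?_, ?_, ?_⟩
  · intro h0
    apply hne
    funext j l
    have h1 : z y1 j - z y2 j = 0 := congrFun h0 j
    have h2 : ∑ l, (((y1 j l : ℕ) : ℤ) - ((y2 j l : ℕ) : ℤ)) • b l = 0 := by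
      simpa [z, sub_smul, Finset.sum_sub_distrib] using h1
    have h3 := Fintype.linearIndependent_iff.1 b.linearIndependent _ h2 l
    apply Fin.ext
    omega
  · intro w i
    have hd : ∑ j, (A w i j : K) * ((z y1 j - z y2 j : 𝓞 K) : K) = form y1 w i - form y2 w i := by
      simp [form, mul_sub, Finset.sum_sub_distrib]
    rw [hd, ← InfinitePlace.norm_embedding_eq, map_sub]
    have hG := congrFun (congrFun (congrArg Prod.fst heq) w) i
    have hre' : |(InfinitePlace.embedding w (form y1 w i)).re -
        (InfinitePlace.embedding w (form y2 w i)).re| ≤ s w i / 2 := by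
      have h0 := congrFun hG ⟨0, InfinitePlace.mult_pos⟩
      simp only [G, if_true] at h0
      exact cell_close (hs w i) (hre y1 w i) (hre y2 w i) (Fin.mk.inj_iff.1 h0)
    have him' : |(InfinitePlace.embedding w (form y1 w i)).im -
        (InfinitePlace.embedding w (form y2 w i)).im| ≤ s w i / 2 := by
      by_cases hw : w.IsReal
      · have hr : ∀ x : K, (InfinitePlace.embedding w x).im = 0 := fun x => by
          have := RingHom.congr_fun (InfinitePlace.isReal_iff.1 hw) x
          exact Complex.conj_eq_iff_im.1 this
        rw [hr, hr, sub_self, abs_zero]; linarith [hs w i]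
      · have hm : w.mult = 2 := by simp [InfinitePlace.mult, hw]
        have h0 := congrFun hG ⟨1, by omega⟩
        simp only [G, one_ne_zero, if_false] at h0
        exact cell_close (hs w i) (him y1 w i) (him y2 w i) (Fin.mk.inj_iff.1 h0)
    refine (Complex.norm_le_abs_re_add_abs_im _).trans ?_
    rw [Complex.sub_re, Complex.sub_im]
    linarith
  · intro v i
    have hG := congrFun (congrFun (congrArg Prod.snd heq) v) i
    have h1 : (∑ j, (A' v i j : 𝓞 K) * z y1 j) - ∑ j, (A' v i j : 𝓞 K) * z y2 j ∈
        (fp v).maximalIdeal.asIdeal ^ (k v i) := Ideal.Quotient.eq.1 hG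
    have h2 := fin_pow_le (fp v) _ _ h1
    have hd : ∑ j, (A' v i j : K) * ((z y1 j - z y2 j : 𝓞 K) : K) =
        (((∑ j, (A' v i j : 𝓞 K) * z y1 j) - ∑ j, (A' v i j : 𝓞 K) * z y2 j : 𝓞 K) : K) := by
      simp [mul_sub, Finset.sum_sub_distrib]
    rw [hd]
    have h3 := hk1 v i
    have hqk : 0 < (q v : ℝ) ^ k v i := by have := hq1 v; positivity
    exact le_of_mul_le_mul_right (h2.trans h3) hqk

end Rt

end

section

namespace Rt
open NumberField

variable {K : Type*} [Field K] [NumberField K]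

/-- the finite places dividing `P` -/
def FP (K : Type*) [Field K] [NumberField K] (P : ℕ) : Type _ :=
  {w : FinitePlace K // w (P : K) ≠ 1}

theorem FP_finite (P : ℕ) (hP : P ≠ 0) : Finite (FP K P) := by
  have h := FinitePlace.hasFiniteMulSupport (K := K) (x := (P : K)) (by exact_mod_cast hP)
  exact Set.Finite.to_subtype h

theorem fin_nat_le_one (w : FinitePlace K) (P : ℕ) : w (P : K) ≤ 1 := by
  have := FinitePlace.norm_le_one K w.maximalIdeal ((P : ℕ) : 𝓞 K)
  rw [FinitePlace.norm_embedding_eq] at this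
  simpa using this

theorem fin_int_le_one (w : FinitePlace K) (x : 𝓞 K) : w (x : K) ≤ 1 := by
  have := FinitePlace.norm_le_one K w.maximalIdeal x
  rwa [FinitePlace.norm_embedding_eq] at this

/-- the ring of `S`-integers -/
def SO (K : Type*) [Field K] [NumberField K] (P : ℕ) : Subring K where
  carrier := {x | ∀ w : FinitePlace K, w (P : K) = 1 → w x ≤ 1}
  mul_mem' := by
    intro x y hx hy w hw
    rw [map_mul]
    exact mul_le_one₀ (hx w hw) (apply_nonneg w _) (hy w hw)
  one_mem' := by intro w _; rw [map_one]
  add_mem' := by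
    intro x y hx hy w hw
    exact (w.add_le x y).trans (max_le (hx w hw) (hy w hw))
  zero_mem' := by intro w _; rw [map_zero]; exact zero_le_one
  neg_mem' := by
    intro x hx w hw
    rw [map_neg_eq_map]; exact hx w hw

theorem prod_FP (P : ℕ) [Fintype (FP K P)] (x : K) [∀ w : FinitePlace K, Decidable (w (P : K) ≠ 1)] :
    ∏ᶠ w : FinitePlace K, (if w (P : K) ≠ 1 then w x else 1) = ∏ w : FP K P, w.1 x := by
  rw [← finprod_eq_prod_of_fintype]
  refine Eq.trans ?_ (finprod_subtype_eq_finprod_cond (f := fun w : FinitePlace K => w x)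
    (fun w : FinitePlace K => w (P : K) ≠ 1)).symm
  refine finprod_congr fun w => ?_
  rw [finprod_eq_if]

theorem prod_S_ge (P : ℕ) [Fintype (FP K P)] (x : K) (hx : x ≠ 0) (hO : x ∈ SO K P) :
    1 ≤ (∏ w : InfinitePlace K, w x ^ w.mult) * ∏ w : FP K P, w.1 x := by
  classical
  have h := prod_abs_eq_one (K := K) hx
  have hf := FinitePlace.hasFiniteMulSupport (K := K) hx
  refine h.symm.le.trans ?_
  rw [← prod_FP P x]
  refine mul_le_mul_of_nonneg_left ?_ (Finset.prod_nonneg fun w _ => pow_nonneg (apply_nonneg w x) _)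
  refine finprod_le_finprod hf (fun w => apply_nonneg w x) ?_ ?_
  · refine Set.Finite.subset hf fun w hw => ?_
    simp only [Function.mem_mulSupport] at hw ⊢
    intro h1
    apply hw
    rw [h1]; simp
  · intro w
    simp only
    split_ifs with h1
    · exact le_rfl
    · exact hO w (not_not.1 h1)

theorem prod_S_eq (P : ℕ) [Fintype (FP K P)] (hP : P ≠ 0) :
    (∏ w : InfinitePlace K, w (P : K) ^ w.mult) * ∏ w : FP K P, w.1 (P : K) = 1 := by
  classical
  have h := prod_abs_eq_one (K := K) (x := (P : K)) (by exact_mod_cast hP)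
  refine Eq.trans ?_ h
  rw [← prod_FP P (P : K)]
  congr 1
  refine finprod_congr fun w => ?_
  split_ifs with h1
  · rfl
  · exact (not_not.1 h1).symm

theorem mink1 (P : ℕ) [Fintype (FP K P)] (hP : P ≠ 0) (d : ℕ)
    (A : InfinitePlace K → Matrix (Fin d) (Fin d) ℤ) (A' : FP K P → Matrix (Fin d) (Fin d) ℤ) :
    ∃ C : ℝ, 0 < C ∧ ∀ (s : InfinitePlace K → Fin d → ℝ) (s' : FP K P → Fin d → ℝ),
      (∀ w i, 0 < s w i) → (∀ v i, 0 < s' v i) →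
      C ≤ (∏ w, ∏ i, s w i ^ w.mult) * ∏ v, ∏ i, s' v i →
      ∃ z : Fin d → K, z ≠ 0 ∧ (∀ i, z i ∈ SO K P) ∧
        (∀ w i, w (∑ j, (A w i j : K) * z j) ≤ s w i) ∧
        ∀ v i, v.1 (∑ j, (A' v i j : K) * z j) ≤ s' v i := by
  obtain ⟨C, hC, h⟩ := mink0 (fun v : FP K P => v.1) d A A'
  refine ⟨C, hC, fun s s' hs hs' hp => ?_⟩
  have hPK : (P : K) ≠ 0 := by exact_mod_cast hP
  obtain ⟨e, he⟩ : ∃ e : ℕ, ∀ (v : FP K P) (i : Fin d), s' v i * v.1 (P : K) ^ e ≤ 1 := by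
    have : ∀ᶠ e : ℕ in Filter.atTop, ∀ (v : FP K P) (i : Fin d), s' v i * v.1 (P : K) ^ e ≤ 1 := by
      refine Filter.eventually_all.2 fun v => Filter.eventually_all.2 fun i => ?_
      have h1 : v.1 (P : K) < 1 := lt_of_le_of_ne (fin_nat_le_one v.1 P) v.2
      have h2 := (tendsto_pow_atTop_nhds_zero_of_lt_one (apply_nonneg v.1 (P : K)) h1).const_mul (s' v i)
      rw [mul_zero] at h2
      exact h2.eventually_le_const zero_lt_one
    exact this.exists
  have hw0 : ∀ w : InfinitePlace K, 0 < w (P : K) := fun w => InfinitePlace.pos_iff.2 hPK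
  have hv0 : ∀ w : FinitePlace K, 0 < w (P : K) := fun w => FinitePlace.pos_iff.2 hPK
  obtain ⟨z, hz, h1, h2⟩ := h (fun w i => s w i * w (P : K) ^ e) (fun v i => s' v i * v.1 (P : K) ^ e)
    (fun w i => mul_pos (hs w i) (pow_pos (hw0 w) _)) (fun v i => mul_pos (hs' v i) (pow_pos (hv0 _) _))
    he (by
      refine hp.trans (le_of_eq ?_)
      have e1 := prod_S_eq (K := K) P hP
      have e2 : ∏ w : InfinitePlace K, ∏ i : Fin d, (s w i * w (P : K) ^ e) ^ w.mult =
          (∏ w : InfinitePlace K, ∏ i : Fin d, s w i ^ w.mult) *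
            (∏ w : InfinitePlace K, w (P : K) ^ w.mult) ^ (e * d) := by
        rw [← Finset.prod_pow, ← Finset.prod_mul_distrib]
        refine Finset.prod_congr rfl fun w _ => ?_
        simp only [mul_pow, Finset.prod_mul_distrib, Finset.prod_const, Finset.card_univ,
          Fintype.card_fin]
        congr 1
        rw [← pow_mul, ← pow_mul, ← pow_mul]
        congr 1
        ring
      have e3 : ∏ v : FP K P, ∏ i : Fin d, s' v i * v.1 (P : K) ^ e =
          (∏ v : FP K P, ∏ i : Fin d, s' v i) * (∏ v : FP K P, v.1 (P : K)) ^ (e * d) := by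
        rw [← Finset.prod_pow, ← Finset.prod_mul_distrib]
        refine Finset.prod_congr rfl fun w _ => ?_
        simp only [Finset.prod_mul_distrib, Finset.prod_const, Finset.card_univ,
          Fintype.card_fin, pow_mul]
      rw [e2, e3, mul_mul_mul_comm, ← mul_pow, e1, one_pow, mul_one])
  have hPe : (P : K) ^ e ≠ 0 := pow_ne_zero _ hPK
  have hsum : ∀ (a : Fin d → ℤ), ∑ j, (a j : K) * ((z j : K) / (P : K) ^ e) =
      (∑ j, (a j : K) * (z j : K)) / (P : K) ^ e := fun a => by
    rw [Finset.sum_div]; exact Finset.sum_congr rfl fun j _ => by ring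
  refine ⟨fun j => (z j : K) / (P : K) ^ e, ?_, ?_, ?_, ?_⟩
  · intro h0
    apply hz
    funext j
    have := congrFun h0 j
    simp only [Pi.zero_apply, div_eq_zero_iff, hPe, or_false] at this
    exact RingOfIntegers.ext this
  · intro i w hw
    rw [map_div₀, map_pow, hw, one_pow, div_one]
    exact fin_int_le_one w _
  · intro w i
    rw [hsum (A w i), map_div₀, map_pow, div_le_iff₀ (pow_pos (hw0 w) _)]
    exact h1 w i
  · intro v i
    rw [hsum (A' v i), map_div₀, map_pow, div_le_iff₀ (pow_pos (hv0 v.1) _)]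
    exact h2 v i

/-- the set of places -/
noncomputable def nfS (K : Type*) [Field K] [NumberField K] (P : ℕ) [Fintype (FP K P)] (hP : P ≠ 0) :
    SPl K (InfinitePlace K ⊕ FP K P) where
  av := Sum.elim (fun w => w.1) (fun v => v.1.1)
  n := Sum.elim (fun w => w.mult) (fun _ => 1)
  npos := by
    rintro (w | v)
    · exact InfinitePlace.mult_pos
    · exact zero_lt_one
  O := SO K P
  prod_ge := by
    intro c hc h0
    rw [Fintype.prod_sum_type]
    have := prod_S_ge P c h0 hc
    simp only [Sum.elim_inl, Sum.elim_inr, pow_one]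
    exact this
  mink := by
    intro d A
    obtain ⟨C, hC, h⟩ := mink1 P hP d (fun w => A (Sum.inl w)) (fun v => A (Sum.inr v))
    refine ⟨C, hC, fun s hs hp => ?_⟩
    rw [Fintype.prod_sum_type] at hp
    simp only [Sum.elim_inl, Sum.elim_inr, pow_one] at hp
    obtain ⟨z, h1, h2, h3, h4⟩ := h (fun w => s (Sum.inl w)) (fun v => s (Sum.inr v))
      (fun w i => hs _ i) (fun v i => hs _ i) hp
    refine ⟨z, h1, h2, ?_⟩
    rintro (w | v) i
    · exact h3 w i
    · exact h4 v i

/-- Kronecker -/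
theorem exists_av_ne_one (l : K) (hl : ∀ m : ℕ, 1 ≤ m → l ^ m ≠ 1) (P : ℕ) [Fintype (FP K P)]
    (hP : P ≠ 0) (hO : l ∈ SO K P) : ∃ v, (nfS K P hP).av v l ≠ 1 := by
  by_contra hc
  push Not at hc
  have h1 : ∀ w : InfinitePlace K, w l = 1 := fun w => hc (Sum.inl w)
  have h2 : ∀ w : FinitePlace K, w l ≤ 1 := fun w => by
    by_cases hw : w (P : K) = 1
    · exact hO w hw
    · exact (hc (Sum.inr ⟨w, hw⟩)).le
  have hintg : IsIntegral ℤ l := by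
    obtain ⟨y, hy⟩ := IsDedekindDomain.HeightOneSpectrum.mem_integers_of_valuation_le_one
      (R := 𝓞 K) K l (fun v => by
        have h3 := h2 (FinitePlace.mk v)
        rw [FinitePlace.mk_apply, FinitePlace.norm_embedding'] at h3
        have h4 := WithZeroMulInt.toNNReal_le_one_iff (e := Ideal.absNorm v.asIdeal)
          (m := v.valuation K l) (HeightOneSpectrum.one_lt_absNorm_nnreal v)
        exact h4.1 (by exact_mod_cast h3))
    rw [← hy]
    exact RingOfIntegers.isIntegral_coe y
  obtain ⟨n, hn, hn1⟩ := Embeddings.pow_eq_one_of_norm_eq_one K ℂ hintg (fun φ => by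
    have := h1 (InfinitePlace.mk φ)
    rwa [InfinitePlace.apply] at this)
  exact hl n hn hn1

/-- choice of `P` -/
theorem exists_P {D : ℕ} (lam : Fin D → K) (hl : ∀ j, lam j ≠ 0) :
    ∃ P : ℕ, P ≠ 0 ∧ ∀ j, lam j ∈ SO K P ∧ (lam j)⁻¹ ∈ SO K P := by
  have h1 : ∀ j, ∃ a b : 𝓞 K, a ≠ 0 ∧ b ≠ 0 ∧ lam j = (a : K) / (b : K) := by
    intro j
    obtain ⟨a, b, hb, hab⟩ := IsFractionRing.div_surjective (𝓞 K) (lam j)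
    refine ⟨a, b, ?_, nonZeroDivisors.ne_zero hb, hab.symm⟩
    rintro rfl
    apply hl j
    rw [← hab]; simp
  choose a b ha hb hab using h1
  let x : 𝓞 K := ∏ j, a j * b j
  have hx : x ≠ 0 := Finset.prod_ne_zero_iff.2 fun j _ => mul_ne_zero (ha j) (hb j)
  let P := Ideal.absNorm (Ideal.span {x})
  have hP : P ≠ 0 := by
    rw [Ne, Ideal.absNorm_eq_zero_iff, Ideal.span_singleton_eq_bot]; exact hx
  have hdvd : x ∣ ((P : ℕ) : 𝓞 K) := Ideal.mem_span_singleton.1 (Ideal.absNorm_mem _)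
  have hone : ∀ y : 𝓞 K, y ∣ x → ∀ w : FinitePlace K, w (P : K) = 1 → w (y : K) = 1 := by
    intro y hy w hw
    obtain ⟨c, hc⟩ := hy.trans hdvd
    have h2 : (P : K) = (y : K) * (c : K) := by
      have := congrArg (algebraMap (𝓞 K) K) hc
      simpa using this
    rw [h2, map_mul] at hw
    have h3 := fin_int_le_one w y
    have h4 := fin_int_le_one w c
    have h5 : 0 ≤ w (y : K) := apply_nonneg w _
    nlinarith
  refine ⟨P, hP, fun j => ?_⟩
  have hj : a j * b j ∣ x := Finset.dvd_prod_of_mem (fun j => a j * b j) (Finset.mem_univ j)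
  have hwl : ∀ w : FinitePlace K, w (P : K) = 1 → w (lam j) = 1 := fun w hw => by
    rw [hab j, map_div₀, hone _ ((Dvd.intro _ rfl).trans hj) w hw,
      hone _ ((Dvd.intro_left _ rfl).trans hj) w hw, div_one]
  refine ⟨fun w hw => (hwl w hw).le, fun w hw => ?_⟩
  rw [map_inv₀, hwl w hw, inv_one]

end Rt

end

/-- quantitative claim in the proof of Lemma 6.14, via Schlickewei–Schmidt:
if `K` is a number field, `λ₁,…,λ_D ∈ K` are nonzero and none is a root of unity, and
`α₁,…,α_D ∈ K[X]` are nonzero polynomials, then for every `k ≥ 1` there is `w_k ∈ ℕ` such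
that for all signs `cᵢ ∈ {1,-1}`, indices `jᵢ`, and `r ≠ 0`, at most `w_k` tuples
`(n₁,…,n_k) ∈ ℕ^k` satisfy `Σᵢ cᵢ·α_{jᵢ}(nᵢ)·λ_{jᵢ}^{nᵢ} = r` with no vanishing proper
nonempty subsum. -/
theorem numberField_expPoly_bounded_solutions (K : Type*) [Field K] [NumberField K]
    (D : ℕ) (hD : 1 ≤ D) (lam : Fin D → K) (hlam : ∀ j, lam j ≠ 0)
    (hroot : ∀ (j : Fin D) (m : ℕ), 1 ≤ m → lam j ^ m ≠ 1)
    (α : Fin D → Polynomial K) (hα : ∀ j, α j ≠ 0) (k : ℕ) (hk : 1 ≤ k) :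
    ∃ w : ℕ, ∀ (c : Fin k → K), (∀ i, c i = 1 ∨ c i = -1) →
      ∀ (j : Fin k → Fin D) (r : K), r ≠ 0 →
        (expPolySolSet lam α c j r).Finite ∧ (expPolySolSet lam α c j r).ncard ≤ w := by
  classical
  obtain ⟨P, hP, hPO⟩ := Rt.exists_P lam hlam
  haveI := Rt.FP_finite (K := K) P hP
  letI := Fintype.ofFinite (Rt.FP K P)
  have key : ∀ s : (Fin k → Bool) × (Fin k → Fin D), ∃ w : ℕ, ∀ r : K, r ≠ 0 →
      ∀ X : Finset (Fin k → ℕ), (∀ n ∈ X,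
        ∑ x, (Polynomial.C (if s.1 x then (1 : K) else -1) * α (s.2 x)).eval (n x : K) *
          lam (s.2 x) ^ n x = r ∧
        ∀ I : Finset (Fin k), I.Nonempty → I ≠ Finset.univ →
          ∑ x ∈ I, (Polynomial.C (if s.1 x then (1 : K) else -1) * α (s.2 x)).eval (n x : K) *
            lam (s.2 x) ^ n x ≠ 0) → X.card ≤ w := fun s =>
    Rt.abstract_bound (Rt.nfS K P hP) (fun x => lam (s.2 x)) (fun x => hlam _)
      (fun x => (hPO _).1) (fun x => (hPO _).2)
      (fun x => Rt.exists_av_ne_one _ (hroot _) P hP (hPO _).1)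
      (fun x => Polynomial.C (if s.1 x then (1 : K) else -1) * α (s.2 x)) hk
  choose W hW using key
  refine ⟨∑ s, W s, fun c hc j r hr => ?_⟩
  have hb : ∀ X : Finset (Fin k → ℕ), (X : Set (Fin k → ℕ)) ⊆ expPolySolSet lam α c j r →
      X.card ≤ ∑ s, W s := by
    intro X hX
    refine (hW (fun i => decide (c i = 1), j) r hr X fun n hn => ?_).trans
      (Finset.single_le_sum (f := W) (fun _ _ => Nat.zero_le _) (Finset.mem_univ _))
    have hc' : ∀ i, (if decide (c i = 1) = true then (1 : K) else -1) = c i := fun i => by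
      by_cases h : c i = 1
      · simp [h]
      · have h2 := (hc i).resolve_left h
        simp only [h, decide_false]
        rw [h2]; simp
    have := hX hn
    simp only [expPolySolSet, Set.mem_setOf_eq] at this
    simp only [hc', Polynomial.eval_mul, Polynomial.eval_C]
    exact this
  have hfin : (expPolySolSet lam α c j r).Finite := by
    by_contra hinf
    obtain ⟨X, hX, hcard⟩ := Set.Infinite.exists_subset_card_eq hinf (∑ s, W s + 1)
    have := hb X hX
    omega
  refine ⟨hfin, ?_⟩
  rw [Set.ncard_eq_toFinset_card _ hfin]
  exact hb _ (by simp)
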